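/- Let 𝓘=(I^1,…,I^s) be an s-tuple of subsets of [n]={1,…,n}, each of cardinality r. The following are equivalent: (A) ∏_{j=1}^{s} ω_{I^j} ≠ 0 in H*(Gr(r,n)); (B) for every 0 < d ≤ r and every s-tuple 𝓚=(K^1,…,K^s) of subsets of [r], each of cardinality d, with ∏_{j=1}^{s} ω_{K^j} ≠ 0 in H*(Gr(d,r)), the inequality Σ_{j=1}^{s} Σ_{a∈K^j}(n−r+a−i^j_a) − d(n−r) ≤ 0 holds; (C) for every 0 < d ≤ r and every s-tuple 𝓚=(K^1,…,K^s) of subsets of [r], each of cardinality d, with ∏_{j=1}^{s} ω_{K^j} equal to the class of a point in H*(Gr(d,r)), the inequality Σ_{j=1}^{s} Σ_{a∈K^j}(n−r+a−i^j_a) − d(n−r) ≤ 0 holds. -/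

import Mathlib

noncomputable section

open Module Submodule

/-! ### Polynomial functions and the Zariski topology on a vector space -/

/-- Evaluation of a polynomial in linear functionals at a point of a vector space.
These are exactly the polynomial functions on a finite-dimensional vector space. -/
def mEval (k : Type*) {M : Type*} [Field k] [AddCommGroup M] [Module k M]
    (x : M) (p : MvPolynomial (Module.Dual k M) k) : k :=
  MvPolynomial.eval (fun l : Module.Dual k M => l x) p

/-- The Zariski topology on a (finite-dimensional) vector space, generated by the
complements of zero sets of polynomial functions. -/
def mZariski (k M : Type*) [Field k] [AddCommGroup M] [Module k M] :
    TopologicalSpace M :=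
  TopologicalSpace.generateFrom
    {U : Set M | ∃ p : MvPolynomial (Module.Dual k M) k, U = {x : M | mEval k x p ≠ 0}}

/-- The Zariski tangent space at a point `x` to a subset `A` of a vector space:
the common kernel of the differentials at `x` of all polynomial functions vanishing on `A`. -/
def mTangent (k : Type*) {M : Type*} [Field k] [AddCommGroup M] [Module k M]
    (A : Set M) (x : M) : Submodule k M :=
  letI := Classical.decEq (Module.Dual k M)
  ⨅ p ∈ {p : MvPolynomial (Module.Dual k M) k | ∀ a ∈ A, mEval k a p = 0},
    LinearMap.ker (∑ l ∈ p.vars, mEval k x (MvPolynomial.pderiv l p) • (l : Module.Dual k M))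

/-- `f : M → N` is a polynomial map on a subset `A ⊆ M`. -/
def IsPolyOn (k : Type*) {M N : Type*} [Field k] [AddCommGroup M] [Module k M]
    [AddCommGroup N] [Module k N] (A : Set M) (f : M → N) : Prop :=
  ∀ l : Module.Dual k N, ∃ p : MvPolynomial (Module.Dual k M) k, ∀ x ∈ A, l (f x) = mEval k x p

/-- Dimension (topological Krull dimension) of a subset of a topological space. -/
def subDim {α : Type*} (t : TopologicalSpace α) (C : Set α) : WithBot ℕ∞ :=
  @topologicalKrullDim C (TopologicalSpace.induced (Subtype.val : C → α) t)

/-- The irreducible components of a subset `A` of a topological space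
(for the subspace topology). -/
def subComponents {α : Type*} (t : TopologicalSpace α) (A : Set α) : Set (Set ↥A) :=
  @irreducibleComponents A (TopologicalSpace.induced (Subtype.val : A → α) t)

/-- Dimension of a subset `C` of a subspace `A` of a topological space. -/
def compDim {α : Type*} (t : TopologicalSpace α) (A : Set α) (C : Set ↥A) : WithBot ℕ∞ :=
  subDim (TopologicalSpace.induced (Subtype.val : A → α) t) C

/-! ### Flags, Schubert cells and Schubert varieties -/

/-- A complete flag on a finite-dimensional vector space, recorded as the increasing
function sending `m` to the `m`-th member (of dimension `m`) of the flag. -/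
def IsFlag {k M : Type*} [Field k] [AddCommGroup M] [Module k M]
    (E : ℕ → Submodule k M) : Prop :=
  Monotone E ∧ ∀ m : ℕ, finrank k ↥(E m) = min m (finrank k M)

/-- Membership of `V` in the (open) Schubert cell `Ω°_I(E_•) ⊆ Gr(r, M)` attached to the
subset `I ⊆ [n]` recorded by the strictly increasing tuple `i : Fin r → Fin n`
(`0`-indexed: the `1`-based subset is `{i a + 1}`): `dim (V ∩ E_u) = #{a | i_a ≤ u}`. -/
def cellMem {k M : Type*} [Field k] [AddCommGroup M] [Module k M] {n r : ℕ}
    (i : Fin r → Fin n) (E : ℕ → Submodule k M) (V : Submodule k M) : Prop :=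
  finrank k ↥V = r ∧
    ∀ u : ℕ, u ≤ n →
      finrank k ↥(V ⊓ E u) =
        (Finset.univ.filter (fun a : Fin r => (i a : ℕ) + 1 ≤ u)).card

/-- Membership of `V` in the (closed) Schubert variety `Ω_I(E_•) ⊆ Gr(r, M)`:
`dim (V ∩ E_{i_a}) ≥ a` for `a = 1, …, r`. -/
def varMem {k M : Type*} [Field k] [AddCommGroup M] [Module k M] {n r : ℕ}
    (i : Fin r → Fin n) (E : ℕ → Submodule k M) (V : Submodule k M) : Prop :=
  finrank k ↥V = r ∧ ∀ a : Fin r, (a : ℕ) + 1 ≤ finrank k ↥(V ⊓ E ((i a : ℕ) + 1))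

/-- The flag induced on a subspace `V` by a flag `E` on `M`: its `a`-th member is the
smallest subspace of the form `V ∩ E_u` of dimension `≥ a`. -/
def indSub {k M : Type*} [Field k] [AddCommGroup M] [Module k M]
    (E : ℕ → Submodule k M) (V : Submodule k M) : ℕ → Submodule k ↥V := fun a =>
  ⨅ u ∈ {u : ℕ | a ≤ finrank k ↥(Submodule.comap V.subtype (E u))},
    Submodule.comap V.subtype (E u)

/-- The flag induced on the quotient `M ⧸ V` by a flag `E` on `M`: its `b`-th member is
the smallest subspace of the form `(E_u + V)/V` of dimension `≥ b`. -/
def indQuot {k M : Type*} [Field k] [AddCommGroup M] [Module k M]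
    (E : ℕ → Submodule k M) (V : Submodule k M) : ℕ → Submodule k (M ⧸ V) := fun b =>
  ⨅ u ∈ {u : ℕ | b ≤ finrank k ↥(Submodule.map V.mkQ (E u))},
    Submodule.map V.mkQ (E u)

/-- The flag spanned by a tuple of vectors (a complete flag when the tuple is a basis). -/
def spanFlag (k : Type*) {M : Type*} [Field k] [AddCommGroup M] [Module k M] {r : ℕ}
    (b : Fin r → M) : ℕ → Submodule k M := fun m =>
  Submodule.span k (b '' {a : Fin r | (a : ℕ) < m})

/-- `P` holds for a generic point of `Fl(M)^s` (`r = dim M`): there is a nonempty Zariski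
open set of `s`-tuples of bases of `M` on which the associated tuples of complete flags
satisfy `P`. -/
def GenericFlags (k : Type*) {M : Type*} [Field k] [AddCommGroup M] [Module k M]
    (s r : ℕ) (P : (Fin s → ℕ → Submodule k M) → Prop) : Prop :=
  ∃ U : Set (Fin s → Fin r → M),
    @IsOpen _ (mZariski k (Fin s → Fin r → M)) U ∧
    (∃ b ∈ U, ∀ j, LinearIndependent k (b j)) ∧
    ∀ b ∈ U, (∀ j, LinearIndependent k (b j)) → P (fun j => spanFlag k (b j))

/-- `P` holds for a generic point of `Fl(M)^s × Fl(Q)^s` (`r = dim M`, `q = dim Q`). -/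
def GenericFlagPairs (k : Type*) {M Q : Type*} [Field k] [AddCommGroup M] [Module k M]
    [AddCommGroup Q] [Module k Q] (s r q : ℕ)
    (P : (Fin s → ℕ → Submodule k M) → (Fin s → ℕ → Submodule k Q) → Prop) : Prop :=
  ∃ U : Set ((Fin s → Fin r → M) × (Fin s → Fin q → Q)),
    @IsOpen _ (mZariski k ((Fin s → Fin r → M) × (Fin s → Fin q → Q))) U ∧
    (∃ b ∈ U, (∀ j, LinearIndependent k (b.1 j)) ∧ ∀ j, LinearIndependent k (b.2 j)) ∧
    ∀ b ∈ U, ((∀ j, LinearIndependent k (b.1 j)) ∧ ∀ j, LinearIndependent k (b.2 j)) →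
      P (fun j => spanFlag k (b.1 j)) (fun j => spanFlag k (b.2 j))

/-! ### The spaces `Hom_𝓘(V, Q, 𝓕, 𝓖)` -/

/-- The subspace `{φ : M →ₗ Q | φ(p) ⊆ q}` of `Hom(M, Q)`. -/
def homConstraint {k M Q : Type*} [Field k] [AddCommGroup M] [Module k M]
    [AddCommGroup Q] [Module k Q] (p : Submodule k M) (q : Submodule k Q) :
    Submodule k (M →ₗ[k] Q) :=
  LinearMap.ker ((LinearMap.llcomp k ↥p Q (Q ⧸ q) q.mkQ).comp (LinearMap.lcomp k Q p.subtype))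

/-- `Hom_𝓘(M, Q, F, G) = {φ | φ(F^j_a) ⊆ G^j_{i^j_a - a} for all a = 1, …, r, j = 1, …, s}`. -/
def homSpace {k M Q : Type*} [Field k] [AddCommGroup M] [Module k M]
    [AddCommGroup Q] [Module k Q] {n r s : ℕ} (I : Fin s → Fin r → Fin n)
    (F : Fin s → ℕ → Submodule k M) (G : Fin s → ℕ → Submodule k Q) :
    Submodule k (M →ₗ[k] Q) :=
  ⨅ j : Fin s, ⨅ a : Fin r,
    homConstraint (F j ((a : ℕ) + 1)) (G j ((I j a : ℕ) - (a : ℕ)))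

/-! ### Charts on the Grassmannian, tangent spaces to Schubert cells -/

/-- The graph of `ψ : V →ₗ C`, a point of the Grassmannian chart around `V`
determined by a complement `C` of `V`. -/
def graphMap {k M : Type*} [Field k] [AddCommGroup M] [Module k M]
    (V C : Submodule k M) (ψ : ↥V →ₗ[k] ↥C) : Submodule k M :=
  LinearMap.range (V.subtype + C.subtype ∘ₗ ψ)

/-- The canonical identification `Hom(V, C) ≃ Hom(V, M/V)` (derivative of the chart). -/
def conjMap {k M : Type*} [Field k] [AddCommGroup M] [Module k M]
    (V C : Submodule k M) : (↥V →ₗ[k] ↥C) →ₗ[k] (↥V →ₗ[k] M ⧸ V) :=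
  LinearMap.llcomp k ↥V ↥C (M ⧸ V) (V.mkQ ∘ₗ C.subtype)

/-- The tangent space at `V` to a set `S` of points of the Grassmannian `Gr(r, M)`,
computed in the chart determined by a complement `C` of `V` and viewed inside
`Hom(V, M/V)` via the canonical identification. -/
def grTangent {k M : Type*} [Field k] [AddCommGroup M] [Module k M]
    (S : Set (Submodule k M)) (V C : Submodule k M) :
    Submodule k (↥V →ₗ[k] (M ⧸ V)) :=
  Submodule.map (conjMap V C)
    (mTangent k {ψ : ↥V →ₗ[k] ↥C | graphMap V C ψ ∈ S} 0)

/-- The Zariski topology on the Grassmannian of `r`-dimensional subspaces of `M`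
(as a topology on `Submodule k M`), coinduced from the Stiefel parameterization by
spanning `r`-tuples. -/
def grTop (k : Type*) {M : Type*} [Field k] [AddCommGroup M] [Module k M] (r : ℕ) :
    TopologicalSpace (Submodule k M) :=
  TopologicalSpace.coinduced (fun b : Fin r → M => Submodule.span k (Set.range b))
    (mZariski k (Fin r → M))

/-! ### Numerical quantities -/

/-- `codim ω_I = ∑_{a=1}^r (n - r + a - i_a)` (as an integer). -/
def codimZ (n r : ℕ) (i : Fin r → Fin n) : ℤ :=
  ∑ a : Fin r, ((n : ℤ) - (r : ℤ) + ((a : ℕ) : ℤ) - ((i a : ℕ) : ℤ))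

/-- The quantity `∑_j ∑_{a ∈ K^j} (n - r + a - i^j_a) - d(n - r)` of Inequality `(†^𝓘_𝓚)`. -/
def daggerZ (n r d : ℕ) {s : ℕ} (I : Fin s → Fin r → Fin n)
    (K : Fin s → Fin d → Fin r) : ℤ :=
  (∑ j : Fin s, ∑ t : Fin d,
      ((n : ℤ) - (r : ℤ) + ((K j t : ℕ) : ℤ) - ((I j (K j t) : ℕ) : ℤ)))
    - (d : ℤ) * ((n : ℤ) - (r : ℤ))

/-- The expected dimension `dim(S, M, 𝓕) = d(m - d) - ∑_j ∑_{t=1}^d (m - d + t - k^j_t)`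
of an intersection of Schubert cells `Ω°_{K^j}` in `Gr(d, m)`. -/
def eDimZ {s : ℕ} (m d : ℕ) (K : Fin s → Fin d → Fin m) : ℤ :=
  (d : ℤ) * ((m : ℤ) - (d : ℤ)) -
    ∑ j : Fin s, ∑ t : Fin d,
      ((m : ℤ) - (d : ℤ) + ((t : ℕ) : ℤ) - ((K j t : ℕ) : ℤ))

/-- `codim ω_I` as a natural number. -/
def codimN (n r : ℕ) (i : Fin r → Fin n) : ℕ :=
  ∑ a : Fin r, ((n - r + (a : ℕ)) - (i a : ℕ))

/-! ### The cohomology ring of the Grassmannian, Schubert classes -/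

/-- The ideal `(h_{n-r+1}, …, h_n)` of the polynomial ring in `r` variables
(`h_m` the complete homogeneous symmetric polynomials). -/
def grassIdeal (r n : ℕ) : Ideal (MvPolynomial (Fin r) ℤ) :=
  Ideal.span ((fun m : ℕ => MvPolynomial.hsymm (Fin r) ℤ m) '' Set.Icc (n - r + 1) n)

/-- A presentation of the cohomology (Chow) ring `H^*(Gr(r,n))`: products of Schubert
classes vanish here exactly when they vanish in `H^*(Gr(r,n))`. -/
abbrev grassRing (r n : ℕ) : Type :=
  MvPolynomial (Fin r) ℤ ⧸ grassIdeal r n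

/-- `h_m` for an integer `m` (zero for negative `m`). -/
def hkZ (r : ℕ) (m : ℤ) : MvPolynomial (Fin r) ℤ :=
  if 0 ≤ m then MvPolynomial.hsymm (Fin r) ℤ m.toNat else 0

/-- The Schur polynomial (Jacobi–Trudi determinant) of the partition
`λ_a = n - r + a - i_a` attached to the subset `I ⊆ [n]` recorded by `i`. -/
def schurI {n r : ℕ} (i : Fin r → Fin n) : MvPolynomial (Fin r) ℤ :=
  Matrix.det (Matrix.of fun a b : Fin r =>
    hkZ r ((n : ℤ) - (r : ℤ) + ((b : ℕ) : ℤ) - ((i a : ℕ) : ℤ)))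

/-- The Schubert class `ω_I ∈ H^*(Gr(r,n))` of the subset `I ⊆ [n]` recorded by the
strictly increasing tuple `i : Fin r → Fin n`. -/
def omegaCls {n r : ℕ} (i : Fin r → Fin n) : grassRing r n :=
  Ideal.Quotient.mk (grassIdeal r n) (schurI i)

/-- The class of a point in `H^*(Gr(r,n))`: the Schubert class of `I = {1, …, r}`. -/
def pointCls (r n : ℕ) (h : r ≤ n) : grassRing r n :=
  omegaCls (fun a : Fin r => Fin.castLE h a)

/-! ### Schur polynomials of partitions, Littlewood–Richardson coefficients -/

/-- The Schur polynomial of a partition with at most `r` parts, via Jacobi–Trudi. -/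
def schurP {r : ℕ} (lam : Fin r → ℕ) : MvPolynomial (Fin r) ℤ :=
  Matrix.det (Matrix.of fun a b : Fin r =>
    hkZ r (((lam a : ℕ) : ℤ) - ((a : ℕ) : ℤ) + ((b : ℕ) : ℤ)))

/-- The Vandermonde alternant `a_δ = det(x_a^{r-1-b})`. -/
def alternant (r : ℕ) : MvPolynomial (Fin r) ℤ :=
  Matrix.det (Matrix.of fun a b : Fin r => (MvPolynomial.X a) ^ (r - 1 - (b : ℕ)))

/-- The coefficient of the Schur polynomial `s_δ` in a symmetric polynomial `f`
(in `r` variables): the coefficient of the monomial `x^{δ + (r-1, …, 1, 0)}` in `f ⬝ a_δ`. -/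
def schurCoeff (r : ℕ) (f : MvPolynomial (Fin r) ℤ) (δ : Fin r → ℕ) : ℤ :=
  MvPolynomial.coeff
    (Finsupp.equivFunOnFinite.symm (fun a : Fin r => δ a + (r - 1 - (a : ℕ))))
    (f * alternant r)

/-- The Littlewood–Richardson coefficient `c^λ_{μ,ν}` (partitions with at most `r` parts):
the multiplicity of `V_λ` in `V_μ ⊗ V_ν`, i.e. of `s_λ` in `s_μ s_ν`. -/
def lrCoeff (r : ℕ) (lam mu nu : Fin r → ℕ) : ℤ :=
  schurCoeff r (schurP mu * schurP nu) lam

/-- The multiplicity of `V_δ` in `V_{Λ 1} ⊗ ⋯ ⊗ V_{Λ t}` (as `GL(r)`-representations),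
i.e. of `s_δ` in `∏_j s_{Λ j}`. -/
def multiCoeff (r : ℕ) {t : ℕ} (Λ : Fin t → Fin r → ℕ) (δ : Fin r → ℕ) : ℤ :=
  schurCoeff r (∏ j : Fin t, schurP (Λ j)) δ

/-! ### Symmetric polynomials -/

theorem hsymm_eq_sum_finsuppAntidiag (σ : Type*) [Fintype σ] [DecidableEq σ] (R : Type*)
    [CommSemiring R] (n : ℕ) :
    MvPolynomial.hsymm σ R n =
      ∑ l ∈ (Finset.univ : Finset σ).finsuppAntidiag n, ∏ i, (MvPolynomial.X i) ^ (l i) := by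
  classical
  unfold MvPolynomial.hsymm
  refine Finset.sum_bij (fun s _ => (Sym.equivNatSum σ n s : σ →₀ ℕ)) ?_ ?_ ?_ ?_
  · intro s _
    have := (Sym.equivNatSum σ n s).2
    rw [Finset.mem_finsuppAntidiag']
    exact ⟨this, Finset.subset_univ _⟩
  · intro s _ t _ h
    exact (Sym.equivNatSum σ n).injective (Subtype.ext h)
  · intro l hl
    rw [Finset.mem_finsuppAntidiag'] at hl
    exact ⟨(Sym.equivNatSum σ n).symm ⟨l, hl.1⟩, Finset.mem_univ _, by simp⟩
  · intro s _
    rw [Finset.prod_multiset_map_count]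
    refine Finset.prod_subset (Finset.subset_univ _) ?_
    intro x _ hx
    rw [Multiset.mem_toFinset, ← Multiset.count_eq_zero] at hx
    rw [hx, pow_zero]

theorem hsymm_eq_coeff_prod (σ : Type*) [Fintype σ] [DecidableEq σ] (R : Type*) [CommRing R] (n : ℕ) :
    MvPolynomial.hsymm σ R n = PowerSeries.coeff n
      (∏ i : σ, PowerSeries.mk fun k => (MvPolynomial.X i : MvPolynomial σ R) ^ k) := by
  rw [hsymm_eq_sum_finsuppAntidiag, PowerSeries.coeff_prod]
  simp

theorem mk_pow_mul_one_sub {S : Type*} [CommRing S] (x : S) :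
    (PowerSeries.mk fun k => x ^ k) * (1 - PowerSeries.C x * PowerSeries.X) = 1 := by
  ext n
  rw [mul_sub, mul_one, ← mul_assoc, map_sub]
  cases n with
  | zero => simp
  | succ n => simp [PowerSeries.coeff_succ_mul_X, PowerSeries.coeff_one, pow_succ]

/-- Coefficients of `∏_{j ∈ s} (1 - x_j t)`. -/
def elemSgn {σ : Type*} (R : Type*) [CommRing R] (s : Finset σ) (k : ℕ) : MvPolynomial σ R :=
  (∏ j ∈ s, (1 - Polynomial.C (MvPolynomial.X j : MvPolynomial σ R) * Polynomial.X)).coeff k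

theorem elemSgn_eq_zero {σ : Type*} (R : Type*) [CommRing R] (s : Finset σ) (k : ℕ)
    (h : s.card < k) : elemSgn R s k = 0 := by
  refine Polynomial.coeff_eq_zero_of_natDegree_lt (lt_of_le_of_lt ?_ h)
  refine (Polynomial.natDegree_prod_le _ _).trans ?_
  refine (Finset.sum_le_card_nsmul _ _ 1 ?_).trans (by simp)
  intro j _
  compute_degree

theorem elemSgn_zero {σ : Type*} (R : Type*) [CommRing R] (s : Finset σ) :
    elemSgn R s 0 = 1 := by
  rw [elemSgn, Polynomial.coeff_zero_eq_eval_zero, Polynomial.eval_prod]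
  simp

theorem mk_elemSgn {σ : Type*} (R : Type*) [CommRing R] (s : Finset σ) :
    PowerSeries.mk (elemSgn R s) =
      ∏ j ∈ s, (1 - PowerSeries.C (MvPolynomial.X j : MvPolynomial σ R) * PowerSeries.X) := by
  have : PowerSeries.mk (elemSgn R s) =
    Polynomial.coeToPowerSeries.ringHom (∏ j ∈ s, (1 - Polynomial.C (MvPolynomial.X j : MvPolynomial σ R) * Polynomial.X)) := by
    ext1 n
    rw [PowerSeries.coeff_mk, Polynomial.coeToPowerSeries.ringHom_apply, Polynomial.coeff_coe,
      elemSgn]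
  rw [this, map_prod]
  simp

theorem sum_hsymm_mul_elemSgn {σ : Type*} [Fintype σ] [DecidableEq σ] (R : Type*) [CommRing R]
    (s : Finset σ) (n : ℕ) :
    ∑ p ∈ Finset.HasAntidiagonal.antidiagonal n, MvPolynomial.hsymm σ R p.1 * elemSgn R s p.2 =
      PowerSeries.coeff n
        (∏ i ∈ sᶜ, PowerSeries.mk fun k => (MvPolynomial.X i : MvPolynomial σ R) ^ k) := by
  have h1 : (∏ i : σ, PowerSeries.mk fun k => (MvPolynomial.X i : MvPolynomial σ R) ^ k) *
      PowerSeries.mk (elemSgn R s) =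
      ∏ i ∈ sᶜ, PowerSeries.mk fun k => (MvPolynomial.X i : MvPolynomial σ R) ^ k := by
    rw [mk_elemSgn, ← Finset.prod_compl_mul_prod s, mul_assoc, ← Finset.prod_mul_distrib]
    simp only [mk_pow_mul_one_sub, Finset.prod_const_one, mul_one]
  rw [← h1, PowerSeries.coeff_mul]
  simp [← hsymm_eq_coeff_prod]

theorem sum_hkZ_mul_elemSgn (r : ℕ) (i : Fin r) (N : ℕ) :
    ∑ b : Fin r, hkZ r ((N : ℤ) - ((r - 1 - (b : ℕ) : ℕ) : ℤ)) *
      elemSgn ℤ (Finset.univ.erase i) (r - 1 - (b : ℕ)) = MvPolynomial.X i ^ N := by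
  have hr : 0 < r := i.pos
  have h := sum_hsymm_mul_elemSgn ℤ (Finset.univ.erase i) N
  have hc : (Finset.univ.erase i)ᶜ = {i} := by ext; simp
  rw [hc, Finset.prod_singleton, PowerSeries.coeff_mk] at h
  rw [← h]
  have h2 : ∑ b : Fin r, hkZ r ((N : ℤ) - ((r - 1 - (b : ℕ) : ℕ) : ℤ)) *
      elemSgn ℤ (Finset.univ.erase i) (r - 1 - (b : ℕ)) =
      ∑ k ∈ Finset.range r, hkZ r ((N : ℤ) - (k : ℤ)) * elemSgn ℤ (Finset.univ.erase i) k := by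
    rw [← Finset.sum_range_reflect, Finset.sum_range]
  rw [h2, ← Finset.Nat.sum_antidiagonal_swap, Finset.Nat.sum_antidiagonal_eq_sum_range_succ_mk]
  simp only [Prod.fst_swap, Prod.snd_swap]
  have e1 : ∀ k ∈ Finset.range N.succ, MvPolynomial.hsymm (Fin r) ℤ (N - k) *
      elemSgn ℤ (Finset.univ.erase i) k =
      hkZ r ((N : ℤ) - (k : ℤ)) * elemSgn ℤ (Finset.univ.erase i) k := by
    intro k hk
    rw [Finset.mem_range] at hk
    rw [hkZ, if_pos (by omega)]
    congr 2
    omega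
  rw [Finset.sum_congr rfl e1]
  have z1 : ∀ k, r ≤ k → elemSgn ℤ (Finset.univ.erase i) k = 0 := by
    intro k hk
    apply elemSgn_eq_zero
    rw [Finset.card_erase_of_mem (Finset.mem_univ _), Finset.card_univ, Fintype.card_fin]
    omega
  have z2 : ∀ k, N.succ ≤ k → hkZ r ((N : ℤ) - (k : ℤ)) = 0 := by
    intro k hk
    rw [hkZ, if_neg (by omega)]
  have l1 : Finset.range r ⊆ Finset.range (r + N.succ) := by
    intro x; simp; omega
  have l2 : Finset.range N.succ ⊆ Finset.range (r + N.succ) := by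
    intro x; simp; omega
  rw [Finset.sum_subset l1, Finset.sum_subset l2]
  · intro k _ hk
    rw [z2 k (by simpa using hk), zero_mul]
  · intro k _ hk
    rw [z1 k (by simpa using hk), mul_zero]

/-- The alternant `det (x_i ^ e_a)`. -/
def altDet {r : ℕ} (e : Fin r → ℕ) : MvPolynomial (Fin r) ℤ :=
  Matrix.det (Matrix.of fun a i : Fin r => (MvPolynomial.X i : MvPolynomial (Fin r) ℤ) ^ (e a))

theorem alternant_eq_altDet (r : ℕ) :
    alternant r = altDet (fun a : Fin r => r - 1 - (a : ℕ)) := by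
  rw [alternant, altDet, ← Matrix.det_transpose]
  rfl

/-- The Jacobi-Trudi matrix. -/
def jtMat {r : ℕ} (lam : Fin r → ℕ) : Matrix (Fin r) (Fin r) (MvPolynomial (Fin r) ℤ) :=
  Matrix.of fun a b : Fin r =>
    hkZ r (((lam a : ℕ) : ℤ) - ((a : ℕ) : ℤ) + ((b : ℕ) : ℤ))

theorem schurP_eq {r : ℕ} (lam : Fin r → ℕ) : schurP lam = (jtMat lam).det := rfl

theorem schurP_mul_det {r : ℕ} (lam : Fin r → ℕ) :
    schurP lam * Matrix.det (Matrix.of fun b i : Fin r =>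
      elemSgn ℤ (Finset.univ.erase i) (r - 1 - (b : ℕ))) =
      altDet (fun a => lam a + (r - 1 - (a : ℕ))) := by
  rw [schurP_eq, ← Matrix.det_mul, altDet]
  congr 1
  ext1 a i
  rw [Matrix.mul_apply, Matrix.of_apply, ← sum_hkZ_mul_elemSgn]
  refine Finset.sum_congr rfl fun b _ => ?_
  simp only [jtMat, Matrix.of_apply]
  congr 2
  omega

theorem hkZ_neg (r : ℕ) (m : ℤ) (h : m < 0) : hkZ r m = 0 := by
  rw [hkZ, if_neg (by omega)]

theorem hkZ_natCast (r : ℕ) (m : ℕ) : hkZ r m = MvPolynomial.hsymm (Fin r) ℤ m := by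
  rw [hkZ, if_pos (by omega)]; simp

theorem hkZ_zero (r : ℕ) : hkZ r 0 = 1 := by
  simp [hkZ]

theorem schurP_zero (r : ℕ) : schurP (fun _ : Fin r => 0) = 1 := by
  rw [schurP_eq, Matrix.det_of_isUpperTriangular]
  · simp [jtMat, hkZ_zero]
  · intro a b hab
    simp only [jtMat, Matrix.of_apply]
    apply hkZ_neg
    simp only [id] at hab
    have : (b : ℕ) < a := hab
    omega

theorem det_elemSgn (r : ℕ) : Matrix.det (Matrix.of fun b i : Fin r =>
      elemSgn ℤ (Finset.univ.erase i) (r - 1 - (b : ℕ))) = alternant r := by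
  have := schurP_mul_det (fun _ : Fin r => 0)
  rw [schurP_zero, one_mul] at this
  rw [this, alternant_eq_altDet]
  simp

theorem schurP_mul_alternant {r : ℕ} (lam : Fin r → ℕ) :
    schurP lam * alternant r = altDet (fun a => lam a + (r - 1 - (a : ℕ))) := by
  rw [← det_elemSgn, schurP_mul_det]

theorem altDet_eq_sum {r : ℕ} (e : Fin r → ℕ) : altDet e =
    ∑ σ : Equiv.Perm (Fin r), MvPolynomial.monomial
      (Finsupp.equivFunOnFinite.symm (fun i => e (σ i))) ((Equiv.Perm.sign σ : ℤ)) := by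
  rw [altDet, Matrix.det_apply]
  refine Finset.sum_congr rfl fun σ _ => ?_
  rw [MvPolynomial.monomial_eq, Finsupp.prod_fintype _ _ (by simp), Units.smul_def,
    zsmul_eq_mul]
  simp

theorem coeff_altDet {r : ℕ} (e f : Fin r → ℕ) (he : StrictAnti e) (hf : StrictAnti f) :
    MvPolynomial.coeff (Finsupp.equivFunOnFinite.symm f) (altDet e) = if e = f then 1 else 0 := by
  classical
  rw [altDet_eq_sum, MvPolynomial.coeff_sum]
  simp only [MvPolynomial.coeff_monomial, EmbeddingLike.apply_eq_iff_eq]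
  have key : ∀ σ : Equiv.Perm (Fin r), (fun i => e (σ i)) = f → σ = 1 := by
    intro σ h
    have hm : StrictMono σ := by
      intro a b hab
      have h1 : e (σ b) < e (σ a) := by
        have := hf hab
        rwa [← h] at this
      exact he.lt_iff_gt.1 h1
    have : (⟨σ, by intro a b; exact hm.le_iff_le⟩ : Fin r ≃o Fin r) = OrderIso.refl _ :=
      Subsingleton.elim _ _
    ext i
    have := congrArg (fun g : Fin r ≃o Fin r => g i) this
    simpa using congrArg Fin.val this
  rw [Finset.sum_eq_single 1]
  · simp
  · intro σ _ hσ
    rw [if_neg]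
    intro h
    exact hσ (key σ h)
  · simp

theorem strictAnti_add_rho {r : ℕ} {ν : Fin r → ℕ} (hν : Antitone ν) :
    StrictAnti (fun a : Fin r => ν a + (r - 1 - (a : ℕ))) := by
  intro a b hab
  have h1 := hν hab.le
  have h2 : (a : ℕ) < b := hab
  have := b.2
  show ν b + (r - 1 - (b : ℕ)) < ν a + (r - 1 - (a : ℕ))
  omega

theorem schurCoeff_schurP {r : ℕ} {μ ν : Fin r → ℕ} (hμ : Antitone μ) (hν : Antitone ν) :
    schurCoeff r (schurP μ) ν = if μ = ν then 1 else 0 := by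
  rw [schurCoeff, schurP_mul_alternant,
    coeff_altDet _ _ (strictAnti_add_rho hμ) (strictAnti_add_rho hν)]
  congr 1
  rw [eq_iff_iff]
  constructor
  · intro h
    ext a
    have := congrFun h a
    simpa using this
  · rintro rfl; rfl

theorem alternant_ne_zero (r : ℕ) : alternant r ≠ 0 := by
  intro h
  have := schurCoeff_schurP (r := r) (μ := fun _ => 0) (ν := fun _ => 0)
    (fun _ _ _ => le_rfl) (fun _ _ _ => le_rfl)
  rw [schurCoeff, h] at this
  simp at this

theorem hkZ_isSymmetric (r : ℕ) (m : ℤ) : (hkZ r m).IsSymmetric := by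
  rw [hkZ]
  split_ifs
  · exact MvPolynomial.hsymm_isSymmetric _ _ _
  · exact MvPolynomial.IsSymmetric.zero

theorem schurP_isSymmetric {r : ℕ} (lam : Fin r → ℕ) : (schurP lam).IsSymmetric := by
  intro σ
  rw [schurP_eq, AlgHom.map_det]
  congr 1
  ext1 a b
  exact hkZ_isSymmetric _ _ σ

theorem rename_altDet {r : ℕ} (e : Fin r → ℕ) (σ : Equiv.Perm (Fin r)) :
    MvPolynomial.rename σ (altDet e) = ((Equiv.Perm.sign σ : ℤ) : MvPolynomial (Fin r) ℤ) * altDet e := by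
  rw [altDet, ← Matrix.det_permute', AlgHom.map_det]
  congr 1
  ext1 a b
  simp

theorem eq_zero_of_antisymmetric {r : ℕ} (G : MvPolynomial (Fin r) ℤ)
    (hG : ∀ σ : Equiv.Perm (Fin r),
      MvPolynomial.rename σ G = ((Equiv.Perm.sign σ : ℤ) : MvPolynomial (Fin r) ℤ) * G)
    (h0 : ∀ f : Fin r → ℕ, StrictAnti f →
      MvPolynomial.coeff (Finsupp.equivFunOnFinite.symm f) G = 0) : G = 0 := by
  have key : ∀ (σ : Equiv.Perm (Fin r)) (α : Fin r → ℕ),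
      MvPolynomial.coeff (Finsupp.equivFunOnFinite.symm (fun i => α (σ i))) G =
        (Equiv.Perm.sign σ : ℤ) * MvPolynomial.coeff (Finsupp.equivFunOnFinite.symm α) G := by
    intro σ α
    have h1 := MvPolynomial.coeff_rename_mapDomain σ σ.injective G
      (Finsupp.equivFunOnFinite.symm (fun i => α (σ i)))
    have h2 : Finsupp.mapDomain σ (Finsupp.equivFunOnFinite.symm (fun i => α (σ i))) =
        Finsupp.equivFunOnFinite.symm α := by
      ext i
      rw [← σ.apply_symm_apply i, Finsupp.mapDomain_apply σ.injective]
      simp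
    rw [h2, hG] at h1
    rw [← h1, ← MvPolynomial.coeff_C_mul]
    simp
  ext α'
  rw [MvPolynomial.coeff_zero]
  obtain ⟨α, rfl⟩ := Finsupp.equivFunOnFinite.symm.surjective α'
  by_cases hinj : Function.Injective α
  · have hs := Tuple.monotone_sort (fun i => OrderDual.toDual (α i))
    set σ := Tuple.sort (fun i => OrderDual.toDual (α i))
    have ha : StrictAnti (fun i => α (σ i)) := by
      have : Antitone (fun i => α (σ i)) := fun a b hab => hs hab
      exact this.strictAnti_of_injective (hinj.comp σ.injective)
    have h3 := key σ α
    rw [h0 _ ha] at h3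
    rcases Int.units_eq_one_or (Equiv.Perm.sign σ) with h | h <;> rw [h] at h3 <;> simpa using h3.symm
  · rw [Function.Injective] at hinj
    push Not at hinj
    obtain ⟨i, j, hij, hne⟩ := hinj
    have h3 := key (Equiv.swap i j) α
    have h4 : (fun k => α (Equiv.swap i j k)) = α := by
      ext k
      by_cases hki : k = i
      · subst hki; simp [hij]
      · by_cases hkj : k = j
        · subst hkj; simp [hij]
        · rw [Equiv.swap_apply_of_ne_of_ne hki hkj]
    rw [h4, Equiv.Perm.sign_swap hne] at h3
    simp at h3
    omega

theorem symmetric_expansion {r : ℕ} (f : MvPolynomial (Fin r) ℤ) (hf : f.IsSymmetric) :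
    ∃ N : Finset (Fin r → ℕ), (∀ ν ∈ N, Antitone ν) ∧
      f = ∑ ν ∈ N, MvPolynomial.C (schurCoeff r f ν) * schurP ν := by
  classical
  set F := f * alternant r with hF
  refine ⟨(Fintype.piFinset fun _ => Finset.range (F.totalDegree + 1)).filter Antitone,
    fun ν hν => (Finset.mem_filter.1 hν).2, ?_⟩
  set N := (Fintype.piFinset fun _ : Fin r => Finset.range (F.totalDegree + 1)).filter Antitone
  have hs : (∑ ν ∈ N, MvPolynomial.C (schurCoeff r f ν) * schurP ν) * alternant r =
      ∑ ν ∈ N, MvPolynomial.C (schurCoeff r f ν) * altDet (fun a => ν a + (r - 1 - (a : ℕ))) := by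
    rw [Finset.sum_mul]
    refine Finset.sum_congr rfl fun ν _ => ?_
    rw [mul_assoc, schurP_mul_alternant]
  apply mul_right_cancel₀ (alternant_ne_zero r)
  rw [hs, ← hF, ← sub_eq_zero]
  apply eq_zero_of_antisymmetric
  · intro σ
    rw [map_sub, map_sum, hF, map_mul, hf σ, alternant_eq_altDet, rename_altDet, mul_sub,
      Finset.mul_sum]
    congr 1
    · ring
    · refine Finset.sum_congr rfl fun ν _ => ?_
      rw [map_mul, rename_altDet, MvPolynomial.rename_C]
      ring
  · intro e he
    rw [MvPolynomial.coeff_sub, MvPolynomial.coeff_sum]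
    simp only [MvPolynomial.coeff_C_mul]
    have hle : ∀ a : Fin r, r - 1 - (a : ℕ) ≤ e a := by
      have : ∀ k : ℕ, ∀ a : Fin r, r - 1 - (a : ℕ) = k → k ≤ e a := by
        intro k
        induction k with
        | zero => intro a _; exact Nat.zero_le _
        | succ k ih =>
          intro a ha
          have hlt : (a : ℕ) + 1 < r := by omega
          have h1 := ih ⟨a + 1, hlt⟩ (by simp only; omega)
          have h2 : e ⟨a + 1, hlt⟩ < e a := he (by rw [Fin.lt_def]; simp)
          omega
      exact fun a => this _ a rfl
    obtain ⟨ν, hν⟩ : ∃ ν : Fin r → ℕ, e = fun a => ν a + (r - 1 - (a : ℕ)) :=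
      ⟨fun a => e a - (r - 1 - (a : ℕ)), by ext a; have := hle a; simp only; omega⟩
    have hanti : Antitone ν := by
      have : ∀ k : ℕ, ∀ a b : Fin r, (b : ℕ) = a + k → ν b ≤ ν a := by
        intro k
        induction k with
        | zero => intro a b h; have : a = b := by ext; omega
                  rw [this]
        | succ k ih =>
          intro a b h
          have hb := b.2
          have h1 := ih a ⟨a + k, by omega⟩ rfl
          have h2 : e b < e ⟨a + k, by omega⟩ := he (by rw [Fin.lt_def]; simp only; omega)
          rw [hν] at h2
          simp only at h2
          omega
      intro a b hab
      exact this (b - a) a b (by have : (a : ℕ) ≤ b := hab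
                                 omega)
    have hcoef : MvPolynomial.coeff (Finsupp.equivFunOnFinite.symm e) F = schurCoeff r f ν := by
      rw [schurCoeff, ← hν]
    rw [hcoef]
    by_cases hN : ν ∈ N
    · rw [Finset.sum_eq_single ν]
      · rw [hν, coeff_altDet _ _ (strictAnti_add_rho hanti) (strictAnti_add_rho hanti)]
        simp
      · intro μ hμ hne
        rw [hν, coeff_altDet _ _ (strictAnti_add_rho (Finset.mem_filter.1 hμ).2)
          (strictAnti_add_rho hanti), if_neg, mul_zero]
        intro h
        apply hne
        ext a
        have := congrFun h a
        simpa using this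
      · exact fun h => absurd hN h
    · have hz : schurCoeff r f ν = 0 := by
        by_contra hne
        apply hN
        rw [Finset.mem_filter, Fintype.mem_piFinset]
        refine ⟨fun a => ?_, hanti⟩
        rw [Finset.mem_range]
        rw [← hcoef] at hne
        have h1 := MvPolynomial.le_totalDegree (MvPolynomial.mem_support_iff.2 hne)
        rw [Finsupp.sum_fintype _ _ (by simp)] at h1
        have h2 : e a ≤ ∑ i, e i := Finset.single_le_sum (f := e) (by simp) (Finset.mem_univ a)
        have h3 : ν a ≤ e a := by rw [hν]; simp
        simp at h1
        omega
      rw [hz, zero_sub, neg_eq_zero]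
      refine Finset.sum_eq_zero fun μ hμ => ?_
      rw [hν, coeff_altDet _ _ (strictAnti_add_rho (Finset.mem_filter.1 hμ).2)
          (strictAnti_add_rho hanti), if_neg, mul_zero]
      intro h
      apply hN
      have : μ = ν := by
        ext a
        have := congrFun h a
        simpa using this
      rwa [← this]

theorem hsymm_mem_grassIdeal {r n : ℕ} (hrn : r ≤ n) (k : ℕ) (hk : n - r + 1 ≤ k) :
    MvPolynomial.hsymm (Fin r) ℤ k ∈ grassIdeal r n := by
  induction k using Nat.strong_induction_on with
  | _ k ih =>
    by_cases hkn : k ≤ n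
    · exact Ideal.subset_span ⟨k, ⟨hk, hkn⟩, rfl⟩
    · push Not at hkn
      have h := sum_hsymm_mul_elemSgn ℤ (Finset.univ : Finset (Fin r)) k
      rw [Finset.compl_univ, Finset.prod_empty, PowerSeries.coeff_one, if_neg (by omega),
        ← Finset.Nat.sum_antidiagonal_swap, Finset.Nat.sum_antidiagonal_eq_sum_range_succ_mk,
        Finset.sum_range_succ'] at h
      simp only [Prod.fst_swap, Prod.snd_swap, elemSgn_zero, mul_one, Nat.sub_zero] at h
      rw [eq_neg_of_add_eq_zero_right h]
      refine (grassIdeal r n).neg_mem (Ideal.sum_mem _ fun i hi => ?_)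
      rw [Finset.mem_range] at hi
      by_cases hir : i + 1 ≤ r
      · exact Ideal.mul_mem_right _ _ (ih _ (by omega) (by omega))
      · rw [elemSgn_eq_zero _ _ _ (by simp; omega), mul_zero]
        exact Ideal.zero_mem _

theorem schurP_mem_grassIdeal {r n : ℕ} (hrn : r ≤ n) (ν : Fin r → ℕ) (hν : Antitone ν)
    (a : Fin r) (ha : n - r < ν a) : schurP ν ∈ grassIdeal r n := by
  have hr : 0 < r := a.pos
  have h0 : ν a ≤ ν ⟨0, hr⟩ := hν (by rw [Fin.le_def]; simp)
  rw [← Ideal.Quotient.eq_zero_iff_mem, schurP_eq, RingHom.map_det]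
  apply Matrix.det_eq_zero_of_row_eq_zero ⟨0, hr⟩
  intro b
  rw [RingHom.mapMatrix_apply, Matrix.map_apply, Ideal.Quotient.eq_zero_iff_mem]
  simp only [jtMat, Matrix.of_apply]
  have : ((ν ⟨0, hr⟩ : ℕ) : ℤ) - ((0 : ℕ) : ℤ) + ((b : ℕ) : ℤ) = ((ν ⟨0, hr⟩ + b : ℕ) : ℤ) := by
    push_cast; ring
  rw [this, hkZ_natCast]
  exact hsymm_mem_grassIdeal hrn _ (by omega)

theorem schurP_single {r : ℕ} (hr : 0 < r) (k : ℕ) :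
    schurP (fun a : Fin r => if (a : ℕ) = 0 then k else 0) = MvPolynomial.hsymm (Fin r) ℤ k := by
  rw [schurP_eq, Matrix.det_of_isUpperTriangular]
  · have : ∀ a : Fin r, jtMat (fun a : Fin r => if (a : ℕ) = 0 then k else 0) a a =
        if a = ⟨0, hr⟩ then MvPolynomial.hsymm (Fin r) ℤ k else 1 := by
      intro a
      simp only [jtMat, Matrix.of_apply]
      by_cases h : a = ⟨0, hr⟩
      · subst h; simp [hkZ_natCast]
      · have h' : (a : ℕ) ≠ 0 := fun h' => h (Fin.ext h')
        simp [h, h', hkZ_zero]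
    simp [this]
  · intro a b hab
    simp only [jtMat, Matrix.of_apply]
    apply hkZ_neg
    simp only [id] at hab
    have : (b : ℕ) < a := hab
    rw [if_neg (by omega)]
    omega

theorem schurCoeff_hsymm_mul {r n : ℕ} (hrn : r ≤ n) (k : ℕ) (hk : n - r + 1 ≤ k)
    (p : MvPolynomial (Fin r) ℤ) :
    schurCoeff r (MvPolynomial.hsymm (Fin r) ℤ k * p) (fun _ => n - r) = 0 := by
  classical
  rcases Nat.eq_zero_or_pos r with rfl | hr
  · rw [hsymm_eq_sum_finsuppAntidiag, Finset.univ_eq_empty,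
      Finset.finsuppAntidiag_empty_of_ne_zero (by omega)]
    simp [schurCoeff]
  · rw [schurCoeff, ← schurP_single hr, mul_right_comm, schurP_mul_alternant, altDet_eq_sum,
      Finset.sum_mul, MvPolynomial.coeff_sum]
    refine Finset.sum_eq_zero fun σ _ => ?_
    rw [MvPolynomial.coeff_monomial_mul', if_neg]
    intro hle
    have := hle (σ.symm ⟨0, hr⟩)
    have h2 := (σ.symm ⟨0, hr⟩).2
    simp at this
    omega

theorem schurCoeff_add (r : ℕ) (f g : MvPolynomial (Fin r) ℤ) (ν : Fin r → ℕ) :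
    schurCoeff r (f + g) ν = schurCoeff r f ν + schurCoeff r g ν := by
  simp [schurCoeff, add_mul]

theorem schurCoeff_grassIdeal {r n : ℕ} (hrn : r ≤ n) (f : MvPolynomial (Fin r) ℤ)
    (hf : f ∈ grassIdeal r n) : schurCoeff r f (fun _ => n - r) = 0 := by
  refine Submodule.span_induction (p := fun f _ => ∀ p, schurCoeff r (f * p) (fun _ => n - r) = 0)
    ?_ ?_ ?_ ?_ hf 1 |> fun h => by simpa using h
  · rintro _ ⟨k, hk, rfl⟩ p
    exact schurCoeff_hsymm_mul hrn k hk.1 p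
  · intro p; simp [schurCoeff]
  · intro x y _ _ hx hy p
    rw [add_mul, schurCoeff_add, hx, hy, add_zero]
  · intro a x _ hx p
    rw [smul_eq_mul, mul_comm a, mul_assoc]
    exact hx _

/-- The partition `λ_a = n - r + a - i_a` attached to a subset. -/
def lamOf {n r : ℕ} (i : Fin r → Fin n) : Fin r → ℕ := fun a => n - r + (a : ℕ) - (i a : ℕ)

theorem le_of_strictMono {n r : ℕ} {i : Fin r → Fin n} (hi : StrictMono i) : r ≤ n := by
  simpa using Fintype.card_le_of_injective i hi.injective

theorem add_le_of_strictMono {n r : ℕ} {i : Fin r → Fin n} (hi : StrictMono i) {a b : Fin r}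
    (hab : a ≤ b) : (i a : ℕ) + (b - a) ≤ i b := by
  have : ∀ k : ℕ, ∀ b : Fin r, (b : ℕ) = a + k → (i a : ℕ) + k ≤ i b := by
    intro k
    induction k with
    | zero => intro b hb; have : a = b := by ext; omega
              rw [this]; simp
    | succ k ih =>
      intro b hb
      have hb2 := b.2
      have h1 := ih ⟨a + k, by omega⟩ rfl
      have h2 : i ⟨a + k, by omega⟩ < i b := hi (by rw [Fin.lt_def]; simp only; omega)
      rw [Fin.lt_def] at h2
      omega
  have hab' : (a : ℕ) ≤ b := hab
  exact this _ b (by omega)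

theorem lamOf_aux {n r : ℕ} {i : Fin r → Fin n} (hi : StrictMono i) (a : Fin r) :
    (i a : ℕ) ≤ n - r + a ∧ (a : ℕ) ≤ i a := by
  have hr := a.2
  have h1 := add_le_of_strictMono hi (a := a) (b := ⟨r - 1, by omega⟩)
    (by rw [Fin.le_def]; simp only; omega)
  have h2 := add_le_of_strictMono hi (a := ⟨0, by omega⟩) (b := a)
    (by rw [Fin.le_def]; simp)
  have h3 := (i ⟨r - 1, by omega⟩).2
  have := le_of_strictMono hi
  simp only at h1 h2
  omega

theorem lamOf_cast {n r : ℕ} {i : Fin r → Fin n} (hi : StrictMono i) (a : Fin r) :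
    ((lamOf i a : ℕ) : ℤ) = (n : ℤ) - r + ((a : ℕ) : ℤ) - ((i a : ℕ) : ℤ) := by
  have := lamOf_aux hi a
  have := le_of_strictMono hi
  rw [lamOf]
  omega

theorem lamOf_le {n r : ℕ} {i : Fin r → Fin n} (hi : StrictMono i) (a : Fin r) :
    lamOf i a ≤ n - r := by
  have := lamOf_aux hi a
  rw [lamOf]
  omega

theorem lamOf_antitone {n r : ℕ} {i : Fin r → Fin n} (hi : StrictMono i) :
    Antitone (lamOf i) := by
  intro a b hab
  have h1 := add_le_of_strictMono hi hab
  have h2 : (a : ℕ) ≤ b := hab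
  rw [lamOf, lamOf]
  omega

theorem schurI_eq {n r : ℕ} {i : Fin r → Fin n} (hi : StrictMono i) :
    schurI i = schurP (lamOf i) := by
  rw [schurI, schurP]
  congr 1
  ext1 a b
  simp only [Matrix.of_apply]
  rw [lamOf_cast hi]
  congr 1
  ring

theorem prod_omegaCls_eq {n r : ℕ} {ι : Type*} [Fintype ι] {I : ι → Fin r → Fin n}
    (hI : ∀ j, StrictMono (I j)) : ∏ j, omegaCls (I j) =
      Ideal.Quotient.mk (grassIdeal r n) (∏ j, schurP (lamOf (I j))) := by
  rw [map_prod]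
  refine Finset.prod_congr rfl fun j _ => ?_
  rw [omegaCls, schurI_eq (hI j)]

theorem prod_schurP_isSymmetric {r : ℕ} {ι : Type*} [Fintype ι] (lam : ι → Fin r → ℕ) :
    (∏ j, schurP (lam j)).IsSymmetric := by
  intro σ
  rw [map_prod]
  exact Finset.prod_congr rfl fun j _ => schurP_isSymmetric _ σ

theorem exists_schurCoeff_ne_zero {n r : ℕ} (hrn : r ≤ n) {ι : Type*} [Fintype ι]
    {I : ι → Fin r → Fin n} (hI : ∀ j, StrictMono (I j)) (hA : ∏ j, omegaCls (I j) ≠ 0) :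
    ∃ ν : Fin r → ℕ, Antitone ν ∧ (∀ a, ν a ≤ n - r) ∧
      schurCoeff r (∏ j, schurP (lamOf (I j))) ν ≠ 0 := by
  by_contra hcon
  push Not at hcon
  apply hA
  rw [prod_omegaCls_eq hI, Ideal.Quotient.eq_zero_iff_mem]
  obtain ⟨N, hN, hf⟩ := symmetric_expansion _ (prod_schurP_isSymmetric fun j => lamOf (I j))
  rw [hf]
  refine Ideal.sum_mem _ fun ν hν => ?_
  by_cases hle : ∀ a, ν a ≤ n - r
  · rw [hcon ν (hN ν hν) hle, map_zero, zero_mul]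
    exact Ideal.zero_mem _
  · push Not at hle
    obtain ⟨a, ha⟩ := hle
    exact Ideal.mul_mem_left _ _ (schurP_mem_grassIdeal hrn ν (hN ν hν) a ha)

theorem prod_omegaCls_ne_zero {n r : ℕ} (hrn : r ≤ n) {ι : Type*} [Fintype ι]
    {I : ι → Fin r → Fin n} (hI : ∀ j, StrictMono (I j)) (p : MvPolynomial (Fin r) ℤ)
    (h : schurCoeff r ((∏ j, schurP (lamOf (I j))) * p) (fun _ => n - r) ≠ 0) :
    ∏ j, omegaCls (I j) ≠ 0 := by
  intro h0
  rw [prod_omegaCls_eq hI, Ideal.Quotient.eq_zero_iff_mem] at h0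
  exact h (schurCoeff_grassIdeal hrn _ (Ideal.mul_mem_right _ _ h0))

theorem pointCls_eq {r n : ℕ} (h : r ≤ n) :
    pointCls r n h = Ideal.Quotient.mk (grassIdeal r n) (schurP fun _ => n - r) := by
  have hm : StrictMono (fun a : Fin r => Fin.castLE h a) := fun a b hab => hab
  rw [pointCls, omegaCls, schurI_eq hm]
  congr 2
  ext a
  simp [lamOf]

theorem pointCls_ne_zero {r n : ℕ} (h : r ≤ n) : pointCls r n h ≠ 0 := by
  intro h0
  rw [pointCls_eq, Ideal.Quotient.eq_zero_iff_mem] at h0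
  have := schurCoeff_grassIdeal h _ h0
  rw [schurCoeff_schurP (fun _ _ _ => le_rfl) (fun _ _ _ => le_rfl)] at this
  simp at this

theorem schurP_isHomogeneous {r : ℕ} (lam : Fin r → ℕ) :
    (schurP lam).IsHomogeneous (∑ a, lam a) := by
  rw [schurP_eq, Matrix.det_apply]
  refine MvPolynomial.IsHomogeneous.sum _ _ _ fun σ _ => ?_
  rw [Units.smul_def, zsmul_eq_mul]
  have hC : ((Equiv.Perm.sign σ : ℤ) : MvPolynomial (Fin r) ℤ) =
    MvPolynomial.C (Equiv.Perm.sign σ : ℤ) := by simp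
  rw [hC]
  apply MvPolynomial.IsHomogeneous.C_mul
  by_cases hneg : ∃ a, (((lam (σ a) : ℕ) : ℤ) - ((σ a : ℕ) : ℤ) + ((a : ℕ) : ℤ)) < 0
  · obtain ⟨a, ha⟩ := hneg
    rw [Finset.prod_eq_zero (Finset.mem_univ a)]
    · exact MvPolynomial.isHomogeneous_zero _ _ _
    · exact hkZ_neg _ _ ha
  · push Not at hneg
    have hsum : ∑ a, lam a =
        ∑ a, (((lam (σ a) : ℕ) : ℤ) - ((σ a : ℕ) : ℤ) + ((a : ℕ) : ℤ)).toNat := by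
      zify
      simp only [Int.toNat_of_nonneg (hneg _)]
      rw [Finset.sum_add_distrib, Finset.sum_sub_distrib,
        Equiv.sum_comp σ (fun a => ((lam a : ℕ) : ℤ)), Equiv.sum_comp σ (fun a => ((a : ℕ) : ℤ))]
      ring
    rw [hsum]
    apply MvPolynomial.IsHomogeneous.prod
    intro a _
    rw [jtMat, Matrix.of_apply, hkZ, if_pos (hneg a), hsymm_eq_sum_finsuppAntidiag]
    refine MvPolynomial.IsHomogeneous.sum _ _ _ fun l hl => ?_
    rw [Finset.mem_finsuppAntidiag] at hl
    rw [← hl.1]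
    apply MvPolynomial.IsHomogeneous.prod
    intro i _
    simpa using (MvPolynomial.isHomogeneous_X ℤ i).pow (l i)

theorem altDet_isHomogeneous {r : ℕ} (e : Fin r → ℕ) :
    (altDet e).IsHomogeneous (∑ a, e a) := by
  rw [altDet_eq_sum]
  refine MvPolynomial.IsHomogeneous.sum _ _ _ fun σ _ => ?_
  apply MvPolynomial.isHomogeneous_monomial
  rw [Finsupp.degree_eq_sum]
  simpa using Equiv.sum_comp σ e

theorem schurCoeff_eq_zero_of_degree {r : ℕ} {ι : Type*} [Fintype ι] (lam : ι → Fin r → ℕ)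
    (ν : Fin r → ℕ) (h : schurCoeff r (∏ j, schurP (lam j)) ν ≠ 0) :
    ∑ a, ν a = ∑ j, ∑ a, lam j a := by
  have h1 : ((∏ j, schurP (lam j)) * alternant r).IsHomogeneous
      (∑ j, ∑ a, lam j a + ∑ a : Fin r, (r - 1 - (a : ℕ))) := by
    rw [alternant_eq_altDet]
    exact (MvPolynomial.IsHomogeneous.prod _ _ _ fun j _ => schurP_isHomogeneous _).mul
      (altDet_isHomogeneous _)
  have h2 := h1 h
  rw [Finsupp.weight_apply, Finsupp.sum_fintype _ _ (by simp)] at h2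
  simp [Finset.sum_add_distrib] at h2
  omega

theorem prod_omegaCls_eq_pointCls {n r : ℕ} (hrn : r ≤ n) {ι : Type*} [Fintype ι]
    {I : ι → Fin r → Fin n} (hI : ∀ j, StrictMono (I j))
    (hdeg : ∑ j, ∑ a, lamOf (I j) a = r * (n - r))
    (h : schurCoeff r (∏ j, schurP (lamOf (I j))) (fun _ => n - r) = 1) :
    ∏ j, omegaCls (I j) = pointCls r n hrn := by
  rw [prod_omegaCls_eq hI, pointCls_eq, Ideal.Quotient.eq]
  obtain ⟨N, hN, hf⟩ := symmetric_expansion _ (prod_schurP_isSymmetric fun j => lamOf (I j))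
  set f := ∏ j, schurP (lamOf (I j)) with hfdef
  have hmem : (fun _ => n - r : Fin r → ℕ) ∈ N := by
    by_contra hnot
    rw [hf, schurCoeff, Finset.sum_mul, MvPolynomial.coeff_sum, Finset.sum_eq_zero] at h
    · simp at h
    · intro ν hν
      rw [mul_assoc, MvPolynomial.coeff_C_mul]
      have := schurCoeff_schurP (hN ν hν) (ν := fun _ => n - r) (fun _ _ _ => le_rfl)
      rw [schurCoeff, if_neg (by rintro rfl; exact hnot hν)] at this
      rw [this, mul_zero]
  rw [hf, ← Finset.add_sum_erase _ _ hmem, h, map_one, one_mul, add_sub_cancel_left]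
  refine Ideal.sum_mem _ fun ν hν => ?_
  rw [Finset.mem_erase] at hν
  by_cases hc : schurCoeff r f ν = 0
  · rw [hc, map_zero, zero_mul]
    exact Ideal.zero_mem _
  · have hd := schurCoeff_eq_zero_of_degree _ _ hc
    rw [hdeg] at hd
    by_cases hle : ∀ a, ν a ≤ n - r
    · exfalso
      apply hν.1
      have : ∑ a, ν a = ∑ _a : Fin r, (n - r) := by rw [hd]; simp
      rw [Finset.sum_eq_sum_iff_of_le fun a _ => hle a] at this
      ext a
      exact this a (Finset.mem_univ a)
    · push Not at hle
      obtain ⟨a, ha⟩ := hle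
      exact Ideal.mul_mem_left _ _ (schurP_mem_grassIdeal hrn ν (hN ν hν.2) a ha)

/-! ### Highest weight vectors of unitary representations of `gl_r` over `ℚ` -/

/-- A representation of `gl_r` on a `ℚ`-vector space with an invariant positive definite form,
all of whose vectors are sums of weight vectors with nonnegative integral weights. -/
structure GLRep (r : ℕ) (E : Type) [AddCommGroup E] [Module ℚ E] where
  e : Fin r → Fin r → E →ₗ[ℚ] E
  B : E →ₗ[ℚ] E →ₗ[ℚ] ℚ
  rel : ∀ a b c d v, e a b (e c d v) - e c d (e a b v) =
    (if b = c then e a d v else 0) - (if d = a then e c b v else 0)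
  symm : ∀ v w, B v w = B w v
  pos : ∀ v, v ≠ 0 → 0 < B v v
  adj : ∀ a b v w, B (e a b v) w = B v (e b a w)
  graded : ∀ v, ∃ s : Finset (Fin r → ℤ), ∃ x : (Fin r → ℤ) → E,
    (∀ μ a, e a a (x μ) = (μ a : ℚ) • x μ) ∧ v = ∑ μ ∈ s, x μ
  nonneg : ∀ (μ : Fin r → ℤ) (v : E), v ≠ 0 → (∀ a, e a a v = (μ a : ℚ) • v) → ∀ a, 0 ≤ μ a

namespace GLRep

variable {r : ℕ} {E : Type} [AddCommGroup E] [Module ℚ E] (ρ : GLRep r E)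

/-- Weight spaces. -/
def wt (μ : Fin r → ℤ) : Submodule ℚ E :=
  ⨅ a, LinearMap.ker (ρ.e a a - (μ a : ℚ) • LinearMap.id)

theorem mem_wt {μ : Fin r → ℤ} {v : E} : v ∈ ρ.wt μ ↔ ∀ a, ρ.e a a v = (μ a : ℚ) • v := by
  simp [wt, sub_eq_zero]

/-- Highest weight vectors. -/
def hw (μ : Fin r → ℤ) : Submodule ℚ E :=
  ρ.wt μ ⊓ ⨅ a, ⨅ b, ⨅ _ : a < b, LinearMap.ker (ρ.e a b)

theorem mem_hw {μ : Fin r → ℤ} {v : E} :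
    v ∈ ρ.hw μ ↔ (∀ a, ρ.e a a v = (μ a : ℚ) • v) ∧ ∀ a b, a < b → ρ.e a b v = 0 := by
  simp [hw, mem_wt]

/-- Subrepresentations. -/
def Stable (W : Submodule ℚ E) : Prop := ∀ a b, ∀ v ∈ W, ρ.e a b v ∈ W

/-- Vectors obtained from `v` by applying lowering operators. -/
inductive LowWord (v : E) : E → Prop
  | base : LowWord v v
  | step (a b : Fin r) (hab : a < b) (x : E) : LowWord v x → LowWord v (ρ.e b a x)

/-- The subrepresentation generated by a highest weight vector. -/
def cyc (v : E) : Submodule ℚ E := span ℚ {x | ρ.LowWord v x}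

theorem self_mem_cyc (v : E) : v ∈ ρ.cyc v := subset_span (LowWord.base)

theorem low_mem_cyc {v x : E} (hx : x ∈ ρ.cyc v) {a b : Fin r} (hab : a < b) :
    ρ.e b a x ∈ ρ.cyc v := by
  refine span_induction (p := fun x _ => ρ.e b a x ∈ ρ.cyc v) ?_ ?_ ?_ ?_ hx
  · intro y hy
    exact subset_span (LowWord.step a b hab y hy)
  · simp
  · intro y z _ _ hy hz
    rw [map_add]; exact add_mem hy hz
  · intro c y _ hy
    rw [map_smul]; exact smul_mem _ _ hy

theorem stable_cyc {lam : Fin r → ℤ} {v : E} (hv : v ∈ ρ.hw lam) : ρ.Stable (ρ.cyc v) := by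
  rw [mem_hw] at hv
  have key : ∀ x, ρ.LowWord v x → ∀ c d, ρ.e c d x ∈ ρ.cyc v := by
    intro x hx
    induction hx with
    | base =>
      intro c d
      rcases lt_trichotomy c d with h | h | h
      · rw [hv.2 c d h]; exact zero_mem _
      · subst h; rw [hv.1]; exact smul_mem _ _ (ρ.self_mem_cyc v)
      · exact ρ.low_mem_cyc (ρ.self_mem_cyc v) h
    | step a b hab x hx ih =>
      intro c d
      have h := ρ.rel c d b a x
      rw [sub_eq_iff_eq_add] at h
      rw [h]
      refine add_mem (sub_mem ?_ ?_) (ρ.low_mem_cyc (ih c d) hab)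
      · split_ifs
        · exact ih _ _
        · exact zero_mem _
      · split_ifs
        · exact ih _ _
        · exact zero_mem _
  intro c d x hx
  refine span_induction (p := fun x _ => ρ.e c d x ∈ ρ.cyc v) ?_ ?_ ?_ ?_ hx
  · intro y hy
    exact key y hy c d
  · simp
  · intro y z _ _ hy hz
    rw [map_add]; exact add_mem hy hz
  · intro c y _ hy
    rw [map_smul]; exact smul_mem _ _ hy

theorem cyc_le {W : Submodule ℚ E} (hW : ρ.Stable W) {v : E} (hv : v ∈ W) : ρ.cyc v ≤ W := by
  rw [cyc, span_le]
  intro x hx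
  induction hx with
  | base => exact hv
  | step a b hab x hx ih => exact hW _ _ _ ih

/-- A vector of `cyc v` orthogonal to all lowering words vanishes. -/
theorem eq_zero_of_orth {v z : E} (hz : z ∈ ρ.cyc v) (h : ∀ x, ρ.LowWord v x → ρ.B z x = 0) :
    z = 0 := by
  by_contra hne
  have : ∀ y ∈ ρ.cyc v, ρ.B z y = 0 := by
    intro y hy
    refine span_induction (p := fun y _ => ρ.B z y = 0) h ?_ ?_ ?_ hy
    · simp
    · intro y z _ _ hy hz
      rw [map_add, hy, hz, add_zero]
    · intro c y _ hy
      rw [map_smul, hy, smul_zero]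
  exact (ρ.pos z hne).ne' (this z hz)

theorem orth_low {lam : Fin r → ℤ} {y : E} (hy : y ∈ ρ.hw lam) {a b : Fin r} (hab : a < b)
    (x : E) : ρ.B y (ρ.e b a x) = 0 := by
  rw [mem_hw] at hy
  rw [← ρ.adj, hy.2 a b hab, map_zero, LinearMap.zero_apply]

theorem eq_smul_of_orth {lam : Fin r → ℤ} {v y : E} (hv : v ∈ ρ.hw lam) (hv0 : v ≠ 0)
    (hy : y ∈ ρ.cyc v)
    (h : ∀ a b x, a < b → ρ.LowWord v x → ρ.B y (ρ.e b a x) = 0) :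
    y = (ρ.B y v / ρ.B v v) • v := by
  have hpos := ρ.pos v hv0
  rw [← sub_eq_zero]
  apply ρ.eq_zero_of_orth (v := v) (sub_mem hy (smul_mem _ _ (ρ.self_mem_cyc v)))
  intro x hx
  cases hx with
  | base =>
    rw [map_sub, LinearMap.sub_apply, map_smul, LinearMap.smul_apply, smul_eq_mul,
      div_mul_cancel₀ _ hpos.ne', sub_self]
  | step a b hab x hx =>
    rw [map_sub, LinearMap.sub_apply, map_smul, LinearMap.smul_apply, h a b x hab hx,
      ρ.orth_low hv hab, smul_zero, sub_zero]

theorem wt_unique {lam mu : Fin r → ℤ} {v : E} (h1 : v ∈ ρ.wt lam) (h2 : v ∈ ρ.wt mu)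
    (hv0 : v ≠ 0) : lam = mu := by
  rw [mem_wt] at h1 h2
  ext a
  have h := (h1 a).symm.trans (h2 a)
  have := smul_left_injective ℚ hv0 h
  exact_mod_cast this

theorem hw_le_wt (mu : Fin r → ℤ) : ρ.hw mu ≤ ρ.wt mu := inf_le_left

theorem cyc_inf_hw_self {lam : Fin r → ℤ} {v : E} (hv : v ∈ ρ.hw lam) (hv0 : v ≠ 0) :
    ρ.cyc v ⊓ ρ.hw lam = span ℚ {v} := by
  apply le_antisymm
  · rintro y ⟨hy, hyw⟩
    rw [ρ.eq_smul_of_orth hv hv0 hy fun a b x hab _ => ρ.orth_low hyw hab x]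
    exact smul_mem _ _ (mem_span_singleton_self v)
  · rw [span_singleton_le_iff_mem]
    exact ⟨ρ.self_mem_cyc v, hv⟩

theorem cyc_inf_hw_ne {lam mu : Fin r → ℤ} {v : E} (hv : v ∈ ρ.hw lam) (hv0 : v ≠ 0)
    (hne : mu ≠ lam) : ρ.cyc v ⊓ ρ.hw mu = ⊥ := by
  rw [eq_bot_iff]
  rintro y ⟨hy, hyw⟩
  rw [mem_bot]
  by_contra hy0
  have h := ρ.eq_smul_of_orth hv hv0 hy fun a b x hab _ => ρ.orth_low hyw hab x
  apply hne
  refine ρ.wt_unique (ρ.hw_le_wt _ hyw) ?_ hy0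
  rw [h]
  exact smul_mem _ _ (ρ.hw_le_wt _ hv)

/-- The height of a weight. -/
def ht (mu : Fin r → ℤ) : ℤ := ∑ a : Fin r, ((r : ℤ) - (a : ℕ)) * mu a

theorem lowWord_wt {lam : Fin r → ℤ} {v : E} (hv : v ∈ ρ.wt lam) {x : E} (hx : ρ.LowWord v x) :
    x = v ∨ ∃ mu : Fin r → ℤ, ht mu < ht lam ∧ x ∈ ρ.wt mu := by
  suffices h : (x = v ∨ ∃ mu : Fin r → ℤ, ht mu < ht lam ∧ x ∈ ρ.wt mu) ∧
      ∃ mu : Fin r → ℤ, ht mu ≤ ht lam ∧ x ∈ ρ.wt mu from h.1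
  induction hx with
  | base => exact ⟨Or.inl rfl, lam, le_rfl, hv⟩
  | step a b hab x hx ih =>
    obtain ⟨-, mu, hmu, hx⟩ := ih
    have : ∃ mu' : Fin r → ℤ, ht mu' < ht lam ∧ ρ.e b a x ∈ ρ.wt mu' := by
      refine ⟨mu + Pi.single b 1 - Pi.single a 1, ?_, ?_⟩
      · refine lt_of_lt_of_le ?_ hmu
        rw [ht, ht, ← sub_neg, ← Finset.sum_sub_distrib]
        have : ∀ i : Fin r, ((r : ℤ) - (i : ℕ)) *
            (mu + Pi.single b 1 - Pi.single a 1 : Fin r → ℤ) i - ((r : ℤ) - (i : ℕ)) * mu i =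
            ((r : ℤ) - (i : ℕ)) * (Pi.single b 1 : Fin r → ℤ) i -
              ((r : ℤ) - (i : ℕ)) * (Pi.single a 1 : Fin r → ℤ) i := by
          intro i
          simp only [Pi.add_apply, Pi.sub_apply]
          ring
        rw [Finset.sum_congr rfl fun i _ => this i, Finset.sum_sub_distrib]
        simp only [Pi.single_apply, mul_ite, mul_one, mul_zero, Finset.sum_ite_eq',
          Finset.mem_univ, if_true]
        have : (a : ℕ) < b := hab
        omega
      · rw [mem_wt] at hx ⊢
        intro c
        have h := ρ.rel c c b a x
        rw [sub_eq_iff_eq_add] at h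
        rw [h, hx c, map_smul]
        simp only [Pi.add_apply, Pi.sub_apply, Pi.single_apply]
        by_cases h1 : c = b <;> by_cases h2 : c = a
        · subst h1; exact absurd h2 hab.ne'
        · subst h1
          simp [h2, Ne.symm h2, add_smul, add_comm]
        · subst h2
          simp [h1, sub_smul]
          abel
        · simp [h1, h2, Ne.symm h2]
    exact ⟨Or.inr this, this.imp fun mu' h => ⟨h.1.le, h.2⟩⟩

theorem orth_of_ht {mu nu : Fin r → ℤ} {x y : E} (hx : x ∈ ρ.wt mu) (hy : y ∈ ρ.wt nu)
    (h : mu ≠ nu) : ρ.B x y = 0 := by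
  rw [mem_wt] at hx hy
  obtain ⟨a, ha⟩ := Function.ne_iff.1 h
  have h1 := ρ.adj a a x y
  rw [hx, hy, map_smul, LinearMap.smul_apply, map_smul, smul_eq_mul, smul_eq_mul] at h1
  rw [← sub_eq_zero, ← sub_mul, mul_eq_zero] at h1
  rcases h1 with h1 | h1
  · exfalso
    apply ha
    rw [sub_eq_zero] at h1
    exact_mod_cast h1
  · exact h1

theorem cyc_inf_wt {lam mu : Fin r → ℤ} {v : E} (hv : v ∈ ρ.hw lam) (hv0 : v ≠ 0)
    (hle : ht lam ≤ ht mu) : ρ.cyc v ⊓ ρ.wt mu ≤ span ℚ {v} := by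
  rintro y ⟨hy, hyw⟩
  rw [ρ.eq_smul_of_orth hv hv0 hy]
  · exact smul_mem _ _ (mem_span_singleton_self v)
  · intro a b x hab hx
    rcases ρ.lowWord_wt (ρ.hw_le_wt _ hv) (LowWord.step a b hab x hx) with h | ⟨nu, hnu, h⟩
    · exfalso
      have h1 := ρ.orth_low hv hab x
      rw [h] at h1
      exact (ρ.pos v hv0).ne' h1
    · refine ρ.orth_of_ht hyw h ?_
      rintro rfl
      omega

/-- The alternating sum of weight multiplicities. -/
def altDim (W : Submodule ℚ E) (nu : Fin r → ℤ) : ℤ :=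
  ∑ σ : Equiv.Perm (Fin r), (Equiv.Perm.sign σ : ℤ) *
    (finrank ℚ ↥(W ⊓ ρ.wt fun a => nu a + ((σ a : ℕ) : ℤ) - ((a : ℕ) : ℤ)) : ℤ)

theorem ht_perm (nu : Fin r → ℤ) (σ : Equiv.Perm (Fin r)) :
    ht nu ≤ ht (fun a => nu a + ((σ a : ℕ) : ℤ) - ((a : ℕ) : ℤ)) := by
  rw [ht, ht, ← sub_nonneg, ← Finset.sum_sub_distrib]
  have h1 : ∑ a : Fin r, (((σ a : ℕ) : ℤ) ^ 2) = ∑ a : Fin r, (((a : ℕ) : ℤ) ^ 2) :=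
    Equiv.sum_comp σ (fun a => (((a : ℕ) : ℤ) ^ 2))
  have h2 : ∑ a : Fin r, (((σ a : ℕ) : ℤ)) = ∑ a : Fin r, (((a : ℕ) : ℤ)) :=
    Equiv.sum_comp σ (fun a => (((a : ℕ) : ℤ)))
  have h3 : 0 ≤ ∑ a : Fin r, (((σ a : ℕ) : ℤ) - ((a : ℕ) : ℤ)) ^ 2 :=
    Finset.sum_nonneg fun a _ => sq_nonneg _
  have h4 : ∑ a : Fin r, (((σ a : ℕ) : ℤ) - ((a : ℕ) : ℤ)) ^ 2 =
      2 * ∑ a : Fin r, ((r : ℤ) - (a : ℕ)) * (((σ a : ℕ) : ℤ) - ((a : ℕ) : ℤ)) := by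
    have : ∀ a : Fin r, (((σ a : ℕ) : ℤ) - ((a : ℕ) : ℤ)) ^ 2 =
        2 * (((r : ℤ) - (a : ℕ)) * (((σ a : ℕ) : ℤ) - ((a : ℕ) : ℤ))) +
          (((σ a : ℕ) : ℤ) ^ 2 - ((a : ℕ) : ℤ) ^ 2) -
          2 * r * (((σ a : ℕ) : ℤ) - ((a : ℕ) : ℤ)) := by
      intro a; ring
    rw [Finset.sum_congr rfl fun a _ => this a, Finset.sum_sub_distrib, Finset.sum_add_distrib,
      ← Finset.mul_sum, ← Finset.mul_sum, Finset.sum_sub_distrib, Finset.sum_sub_distrib, h1, h2]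
    ring
  have h5 : ∀ a : Fin r, ((r : ℤ) - (a : ℕ)) * (nu a + ((σ a : ℕ) : ℤ) - ((a : ℕ) : ℤ)) -
      ((r : ℤ) - (a : ℕ)) * nu a = ((r : ℤ) - (a : ℕ)) * (((σ a : ℕ) : ℤ) - ((a : ℕ) : ℤ)) := by
    intro a; ring
  rw [Finset.sum_congr rfl fun a _ => h5 a]
  omega

theorem altDim_cyc_self {lam : Fin r → ℤ} {v : E} (hv : v ∈ ρ.hw lam) (hv0 : v ≠ 0) :
    ρ.altDim (ρ.cyc v) lam = 1 := by
  rw [altDim, Finset.sum_eq_single 1]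
  · have : ρ.cyc v ⊓ ρ.wt (fun a => lam a + (((1 : Equiv.Perm (Fin r)) a : ℕ) : ℤ) -
        ((a : ℕ) : ℤ)) = span ℚ {v} := by
      simp only [Equiv.Perm.coe_one, id, add_sub_cancel_right]
      apply le_antisymm (ρ.cyc_inf_wt hv hv0 le_rfl)
      rw [span_singleton_le_iff_mem]
      exact ⟨ρ.self_mem_cyc v, ρ.hw_le_wt _ hv⟩
    rw [this, finrank_span_singleton hv0]
    simp
  · intro σ _ hσ
    have : ρ.cyc v ⊓ ρ.wt (fun a => lam a + ((σ a : ℕ) : ℤ) - ((a : ℕ) : ℤ)) = ⊥ := by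
      rw [eq_bot_iff]
      intro y hy
      rw [mem_bot]
      by_contra hy0
      have h := ρ.cyc_inf_wt hv hv0 (ht_perm lam σ) hy
      rw [mem_span_singleton] at h
      obtain ⟨c, rfl⟩ := h
      have h2 := ρ.wt_unique hy.2 (smul_mem _ c (ρ.hw_le_wt _ hv)) hy0
      apply hσ
      ext a
      have h3 := congrFun h2 a
      rw [Equiv.Perm.coe_one, id]
      omega
    rw [this]
    simp
  · simp

theorem hw_antitone {lam : Fin r → ℤ} {v : E} (hv : v ∈ ρ.hw lam) (hv0 : v ≠ 0) :
    Antitone lam := by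
  intro a b hab
  rcases hab.eq_or_lt with rfl | hab
  · exact le_rfl
  have hpos := ρ.pos v hv0
  rw [mem_hw] at hv
  have h1 : ρ.B (ρ.e b a v) (ρ.e b a v) = ((lam a : ℚ) - lam b) * ρ.B v v := by
    have h := ρ.rel a b b a v
    rw [sub_eq_iff_eq_add, hv.2 a b hab, if_pos rfl, if_pos rfl, map_zero, add_zero, hv.1,
      hv.1] at h
    rw [ρ.adj, h, map_sub, map_smul, map_smul, smul_eq_mul, smul_eq_mul, sub_mul]
  have h2 : 0 ≤ ρ.B (ρ.e b a v) (ρ.e b a v) := by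
    by_cases h0 : ρ.e b a v = 0
    · rw [h0]; simp
    · exact (ρ.pos _ h0).le
  rw [h1] at h2
  have h3 := nonneg_of_mul_nonneg_left h2 hpos
  have : (lam b : ℚ) ≤ lam a := by linarith
  exact_mod_cast this

end GLRep

namespace GLRep

variable {r : ℕ} {E : Type} [AddCommGroup E] [Module ℚ E] (ρ : GLRep r E)
  {E' : Type} [AddCommGroup E'] [Module ℚ E'] (ρ' : GLRep r E')

theorem injOn_cyc (φ : E →ₗ[ℚ] E') (hφ : ∀ a b x, φ (ρ.e a b x) = ρ'.e a b (φ x))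
    {lam : Fin r → ℤ} {u : E} (hu : u ∈ ρ.hw lam) (hu0 : φ u ≠ 0) {x : E} (hx : x ∈ ρ.cyc u)
    (hx0 : φ x = 0) : x = 0 := by
  have hu' : φ u ∈ ρ'.hw lam := by
    rw [mem_hw] at hu ⊢
    refine ⟨fun a => ?_, fun a b hab => ?_⟩
    · rw [← hφ, hu.1, map_smul]
    · rw [← hφ, hu.2 a b hab, map_zero]
  have h1 : ∀ z ∈ ρ.cyc u,
      ρ'.B (φ u) (φ z) * ρ.B u u = ρ.B u z * ρ'.B (φ u) (φ u) := by
    intro z hz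
    refine span_induction
      (p := fun z _ => ρ'.B (φ u) (φ z) * ρ.B u u = ρ.B u z * ρ'.B (φ u) (φ u)) ?_ ?_ ?_ ?_ hz
    · intro y hy
      cases hy with
      | base => ring
      | step a b hab y hy =>
        rw [hφ, ρ.orth_low hu hab, ρ'.orth_low hu' hab, zero_mul, zero_mul]
    · simp
    · intro y z _ _ hy hz
      rw [map_add, map_add, map_add, add_mul, add_mul, hy, hz]
    · intro c y _ hy
      rw [map_smul, map_smul, map_smul, smul_eq_mul, smul_eq_mul, mul_assoc, hy, mul_assoc]
  have h2 : ∀ y, ρ.LowWord u y → ∀ z ∈ ρ.cyc u, φ z = 0 → ρ.B z y = 0 := by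
    intro y hy
    induction hy with
    | base =>
      intro z hz hz0
      have h := h1 z hz
      rw [hz0, map_zero, zero_mul] at h
      have := (mul_eq_zero.1 h.symm).resolve_right (ρ'.pos _ hu0).ne'
      rw [ρ.symm, this]
    | step a b hab y hy ih =>
      intro z hz hz0
      rw [← ρ.adj]
      exact ih _ (ρ.stable_cyc hu _ _ _ hz) (by rw [hφ, hz0, map_zero])
  exact ρ.eq_zero_of_orth hx fun y hy => h2 y hy x hx hx0

theorem finrank_cyc_map (φ : E →ₗ[ℚ] E') (hφ : ∀ a b x, φ (ρ.e a b x) = ρ'.e a b (φ x))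
    {lam : Fin r → ℤ} {u : E} (hu : u ∈ ρ.hw lam) (hu0 : φ u ≠ 0) (mu : Fin r → ℤ) :
    finrank ℚ ↥(ρ.cyc u ⊓ ρ.wt mu) = finrank ℚ ↥(ρ'.cyc (φ u) ⊓ ρ'.wt mu) := by
  have hmap : Submodule.map φ (ρ.cyc u) = ρ'.cyc (φ u) := by
    rw [cyc, cyc, map_span]
    congr 1
    ext y
    constructor
    · rintro ⟨x, hx, rfl⟩
      induction hx with
      | base => exact LowWord.base
      | step a b hab x hx ih => rw [hφ]; exact LowWord.step a b hab _ ih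
    · intro hy
      induction hy with
      | base => exact ⟨u, LowWord.base, rfl⟩
      | step a b hab y hy ih =>
        obtain ⟨x, hx, rfl⟩ := ih
        exact ⟨_, LowWord.step a b hab x hx, hφ _ _ _⟩
  have hmap2 : Submodule.map φ (ρ.cyc u ⊓ ρ.wt mu) = ρ'.cyc (φ u) ⊓ ρ'.wt mu := by
    apply le_antisymm
    · rintro _ ⟨x, ⟨hx, hxw⟩, rfl⟩
      refine ⟨hmap ▸ mem_map_of_mem hx, ?_⟩
      rw [SetLike.mem_coe, mem_wt] at hxw
      rw [SetLike.mem_coe, mem_wt]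
      intro a
      rw [← hφ, hxw, map_smul]
    · rintro y ⟨hy, hyw⟩
      rw [← hmap] at hy
      obtain ⟨x, hx, rfl⟩ := hy
      refine ⟨x, ⟨hx, ?_⟩, rfl⟩
      rw [SetLike.mem_coe, mem_wt] at hyw ⊢
      intro a
      rw [← sub_eq_zero]
      apply injOn_cyc ρ ρ' φ hφ hu hu0
      · exact sub_mem (ρ.stable_cyc hu _ _ _ hx) (smul_mem _ _ hx)
      · rw [map_sub, hφ, hyw, map_smul, sub_self]
  rw [← hmap2]
  have hinj : Function.Injective (φ.domRestrict (ρ.cyc u ⊓ ρ.wt mu)) := by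
    rw [← LinearMap.ker_eq_bot, LinearMap.ker_eq_bot']
    rintro ⟨x, hx⟩ h
    exact Subtype.ext (injOn_cyc ρ ρ' φ hφ hu hu0 hx.1 h)
  rw [← LinearMap.finrank_range_of_inj hinj, LinearMap.range_domRestrict]

/-- The direct sum of two representations. -/
def prod : GLRep r (E × E') where
  e a b := (ρ.e a b).prodMap (ρ'.e a b)
  B := ρ.B.compl₁₂ (LinearMap.fst ℚ E E') (LinearMap.fst ℚ E E') +
    ρ'.B.compl₁₂ (LinearMap.snd ℚ E E') (LinearMap.snd ℚ E E')
  rel a b c d v := by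
    ext
    · have := ρ.rel a b c d v.1
      simp only [LinearMap.prodMap_apply, Prod.fst_sub, this]
      split_ifs <;> simp
    · have := ρ'.rel a b c d v.2
      simp only [LinearMap.prodMap_apply, Prod.snd_sub, this]
      split_ifs <;> simp
  symm v w := by simp [ρ.symm v.1, ρ'.symm v.2]
  pos v hv := by
    have h1 : 0 ≤ ρ.B v.1 v.1 := by
      by_cases h : v.1 = 0
      · simp [h]
      · exact (ρ.pos _ h).le
    have h2 : 0 ≤ ρ'.B v.2 v.2 := by
      by_cases h : v.2 = 0
      · simp [h]
      · exact (ρ'.pos _ h).le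
    by_cases h : v.1 = 0
    · have h' : v.2 ≠ 0 := fun h' => hv (Prod.ext h h')
      have := ρ'.pos _ h'
      simp; linarith
    · have := ρ.pos _ h
      simp; linarith
  adj a b v w := by simp [ρ.adj, ρ'.adj]
  graded v := by
    classical
    obtain ⟨s, x, hx, hv⟩ := ρ.graded v.1
    obtain ⟨s', x', hx', hv'⟩ := ρ'.graded v.2
    refine ⟨s ∪ s', fun μ => (if μ ∈ s then x μ else 0, if μ ∈ s' then x' μ else 0), ?_, ?_⟩
    · intro μ a
      ext
      · simp only [LinearMap.prodMap_apply, Prod.smul_fst]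
        split_ifs
        · exact hx μ a
        · simp
      · simp only [LinearMap.prodMap_apply, Prod.smul_snd]
        split_ifs
        · exact hx' μ a
        · simp
    · ext
      · rw [hv, Prod.fst_sum]
        simp
      · rw [hv', Prod.snd_sum]
        simp
  nonneg μ v hv h a := by
    by_cases h0 : v.1 = 0
    · have h' : v.2 ≠ 0 := fun h' => hv (Prod.ext h0 h')
      exact ρ'.nonneg μ v.2 h' (fun a => congrArg Prod.snd (h a)) a
    · exact ρ.nonneg μ v.1 h0 (fun a => congrArg Prod.fst (h a)) a

theorem finrank_cyc_eq {lam : Fin r → ℤ} {v : E} {v' : E'} (hv : v ∈ ρ.hw lam) (hv0 : v ≠ 0)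
    (hv' : v' ∈ ρ'.hw lam) (hv0' : v' ≠ 0) (mu : Fin r → ℤ) :
    finrank ℚ ↥(ρ.cyc v ⊓ ρ.wt mu) = finrank ℚ ↥(ρ'.cyc v' ⊓ ρ'.wt mu) := by
  have hu : (v, v') ∈ (ρ.prod ρ').hw lam := by
    rw [mem_hw] at *
    refine ⟨fun a => Prod.ext (hv.1 a) (hv'.1 a), fun a b hab => ?_⟩
    exact Prod.ext (hv.2 a b hab) (hv'.2 a b hab)
  have h1 := finrank_cyc_map (ρ.prod ρ') ρ (LinearMap.fst ℚ E E') (fun _ _ _ => rfl) hu hv0 mu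
  have h2 := finrank_cyc_map (ρ.prod ρ') ρ' (LinearMap.snd ℚ E E') (fun _ _ _ => rfl) hu hv0' mu
  exact h1.symm.trans h2

theorem altDim_cyc_eq {lam : Fin r → ℤ} {v : E} {v' : E'} (hv : v ∈ ρ.hw lam) (hv0 : v ≠ 0)
    (hv' : v' ∈ ρ'.hw lam) (hv0' : v' ≠ 0) (mu : Fin r → ℤ) :
    ρ.altDim (ρ.cyc v) mu = ρ'.altDim (ρ'.cyc v') mu := by
  rw [altDim, altDim]
  refine Finset.sum_congr rfl fun σ _ => ?_
  rw [finrank_cyc_eq ρ ρ' hv hv0 hv' hv0']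

/-- The alternating multiplicity of `nu` in the irreducible representation of highest
weight `lam`. -/
def irrAlt (lam nu : Fin r → ℤ) : ℤ :=
  Classical.epsilon fun z : ℤ => ∃ (E : Type) (_ : AddCommGroup E) (_ : Module ℚ E)
    (ρ : GLRep r E) (v : E), v ∈ ρ.hw lam ∧ v ≠ 0 ∧ z = ρ.altDim (ρ.cyc v) nu

theorem altDim_cyc {lam : Fin r → ℤ} {v : E} (hv : v ∈ ρ.hw lam) (hv0 : v ≠ 0)
    (nu : Fin r → ℤ) : ρ.altDim (ρ.cyc v) nu = irrAlt lam nu := by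
  have h : ∃ z : ℤ, ∃ (E : Type) (_ : AddCommGroup E) (_ : Module ℚ E)
    (ρ : GLRep r E) (v : E), v ∈ ρ.hw lam ∧ v ≠ 0 ∧ z = ρ.altDim (ρ.cyc v) nu :=
    ⟨_, E, _, _, ρ, v, hv, hv0, rfl⟩
  obtain ⟨E', i1, i2, ρ', v', h1, h2, h3⟩ := Classical.epsilon_spec h
  rw [irrAlt, h3]
  exact altDim_cyc_eq ρ ρ' hv hv0 h1 h2 nu

theorem exists_wt_vector {W : Submodule ℚ E} (hW : ρ.Stable W) (hne : W ≠ ⊥) :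
    ∃ (mu : Fin r → ℤ) (v : E), v ∈ W ∧ v ∈ ρ.wt mu ∧ v ≠ 0 := by
  classical
  have key : ∀ (s : Finset (Fin r → ℤ)) (x : (Fin r → ℤ) → E),
      (∀ μ a, ρ.e a a (x μ) = (μ a : ℚ) • x μ) → ∑ μ ∈ s, x μ ∈ W → ∑ μ ∈ s, x μ ≠ 0 →
      ∃ (mu : Fin r → ℤ) (v : E), v ∈ W ∧ v ∈ ρ.wt mu ∧ v ≠ 0 := by
    intro s
    induction s using Finset.induction_on with
    | empty => intro x _ _ h; simp at h
    | insert μ1 s hμ1 ih =>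
      intro x hx hxW hx0
      set T := ∑ μ ∈ insert μ1 s, x μ with hT
      have hy : ∀ a, ρ.e a a T - (μ1 a : ℚ) • T = ∑ μ ∈ s, ((μ a : ℚ) - μ1 a) • x μ := by
        intro a
        rw [hT, map_sum, Finset.smul_sum, ← Finset.sum_sub_distrib, Finset.sum_insert hμ1, hx,
          sub_self, zero_add]
        refine Finset.sum_congr rfl fun μ _ => ?_
        rw [hx, sub_smul]
      by_cases h : ∀ a, ρ.e a a T - (μ1 a : ℚ) • T = 0
      · refine ⟨μ1, T, hxW, ?_, hx0⟩
        rw [mem_wt]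
        exact fun a => sub_eq_zero.1 (h a)
      · push Not at h
        obtain ⟨a, ha⟩ := h
        have hm : ρ.e a a T - (μ1 a : ℚ) • T ∈ W := sub_mem (hW _ _ _ hxW) (smul_mem _ _ hxW)
        rw [hy a] at ha hm
        refine ih _ ?_ hm ha
        intro μ b
        rw [map_smul, hx, smul_comm]
  obtain ⟨v, hv, hv0⟩ := W.ne_bot_iff.1 hne
  obtain ⟨s, x, hx, rfl⟩ := ρ.graded v
  exact key s x hx hv hv0

theorem exists_hw_vector {W : Submodule ℚ E} (hW : ρ.Stable W) (hne : W ≠ ⊥) :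
    ∃ (mu : Fin r → ℤ) (v : E), v ∈ W ∧ v ∈ ρ.hw mu ∧ v ≠ 0 := by
  have key : ∀ (n : ℕ) (mu : Fin r → ℤ) (v : E), r * ∑ a, mu a - ht mu ≤ n → v ∈ W →
      v ∈ ρ.wt mu → v ≠ 0 → ∃ (mu : Fin r → ℤ) (v : E), v ∈ W ∧ v ∈ ρ.hw mu ∧ v ≠ 0 := by
    intro n
    induction n with
    | zero => ?_
    | succ n ih => ?_
    all_goals
      intro mu v hn hv hmu hv0
      by_cases h : ∀ a b, a < b → ρ.e a b v = 0
      · refine ⟨mu, v, hv, ?_, hv0⟩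
        rw [mem_hw]
        exact ⟨(ρ.mem_wt).1 hmu, h⟩
      push Not at h
      obtain ⟨a, b, hab, h0⟩ := h
      have hab' : (a : ℕ) < b := hab
      have hw : ρ.e a b v ∈ ρ.wt (mu + Pi.single a 1 - Pi.single b 1) := by
        rw [mem_wt] at hmu ⊢
        intro c
        have h := ρ.rel c c a b v
        rw [sub_eq_iff_eq_add] at h
        rw [h, hmu c, map_smul]
        simp only [Pi.add_apply, Pi.sub_apply, Pi.single_apply]
        by_cases h1 : c = b <;> by_cases h2 : c = a
        · subst h1; exact absurd h2 hab.ne'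
        · subst h1
          simp [h2, sub_smul]
          abel
        · subst h2
          simp [h1, Ne.symm h1, add_smul, add_comm]
        · simp [h1, h2, Ne.symm h1]
      have hht : r * ∑ c, (mu + Pi.single a 1 - Pi.single b 1 : Fin r → ℤ) c -
          ht (mu + Pi.single a 1 - Pi.single b 1) =
          r * ∑ c, mu c - ht mu - ((b : ℕ) - (a : ℕ)) := by
        have hs : ∀ (c : Fin r), ((r : ℤ) - (c : ℕ)) * (mu + Pi.single a 1 - Pi.single b 1 : Fin r → ℤ) c
            = ((r : ℤ) - (c : ℕ)) * mu c + ((r : ℤ) - (c : ℕ)) * (Pi.single a 1 : Fin r → ℤ) c -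
              ((r : ℤ) - (c : ℕ)) * (Pi.single b 1 : Fin r → ℤ) c := by
          intro c; simp only [Pi.add_apply, Pi.sub_apply]; ring
        rw [ht, ht, Finset.sum_congr rfl fun c _ => hs c]
        simp only [Pi.add_apply, Pi.sub_apply, Finset.sum_add_distrib, Finset.sum_sub_distrib]
        simp only [Pi.single_apply, mul_ite, mul_one, mul_zero, Finset.sum_ite_eq',
          Finset.mem_univ, if_true]
        ring
    · exfalso
      have hnn := ρ.nonneg _ _ h0 ((ρ.mem_wt).1 hw)
      have : 0 ≤ r * ∑ c, (mu + Pi.single a 1 - Pi.single b 1 : Fin r → ℤ) c -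
          ht (mu + Pi.single a 1 - Pi.single b 1) := by
        rw [ht, Finset.mul_sum, ← Finset.sum_sub_distrib]
        refine Finset.sum_nonneg fun c _ => ?_
        rw [← sub_mul]
        exact mul_nonneg (by simp) (hnn c)
      rw [hht] at this
      push_cast at hn
      omega
    · exact ih _ _ (by rw [hht]; push_cast at hn ⊢; omega) (hW _ _ _ hv) hw h0
  obtain ⟨mu, v, h1, h2, h3⟩ := ρ.exists_wt_vector hW hne
  exact key _ mu v (Int.self_le_toNat _) h1 h2 h3

/-- The orthogonal complement of a cyclic subrepresentation. -/
def compl (W : Submodule ℚ E) (v : E) : Submodule ℚ E :=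
  W ⊓ LinearMap.BilinForm.orthogonal ρ.B (ρ.cyc v)

theorem mem_compl {W : Submodule ℚ E} {v x : E} :
    x ∈ ρ.compl W v ↔ x ∈ W ∧ ∀ y ∈ ρ.cyc v, ρ.B y x = 0 := Iff.rfl

theorem stable_compl {W : Submodule ℚ E} (hW : ρ.Stable W) {lam : Fin r → ℤ} {v : E}
    (hv : v ∈ ρ.hw lam) : ρ.Stable (ρ.compl W v) := by
  intro a b x hx
  rw [mem_compl] at hx ⊢
  refine ⟨hW _ _ _ hx.1, fun y hy => ?_⟩
  rw [← ρ.adj]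
  exact hx.2 _ (ρ.stable_cyc hv _ _ _ hy)

theorem cyc_inf_compl (W : Submodule ℚ E) (v : E) : ρ.cyc v ⊓ ρ.compl W v = ⊥ := by
  rw [eq_bot_iff]
  rintro x ⟨h1, h2⟩
  rw [mem_bot]
  by_contra h
  exact (ρ.pos x h).ne' (((ρ.mem_compl).1 h2).2 x h1)

theorem exists_decomp {W : Submodule ℚ E} (hW : ρ.Stable W) (hfin : FiniteDimensional ℚ W)
    {v : E} (hvW : v ∈ W) {x : E} (hx : x ∈ W) :
    ∃ u ∈ ρ.cyc v, ∃ w ∈ ρ.compl W v, x = u + w := by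
  have hle : ρ.cyc v ≤ W := ρ.cyc_le hW hvW
  have : FiniteDimensional ℚ (ρ.cyc v) := Submodule.finiteDimensional_of_le hle
  have hnd : (LinearMap.BilinForm.restrict ρ.B (ρ.cyc v)).Nondegenerate := by
    have hsep : ∀ a : ρ.cyc v, ρ.B (a : E) (a : E) = 0 → a = 0 := by
      intro a h
      by_contra h0
      exact (ρ.pos (a : E) (by simpa using h0)).ne' h
    constructor
    · intro a h
      exact hsep a (h a)
    · intro a h
      exact hsep a (h a)
  set B' := LinearMap.BilinForm.restrict ρ.B (ρ.cyc v) with hB'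
  let φ : Dual ℚ (ρ.cyc v) := (ρ.B x).comp (ρ.cyc v).subtype
  set u := (LinearMap.BilinForm.toDual B' hnd).symm φ with hu
  have h : ∀ y : ρ.cyc v, ρ.B (u : E) (y : E) = ρ.B x (y : E) := by
    intro y
    have h1 : LinearMap.BilinForm.toDual B' hnd u y = φ y := by
      rw [hu, LinearEquiv.apply_symm_apply]
    rw [LinearMap.BilinForm.toDual_def] at h1
    exact h1
  refine ⟨u, u.2, x - u, ρ.mem_compl.2 ⟨sub_mem hx (hle u.2), fun y hy => ?_⟩, by abel⟩
  rw [ρ.symm, map_sub, LinearMap.sub_apply, h ⟨y, hy⟩, sub_self]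

theorem finrank_split {W : Submodule ℚ E} (hW : ρ.Stable W) (hfin : FiniteDimensional ℚ W)
    {v : E} (hvW : v ∈ W) (T : Submodule ℚ E)
    (hT : ∀ u ∈ ρ.cyc v, ∀ w ∈ ρ.compl W v, u + w ∈ T → u ∈ T ∧ w ∈ T) :
    finrank ℚ ↥(W ⊓ T) = finrank ℚ ↥(ρ.cyc v ⊓ T) + finrank ℚ ↥(ρ.compl W v ⊓ T) := by
  have hle : ρ.cyc v ≤ W := ρ.cyc_le hW hvW
  have i1 : FiniteDimensional ℚ ↥(ρ.cyc v ⊓ T) :=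
    Submodule.finiteDimensional_of_le (inf_le_left.trans hle)
  have i2 : FiniteDimensional ℚ ↥(ρ.compl W v ⊓ T) :=
    Submodule.finiteDimensional_of_le (S₂ := W) (inf_le_left.trans inf_le_left)
  have h := finrank_sup_add_finrank_inf_eq (ρ.cyc v ⊓ T) (ρ.compl W v ⊓ T)
  have h1 : (ρ.cyc v ⊓ T) ⊓ (ρ.compl W v ⊓ T) = ⊥ := by
    rw [eq_bot_iff, ← ρ.cyc_inf_compl W v]
    exact inf_le_inf inf_le_left inf_le_left
  have h2 : (ρ.cyc v ⊓ T) ⊔ (ρ.compl W v ⊓ T) = W ⊓ T := by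
    apply le_antisymm
    · exact sup_le (inf_le_inf_right _ hle) (inf_le_inf_right _ inf_le_left)
    · rintro x ⟨hx, hxT⟩
      obtain ⟨u, hu, w, hw, rfl⟩ := ρ.exists_decomp hW hfin hvW hx
      obtain ⟨h3, h4⟩ := hT u hu w hw hxT
      exact Submodule.add_mem_sup ⟨hu, h3⟩ ⟨hw, h4⟩
  rw [h1, h2, finrank_bot, add_zero] at h
  exact h

theorem eq_zero_of_add_eq_zero {W : Submodule ℚ E} {v u w : E} (hu : u ∈ ρ.cyc v)
    (hw : w ∈ ρ.compl W v) (h : u + w = 0) : u = 0 ∧ w = 0 := by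
  have h1 : u = -w := eq_neg_of_add_eq_zero_left h
  have h2 : u ∈ ρ.cyc v ⊓ ρ.compl W v := ⟨hu, h1 ▸ neg_mem hw⟩
  rw [cyc_inf_compl, mem_bot] at h2
  subst h2
  exact ⟨rfl, by simpa using h⟩

theorem altDim_eq_sum (P : Finset (Fin r → ℤ)) (nu : Fin r → ℤ) : ∀ (n : ℕ) (W : Submodule ℚ E),
    ρ.Stable W → FiniteDimensional ℚ W → finrank ℚ W = n →
    (∀ (mu : Fin r → ℤ) (v : E), v ∈ W → v ∈ ρ.hw mu → v ≠ 0 → mu ∈ P) →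
    ρ.altDim W nu = ∑ lam ∈ P, (finrank ℚ ↥(W ⊓ ρ.hw lam) : ℤ) * irrAlt lam nu := by
  intro n
  induction n using Nat.strong_induction_on with
  | _ n ih =>
  intro W hW hfin hn hP
  by_cases hbot : W = ⊥
  · subst hbot
    have hz : ∀ T : Submodule ℚ E, finrank ℚ ↥((⊥ : Submodule ℚ E) ⊓ T) = 0 := fun T => by
      rw [bot_inf_eq, finrank_bot]
    simp only [altDim, hz, Nat.cast_zero, mul_zero, zero_mul, Finset.sum_const_zero]
  obtain ⟨lam, v, hvW, hv, hv0⟩ := ρ.exists_hw_vector hW hbot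
  have hwt : ∀ mu : Fin r → ℤ, ∀ u ∈ ρ.cyc v, ∀ w ∈ ρ.compl W v, u + w ∈ ρ.wt mu →
      u ∈ ρ.wt mu ∧ w ∈ ρ.wt mu := by
    intro mu u hu w hw huw
    rw [mem_wt] at *
    rw [mem_wt, ← forall_and]
    intro a
    have h := huw a
    rw [map_add, smul_add, ← sub_eq_zero, add_sub_add_comm] at h
    have := ρ.eq_zero_of_add_eq_zero
      (sub_mem (ρ.stable_cyc hv a a u hu) (smul_mem _ _ hu))
      (sub_mem (ρ.stable_compl hW hv a a w hw) (smul_mem _ _ hw)) h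
    rwa [sub_eq_zero, sub_eq_zero] at this
  have hhw : ∀ mu : Fin r → ℤ, ∀ u ∈ ρ.cyc v, ∀ w ∈ ρ.compl W v, u + w ∈ ρ.hw mu →
      u ∈ ρ.hw mu ∧ w ∈ ρ.hw mu := by
    intro mu u hu w hw huw
    obtain ⟨h1, h2⟩ := hwt mu u hu w hw (ρ.hw_le_wt _ huw)
    have h3 := (ρ.mem_hw.1 huw).2
    have h4 : ∀ a b, a < b → ρ.e a b u = 0 ∧ ρ.e a b w = 0 := by
      intro a b hab
      have h := h3 a b hab
      rw [map_add] at h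
      exact ρ.eq_zero_of_add_eq_zero (ρ.stable_cyc hv a b u hu)
        (ρ.stable_compl hW hv a b w hw) h
    exact ⟨ρ.mem_hw.2 ⟨ρ.mem_wt.1 h1, fun a b hab => (h4 a b hab).1⟩,
      ρ.mem_hw.2 ⟨ρ.mem_wt.1 h2, fun a b hab => (h4 a b hab).2⟩⟩
  have hfin' : FiniteDimensional ℚ ↥(ρ.compl W v) :=
    Submodule.finiteDimensional_of_le (S₂ := W) inf_le_left
  have hlt : finrank ℚ ↥(ρ.compl W v) < n := by
    rw [← hn]
    apply Submodule.finrank_lt_finrank_of_lt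
    refine lt_of_le_of_ne inf_le_left ?_
    intro h
    have : v ∈ ρ.cyc v ⊓ ρ.compl W v := ⟨ρ.self_mem_cyc v, by rw [h]; exact hvW⟩
    rw [cyc_inf_compl, mem_bot] at this
    exact hv0 this
  have hI := ih _ hlt (ρ.compl W v) (ρ.stable_compl hW hv) hfin' rfl
    (fun mu x hx => hP mu x hx.1)
  have h1 : ρ.altDim W nu = ρ.altDim (ρ.cyc v) nu + ρ.altDim (ρ.compl W v) nu := by
    rw [altDim, altDim, altDim, ← Finset.sum_add_distrib]
    refine Finset.sum_congr rfl fun σ _ => ?_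
    rw [ρ.finrank_split hW hfin hvW _ (hwt _)]
    push_cast
    ring
  rw [h1, hI, ρ.altDim_cyc hv hv0]
  have h2 : ∀ mu ∈ P, (finrank ℚ ↥(W ⊓ ρ.hw mu) : ℤ) * irrAlt mu nu =
      (if mu = lam then irrAlt lam nu else 0) +
        (finrank ℚ ↥(ρ.compl W v ⊓ ρ.hw mu) : ℤ) * irrAlt mu nu := by
    intro mu _
    rw [ρ.finrank_split hW hfin hvW _ (hhw mu)]
    split_ifs with h
    · subst h
      rw [ρ.cyc_inf_hw_self hv hv0, finrank_span_singleton hv0]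
      push_cast
      ring
    · rw [ρ.cyc_inf_hw_ne hv hv0 h, finrank_bot]
      push_cast
      ring
  rw [Finset.sum_congr rfl h2, Finset.sum_add_distrib, Finset.sum_ite_eq',
    if_pos (hP lam v hvW hv hv0)]

theorem irrAlt_self {lam : Fin r → ℤ} {v : E} (hv : v ∈ ρ.hw lam) (hv0 : v ≠ 0) :
    irrAlt lam lam = 1 := by
  rw [← ρ.altDim_cyc hv hv0, ρ.altDim_cyc_self hv hv0]

end GLRep

/-! ### Polarization operators on polynomial rings -/

section Polarization

set_option linter.unusedSectionVars false

variable {σ : Type} [Fintype σ] [DecidableEq σ] {r : ℕ} {γ : Type} [Fintype γ] [DecidableEq γ]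

open MvPolynomial

/-- The factor `∏ (α s)!` of the Fischer form. -/
def multiFact (α : σ →₀ ℕ) : ℚ := ∏ s, ((α s).factorial : ℚ)

theorem multiFact_pos (α : σ →₀ ℕ) : 0 < multiFact α :=
  Finset.prod_pos fun s _ => by exact_mod_cast (α s).factorial_pos

theorem multiFact_add_single (α : σ →₀ ℕ) (p : σ) :
    multiFact (α + Finsupp.single p 1) = (α p + 1) * multiFact α := by
  rw [multiFact, multiFact, ← Finset.mul_prod_erase _ _ (Finset.mem_univ p),
    ← Finset.mul_prod_erase Finset.univ (fun s => ((α s).factorial : ℚ)) (Finset.mem_univ p)]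
  have : ∏ s ∈ Finset.univ.erase p, (((α + Finsupp.single p 1 : σ →₀ ℕ) s).factorial : ℚ) =
      ∏ s ∈ Finset.univ.erase p, ((α s).factorial : ℚ) := by
    refine Finset.prod_congr rfl fun s hs => ?_
    rw [Finsupp.add_apply, Finsupp.single_eq_of_ne (Finset.ne_of_mem_erase hs), add_zero]
  rw [this]
  simp [Nat.factorial_succ]
  ring

/-- The Fischer inner product on a polynomial ring. -/
def fischer : MvPolynomial σ ℚ →ₗ[ℚ] MvPolynomial σ ℚ →ₗ[ℚ] ℚ :=
  (basisMonomials σ ℚ).constr ℚ fun α => multiFact α • lcoeff ℚ α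

theorem fischer_monomial (α : σ →₀ ℕ) (c : ℚ) (q : MvPolynomial σ ℚ) :
    fischer (monomial α c) q = c * multiFact α * coeff α q := by
  have h : (monomial α c : MvPolynomial σ ℚ) = c • basisMonomials σ ℚ α := by
    rw [coe_basisMonomials, smul_monomial, smul_eq_mul, mul_one]
  rw [h, map_smul, fischer, Basis.constr_basis]
  simp [mul_assoc]

theorem fischer_apply (p q : MvPolynomial σ ℚ) :
    fischer p q = ∑ α ∈ p.support, multiFact α * (coeff α p * coeff α q) := by
  conv_lhs => rw [p.as_sum]
  rw [map_sum, LinearMap.sum_apply]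
  refine Finset.sum_congr rfl fun α _ => ?_
  rw [fischer_monomial]; ring

theorem fischer_symm (p q : MvPolynomial σ ℚ) : fischer p q = fischer q p := by
  have key : ∀ p q : MvPolynomial σ ℚ, fischer p q =
      ∑ α ∈ p.support ∪ q.support, multiFact α * (coeff α p * coeff α q) := by
    intro p q
    rw [fischer_apply]
    refine Finset.sum_subset Finset.subset_union_left fun α _ h => ?_
    rw [notMem_support_iff.1 h]; ring
  rw [key, key, Finset.union_comm]
  exact Finset.sum_congr rfl fun α _ => by ring

theorem fischer_pos (p : MvPolynomial σ ℚ) (hp : p ≠ 0) : 0 < fischer p p := by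
  rw [fischer_apply]
  refine Finset.sum_pos (fun α hα => ?_) (support_nonempty.2 hp)
  have := mem_support_iff.1 hα
  exact mul_pos (multiFact_pos α) (mul_self_pos.2 this)

theorem fischer_X_mul (s : σ) (p q : MvPolynomial σ ℚ) :
    fischer (X s * p) q = fischer p (pderiv s q) := by
  induction p using MvPolynomial.induction_on' with
  | monomial α c =>
    rw [X, monomial_mul, one_mul, fischer_monomial, fischer_monomial, coeff_pderiv, add_comm,
      multiFact_add_single]
    ring
  | add p1 p2 h1 h2 =>
    rw [mul_add, map_add, map_add, LinearMap.add_apply, LinearMap.add_apply, h1, h2]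

/-- The derivation `∑_c x_{T(a,c)} ∂_{T(b,c)}`. -/
def polD (T : Fin r × γ → σ) (a b : Fin r) : Derivation ℚ (MvPolynomial σ ℚ) (MvPolynomial σ ℚ) :=
  ∑ c, (X (T (a, c)) : MvPolynomial σ ℚ) • pderiv (T (b, c))

theorem polD_apply (T : Fin r × γ → σ) (a b : Fin r) (p : MvPolynomial σ ℚ) :
    polD T a b p = ∑ c, X (T (a, c)) * pderiv (T (b, c)) p := by
  rw [polD, ← Derivation.coeFnAddMonoidHom_apply, map_sum, Finset.sum_apply]
  rfl

theorem polD_X (T : Fin r × γ → σ) (hT : Function.Injective T) (a b a' : Fin r) (c : γ) :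
    polD T a b (X (T (a', c))) = if b = a' then X (T (a, c)) else 0 := by
  rw [polD_apply]
  simp only [pderiv_X, Pi.single_apply, hT.eq_iff, Prod.mk.injEq]
  split_ifs with h
  · subst h
    simp
  · simp [Ne.symm h]

theorem polD_X_of_notMem (T : Fin r × γ → σ) (a b : Fin r) {s : σ} (hs : s ∉ Set.range T) :
    polD T a b (X s) = 0 := by
  rw [polD_apply]
  refine Finset.sum_eq_zero fun c _ => ?_
  rw [pderiv_X_of_ne, mul_zero]
  rintro rfl
  exact hs ⟨_, rfl⟩

theorem polD_comm (T : Fin r × γ → σ) (hT : Function.Injective T) (a b c d : Fin r)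
    (p : MvPolynomial σ ℚ) : polD T a b (polD T c d p) - polD T c d (polD T a b p) =
    (if b = c then polD T a d p else 0) - (if d = a then polD T c b p else 0) := by
  have h : ⁅polD T a b, polD T c d⁆ =
      (if b = c then polD T a d else 0) - (if d = a then polD T c b else 0) := by
    refine derivation_ext fun s => ?_
    rw [Derivation.commutator_apply]
    by_cases hs : s ∈ Set.range T
    · obtain ⟨⟨i, x⟩, rfl⟩ := hs
      rw [polD_X T hT, polD_X T hT, apply_ite (polD T a b), apply_ite (polD T c d), polD_X T hT,
        polD_X T hT, map_zero, map_zero, Derivation.sub_apply,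
        apply_ite (fun D : Derivation ℚ (MvPolynomial σ ℚ) (MvPolynomial σ ℚ) => D (X (T (i, x)))),
        apply_ite (fun D : Derivation ℚ (MvPolynomial σ ℚ) (MvPolynomial σ ℚ) => D (X (T (i, x)))),
        polD_X T hT, polD_X T hT]
      simp only [Derivation.zero_apply]
      by_cases h1 : d = i <;> by_cases h2 : b = i <;> by_cases h3 : b = c <;>
        by_cases h4 : d = a <;> simp [h1, h2, h3, h4] <;> grind
    · rw [polD_X_of_notMem T _ _ hs, polD_X_of_notMem T _ _ hs, map_zero, map_zero,
        Derivation.sub_apply,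
        apply_ite (fun D : Derivation ℚ (MvPolynomial σ ℚ) (MvPolynomial σ ℚ) => D (X s)),
        apply_ite (fun D : Derivation ℚ (MvPolynomial σ ℚ) (MvPolynomial σ ℚ) => D (X s)),
        polD_X_of_notMem T _ _ hs, polD_X_of_notMem T _ _ hs]
      simp
  have h2 := DFunLike.congr_fun h p
  rw [Derivation.commutator_apply] at h2
  rw [h2, Derivation.sub_apply]
  congr 1 <;> split_ifs <;> simp

/-- Polarization operators in disjoint directions commute. -/
theorem polD_comm_of {r' : ℕ} {γ' : Type} [Fintype γ'] [DecidableEq γ'] (T : Fin r × γ → σ)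
    (T' : Fin r' × γ' → σ) (a b : Fin r) (c d : Fin r')
    (h : ∀ s, polD T a b (polD T' c d (X s)) = polD T' c d (polD T a b (X s)))
    (p : MvPolynomial σ ℚ) : polD T a b (polD T' c d p) = polD T' c d (polD T a b p) := by
  have h : ⁅polD T a b, polD T' c d⁆ = 0 := by
    refine derivation_ext fun s => ?_
    rw [Derivation.commutator_apply, h, sub_self, Derivation.zero_apply]
  have h2 := DFunLike.congr_fun h p
  rw [Derivation.commutator_apply] at h2
  exact sub_eq_zero.1 h2

theorem coeff_polD_self (T : Fin r × γ → σ) (a : Fin r) (α : σ →₀ ℕ) (p : MvPolynomial σ ℚ) :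
    coeff α (polD T a a p) = ((∑ c, α (T (a, c)) : ℕ) : ℚ) * coeff α p := by
  induction p using MvPolynomial.induction_on' with
  | monomial β c =>
    rw [polD_apply]
    simp only [X_mul_pderiv_monomial, coeff_sum, coeff_smul, coeff_monomial]
    split_ifs with h
    · subst h; simp [Finset.sum_mul]
    · simp
  | add p1 p2 h1 h2 => rw [map_add, coeff_add, coeff_add, h1, h2, mul_add]

/-- The representation of `gl_r` by polarization operators. -/
def polRep (T : Fin r × γ → σ) (hT : Function.Injective T) : GLRep r (MvPolynomial σ ℚ) where
  e a b := (polD T a b : MvPolynomial σ ℚ →ₗ[ℚ] MvPolynomial σ ℚ)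
  B := fischer
  rel := polD_comm T hT
  symm := fischer_symm
  pos := fischer_pos
  adj a b v w := by
    simp only [Derivation.coeFn_coe, polD_apply, map_sum, LinearMap.sum_apply]
    refine Finset.sum_congr rfl fun c _ => ?_
    rw [fischer_X_mul, fischer_symm, ← fischer_X_mul, fischer_symm]
  graded v := by
    let w : (σ →₀ ℕ) → Fin r → ℤ := fun α a => ((∑ c, α (T (a, c)) : ℕ) : ℤ)
    refine ⟨v.support.image w, fun μ => ∑ α ∈ v.support with w α = μ, monomial α (coeff α v),
      ?_, ?_⟩
    · intro μ a
      ext α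
      rw [Derivation.coeFn_coe, coeff_polD_self, coeff_smul, smul_eq_mul]
      by_cases h : w α = μ
      · subst h
        simp [w]
      · have : coeff α (∑ α ∈ v.support with w α = μ, monomial α (coeff α v)) = 0 := by
          rw [coeff_sum]
          refine Finset.sum_eq_zero fun β hβ => ?_
          rw [coeff_monomial, if_neg]
          rintro rfl
          exact h (Finset.mem_filter.1 hβ).2
        rw [this, mul_zero, mul_zero]
    · conv_lhs => rw [v.as_sum]
      exact (Finset.sum_fiberwise_of_maps_to (fun α hα => Finset.mem_image_of_mem w hα) _).symm
  nonneg μ v hv h a := by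
    obtain ⟨α, hα⟩ := ne_zero_iff.1 hv
    have h1 := congrArg (coeff α) (h a)
    rw [Derivation.coeFn_coe, coeff_polD_self, coeff_smul, smul_eq_mul] at h1
    have h2 := mul_right_cancel₀ hα h1
    have h3 : (0 : ℚ) ≤ (μ a : ℚ) := h2 ▸ Nat.cast_nonneg _
    exact_mod_cast h3

theorem polRep_e (T : Fin r × γ → σ) (hT : Function.Injective T) (a b : Fin r)
    (p : MvPolynomial σ ℚ) : (polRep T hT).e a b p = polD T a b p := rfl

theorem mem_polRep_wt (T : Fin r × γ → σ) (hT : Function.Injective T) {μ : Fin r → ℤ}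
    {p : MvPolynomial σ ℚ} : p ∈ (polRep T hT).wt μ ↔
      ∀ α ∈ p.support, ∀ a, ((∑ c, α (T (a, c)) : ℕ) : ℤ) = μ a := by
  rw [GLRep.mem_wt]
  constructor
  · intro h α hα a
    have h1 := congrArg (coeff α) (h a)
    rw [polRep_e, coeff_polD_self, coeff_smul, smul_eq_mul] at h1
    exact_mod_cast mul_right_cancel₀ (mem_support_iff.1 hα) h1
  · intro h a
    ext α
    rw [polRep_e, coeff_polD_self, coeff_smul, smul_eq_mul]
    by_cases hα : α ∈ p.support
    · rw [← h α hα a]; simp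
    · rw [notMem_support_iff.1 hα]; simp

end Polarization

/-! ### Vanishing to infinite order -/

section Taylor

open MvPolynomial

variable {σ L : Type*} [Field L] (h : σ → L)

/-- All partial derivatives of order at most `n` vanish at `h`. -/
def VanishTo : ℕ → MvPolynomial σ L → Prop
  | 0, f => eval h f = 0
  | n + 1, f => VanishTo n f ∧ ∀ s, VanishTo n (pderiv s f)

theorem VanishTo.zero (n : ℕ) : VanishTo h n (0 : MvPolynomial σ L) := by
  induction n with
  | zero => simp [VanishTo]
  | succ n ih => exact ⟨ih, fun s => by rw [map_zero]; exact ih⟩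

theorem VanishTo.add {n : ℕ} : ∀ {f g : MvPolynomial σ L}, VanishTo h n f → VanishTo h n g →
    VanishTo h n (f + g) := by
  induction n with
  | zero => intro f g hf hg; simp only [VanishTo] at *; rw [map_add, hf, hg, add_zero]
  | succ n ih =>
    intro f g hf hg
    exact ⟨ih hf.1 hg.1, fun s => by rw [map_add]; exact ih (hf.2 s) (hg.2 s)⟩

theorem VanishTo.C_mul {n : ℕ} (c : L) : ∀ {f : MvPolynomial σ L}, VanishTo h n f →
    VanishTo h n (C c * f) := by
  induction n with
  | zero => intro f hf; simp only [VanishTo] at *; rw [map_mul, hf, mul_zero]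
  | succ n ih =>
    intro f hf
    exact ⟨ih hf.1, fun s => by rw [pderiv_C_mul]; exact ih (hf.2 s)⟩

theorem VanishTo.sum {ι : Type*} {n : ℕ} (t : Finset ι) {f : ι → MvPolynomial σ L}
    (hf : ∀ i ∈ t, VanishTo h n (f i)) : VanishTo h n (∑ i ∈ t, f i) := by
  classical
  induction t using Finset.induction_on with
  | empty => exact VanishTo.zero h n
  | insert i t hi ih =>
    rw [Finset.sum_insert hi]
    exact (hf i (Finset.mem_insert_self _ _)).add h
      (ih fun j hj => hf j (Finset.mem_insert_of_mem hj))

theorem VanishTo.linear_mul_zero (s : σ) (f : MvPolynomial σ L) :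
    VanishTo h 0 ((X s - C (h s)) * f) := by
  simp [VanishTo]

theorem pderiv_linear_mul [DecidableEq σ] (s t : σ) (f : MvPolynomial σ L) :
    pderiv t ((X s - C (h s)) * f) = (if s = t then f else 0) + (X s - C (h s)) * pderiv t f := by
  rw [Derivation.leibniz, map_sub, pderiv_X, pderiv_C]
  simp only [Pi.single_apply, smul_eq_mul]
  split_ifs <;> ring

theorem VanishTo.linear_mul [DecidableEq σ] {n : ℕ} (s : σ) : ∀ {f : MvPolynomial σ L},
    VanishTo h n f → VanishTo h (n + 1) ((X s - C (h s)) * f) := by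
  induction n with
  | zero =>
    intro f hf
    refine ⟨VanishTo.linear_mul_zero h s f, fun t => ?_⟩
    rw [pderiv_linear_mul]
    refine VanishTo.add h ?_ (VanishTo.linear_mul_zero h s _)
    split_ifs
    exacts [hf, VanishTo.zero h 0]
  | succ n ih =>
    intro f hf
    refine ⟨ih hf.1, fun t => ?_⟩
    rw [pderiv_linear_mul]
    refine VanishTo.add h ?_ (ih (hf.2 t))
    split_ifs
    exacts [hf, VanishTo.zero h _]

theorem eq_C_of_pderiv_eq_zero [CharZero L] {f : MvPolynomial σ L} (hf : ∀ s, pderiv s f = 0) :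
    f = C (coeff 0 f) := by
  classical
  ext α
  rw [coeff_C]
  split_ifs with h0
  · rw [← h0]
  · obtain ⟨s, hs⟩ := Finsupp.ne_iff.1 (Ne.symm h0)
    rw [Finsupp.zero_apply] at hs
    have h1 := congrArg (coeff (α - Finsupp.single s 1)) (hf s)
    have h2 : α - Finsupp.single s 1 + Finsupp.single s 1 = α := by
      apply tsub_add_cancel_of_le
      rw [Finsupp.single_le_iff]
      omega
    rw [coeff_pderiv, h2, coeff_zero] at h1
    rcases mul_eq_zero.1 h1 with h3 | h3
    · exact h3
    · exfalso
      exact Nat.cast_add_one_ne_zero _ h3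

theorem eq_zero_of_vanishTo [CharZero L] {f : MvPolynomial σ L} (hf : ∀ n, VanishTo h n f) :
    f = 0 := by
  classical
  have key : ∀ (d : ℕ) (f : MvPolynomial σ L), f.totalDegree ≤ d → (∀ n, VanishTo h n f) →
      f = 0 := by
    intro d
    induction d with
    | zero =>
      intro f hd hf
      have h1 := totalDegree_eq_zero_iff_eq_C.1 (Nat.le_zero.1 hd)
      have h2 := hf 0
      rw [h1] at h2 ⊢
      simp only [VanishTo, eval_C] at h2
      rw [h2, map_zero]
    | succ d ih =>
      intro f hd hf
      have h3 : ∀ s, pderiv s f = 0 := by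
        intro s
        refine ih _ ?_ fun n => (hf (n + 1)).2 s
        refine Finset.sup_le ?_
        intro α hα
        rw [MvPolynomial.mem_support_iff, coeff_pderiv] at hα
        have h4 := le_totalDegree (MvPolynomial.mem_support_iff.2 (left_ne_zero_of_mul hα))
        have h5 : ((α + Finsupp.single s 1).sum fun _ e => e) = (α.sum fun _ e => e) + 1 := by
          rw [Finsupp.sum_add_index' (fun _ => rfl) (fun _ _ _ => rfl),
            Finsupp.sum_single_index rfl]
        omega
      have h1 := eq_C_of_pderiv_eq_zero h3
      have h2 := hf 0
      rw [h1] at h2 ⊢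
      simp only [VanishTo, eval_C] at h2
      rw [h2, map_zero]
  exact key _ f le_rfl hf

/-- A family of polynomials on a product of matrix groups, stable under the Lie algebra and
vanishing at an invertible point, is zero. -/
theorem eq_zero_of_stable [CharZero L] {ι : Type*} {r : ℕ} (h : ι × Fin r × Fin r → L)
    (hdet : ∀ j, IsUnit (Matrix.of fun a c => h (j, a, c)).det)
    (N : MvPolynomial (ι × Fin r × Fin r) L → Prop)
    (hst : ∀ f, N f → ∀ j a b, N (∑ c, X (j, a, c) * pderiv (j, b, c) f))
    (hev : ∀ f, N f → eval h f = 0) {f : MvPolynomial (ι × Fin r × Fin r) L} (hf : N f) :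
    f = 0 := by
  classical
  refine eq_zero_of_vanishTo h fun n => ?_
  induction n generalizing f with
  | zero => exact hev f hf
  | succ n ih =>
    refine ⟨ih hf, ?_⟩
    rintro ⟨j, b, c⟩
    have h1 : ∀ a, VanishTo h n (∑ c, C (h (j, a, c)) * pderiv (j, b, c) f) := by
      intro a
      have h2 := ih (hst f hf j a b)
      have h3 : ∑ c, C (h (j, a, c)) * pderiv (j, b, c) f =
          ∑ c, X (j, a, c) * pderiv (j, b, c) f +
          ∑ c, C (-1) * ((X (j, a, c) - C (h (j, a, c))) * pderiv (j, b, c) f) := by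
        rw [← Finset.sum_add_distrib]
        refine Finset.sum_congr rfl fun c _ => ?_
        rw [map_neg, map_one]
        ring
      rw [h3]
      refine h2.add h (VanishTo.sum h _ fun c _ => VanishTo.C_mul h _ ?_)
      cases n with
      | zero => exact VanishTo.linear_mul_zero h _ _
      | succ n => exact VanishTo.linear_mul h _ ((ih hf).2 _)
    set A : Matrix (Fin r) (Fin r) L := Matrix.of fun a c => h (j, a, c) with hA
    have h4 : pderiv (j, b, c) f =
        ∑ a, C (A⁻¹ c a) * ∑ c', C (h (j, a, c')) * pderiv (j, b, c') f := by
      simp only [Finset.mul_sum]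
      rw [Finset.sum_comm]
      have h5 : ∀ c', ∑ a, C (A⁻¹ c a) * (C (h (j, a, c')) * pderiv (j, b, c') f) =
          if c = c' then pderiv (j, b, c') f else 0 := by
        intro c'
        have h6 : (A⁻¹ * A) c c' = (1 : Matrix (Fin r) (Fin r) L) c c' := by
          rw [Matrix.nonsing_inv_mul _ (hdet j)]
        rw [Matrix.mul_apply, Matrix.one_apply] at h6
        have h7 : ∑ a, C (A⁻¹ c a) * (C (h (j, a, c')) * pderiv (j, b, c') f) =
          C (∑ a, A⁻¹ c a * A a c') * pderiv (j, b, c') f := by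
          rw [map_sum, Finset.sum_mul]
          refine Finset.sum_congr rfl fun a _ => ?_
          rw [map_mul, mul_assoc]; rfl
        rw [h7, h6]
        split_ifs <;> simp
      rw [Finset.sum_congr rfl fun c' _ => h5 c', Finset.sum_ite_eq, if_pos (Finset.mem_univ _)]
    rw [h4]
    exact VanishTo.sum h _ fun a _ => VanishTo.C_mul h _ (h1 a)

end Taylor

/-! ### Weight multiplicities in polynomial rings on tuples of matrices -/

section Weights

set_option linter.unusedSectionVars false

open MvPolynomial

/-- The coefficient of a monomial with integral exponents. -/
def zcoeff {r : ℕ} (mu : Fin r → ℤ) (p : MvPolynomial (Fin r) ℤ) : ℤ :=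
  if ∀ a, 0 ≤ mu a then coeff (Finsupp.equivFunOnFinite.symm fun a => (mu a).toNat) p else 0

theorem zcoeff_zero {r : ℕ} (mu : Fin r → ℤ) : zcoeff mu 0 = 0 := by
  simp [zcoeff]

theorem zcoeff_natCast {r : ℕ} (nu : Fin r → ℕ) (p : MvPolynomial (Fin r) ℤ) :
    zcoeff (fun a => (nu a : ℤ)) p = coeff (Finsupp.equivFunOnFinite.symm nu) p := by
  simp [zcoeff]

theorem zcoeff_sum {r : ℕ} {β : Type*} (s : Finset β) (mu : Fin r → ℤ)
    (p : β → MvPolynomial (Fin r) ℤ) : zcoeff mu (∑ i ∈ s, p i) = ∑ i ∈ s, zcoeff mu (p i) := by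
  unfold zcoeff
  split_ifs
  · rw [coeff_sum]
  · simp

theorem zcoeff_int_mul {r : ℕ} (mu : Fin r → ℤ) (z : ℤ)
    (p : MvPolynomial (Fin r) ℤ) : zcoeff mu ((z : MvPolynomial (Fin r) ℤ) * p) =
      z * zcoeff mu p := by
  unfold zcoeff
  have : (z : MvPolynomial (Fin r) ℤ) = C z := by simp
  rw [this]
  split_ifs
  · rw [coeff_C_mul]
  · simp

theorem schurCoeff_eq_sum_zcoeff {r : ℕ} (p : MvPolynomial (Fin r) ℤ) (nu : Fin r → ℕ) :
    schurCoeff r p nu = ∑ σ : Equiv.Perm (Fin r), (Equiv.Perm.sign σ : ℤ) *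
      zcoeff (fun a => (nu a : ℤ) + ((σ a : ℕ) : ℤ) - ((a : ℕ) : ℤ)) p := by
  classical
  rw [schurCoeff, alternant_eq_altDet, altDet_eq_sum, Finset.mul_sum, coeff_sum]
  refine Finset.sum_congr rfl fun σ _ => ?_
  rw [coeff_mul_monomial', zcoeff]
  have h1 : (Finsupp.equivFunOnFinite.symm (fun i => r - 1 - ((σ i : Fin r) : ℕ)) ≤
      Finsupp.equivFunOnFinite.symm (fun a : Fin r => nu a + (r - 1 - (a : ℕ)))) ↔
      ∀ a, 0 ≤ (nu a : ℤ) + ((σ a : ℕ) : ℤ) - ((a : ℕ) : ℤ) := by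
    rw [Finsupp.le_def]
    refine forall_congr' fun a => ?_
    simp only [Finsupp.equivFunOnFinite_symm_apply_apply]
    have := (σ a).2
    have := a.2
    omega
  by_cases h : ∀ a, 0 ≤ (nu a : ℤ) + ((σ a : ℕ) : ℤ) - ((a : ℕ) : ℤ)
  · rw [if_pos (h1.2 h), if_pos h, mul_comm]
    congr 2
    ext a
    have := (σ a).2
    have := a.2
    have := h a
    simp only [Finsupp.tsub_apply, Finsupp.equivFunOnFinite_symm_apply_apply]
    omega
  · rw [if_neg (mt h1.1 h), if_neg h, mul_zero]

variable {ι : Type} [Fintype ι] [DecidableEq ι] {r : ℕ}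

/-- Polynomial functions on tuples of square matrices. -/
abbrev MPoly (ι : Type) (r : ℕ) : Type := MvPolynomial (ι × Fin r × Fin r) ℚ

/-- Row indexing of matrix entries. -/
def rowT (x : Fin r × (ι × Fin r)) : ι × Fin r × Fin r := (x.2.1, x.1, x.2.2)

/-- Column indexing of the entries of the matrix with index `j`. -/
def colT (j : ι) (x : Fin r × Fin r) : ι × Fin r × Fin r := (j, x.2, x.1)

theorem rowT_injective : Function.Injective (rowT : Fin r × (ι × Fin r) → _) := by
  rintro ⟨a, j, c⟩ ⟨a', j', c'⟩ h
  simp only [rowT, Prod.mk.injEq] at h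
  obtain ⟨rfl, rfl, rfl⟩ := h
  rfl

theorem colT_injective (j : ι) : Function.Injective (colT j : Fin r × Fin r → _) := by
  rintro ⟨a, c⟩ ⟨a', c'⟩ h
  simp only [colT, Prod.mk.injEq] at h
  obtain ⟨_, rfl, rfl⟩ := h
  rfl

/-- The diagonal row action. -/
def rowRep (ι : Type) [Fintype ι] [DecidableEq ι] (r : ℕ) : GLRep r (MPoly ι r) :=
  polRep rowT rowT_injective

/-- The column action on the matrix with index `j`. -/
def colRep (r : ℕ) (j : ι) : GLRep r (MPoly ι r) := polRep (colT j) (colT_injective j)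

theorem rowRep_X (a b : Fin r) (s : ι × Fin r × Fin r) : (rowRep ι r).e a b (X s) =
    if b = s.2.1 then X (s.1, a, s.2.2) else 0 :=
  polD_X rowT rowT_injective a b s.2.1 (s.1, s.2.2)

theorem colRep_X (j : ι) (c d : Fin r) (s : ι × Fin r × Fin r) : (colRep r j).e c d (X s) =
    if j = s.1 ∧ d = s.2.2 then X (s.1, s.2.1, c) else 0 := by
  by_cases h : j = s.1
  · subst h
    rw [colRep, polRep_e]
    have := polD_X (colT s.1) (colT_injective s.1) c d s.2.2 s.2.1
    simp only [true_and]
    exact this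
  · rw [if_neg (fun h1 => h h1.1)]
    apply polD_X_of_notMem
    rintro ⟨x, rfl⟩
    exact h rfl

theorem row_col_comm (j : ι) (a b c d : Fin r) (p : MPoly ι r) :
    (rowRep ι r).e a b ((colRep r j).e c d p) = (colRep r j).e c d ((rowRep ι r).e a b p) := by
  refine polD_comm_of rowT (colT j) a b c d (fun s => ?_) p
  have h1 := fun s => rowRep_X (ι := ι) a b s
  have h2 := fun s => colRep_X j c d s
  simp only [rowRep, colRep, polRep_e] at h1 h2
  rw [h1, h2, apply_ite (polD rowT a b), apply_ite (polD (colT j) c d), h1, h2, map_zero,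
    map_zero]
  dsimp only
  grind

theorem col_col_comm {j j' : ι} (hj : j ≠ j') (a b c d : Fin r) (p : MPoly ι r) :
    (colRep r j).e a b ((colRep r j').e c d p) = (colRep r j').e c d ((colRep r j).e a b p) := by
  refine polD_comm_of (colT j) (colT j') a b c d (fun s => ?_) p
  have h2 := fun j c d s => colRep_X (r := r) (j : ι) c d s
  simp only [colRep, polRep_e] at h2
  rw [h2, h2, apply_ite (polD (colT j) a b), apply_ite (polD (colT j') c d), h2, h2, map_zero,
    map_zero]
  dsimp only
  grind

theorem mem_row_wt {μ : Fin r → ℤ} {p : MPoly ι r} : p ∈ (rowRep ι r).wt μ ↔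
    ∀ α ∈ p.support, ∀ a, ((∑ x : ι × Fin r, α (x.1, a, x.2) : ℕ) : ℤ) = μ a :=
  mem_polRep_wt _ _

theorem mem_col_wt {j : ι} {μ : Fin r → ℤ} {p : MPoly ι r} : p ∈ (colRep r j).wt μ ↔
    ∀ α ∈ p.support, ∀ c, ((∑ i, α (j, i, c) : ℕ) : ℤ) = μ c :=
  mem_polRep_wt _ _

theorem finiteDimensional_of_bound (W : Submodule ℚ (MPoly ι r)) (N : ℕ)
    (h : ∀ p ∈ W, ∀ α ∈ p.support, ∀ s, α s ≤ N) : FiniteDimensional ℚ W := by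
  set S : Set (ι × Fin r × Fin r →₀ ℕ) :=
    Set.Iic (Finsupp.equivFunOnFinite.symm fun _ => N) with hS
  have : Finite S := (Set.finite_Iic _).to_subtype
  have : FiniteDimensional ℚ (restrictSupport ℚ S) :=
    (basisRestrictSupport ℚ S).finiteDimensional_of_finite
  refine Submodule.finiteDimensional_of_le (S₂ := restrictSupport ℚ S) fun p hp => ?_
  rw [mem_restrictSupport_iff]
  intro α hα
  rw [hS, Set.mem_Iic, Finsupp.le_def]
  intro s
  exact h p hp α hα s

/-- Arrays correspond to tuples of column vectors. -/
def arrEquiv : (ι × Fin r → (Fin r →₀ ℕ)) ≃ (ι × Fin r × Fin r →₀ ℕ) where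
  toFun p := Finsupp.equivFunOnFinite.symm fun s => p (s.1, s.2.2) s.2.1
  invFun α := fun x => Finsupp.equivFunOnFinite.symm fun a => α (x.1, a, x.2)
  left_inv p := by funext x; ext a; simp
  right_inv α := by ext s; simp

theorem card_arrays (ν : Fin r → ℤ) (κ : ι → Fin r → ℤ) :
    ((Set.ncard {α : ι × Fin r × Fin r →₀ ℕ |
      (∀ a, ((∑ x : ι × Fin r, α (x.1, a, x.2) : ℕ) : ℤ) = ν a) ∧
      ∀ j c, ((∑ i, α (j, i, c) : ℕ) : ℤ) = κ j c} : ℕ) : ℤ) =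
    zcoeff ν (∏ j, ∏ c, hkZ r (κ j c)) := by
  classical
  by_cases hκ : ∀ j c, 0 ≤ κ j c
  swap
  · push Not at hκ
    obtain ⟨j, c, hjc⟩ := hκ
    rw [Finset.prod_eq_zero (Finset.mem_univ j)
      (Finset.prod_eq_zero (Finset.mem_univ c) (hkZ_neg r _ hjc)), zcoeff_zero]
    have h0 : {α : ι × Fin r × Fin r →₀ ℕ |
      (∀ a, ((∑ x : ι × Fin r, α (x.1, a, x.2) : ℕ) : ℤ) = ν a) ∧
      ∀ j c, ((∑ i, α (j, i, c) : ℕ) : ℤ) = κ j c} = ∅ := by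
      rw [Set.eq_empty_iff_forall_notMem]
      rintro α ⟨_, h⟩
      have := h j c
      omega
    rw [h0, Set.ncard_empty, Nat.cast_zero]
  by_cases hν : ∀ a, 0 ≤ ν a
  swap
  · rw [zcoeff, if_neg hν]
    push Not at hν
    obtain ⟨a, ha⟩ := hν
    have h0 : {α : ι × Fin r × Fin r →₀ ℕ |
      (∀ a, ((∑ x : ι × Fin r, α (x.1, a, x.2) : ℕ) : ℤ) = ν a) ∧
      ∀ j c, ((∑ i, α (j, i, c) : ℕ) : ℤ) = κ j c} = ∅ := by
      rw [Set.eq_empty_iff_forall_notMem]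
      rintro α ⟨h, _⟩
      have := h a
      omega
    rw [h0, Set.ncard_empty, Nat.cast_zero]
  choose k hk using fun j c => Int.eq_ofNat_of_zero_le (hκ j c)
  choose n hn using fun a => Int.eq_ofNat_of_zero_le (hν a)
  obtain rfl : κ = fun j c => (k j c : ℤ) := by funext j c; exact hk j c
  obtain rfl : ν = fun a => (n a : ℤ) := funext hn
  rw [zcoeff_natCast]
  simp only [hkZ_natCast]
  rw [← Fintype.prod_prod_type' (fun j c => hsymm (Fin r) ℤ (k j c))]
  simp only [hsymm_eq_sum_finsuppAntidiag]
  rw [Finset.prod_univ_sum, coeff_sum]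
  have hmon : ∀ p : ι × Fin r → (Fin r →₀ ℕ),
      (∏ x, ∏ i, (X i : MvPolynomial (Fin r) ℤ) ^ (p x i)) = monomial (∑ x, p x) 1 := by
    intro p
    rw [monomial_sum_one]
    refine Finset.prod_congr rfl fun x _ => ?_
    rw [monomial_eq, C_1, one_mul, Finsupp.prod_fintype _ _ (fun _ => pow_zero _)]
  simp only [hmon, coeff_monomial]
  rw [Finset.sum_boole]
  congr 1
  rw [← Set.ncard_coe_finset, ← Set.ncard_image_of_injective _ (arrEquiv (ι := ι) (r := r)).injective]
  congr 1
  ext α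
  rw [Equiv.image_eq_preimage_symm]
  simp only [Set.mem_ofPred_eq, Set.mem_preimage, Finset.coe_filter, Fintype.mem_piFinset,
    Finset.mem_finsuppAntidiag, Finset.subset_univ, and_true, Nat.cast_inj]
  rw [and_comm]
  refine and_congr ?_ ?_
  · rw [Prod.forall]
    rfl
  · rw [Finsupp.ext_iff]
    refine forall_congr' fun a => ?_
    rw [Finsupp.finsetSum_apply]
    rfl

end Weights

/-! ### The Cauchy identity and highest weight multiplicities -/

namespace GLRep

variable {r : ℕ} {E : Type} [AddCommGroup E] [Module ℚ E] (ρ : GLRep r E)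

/-- Vectors obtained from `v` by words of bounded length in the operators. -/
inductive Word (v : E) : ℕ → E → Prop
  | base : Word v 0 v
  | zero (n : ℕ) : Word v n 0
  | add {n : ℕ} {x y : E} : Word v n x → Word v n y → Word v n (x + y)
  | smul {n : ℕ} {x : E} (c : ℚ) : Word v n x → Word v n (c • x)
  | mono {n : ℕ} {x : E} : Word v n x → Word v (n + 1) x
  | step {n : ℕ} {x : E} (a b : Fin r) : Word v n x → Word v (n + 1) (ρ.e a b x)

variable {ρ}

theorem Word.neg {v x : E} {n : ℕ} (h : ρ.Word v n x) : ρ.Word v n (-x) := by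
  rw [← neg_one_smul ℚ x]; exact h.smul _

theorem Word.sub {v x y : E} {n : ℕ} (h : ρ.Word v n x) (h' : ρ.Word v n y) :
    ρ.Word v n (x - y) := by
  rw [sub_eq_add_neg]; exact h.add h'.neg

theorem Word.raise {lam : Fin r → ℤ} {v : E} (hv : v ∈ ρ.hw lam) {a b : Fin r} (hab : a < b)
    {n : ℕ} {x : E} (hx : ρ.Word v n x) : ρ.Word v n (ρ.e a b x) := by
  induction hx with
  | base => rw [(ρ.mem_hw.1 hv).2 a b hab]; exact Word.zero _
  | zero n => rw [map_zero]; exact Word.zero _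
  | add _ _ h1 h2 => rw [map_add]; exact h1.add h2
  | smul c _ h => rw [map_smul]; exact h.smul c
  | mono _ h => exact h.mono
  | step c d hx h =>
    have h1 := ρ.rel a b c d ‹_›
    rw [sub_eq_iff_eq_add] at h1
    rw [h1]
    refine Word.add (Word.sub ?_ ?_) (h.step c d)
    · split_ifs
      exacts [hx.step _ _, Word.zero _]
    · split_ifs
      exacts [hx.step _ _, Word.zero _]

variable (ρ) in
theorem wt_sum_cyc {lam mu : Fin r → ℤ} {v x : E} (hv : v ∈ ρ.hw lam)
    (hx : x ∈ ρ.cyc v) (hxm : x ∈ ρ.wt mu) (hx0 : x ≠ 0) : ∑ a, mu a = ∑ a, lam a := by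
  set Z : E →ₗ[ℚ] E := ∑ a, ρ.e a a with hZ
  have hcomm : ∀ b c y, Z (ρ.e b c y) = ρ.e b c (Z y) := by
    intro b c y
    rw [hZ, LinearMap.sum_apply, LinearMap.sum_apply, map_sum, ← sub_eq_zero,
      ← Finset.sum_sub_distrib]
    simp only [ρ.rel]
    rw [Finset.sum_sub_distrib]
    simp
  have hwt : ∀ (mu : Fin r → ℤ) (y : E), y ∈ ρ.wt mu → Z y = ((∑ a, mu a : ℤ) : ℚ) • y := by
    intro mu y hy
    rw [hZ, LinearMap.sum_apply, Int.cast_sum, Finset.sum_smul]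
    exact Finset.sum_congr rfl fun a _ => ρ.mem_wt.1 hy a
  have hcyc : ∀ y ∈ ρ.cyc v, Z y = ((∑ a, lam a : ℤ) : ℚ) • y := by
    have hle : ρ.cyc v ≤ LinearMap.ker (Z - ((∑ a, lam a : ℤ) : ℚ) • LinearMap.id) := by
      rw [cyc, span_le]
      intro y hy
      have : Z y = ((∑ a, lam a : ℤ) : ℚ) • y := by
        induction hy with
        | base => exact hwt _ _ (ρ.hw_le_wt _ hv)
        | step a b hab y _ ih => rw [hcomm, ih, map_smul]
      simp [this]
    intro y hy
    have := hle hy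
    simpa [sub_eq_zero] using this
  have h1 := hcyc x hx
  rw [hwt mu x hxm, ← sub_eq_zero, ← sub_smul, smul_eq_zero] at h1
  rcases h1 with h1 | h1
  · have := sub_eq_zero.1 h1
    exact_mod_cast this
  · exact absurd h1 hx0

variable (ρ) in
theorem irrAlt_eq_zero_of_sum_ne {lam nu : Fin r → ℤ} {v : E} (hv : v ∈ ρ.hw lam) (hv0 : v ≠ 0)
    (h : ∑ a, nu a ≠ ∑ a, lam a) : irrAlt lam nu = 0 := by
  rw [← ρ.altDim_cyc hv hv0, altDim]
  refine Finset.sum_eq_zero fun σ _ => ?_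
  have h1 : ρ.cyc v ⊓ ρ.wt (fun a => nu a + ((σ a : ℕ) : ℤ) - ((a : ℕ) : ℤ)) = ⊥ := by
    rw [eq_bot_iff]
    rintro x ⟨hx1, hx2⟩
    by_contra hx0
    apply h
    rw [← ρ.wt_sum_cyc hv hx1 hx2 hx0, Finset.sum_sub_distrib, Finset.sum_add_distrib,
      Equiv.sum_comp σ (fun a => ((a : ℕ) : ℤ))]
    ring
  rw [h1, finrank_bot, Nat.cast_zero, mul_zero]

end GLRep

section Cauchy

set_option linter.unusedSectionVars false

open MvPolynomial

theorem finrank_wt_inf_wt {ι : Type} [Fintype ι] [DecidableEq ι] {r : ℕ} (nu : Fin r → ℤ)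
    (kappa : ι → Fin r → ℤ) :
    (finrank ℚ ↥((rowRep ι r).wt nu ⊓ ⨅ j, (colRep r j).wt (kappa j)) : ℤ) =
      zcoeff nu (∏ j, ∏ c, hkZ r (kappa j c)) := by
  rw [← card_arrays nu kappa]
  set S : Set (ι × Fin r × Fin r →₀ ℕ) :=
    {α | (∀ a, ((∑ x : ι × Fin r, α (x.1, a, x.2) : ℕ) : ℤ) = nu a) ∧
      ∀ j c, ((∑ i, α (j, i, c) : ℕ) : ℤ) = kappa j c} with hS
  have h : (rowRep ι r).wt nu ⊓ ⨅ j, (colRep r j).wt (kappa j) = restrictSupport ℚ S := by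
    ext p
    rw [mem_inf, mem_iInf, mem_restrictSupport_iff, mem_row_wt]
    simp only [mem_col_wt]
    constructor
    · rintro ⟨h1, h2⟩ α hα
      exact ⟨h1 α hα, fun j => h2 j α hα⟩
    · exact fun h => ⟨fun α hα => (h hα).1, fun j α hα => (h hα).2 j⟩
  rw [h, finrank_eq_nat_card_basis (basisRestrictSupport ℚ S)]
  rfl

variable {r : ℕ}

theorem eval_one_row_col (a b : Fin r) (p : MPoly Unit r) :
    eval (fun s => if s.2.1 = s.2.2 then 1 else 0) ((rowRep Unit r).e a b p) =
    eval (fun s => if s.2.1 = s.2.2 then 1 else 0) ((colRep r ()).e b a p) := by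
  rw [rowRep, colRep, polRep_e, polRep_e, polD_apply, polD_apply, map_sum, map_sum,
    Fintype.sum_prod_type]
  simp only [rowT, colT, map_mul, eval_X, ite_mul, one_mul, zero_mul, Finset.univ_unique,
    Finset.sum_singleton, Finset.sum_ite_eq, Finset.sum_ite_eq', Finset.mem_univ, if_true]

theorem bihw_eq_zero {lam mu : Fin r → ℤ} {f : MPoly Unit r} (h1 : f ∈ (rowRep Unit r).hw lam)
    (h2 : f ∈ (colRep r ()).hw mu)
    (h3 : eval (fun s => if s.2.1 = s.2.2 then 1 else 0) f = 0) : f = 0 := by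
  have h1' := (GLRep.mem_hw _).1 h1
  have h2' := (GLRep.mem_hw _).1 h2
  have hcol : ∀ n F, (rowRep Unit r).Word f n F →
      (∀ a, (colRep r ()).e a a F = (mu a : ℚ) • F) ∧
      ∀ a b, a < b → (colRep r ()).e a b F = 0 := by
    intro n F hF
    induction hF with
    | base => exact h2'
    | zero n => simp
    | add _ _ h h' =>
      refine ⟨fun a => ?_, fun a b hab => ?_⟩
      · rw [map_add, h.1, h'.1, smul_add]
      · rw [map_add, h.2 a b hab, h'.2 a b hab, add_zero]
    | smul c _ h =>
      refine ⟨fun a => ?_, fun a b hab => ?_⟩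
      · rw [map_smul, h.1, smul_comm]
      · rw [map_smul, h.2 a b hab, smul_zero]
    | mono _ h => exact h
    | step c d _ h =>
      refine ⟨fun a => ?_, fun a b hab => ?_⟩
      · rw [← row_col_comm, h.1, map_smul]
      · rw [← row_col_comm, h.2 a b hab, map_zero]
  have hev : ∀ n F, (rowRep Unit r).Word f n F →
      eval (fun s => if s.2.1 = s.2.2 then 1 else 0) F = 0 := by
    intro n
    induction n with
    | zero =>
      intro F hF
      generalize hn : 0 = n at hF
      induction hF with
      | base => exact h3
      | zero n => simp
      | add _ _ h h' => rw [map_add, h hn, h' hn, add_zero]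
      | smul c _ h => rw [smul_eval, h hn, mul_zero]
      | mono _ h => exact absurd hn (by omega)
      | step c d _ h => exact absurd hn (by omega)
    | succ n ih =>
      intro F hF
      generalize hn : n + 1 = m at hF
      induction hF with
      | base => exact h3
      | zero n => simp
      | add _ _ h h' => rw [map_add, h hn, h' hn, add_zero]
      | smul c _ h => rw [smul_eval, h hn, mul_zero]
      | mono hx h =>
        obtain rfl := Nat.succ_injective hn
        exact ih _ hx
      | step c d hx h =>
        obtain rfl := Nat.succ_injective hn
        rcases lt_trichotomy c d with hcd | rfl | hcd
        · exact ih _ (hx.raise h1 hcd)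
        · rw [eval_one_row_col, (hcol _ _ hx).1, smul_eval, ih _ hx, mul_zero]
        · rw [eval_one_row_col, (hcol _ _ hx).2 d c hcd, map_zero]
  refine eq_zero_of_stable (fun s => if s.2.1 = s.2.2 then (1 : ℚ) else 0) ?_
    (fun F => ∃ n, (rowRep Unit r).Word f n F) ?_ ?_ ⟨0, GLRep.Word.base⟩
  · intro j
    have : (Matrix.of fun a c : Fin r => if a = c then (1 : ℚ) else 0) = 1 := by
      ext a c
      rw [Matrix.of_apply, Matrix.one_apply]
    rw [this, Matrix.det_one]
    exact isUnit_one
  · rintro F ⟨n, hF⟩ j a b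
    refine ⟨n + 1, ?_⟩
    have h : (rowRep Unit r).e a b F = ∑ c, X (j, a, c) * pderiv (j, b, c) F := by
      rw [rowRep, polRep_e, polD_apply, Fintype.sum_prod_type, Fintype.sum_unique]
      rfl
    rw [← h]
    exact hF.step a b
  · rintro F ⟨n, hF⟩
    exact hev n F hF

theorem bihw_finrank_le (lam mu : Fin r → ℤ) :
    finrank ℚ ↥((rowRep Unit r).hw lam ⊓ (colRep r ()).hw mu) ≤ 1 := by
  by_cases h : ∃ f ∈ (rowRep Unit r).hw lam ⊓ (colRep r ()).hw mu, f ≠ 0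
  · obtain ⟨f, hf, hf0⟩ := h
    set ev : MPoly Unit r →+* ℚ := eval (fun s : Unit × Fin r × Fin r => if s.2.1 = s.2.2 then (1 : ℚ) else 0) with hev
    have hne : ev f ≠ 0 := fun h => hf0 (bihw_eq_zero hf.1 hf.2 h)
    refine finrank_le_one (⟨f, hf⟩ : ↥((rowRep Unit r).hw lam ⊓ (colRep r ()).hw mu)) ?_
    rintro ⟨g, hg⟩
    refine ⟨ev g / ev f, Subtype.ext ?_⟩
    have hm : (ev g / ev f) • f - g ∈ (rowRep Unit r).hw lam ⊓ (colRep r ()).hw mu :=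
      sub_mem (smul_mem _ _ hf) hg
    have := bihw_eq_zero hm.1 hm.2 (by
      rw [map_sub, smul_eval, ← hev, div_mul_cancel₀ _ hne, sub_self])
    exact sub_eq_zero.1 this
  · push Not at h
    have : (rowRep Unit r).hw lam ⊓ (colRep r ()).hw mu = ⊥ := by
      rw [eq_bot_iff]; exact fun x hx => h x hx
    rw [this, finrank_bot]
    exact Nat.zero_le _

theorem bihw_finrank_ne {lam mu : Fin r → ℤ} (h : lam ≠ mu) :
    finrank ℚ ↥((rowRep Unit r).hw lam ⊓ (colRep r ()).hw mu) = 0 := by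
  have : (rowRep Unit r).hw lam ⊓ (colRep r ()).hw mu = ⊥ := by
    rw [eq_bot_iff]
    rintro f ⟨h1, h2⟩
    refine bihw_eq_zero h1 h2 ?_
    obtain ⟨a, ha⟩ := Function.ne_iff.1 h
    have h3 := eval_one_row_col a a f
    rw [((GLRep.mem_hw _).1 h1).1, ((GLRep.mem_hw _).1 h2).1, smul_eval, smul_eval,
      ← sub_eq_zero, ← sub_mul, mul_eq_zero] at h3
    rcases h3 with h3 | h3
    · exfalso
      apply ha
      exact_mod_cast sub_eq_zero.1 h3
    · exact h3
  rw [this, finrank_bot]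

theorem stable_row_wt (j : Unit) (mu : Fin r → ℤ) : (colRep r j).Stable ((rowRep Unit r).wt mu) := by
  intro a b v hv
  rw [GLRep.mem_wt] at *
  intro c
  rw [row_col_comm, hv, map_smul]

theorem stable_col_hw (j : Unit) (mu : Fin r → ℤ) : (rowRep Unit r).Stable ((colRep r j).hw mu) := by
  intro a b v hv
  rw [GLRep.mem_hw] at *
  refine ⟨fun c => ?_, fun c d hcd => ?_⟩
  · rw [← row_col_comm, hv.1, map_smul]
  · rw [← row_col_comm, hv.2 c d hcd, map_zero]

theorem sum_of_mem_row_wt {mu : Fin r → ℤ} {p : MPoly Unit r} (hp : p ∈ (rowRep Unit r).wt mu)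
    {α : Unit × Fin r × Fin r →₀ ℕ} (hα : α ∈ p.support) :
    ∑ s, (α s : ℤ) = ∑ a, mu a := by
  rw [mem_row_wt] at hp
  rw [← Finset.sum_congr rfl fun a _ => hp α hα a]
  simp [Fintype.sum_prod_type]

theorem sum_of_mem_col_wt {mu : Fin r → ℤ} {p : MPoly Unit r} (hp : p ∈ (colRep r ()).wt mu)
    {α : Unit × Fin r × Fin r →₀ ℕ} (hα : α ∈ p.support) :
    ∑ s, (α s : ℤ) = ∑ a, mu a := by
  rw [mem_col_wt] at hp
  rw [← Finset.sum_congr rfl fun a _ => hp α hα a]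
  simp [Fintype.sum_prod_type]
  exact Finset.sum_comm

theorem finite_of_sum (W : Submodule ℚ (MPoly Unit r)) (N : ℤ)
    (h : ∀ p ∈ W, ∀ α ∈ p.support, ∑ s, (α s : ℤ) = N) : FiniteDimensional ℚ W := by
  refine finiteDimensional_of_bound W N.toNat fun p hp α hα s => ?_
  have h1 := h p hp α hα
  have h2 := Finset.single_le_sum (f := fun s => (α s : ℤ)) (fun i _ => Int.natCast_nonneg _)
    (Finset.mem_univ s)
  omega

/-- Partitions of `n` with at most `r` parts. -/
def parts (r n : ℕ) : Finset (Fin r → ℤ) :=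
  (Fintype.piFinset fun _ => Finset.Icc (0 : ℤ) n).filter fun mu =>
    (∀ a b, a ≤ b → mu b ≤ mu a) ∧ ∑ a, mu a = n

theorem mem_parts {n : ℕ} {mu : Fin r → ℤ} :
    mu ∈ parts r n ↔ Antitone mu ∧ (∀ a, 0 ≤ mu a) ∧ ∑ a, mu a = n := by
  rw [parts, Finset.mem_filter, Fintype.mem_piFinset]
  constructor
  · rintro ⟨h1, h2, h3⟩
    exact ⟨fun a b => h2 a b, fun a => (Finset.mem_Icc.1 (h1 a)).1, h3⟩
  · rintro ⟨h1, h2, h3⟩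
    refine ⟨fun a => Finset.mem_Icc.2 ⟨h2 a, ?_⟩, fun a b => @h1 a b, h3⟩
    rw [← h3]
    exact Finset.single_le_sum (fun i _ => h2 i) (Finset.mem_univ a)

theorem sum_twist (nu : Fin r → ℤ) (σ : Equiv.Perm (Fin r)) :
    ∑ a, (nu a + ((σ a : ℕ) : ℤ) - ((a : ℕ) : ℤ)) = ∑ a, nu a := by
  rw [Finset.sum_sub_distrib, Finset.sum_add_distrib,
    Equiv.sum_comp σ (fun a => ((a : ℕ) : ℤ))]
  ring

theorem mem_parts_of_hw {ρ : GLRep r (MPoly Unit r)} {mu : Fin r → ℤ} {n : ℕ}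
    {v : MPoly Unit r} (hv : v ∈ ρ.hw mu) (hv0 : v ≠ 0) (h : ∑ a, mu a = n) :
    mu ∈ parts r n :=
  mem_parts.2 ⟨ρ.hw_antitone hv hv0, ρ.nonneg _ _ hv0 (ρ.mem_wt.1 (ρ.hw_le_wt _ hv)), h⟩

theorem finrank_bi_wt (mu kappa : Fin r → ℤ) :
    (finrank ℚ ↥((rowRep Unit r).wt mu ⊓ (colRep r ()).wt kappa) : ℤ) =
      zcoeff mu (∏ c, hkZ r (kappa c)) := by
  have h := finrank_wt_inf_wt mu (fun _ : Unit => kappa)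
  simp only [Finset.univ_unique, Finset.prod_singleton] at h
  rw [← h, iInf_unique]

theorem bi_altDim (n : ℕ) {nu kappa : Fin r → ℤ} (hn : nu ∈ parts r n) (hk : kappa ∈ parts r n) :
    ∑ lam ∈ parts r n, GLRep.irrAlt lam nu *
      ((finrank ℚ ↥((rowRep Unit r).hw lam ⊓ (colRep r ()).hw lam) : ℤ) *
        GLRep.irrAlt lam kappa) = if nu = kappa then 1 else 0 := by
  classical
  rw [mem_parts] at hn hk
  have h1 : ∀ mu : Fin r → ℤ, ∑ a, mu a = n →
      (colRep r ()).altDim ((rowRep Unit r).wt mu) kappa = ∑ lam ∈ parts r n,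
        (finrank ℚ ↥((rowRep Unit r).wt mu ⊓ (colRep r ()).hw lam) : ℤ) *
          GLRep.irrAlt lam kappa := by
    intro mu hmu
    refine (colRep r ()).altDim_eq_sum _ _ _ _ (stable_row_wt () mu)
      (finite_of_sum _ n fun p hp α hα => by rw [sum_of_mem_row_wt hp hα, hmu]) rfl ?_
    intro lam v hv1 hv2 hv0
    refine mem_parts_of_hw hv2 hv0 ?_
    obtain ⟨α, hα⟩ := support_nonempty.2 hv0
    rw [← sum_of_mem_col_wt ((colRep r ()).hw_le_wt _ hv2) hα, sum_of_mem_row_wt hv1 hα, hmu]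
  have h2 : ∀ lam ∈ parts r n, (rowRep Unit r).altDim ((colRep r ()).hw lam) nu =
      (finrank ℚ ↥((rowRep Unit r).hw lam ⊓ (colRep r ()).hw lam) : ℤ) *
        GLRep.irrAlt lam nu := by
    intro lam hlam
    have hs := (mem_parts.1 hlam).2.2
    rw [(rowRep Unit r).altDim_eq_sum (parts r n) nu _ _ (stable_col_hw () lam)
      (finite_of_sum _ n fun p hp α hα => by
        rw [sum_of_mem_col_wt ((colRep r ()).hw_le_wt _ hp) hα, hs]) rfl,
      Finset.sum_eq_single lam]
    · rw [inf_comm]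
    · intro mu _ hne
      rw [inf_comm, bihw_finrank_ne hne]
      simp
    · exact fun h => absurd hlam h
    · intro mu v hv1 hv2 hv0
      refine mem_parts_of_hw hv2 hv0 ?_
      obtain ⟨α, hα⟩ := support_nonempty.2 hv0
      rw [← sum_of_mem_row_wt ((rowRep Unit r).hw_le_wt _ hv2) hα,
        sum_of_mem_col_wt ((colRep r ()).hw_le_wt _ hv1) hα, hs]
  obtain ⟨nu, rfl⟩ : ∃ nu' : Fin r → ℕ, nu = fun a => (nu' a : ℤ) :=
    ⟨fun a => (nu a).toNat, funext fun a => (Int.toNat_of_nonneg (hn.2.1 a)).symm⟩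
  obtain ⟨kappa, rfl⟩ : ∃ nu' : Fin r → ℕ, kappa = fun a => (nu' a : ℤ) :=
    ⟨fun a => (kappa a).toNat, funext fun a => (Int.toNat_of_nonneg (hk.2.1 a)).symm⟩
  have h3 := schurCoeff_schurP (μ := kappa) (ν := nu)
    (fun a b hab => by have := hk.1 hab; dsimp only at this; exact_mod_cast this)
    (fun a b hab => by have := hn.1 hab; dsimp only at this; exact_mod_cast this)
  have h4 : ∀ mu : Fin r → ℤ, zcoeff mu (schurP kappa) =
      (colRep r ()).altDim ((rowRep Unit r).wt mu) (fun a => (kappa a : ℤ)) := by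
    intro mu
    rw [GLRep.altDim, schurP_eq, ← Matrix.det_transpose, Matrix.det_apply', zcoeff_sum]
    refine Finset.sum_congr rfl fun σ _ => ?_
    rw [finrank_bi_wt, zcoeff_int_mul]
    congr 3
    funext a
    rw [Matrix.transpose_apply, jtMat, Matrix.of_apply]
    congr 1
    ring
  rw [schurCoeff_eq_sum_zcoeff] at h3
  have h5 : ∀ σ : Equiv.Perm (Fin r),
      zcoeff (fun a => (nu a : ℤ) + ((σ a : ℕ) : ℤ) - ((a : ℕ) : ℤ)) (schurP kappa) =
      ∑ lam ∈ parts r n, (finrank ℚ ↥((colRep r ()).hw lam ⊓ (rowRep Unit r).wt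
        (fun a => (nu a : ℤ) + ((σ a : ℕ) : ℤ) - ((a : ℕ) : ℤ))) : ℤ) *
          GLRep.irrAlt lam (fun a => (kappa a : ℤ)) := by
    intro σ
    rw [h4, h1 _ (by rw [sum_twist]; exact hn.2.2)]
    refine Finset.sum_congr rfl fun lam _ => ?_
    rw [inf_comm]
  simp only [h5, Finset.mul_sum] at h3
  rw [Finset.sum_comm] at h3
  have h6 : (if (fun a => (nu a : ℤ)) = (fun a => (kappa a : ℤ)) then (1 : ℤ) else 0) =
      if kappa = nu then 1 else 0 := by
    congr 1
    rw [eq_iff_iff]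
    constructor
    · intro h; funext a; exact_mod_cast (congrFun h a).symm
    · rintro rfl; rfl
  rw [h6, ← h3]
  refine Finset.sum_congr rfl fun lam hlam => ?_
  have h7 := h2 lam hlam
  rw [GLRep.altDim] at h7
  rw [← mul_assoc, mul_comm (GLRep.irrAlt _ _), ← h7, Finset.sum_mul]
  exact Finset.sum_congr rfl fun σ _ => by ring

theorem irrAlt_parts (n : ℕ) {nu lam : Fin r → ℤ} (hn : nu ∈ parts r n) (hl : lam ∈ parts r n) :
    GLRep.irrAlt lam nu = if lam = nu then 1 else 0 := by
  classical
  let M : Matrix (parts r n) (parts r n) ℤ := fun lam nu => GLRep.irrAlt lam.1 nu.1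
  let ε : parts r n → ℤ := fun lam =>
    (finrank ℚ ↥((rowRep Unit r).hw lam.1 ⊓ (colRep r ()).hw lam.1) : ℤ)
  have h1 : M.transpose * (Matrix.diagonal ε * M) = 1 := by
    ext nu kappa
    rw [Matrix.mul_apply, Matrix.one_apply]
    simp only [Matrix.diagonal_mul, Matrix.transpose_apply]
    have h := bi_altDim n nu.2 kappa.2
    rw [← Finset.sum_coe_sort] at h
    simp only [Subtype.ext_iff]
    exact h
  have h2 : ∀ lam, ε lam ≠ 0 := by
    intro lam h0
    have h3 := congrArg Matrix.det h1
    rw [Matrix.det_mul, Matrix.det_mul, Matrix.det_diagonal,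
      Finset.prod_eq_zero (Finset.mem_univ lam) h0] at h3
    simp at h3
  have h3 : ∀ lam, ε lam = 1 := by
    intro lam
    have h4 := bihw_finrank_le lam.1 lam.1
    have h5 := h2 lam
    simp only [ε] at h5 ⊢
    omega
  have h4 : ∀ lam, M lam lam = 1 := by
    intro lam
    have h5 : (rowRep Unit r).hw lam.1 ⊓ (colRep r ()).hw lam.1 ≠ ⊥ := by
      intro h
      apply h2 lam
      simp only [ε]
      rw [h, finrank_bot]; rfl
    obtain ⟨v, hv, hv0⟩ := Submodule.ne_bot_iff _ |>.1 h5
    exact (rowRep Unit r).irrAlt_self hv.1 hv0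
  by_cases h : lam = nu
  · subst h
    rw [if_pos rfl]
    exact h4 ⟨lam, hl⟩
  · rw [if_neg h]
    have h5 := congrFun (congrFun h1 ⟨nu, hn⟩) ⟨nu, hn⟩
    rw [Matrix.mul_apply, Matrix.one_apply_eq] at h5
    simp only [Matrix.diagonal_mul, Matrix.transpose_apply, h3, one_mul] at h5
    rw [← Finset.add_sum_erase _ _ (Finset.mem_univ (⟨nu, hn⟩ : parts r n)), h4] at h5
    have h6 : ∑ x ∈ Finset.univ.erase (⟨nu, hn⟩ : parts r n),
      M x ⟨nu, hn⟩ * M x ⟨nu, hn⟩ = 0 := by linarith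
    rw [Finset.sum_eq_zero_iff_of_nonneg fun x _ => mul_self_nonneg _] at h6
    have h7 := h6 ⟨lam, hl⟩ (Finset.mem_erase.2 ⟨fun h8 => h (congrArg Subtype.val h8),
      Finset.mem_univ _⟩)
    exact mul_self_eq_zero.1 h7

end Cauchy

/-! ### Multiplicities as dimensions of spaces of highest weight vectors -/

namespace GLRep

variable {r : ℕ} {E : Type} [AddCommGroup E] [Module ℚ E] (ρ : GLRep r E)

theorem irrAlt_eq {lam nu : Fin r → ℤ} {v : E} (hv : v ∈ ρ.hw lam) (hv0 : v ≠ 0)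
    (hnu : Antitone nu) (hnu0 : ∀ a, 0 ≤ nu a) :
    irrAlt lam nu = if lam = nu then 1 else 0 := by
  by_cases h : ∑ a, nu a = ∑ a, lam a
  · have h0 : 0 ≤ ∑ a, nu a := Finset.sum_nonneg fun a _ => hnu0 a
    refine irrAlt_parts (∑ a, nu a).toNat (mem_parts.2 ⟨hnu, hnu0, ?_⟩)
      (mem_parts.2 ⟨ρ.hw_antitone hv hv0,
        ρ.nonneg _ _ hv0 (ρ.mem_wt.1 (ρ.hw_le_wt _ hv)), ?_⟩)
    · rw [Int.toNat_of_nonneg h0]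
    · rw [Int.toNat_of_nonneg h0, h]
  · rw [ρ.irrAlt_eq_zero_of_sum_ne hv hv0 h, if_neg]
    rintro rfl
    exact h rfl

theorem altDim_eq_finrank_hw {W : Submodule ℚ E} (hW : ρ.Stable W)
    (hfin : FiniteDimensional ℚ W) (N : ℤ)
    (hN : ∀ (mu : Fin r → ℤ) (v : E), v ∈ W → v ∈ ρ.wt mu → v ≠ 0 → ∀ a, mu a ≤ N)
    {nu : Fin r → ℤ} (hnu : Antitone nu) (hnu0 : ∀ a, 0 ≤ nu a) :
    ρ.altDim W nu = finrank ℚ ↥(W ⊓ ρ.hw nu) := by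
  classical
  have hz : ∀ lam : Fin r → ℤ, ((finrank ℚ ↥(W ⊓ ρ.hw lam) : ℤ) * irrAlt lam nu) =
      if lam = nu then (finrank ℚ ↥(W ⊓ ρ.hw lam) : ℤ) else 0 := by
    intro lam
    by_cases hb : W ⊓ ρ.hw lam = ⊥
    · rw [hb, finrank_bot]; simp
    · obtain ⟨v, hv, hv0⟩ := Submodule.ne_bot_iff _ |>.1 hb
      rw [ρ.irrAlt_eq hv.2 hv0 hnu hnu0]
      simp
  have hmem : ∀ (mu : Fin r → ℤ) (v : E), v ∈ W → v ∈ ρ.hw mu → v ≠ 0 →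
      mu ∈ Fintype.piFinset fun _ : Fin r => Finset.Icc (0 : ℤ) N := by
    intro mu v h1 h2 h3
    rw [Fintype.mem_piFinset]
    exact fun a => Finset.mem_Icc.2
      ⟨ρ.nonneg _ _ h3 (ρ.mem_wt.1 (ρ.hw_le_wt _ h2)) a, hN mu v h1 (ρ.hw_le_wt _ h2) h3 a⟩
  rw [ρ.altDim_eq_sum _ nu _ W hW hfin rfl hmem]
  simp only [hz]
  rw [Finset.sum_ite_eq']
  split_ifs with h
  · rfl
  · by_cases hb : W ⊓ ρ.hw nu = ⊥
    · rw [hb, finrank_bot]; rfl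
    · obtain ⟨v, hv, hv0⟩ := Submodule.ne_bot_iff _ |>.1 hb
      exact absurd (hmem nu v hv.1 hv.2 hv0) h

end GLRep

section HighestWeights

set_option linter.unusedSectionVars false

open MvPolynomial

variable {ι : Type} [Fintype ι] [DecidableEq ι] {r : ℕ}

/-- The highest weight space or weight space of the column action. -/
def colSp (J : Finset ι) (j : ι) (k : Fin r → ℤ) : Submodule ℚ (MPoly ι r) :=
  if j ∈ J then (colRep r j).hw k else (colRep r j).wt k

/-- The character of `colSp`. -/
def colCh (J : Finset ι) (j : ι) (k : Fin r → ℤ) : MvPolynomial (Fin r) ℤ :=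
  if j ∈ J then Matrix.det (Matrix.of fun a b : Fin r => hkZ r (k a - ((a : ℕ) : ℤ) +
    ((b : ℕ) : ℤ))) else ∏ c, hkZ r (k c)

theorem stable_col_row_wt (j : ι) (nu : Fin r → ℤ) :
    (colRep r j).Stable ((rowRep ι r).wt nu) := by
  intro a b v hv
  rw [GLRep.mem_wt] at *
  intro c
  rw [row_col_comm, hv, map_smul]

theorem stable_col_colSp (J : Finset ι) {i j : ι} (hij : i ≠ j) (k : Fin r → ℤ) :
    (colRep r i).Stable (colSp J j k) := by
  intro a b v hv
  unfold colSp at *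
  split_ifs at *
  · rw [GLRep.mem_hw] at *
    refine ⟨fun c => ?_, fun c d hcd => ?_⟩
    · rw [← col_col_comm hij, hv.1, map_smul]
    · rw [← col_col_comm hij, hv.2 c d hcd, map_zero]
  · rw [GLRep.mem_wt] at *
    intro c
    rw [← col_col_comm hij, hv, map_smul]

theorem stable_row_col_hw (j : ι) (k : Fin r → ℤ) :
    (rowRep ι r).Stable ((colRep r j).hw k) := by
  intro a b v hv
  rw [GLRep.mem_hw] at *
  refine ⟨fun c => ?_, fun c d hcd => ?_⟩
  · rw [← row_col_comm, hv.1, map_smul]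
  · rw [← row_col_comm, hv.2 c d hcd, map_zero]

theorem stable_inf {E : Type} [AddCommGroup E] [Module ℚ E] {ρ : GLRep r E}
    {W W' : Submodule ℚ E} (h : ρ.Stable W) (h' : ρ.Stable W') : ρ.Stable (W ⊓ W') :=
  fun a b v hv => ⟨h a b v hv.1, h' a b v hv.2⟩

theorem stable_iInf {E : Type} [AddCommGroup E] [Module ℚ E] {ρ : GLRep r E} {β : Sort*}
    {W : β → Submodule ℚ E} (h : ∀ i, ρ.Stable (W i)) : ρ.Stable (⨅ i, W i) :=
  fun a b v hv => mem_iInf _ |>.2 fun i => h i a b v (mem_iInf _ |>.1 hv i)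

theorem exponent_sum_of_row_wt {nu : Fin r → ℤ} {p : MPoly ι r} (hp : p ∈ (rowRep ι r).wt nu)
    {α : ι × Fin r × Fin r →₀ ℕ} (hα : α ∈ p.support) :
    ∑ s, (α s : ℤ) = ∑ a, nu a := by
  rw [mem_row_wt] at hp
  rw [← Finset.sum_congr rfl fun a _ => hp α hα a]
  simp only [Nat.cast_sum, Fintype.sum_prod_type]
  rw [Finset.sum_comm]

theorem exponent_sum_of_col_wt {k : ι → Fin r → ℤ} {p : MPoly ι r}
    (hp : ∀ j, p ∈ (colRep r j).wt (k j))
    {α : ι × Fin r × Fin r →₀ ℕ} (hα : α ∈ p.support) :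
    ∑ s, (α s : ℤ) = ∑ j, ∑ a, k j a := by
  simp only [mem_col_wt] at hp
  rw [Fintype.sum_prod_type]
  refine Finset.sum_congr rfl fun j _ => ?_
  rw [← Finset.sum_congr rfl fun a _ => hp j α hα a, Fintype.sum_prod_type, Finset.sum_comm]
  simp only [Nat.cast_sum]

theorem exponent_le_sum (α : ι × Fin r × Fin r →₀ ℕ) (s : ι × Fin r × Fin r) :
    (α s : ℤ) ≤ ∑ s, (α s : ℤ) :=
  Finset.single_le_sum (f := fun s => (α s : ℤ)) (fun _ _ => Int.natCast_nonneg _)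
    (Finset.mem_univ s)

theorem finiteDimensional_of_sum (W : Submodule ℚ (MPoly ι r)) (N : ℤ)
    (h : ∀ p ∈ W, ∀ α ∈ p.support, ∑ s, (α s : ℤ) = N) : FiniteDimensional ℚ W := by
  refine finiteDimensional_of_bound W N.toNat fun p hp α hα s => ?_
  have h1 := h p hp α hα
  have h2 := exponent_le_sum α s
  omega

theorem col_wt_le {j : ι} {mu : Fin r → ℤ} {p : MPoly ι r} (hp : p ∈ (colRep r j).wt mu)
    (hp0 : p ≠ 0) {N : ℤ} (hN : ∀ α ∈ p.support, ∑ s, (α s : ℤ) = N) (a : Fin r) :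
    mu a ≤ N := by
  obtain ⟨α, hα⟩ := support_nonempty.2 hp0
  rw [← mem_col_wt.1 hp α hα a, ← hN α hα, Fintype.sum_prod_type, Nat.cast_sum]
  refine le_trans ?_ (Finset.single_le_sum (f := fun j => ∑ s, (α (j, s) : ℤ))
    (fun i _ => Finset.sum_nonneg fun _ _ => Int.natCast_nonneg _) (Finset.mem_univ j))
  rw [Fintype.sum_prod_type]
  exact Finset.sum_le_sum fun i _ => Finset.single_le_sum
    (f := fun c => (α (j, i, c) : ℤ)) (fun _ _ => Int.natCast_nonneg _) (Finset.mem_univ a)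

theorem row_wt_le {mu : Fin r → ℤ} {p : MPoly ι r} (hp : p ∈ (rowRep ι r).wt mu)
    (hp0 : p ≠ 0) {N : ℤ} (hN : ∀ α ∈ p.support, ∑ s, (α s : ℤ) = N) (a : Fin r) :
    mu a ≤ N := by
  obtain ⟨α, hα⟩ := support_nonempty.2 hp0
  have h0 : ∀ a, 0 ≤ mu a := fun a => by
    rw [← mem_row_wt.1 hp α hα a]; exact Int.natCast_nonneg _
  rw [← hN α hα, exponent_sum_of_row_wt hp hα]
  exact Finset.single_le_sum (fun i _ => h0 i) (Finset.mem_univ a)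

theorem colSp_insert_of_ne {J : Finset ι} {i j : ι} (h : j ≠ i) (k : Fin r → ℤ) :
    colSp (insert i J) j k = colSp J j k := by
  simp [colSp, h]

theorem finrank_colSp (nu : Fin r → ℤ) (J : Finset ι) : ∀ (k : ι → Fin r → ℤ),
    (∀ j ∈ J, Antitone (k j) ∧ ∀ a, 0 ≤ k j a) →
    (finrank ℚ ↥((rowRep ι r).wt nu ⊓ ⨅ j, colSp J j (k j)) : ℤ) =
      zcoeff nu (∏ j, colCh J j (k j)) := by
  induction J using Finset.induction_on with
  | empty =>
    intro k _
    simp only [colSp, colCh, Finset.notMem_empty, if_false]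
    exact finrank_wt_inf_wt nu k
  | insert i J hi ih =>
    intro k hk
    set W : Submodule ℚ (MPoly ι r) :=
      (rowRep ι r).wt nu ⊓ ⨅ j, ⨅ _ : i ≠ j, colSp J j (k j) with hWdef
    have hsum : ∀ p ∈ W, ∀ α ∈ p.support, ∑ s, (α s : ℤ) = ∑ a, nu a :=
      fun p hp α hα => exponent_sum_of_row_wt hp.1 hα
    have hst : (colRep r i).Stable W :=
      stable_inf (stable_col_row_wt i nu) (stable_iInf fun j => stable_iInf fun hj =>
        stable_col_colSp J hj _)
    have h1 := (colRep r i).altDim_eq_finrank_hw hst (finiteDimensional_of_sum W _ hsum)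
      (∑ a, nu a) (fun mu v h1 h2 h3 => col_wt_le h2 h3 (hsum v h1))
      (hk i (Finset.mem_insert_self _ _)).1 (hk i (Finset.mem_insert_self _ _)).2
    have h2 : (rowRep ι r).wt nu ⊓ ⨅ j, colSp (insert i J) j (k j) =
        W ⊓ (colRep r i).hw (k i) := by
      ext p
      simp only [hWdef, mem_inf, mem_iInf]
      constructor
      · rintro ⟨h1, h2⟩
        refine ⟨⟨h1, fun j hj => ?_⟩, ?_⟩
        · rw [← colSp_insert_of_ne hj.symm]; exact h2 j
        · have := h2 i
          rwa [colSp, if_pos (Finset.mem_insert_self _ _)] at this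
      · rintro ⟨⟨h1, h2⟩, h3⟩
        refine ⟨h1, fun j => ?_⟩
        by_cases hj : i = j
        · subst hj
          rwa [colSp, if_pos (Finset.mem_insert_self _ _)]
        · rw [colSp_insert_of_ne (Ne.symm hj)]; exact h2 j hj
    have h3 : ∀ mu : Fin r → ℤ, W ⊓ (colRep r i).wt mu =
        (rowRep ι r).wt nu ⊓ ⨅ j, colSp J j (Function.update k i mu j) := by
      intro mu
      ext p
      simp only [hWdef, mem_inf, mem_iInf]
      constructor
      · rintro ⟨⟨h1, h2⟩, h3⟩
        refine ⟨h1, fun j => ?_⟩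
        by_cases hj : i = j
        · subst hj
          rwa [colSp, if_neg hi, Function.update_self]
        · rw [Function.update_of_ne (Ne.symm hj)]; exact h2 j hj
      · rintro ⟨h1, h2⟩
        refine ⟨⟨h1, fun j hj => ?_⟩, ?_⟩
        · have := h2 j
          rwa [Function.update_of_ne (Ne.symm hj)] at this
        · have := h2 i
          rwa [colSp, if_neg hi, Function.update_self] at this
    rw [h2, ← h1, GLRep.altDim]
    have h4 : ∀ mu : Fin r → ℤ, (finrank ℚ ↥(W ⊓ (colRep r i).wt mu) : ℤ) =
        zcoeff nu ((∏ c, hkZ r (mu c)) * ∏ j ∈ Finset.univ.erase i, colCh J j (k j)) := by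
      intro mu
      rw [h3, ih, ← Finset.mul_prod_erase _ _ (Finset.mem_univ i)]
      · congr 2
        · rw [colCh, if_neg hi, Function.update_self]
        · refine Finset.prod_congr rfl fun j hj => ?_
          rw [Function.update_of_ne (Finset.ne_of_mem_erase hj)]
      · intro j hj
        have : j ≠ i := fun h => hi (h ▸ hj)
        rw [Function.update_of_ne this]
        exact hk j (Finset.mem_insert_of_mem hj)
    simp only [h4]
    rw [← Finset.mul_prod_erase _ _ (Finset.mem_univ i)]
    have h5 : ∏ j ∈ Finset.univ.erase i, colCh (insert i J) j (k j) =
        ∏ j ∈ Finset.univ.erase i, colCh J j (k j) := by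
      refine Finset.prod_congr rfl fun j hj => ?_
      simp [colCh, Finset.ne_of_mem_erase hj]
    rw [h5, colCh, if_pos (Finset.mem_insert_self _ _), ← Matrix.det_transpose,
      Matrix.det_apply', Finset.sum_mul, zcoeff_sum]
    refine Finset.sum_congr rfl fun σ _ => ?_
    rw [mul_assoc, zcoeff_int_mul]
    congr 4
    funext a
    rw [Matrix.transpose_apply, Matrix.of_apply]
    congr 1
    ring

/-- Polynomials which are highest weight vectors for the row action and all column actions. -/
def hwSpace (nu : Fin r → ℕ) (lam : ι → Fin r → ℕ) : Submodule ℚ (MPoly ι r) :=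
  (rowRep ι r).hw (fun a => (nu a : ℤ)) ⊓ ⨅ j, (colRep r j).hw fun a => (lam j a : ℤ)

theorem finrank_hwSpace {nu : Fin r → ℕ} (hnu : Antitone nu) {lam : ι → Fin r → ℕ}
    (hlam : ∀ j, Antitone (lam j)) :
    (finrank ℚ ↥(hwSpace nu lam) : ℤ) = schurCoeff r (∏ j, schurP (lam j)) nu := by
  set W : Submodule ℚ (MPoly ι r) := ⨅ j, (colRep r j).hw fun a => (lam j a : ℤ) with hW
  have hsum : ∀ p ∈ W, ∀ α ∈ p.support, ∑ s, (α s : ℤ) = ∑ j, ∑ a, (lam j a : ℤ) :=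
    fun p hp α hα => exponent_sum_of_col_wt
      (fun j => (colRep r j).hw_le_wt _ (mem_iInf _ |>.1 hp j)) hα
  have h1 := (rowRep ι r).altDim_eq_finrank_hw (stable_iInf fun j => stable_row_col_hw j _)
    (finiteDimensional_of_sum W _ hsum) (∑ j, ∑ a, (lam j a : ℤ))
      (fun mu v h1 h2 h3 => row_wt_le h2 h3 (hsum v h1)) (nu := fun a => (nu a : ℤ))
      (fun a b hab => by have := hnu hab; dsimp only; exact_mod_cast this)
      (fun a => Int.natCast_nonneg _)
  rw [hwSpace, inf_comm, ← h1, GLRep.altDim, schurCoeff_eq_sum_zcoeff]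
  refine Finset.sum_congr rfl fun σ _ => ?_
  have h2 := finrank_colSp (ι := ι) (fun a => (nu a : ℤ) + ((σ a : ℕ) : ℤ) - ((a : ℕ) : ℤ))
    Finset.univ (fun j a => (lam j a : ℤ)) (fun j _ =>
      ⟨fun a b hab => by have := hlam j hab; dsimp only; exact_mod_cast this,
        fun a => Int.natCast_nonneg _⟩)
  have e1 : ∀ (j : ι) (k : Fin r → ℤ), colSp Finset.univ j k = (colRep r j).hw k :=
    fun j k => if_pos (Finset.mem_univ j)
  have e2 : ∀ j, colCh Finset.univ j (fun a => (lam j a : ℤ)) = schurP (lam j) :=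
    fun j => if_pos (Finset.mem_univ j)
  have e3 : (⨅ j, colSp Finset.univ j fun a => (lam j a : ℤ)) = W := iInf_congr fun j => e1 j _
  rw [e3] at h2
  simp only [e2] at h2
  rw [inf_comm, h2]

end HighestWeights

/-! ### Equivariance of highest weight vectors under triangular matrices -/

section Equivariance

set_option linter.unusedSectionVars false

open MvPolynomial

theorem derivation_aeval {σ κ : Type*} [Fintype κ] {K : Type*} [CommRing K] [Algebra ℚ K]
    (Δ : κ → Derivation ℚ (MvPolynomial σ ℚ) (MvPolynomial σ ℚ)) (c : κ → K)
    (D : Derivation ℚ K K) (x : σ → K)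
    (h : ∀ s, D (x s) = ∑ k, c k * aeval x (Δ k (X s))) (f : MvPolynomial σ ℚ) :
    D (aeval x f) = ∑ k, c k * aeval x (Δ k f) := by
  induction f using MvPolynomial.induction_on with
  | C a =>
    rw [aeval_C, Derivation.map_algebraMap]
    refine (Finset.sum_eq_zero fun k _ => ?_).symm
    have : Δ k (C a) = 0 := (Δ k).map_algebraMap a
    rw [this, map_zero, mul_zero]
  | add p q hp hq =>
    simp only [map_add, hp, hq, mul_add, Finset.sum_add_distrib]
  | mul_X p s hp =>
    rw [map_mul, Derivation.leibniz, aeval_X, hp, h, smul_eq_mul, smul_eq_mul, Finset.mul_sum,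
      Finset.mul_sum, ← Finset.sum_add_distrib]
    refine Finset.sum_congr rfl fun k _ => ?_
    rw [Derivation.leibniz, smul_eq_mul, smul_eq_mul, map_add, map_mul, map_mul, aeval_X]
    ring

variable {σ : Type} [Fintype σ] [DecidableEq σ] {r : ℕ} {γ : Type} [Fintype γ] [DecidableEq γ]
  {K : Type*} [CommRing K] [IsDomain K] [CharZero K] [Algebra ℚ K]

variable (T : Fin r × γ → σ) (hT : Function.Injective T)

include hT in
theorem aeval_polD_X (z : σ → K) (a d b : Fin r) (c : γ) :
    aeval z (polD T a d (X (T (b, c)))) = if d = b then z (T (a, c)) else 0 := by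
  rw [polD_X T hT]
  split_ifs
  · rw [aeval_X]
  · rw [map_zero]

theorem aeval_polD_X_of_notMem (z : σ → K) (a d : Fin r) {p : σ} (hp : p ∉ Set.range T) :
    aeval z (polD T a d (X p)) = 0 := by
  rw [polD_X_of_notMem T _ _ hp, map_zero]

include hT in
theorem aeval_transvection {a d : Fin r} (had : a ≠ d) {f : MvPolynomial σ ℚ}
    (hf : polD T a d f = 0) (x x' : σ → K) (t : K)
    (h : ∀ p, x' p = x p + t * aeval x (polD T a d (X p))) : aeval x' f = aeval x f := by
  obtain ⟨δ, hδ⟩ : ∃ δ : σ → K, ∀ p, aeval x (polD T a d (X p)) = δ p := ⟨_, fun _ => rfl⟩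
  set y : σ → Polynomial K := fun p =>
    Polynomial.C (x p) + Polynomial.X * Polynomial.C (δ p) with hy
  let D : Derivation ℚ (Polynomial K) (Polynomial K) :=
    (Polynomial.derivative' (R := K)).restrictScalars ℚ
  have hyX : ∀ p, aeval y (polD T a d (X p)) = Polynomial.C (δ p) := by
    intro p
    rw [← hδ]
    by_cases hp : p ∈ Set.range T
    · obtain ⟨⟨b, c⟩, rfl⟩ := hp
      rw [aeval_polD_X T hT, aeval_polD_X T hT]
      split_ifs
      · rw [hy]
        dsimp only
        rw [← hδ, aeval_polD_X T hT, if_neg had.symm]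
        simp
      · simp
    · rw [aeval_polD_X_of_notMem T _ _ _ hp, aeval_polD_X_of_notMem T _ _ _ hp, map_zero]
  have h1 : D (aeval y f) = 0 := by
    have := derivation_aeval (fun _ : Unit => polD T a d) (fun _ => (1 : Polynomial K)) D y
      (fun p => by
        have h2 : D (y p) = Polynomial.derivative (y p) := rfl
        simp only [Finset.univ_unique, Finset.sum_singleton, one_mul]
        rw [hyX, h2, hy]
        simp) f
    rw [this, hf]
    simp
  have h2 : (aeval y f).natDegree = 0 := by
    rw [← Polynomial.derivative_eq_zero]
    exact h1
  obtain ⟨c, hc⟩ := Polynomial.natDegree_eq_zero.1 h2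
  have hev : ∀ s : K, Polynomial.eval s (aeval y f) = aeval (fun p => Polynomial.eval s (y p)) f := by
    intro s
    have := MvPolynomial.map_aeval y (Polynomial.evalRingHom s) f
    rw [Polynomial.coe_evalRingHom] at this
    rw [this, coe_eval₂Hom, aeval_def]
    congr 1
    exact Subsingleton.elim _ _
  have e1 := hev t
  have e0 := hev 0
  rw [← hc, Polynomial.eval_C] at e1 e0
  have h3 : (fun p => Polynomial.eval t (y p)) = x' := by
    funext p
    rw [h, hy, hδ]
    simp only [Polynomial.eval_add, Polynomial.eval_C, Polynomial.eval_mul, Polynomial.eval_X]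
  have h4 : (fun p => Polynomial.eval 0 (y p)) = x := by
    funext p
    rw [hy]
    simp
  rw [h3] at e1
  rw [h4] at e0
  rw [← e1, ← e0]

include hT in
theorem aeval_scale {lam : Fin r → ℕ} {f : MvPolynomial σ ℚ}
    (hf : f ∈ (polRep T hT).wt fun a => (lam a : ℤ)) (x x' : σ → K) (t : Fin r → K)
    (h : ∀ a c, x' (T (a, c)) = t a * x (T (a, c))) (h' : ∀ p, p ∉ Set.range T → x' p = x p) :
    aeval x' f = (∏ a, t a ^ lam a) * aeval x f := by
  rw [mem_polRep_wt] at hf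
  conv_lhs => rw [f.as_sum]
  conv_rhs => rw [f.as_sum]
  rw [map_sum, map_sum, Finset.mul_sum]
  refine Finset.sum_congr rfl fun α hα => ?_
  rw [aeval_monomial, aeval_monomial, Finsupp.prod_fintype _ _ (fun _ => pow_zero _),
    Finsupp.prod_fintype _ _ (fun _ => pow_zero _), mul_left_comm]
  congr 1
  classical
  let u : σ → K := fun p => if hp : p ∈ Set.range T then t hp.choose.1 else 1
  have hu : ∀ a c, u (T (a, c)) = t a := by
    intro a c
    have hp : T (a, c) ∈ Set.range T := ⟨_, rfl⟩
    simp only [u, dif_pos hp]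
    rw [hT hp.choose_spec]
  have hu' : ∀ p, p ∉ Set.range T → u p = 1 := fun p hp => by simp only [u, dif_neg hp]
  have h1 : ∏ p, x' p ^ α p = (∏ p, u p ^ α p) * ∏ p, x p ^ α p := by
    rw [← Finset.prod_mul_distrib]
    refine Finset.prod_congr rfl fun p _ => ?_
    rw [← mul_pow]
    congr 1
    by_cases hp : p ∈ Set.range T
    · obtain ⟨⟨a, c⟩, rfl⟩ := hp
      rw [hu, h]
    · rw [hu' p hp, h' p hp, one_mul]
  rw [h1]
  congr 1
  rw [← Fintype.prod_of_injective T hT (fun y => t y.1 ^ α (T y)) (fun p => u p ^ α p)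
    (fun p hp => by rw [hu' p hp, one_pow]) (fun y => by rw [← hu y.1 y.2]),
    Fintype.prod_prod_type]
  refine Finset.prod_congr rfl fun a _ => ?_
  dsimp only
  rw [Finset.prod_pow_eq_pow_sum]
  congr 1
  exact_mod_cast hf α hα a

include hT in
theorem aeval_column {lam : Fin r → ℕ} {f : MvPolynomial σ ℚ}
    (hf : f ∈ (polRep T hT).hw fun a => (lam a : ℤ)) (d : Fin r) (β : Fin r → K) (x : σ → K) :
    ∀ (s : Finset (Fin r)), (∀ a ∈ s, a < d) → ∀ (z : σ → K),
    (∀ c, z (T (d, c)) = β d * x (T (d, c)) + ∑ a ∈ s, β a * x (T (a, c))) →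
    (∀ p, (∀ c, p ≠ T (d, c)) → z p = x p) → aeval z f = β d ^ lam d * aeval x f := by
  intro s
  induction s using Finset.induction_on with
  | empty =>
    intro _ z hz hz'
    rw [aeval_scale T hT ((polRep T hT).hw_le_wt _ hf) x z (Function.update 1 d (β d)) ?_ ?_]
    · congr 1
      rw [Finset.prod_eq_single d]
      · rw [Function.update_self]
      · intro b _ hb
        rw [Function.update_of_ne hb, Pi.one_apply, one_pow]
      · simp
    · intro a c
      by_cases hd : a = d
      · subst hd
        rw [Function.update_self, hz]
        simp
      · rw [Function.update_of_ne hd, Pi.one_apply, one_mul]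
        exact hz' _ fun c' h => hd (congrArg Prod.fst (hT h))
    · exact fun p hp => hz' p fun c h => hp ⟨_, h.symm⟩
  | insert a s ha ih =>
    intro hs z hz hz'
    have had : a < d := hs a (Finset.mem_insert_self _ _)
    have hδ : ∀ (w : σ → K) p, (∀ c, p ≠ T (d, c)) → aeval w (polD T a d (X p)) = 0 := by
      intro w p hp
      by_cases h : p ∈ Set.range T
      · obtain ⟨⟨b, c⟩, rfl⟩ := h
        rw [aeval_polD_X T hT, if_neg]
        rintro rfl
        exact hp c rfl
      · exact aeval_polD_X_of_notMem T _ _ _ h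
    have hza : ∀ c, z (T (a, c)) = x (T (a, c)) := fun c => hz' _ fun c' h =>
      had.ne (congrArg Prod.fst (hT h))
    rw [← ih (fun b hb => hs b (Finset.mem_insert_of_mem hb))
      (fun p => z p - β a * aeval x (polD T a d (X p))) ?_ ?_]
    · refine aeval_transvection T hT had.ne ((polRep T hT).mem_hw.1 hf |>.2 a d had) _ _ (β a) ?_
      intro p
      by_cases hp : ∀ c, p ≠ T (d, c)
      · rw [hδ _ _ hp, hδ _ _ hp]; ring
      · push Not at hp
        obtain ⟨c, rfl⟩ := hp
        rw [aeval_polD_X T hT, aeval_polD_X T hT, if_pos rfl, if_pos rfl, hza, hδ]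
        · ring
        · exact fun c' h => had.ne (congrArg Prod.fst (hT h))
    · intro c
      rw [aeval_polD_X T hT, if_pos rfl, hz, Finset.sum_insert ha]
      ring
    · intro p hp
      rw [hδ _ _ hp, hz' p hp]
      ring

include hT in
theorem aeval_triangular {lam : Fin r → ℕ} {f : MvPolynomial σ ℚ}
    (hf : f ∈ (polRep T hT).hw fun a => (lam a : ℤ)) (B : Fin r → Fin r → K)
    (hB : ∀ a b, b < a → B a b = 0) (x x' : σ → K)
    (h : ∀ b c, x' (T (b, c)) = ∑ a, B a b * x (T (a, c)))
    (h' : ∀ p, p ∉ Set.range T → x' p = x p) :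
    aeval x' f = (∏ a, B a a ^ lam a) * aeval x f := by
  classical
  let y : ℕ → σ → K := fun k p => if ∃ b c, p = T (b, c) ∧ (b : ℕ) < k then x p else x' p
  have hy1 : ∀ k (b : Fin r) c, (b : ℕ) < k → y k (T (b, c)) = x (T (b, c)) := fun k b c hb =>
    if_pos ⟨b, c, rfl, hb⟩
  have hy2 : ∀ k (b : Fin r) c, k ≤ (b : ℕ) → y k (T (b, c)) = x' (T (b, c)) := by
    intro k b c hb
    refine if_neg ?_
    rintro ⟨b', c', h1, h2⟩
    obtain rfl : b = b' := congrArg Prod.fst (hT h1)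
    omega
  have hy3 : ∀ k p, p ∉ Set.range T → y k p = x p := by
    intro k p hp
    rw [← h' p hp]
    refine if_neg ?_
    rintro ⟨b', c', h1, h2⟩
    exact hp ⟨_, h1.symm⟩
  have key : ∀ k, k ≤ r → aeval (y 0) f =
      (∏ a : Fin r, if (a : ℕ) < k then B a a ^ lam a else 1) * aeval (y k) f := by
    intro k
    induction k with
    | zero => simp
    | succ k ih =>
      intro hk
      rw [ih (by omega)]
      have h2 := aeval_column T hT hf ⟨k, hk⟩ (fun a => B a ⟨k, hk⟩) (y (k + 1))
        (Finset.univ.filter fun a => a < ⟨k, hk⟩) (fun a ha => (Finset.mem_filter.1 ha).2) (y k)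
        ?_ ?_
      · rw [h2, ← mul_assoc]
        congr 1
        rw [← Finset.mul_prod_erase _ _ (Finset.mem_univ (⟨k, hk⟩ : Fin r)),
          ← Finset.mul_prod_erase Finset.univ
            (fun a : Fin r => if (a : ℕ) < k + 1 then B a a ^ lam a else 1)
            (Finset.mem_univ (⟨k, hk⟩ : Fin r)), if_neg (by simp), if_pos (by simp), one_mul,
          mul_comm]
        congr 1
        refine Finset.prod_congr rfl fun a ha => ?_
        have h3 : (a : ℕ) ≠ k := fun h => Finset.ne_of_mem_erase ha (Fin.ext h)
        congr 1
        rw [eq_iff_iff]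
        omega
      · intro c
        rw [hy2 _ _ _ (le_refl k), h, hy1 _ _ _ (by simp),
          ← Finset.add_sum_erase _ _ (Finset.mem_univ (⟨k, hk⟩ : Fin r))]
        congr 1
        symm
        refine Finset.sum_subset_zero_on_sdiff ?_ ?_ ?_
        · intro a ha
          exact Finset.mem_erase.2 ⟨(Finset.mem_filter.1 ha).2.ne, Finset.mem_univ _⟩
        · intro a ha
          have h1 := Finset.ne_of_mem_erase (Finset.mem_sdiff.1 ha).1
          have h2 : ¬ a < ⟨k, hk⟩ := fun h =>
            (Finset.mem_sdiff.1 ha).2 (Finset.mem_filter.2 ⟨Finset.mem_univ _, h⟩)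
          rw [hB _ _ (lt_of_le_of_ne (not_lt.1 h2) (Ne.symm h1)), zero_mul]
        · intro a ha
          have h2 : (a : ℕ) < k := (Finset.mem_filter.1 ha).2
          rw [hy1 _ _ _ (by omega)]
      · intro p hp
        by_cases h3 : p ∈ Set.range T
        · obtain ⟨⟨b, c⟩, rfl⟩ := h3
          have hb : (b : ℕ) ≠ k := by
            rintro rfl
            exact hp c rfl
          rcases lt_or_gt_of_ne hb with hb | hb
          · rw [hy1 _ _ _ hb, hy1 _ _ _ (by omega)]
          · rw [hy2 _ _ _ (by omega), hy2 _ _ _ (by omega)]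
        · rw [hy3 _ _ h3, hy3 _ _ h3]
  have h0 : y 0 = x' := by
    funext p
    by_cases h3 : p ∈ Set.range T
    · obtain ⟨⟨b, c⟩, rfl⟩ := h3
      exact hy2 _ _ _ (Nat.zero_le _)
    · rw [hy3 _ _ h3, h' _ h3]
  have hr : y r = x := by
    funext p
    by_cases h3 : p ∈ Set.range T
    · obtain ⟨⟨b, c⟩, rfl⟩ := h3
      exact hy1 _ _ _ b.2
    · exact hy3 _ _ h3
  have := key r le_rfl
  rw [h0, hr] at this
  rw [this]
  congr 1
  exact Finset.prod_congr rfl fun a _ => if_pos a.2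

end Equivariance

/-! ### Evaluation of highest weight vectors at tuples of matrices -/

section EvalMatrix

open MvPolynomial

variable {ι : Type} [Fintype ι] [DecidableEq ι] {r : ℕ}

/-- Evaluation of a polynomial at a tuple of matrices. -/
def evM {K : Type*} [CommRing K] [Algebra ℚ K] (h : ι → Matrix (Fin r) (Fin r) K)
    (f : MPoly ι r) : K :=
  aeval (fun s => h s.1 s.2.1 s.2.2) f

omit [Fintype ι] [DecidableEq ι] in
theorem map_evM {K K' : Type*} [CommRing K] [Algebra ℚ K] [CommRing K'] [Algebra ℚ K']
    (φ : K →ₐ[ℚ] K') (h : ι → Matrix (Fin r) (Fin r) K) (f : MPoly ι r) :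
    φ (evM h f) = evM (fun j => (h j).map φ) f := by
  rw [evM, evM]
  have := MvPolynomial.comp_aeval (fun s : ι × Fin r × Fin r => h s.1 s.2.1 s.2.2) φ
  exact DFunLike.congr_fun this f

section Domain

variable {K : Type*} [CommRing K] [IsDomain K] [CharZero K] [Algebra ℚ K]

theorem evM_mul_right {lam : ι → Fin r → ℕ} {f : MPoly ι r}
    (hf : ∀ j, f ∈ (colRep r j).hw fun a => (lam j a : ℤ)) (h β : ι → Matrix (Fin r) (Fin r) K)
    (hβ : ∀ j c d, d < c → β j c d = 0) :
    evM (fun j => h j * β j) f = (∏ j, ∏ c, β j c c ^ lam j c) * evM h f := by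
  have key : ∀ s : Finset ι, evM (fun j => if j ∈ s then h j * β j else h j) f =
      (∏ j ∈ s, ∏ c, β j c c ^ lam j c) * evM h f := by
    intro s
    induction s using Finset.induction_on with
    | empty => simp
    | insert i s hi ih =>
      rw [Finset.prod_insert hi, mul_assoc, ← ih]
      refine aeval_triangular (colT i) (colT_injective i) (hf i) (β i) (hβ i) _ _ ?_ ?_
      · intro b c
        change (if i ∈ insert i s then h i * β i else h i) c b =
          ∑ a, β i a b * (if i ∈ s then h i * β i else h i) c a
        rw [if_pos (Finset.mem_insert_self _ _), if_neg hi, Matrix.mul_apply]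
        exact Finset.sum_congr rfl fun a _ => mul_comm (h i c a) (β i a b)
      · rintro ⟨j, a, c⟩ hp
        have hj : j ≠ i := by
          rintro rfl
          exact hp ⟨(c, a), rfl⟩
        simp [Finset.mem_insert, hj]
  simpa using key Finset.univ

theorem evM_mul_left {nu : Fin r → ℕ} {f : MPoly ι r}
    (hf : f ∈ (rowRep ι r).hw fun a => (nu a : ℤ)) (h : ι → Matrix (Fin r) (Fin r) K)
    (b : Matrix (Fin r) (Fin r) K) (hb : ∀ c d, c < d → b c d = 0) :
    evM (fun j => b * h j) f = (∏ c, b c c ^ nu c) * evM h f := by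
  refine aeval_triangular rowT rowT_injective hf (fun a c => b c a) (fun a c hac => hb c a hac)
    _ _ ?_ ?_
  · rintro a ⟨j, c⟩
    simp only [rowT, Matrix.mul_apply]
  · rintro ⟨j, a, c⟩ hp
    exact absurd ⟨(a, (j, c)), rfl⟩ hp

/-- A highest weight vector of rectangular weight is killed by all off-diagonal operators. -/
theorem GLRep.e_eq_zero_of_rect {E : Type} [AddCommGroup E] [Module ℚ E] (R : GLRep r E) {z : ℤ}
    {f : E} (hf : f ∈ R.hw fun _ => z) {a b : Fin r} (hab : a ≠ b) : R.e a b f = 0 := by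
  obtain ⟨h1, h2⟩ := R.mem_hw.1 hf
  rcases lt_or_gt_of_ne hab with h | h
  · exact h2 a b h
  · by_contra h0
    refine (R.pos _ h0).ne' ?_
    have h3 := R.rel b a a b f
    rw [h2 b a h, map_zero, if_pos rfl, if_pos rfl, h1, h1, sub_self, sub_zero] at h3
    rw [R.adj, h3, map_zero]

end Domain

section Field

variable {K : Type*} [Field K] [CharZero K] [Algebra ℚ K]

theorem evM_mul_left_rect {e : ℕ} {f : MPoly ι r}
    (hf : f ∈ (rowRep ι r).hw fun _ => (e : ℤ)) (M : Matrix (Fin r) (Fin r) K)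
    (h : ι → Matrix (Fin r) (Fin r) K) :
    evM (fun j => M * h j) f = M.det ^ e * evM h f := by
  revert h
  refine Matrix.diagonal_transvection_induction
    (fun M => ∀ h : ι → Matrix (Fin r) (Fin r) K,
      evM (fun j => M * h j) f = M.det ^ e * evM h f) M ?_ ?_ ?_
  · intro D _ h
    rw [evM_mul_left (nu := fun _ => e) hf h _ fun c d hcd => Matrix.diagonal_apply_ne _ hcd.ne,
      Matrix.det_diagonal, ← Finset.prod_pow]
    simp
  · intro t h
    rw [Matrix.TransvectionStruct.det, one_pow, one_mul]
    refine aeval_transvection rowT rowT_injective (a := t.j) (d := t.i) t.hij.symm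
      ((rowRep ι r).e_eq_zero_of_rect hf t.hij.symm) _ _ t.c ?_
    rintro ⟨j, a, c⟩
    have h1 := aeval_polD_X rowT rowT_injective
      (fun s : ι × Fin r × Fin r => h s.1 s.2.1 s.2.2) t.j t.i a (j, c)
    simp only [rowT] at h1
    rw [h1]
    change (t.toMatrix * h j) a c = _
    rw [Matrix.TransvectionStruct.toMatrix, Matrix.transvection, add_mul, one_mul,
      Matrix.add_apply]
    congr 1
    by_cases ha : t.i = a
    · subst ha
      rw [if_pos rfl, Matrix.single_mul_apply_same]
    · rw [if_neg ha, Matrix.single_mul_apply_of_ne _ _ _ _ _ (Ne.symm ha), mul_zero]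
  · intro A B hA hB h
    have := hA fun j => B * h j
    simp only [← mul_assoc] at this
    rw [this, hB, Matrix.det_mul, mul_pow, mul_assoc]

end Field

/-- The infinitesimal form of an equivariance property. -/
theorem polD_eq_of_aeval {σ : Type} [Fintype σ] [DecidableEq σ] {γ : Type} [Fintype γ]
    [DecidableEq γ] (T : Fin r × γ → σ) (a b : Fin r)
    (f : MvPolynomial σ ℚ) (n : ℕ) (y : σ → Polynomial (MvPolynomial σ ℚ))
    (hy : ∀ s, y s = Polynomial.C (X s) + Polynomial.X * Polynomial.C (polD T a b (X s)))
    (h : aeval y f = (1 + Polynomial.X) ^ n * Polynomial.C f) : polD T a b f = (n : ℚ) • f := by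
  obtain ⟨δ, hδ⟩ : ∃ δ : σ → MvPolynomial σ ℚ, ∀ p, polD T a b (X p) = δ p := ⟨_, fun _ => rfl⟩
  simp only [hδ] at hy
  let D : Derivation ℚ (Polynomial (MvPolynomial σ ℚ)) (Polynomial (MvPolynomial σ ℚ)) :=
    (Polynomial.derivative' (R := MvPolynomial σ ℚ)).restrictScalars ℚ
  have hD : ∀ p, D p = Polynomial.derivative p := fun _ => rfl
  have h1 := derivation_aeval (fun s : σ => pderiv s) (fun s => Polynomial.C (δ s)) D y
    (fun s => by
      rw [hD, hy]
      simp [pderiv_X, Pi.single_apply]) f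
  rw [h, hD] at h1
  have hev : ∀ p : MvPolynomial σ ℚ, Polynomial.eval 0 (aeval y p) = p := by
    intro p
    have h2 := MvPolynomial.map_aeval y (Polynomial.evalRingHom (0 : MvPolynomial σ ℚ)) p
    rw [Polynomial.coe_evalRingHom] at h2
    rw [h2, coe_eval₂Hom]
    have h3 : (fun i => Polynomial.eval (0 : MvPolynomial σ ℚ) (y i)) = X := by
      funext s
      rw [hy]
      simp
    rw [h3]
    have h4 := MvPolynomial.eval₂_eta p
    refine Eq.trans ?_ h4
    congr 1
    exact Subsingleton.elim _ _
  have h2 := congrArg (Polynomial.eval 0) h1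
  rw [Polynomial.eval_finsetSum] at h2
  simp only [Polynomial.eval_mul, hev, Polynomial.eval_C] at h2
  have h3 : polD T a b f = ∑ s, δ s * pderiv s f := by
    have h4 := derivation_aeval (K := MvPolynomial σ ℚ) (fun s : σ => pderiv s) δ (polD T a b) X
      (fun s => by
        rw [hδ]
        simp [pderiv_X, Pi.single_apply]) f
    simpa only [aeval_X_left, AlgHom.id_apply] using h4
  rw [h3, ← h2]
  simp [Polynomial.derivative_pow, Algebra.smul_def]

/-- A criterion for being a highest weight vector in terms of functional equations. -/
theorem mem_hwSpace_of_evM {e : ℕ} {lam : ι → Fin r → ℕ} {f : MPoly ι r}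
    (h1 : ∀ (K : Type) [CommRing K] [IsDomain K] [Algebra ℚ K] (M : Matrix (Fin r) (Fin r) K)
      (h : ι → Matrix (Fin r) (Fin r) K), evM (fun j => M * h j) f = M.det ^ e * evM h f)
    (h2 : ∀ (K : Type) [CommRing K] [IsDomain K] [Algebra ℚ K] (h β : ι → Matrix (Fin r) (Fin r) K),
      (∀ j c d, d < c → β j c d = 0) →
      evM (fun j => h j * β j) f = (∏ j, ∏ c, β j c c ^ lam j c) * evM h f) :
    f ∈ hwSpace (fun _ => e) lam := by
  let K := Polynomial (MPoly ι r)
  let h0 : ι → Matrix (Fin r) (Fin r) K := fun j => Matrix.of fun a c => Polynomial.C (X (j, a, c))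
  have hh0 : evM h0 f = Polynomial.C f := by
    have h3 := MvPolynomial.map_aeval (X : _ → MPoly ι r) (Polynomial.C) f
    rw [aeval_X_left, AlgHom.id_apply] at h3
    rw [h3, coe_eval₂Hom, evM, aeval_def]
    congr 1
  let E : Fin r → Fin r → Matrix (Fin r) (Fin r) K := fun a b =>
    1 + Matrix.single a b Polynomial.X
  have hE : ∀ a b (N : Matrix (Fin r) (Fin r) K) i j, (E a b * N) i j =
      N i j + Polynomial.X * if a = i then N b j else 0 := by
    intro a b N i j
    simp only [E, add_mul, one_mul, Matrix.add_apply]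
    congr 1
    split_ifs with h
    · subst h
      rw [Matrix.single_mul_apply_same]
    · rw [Matrix.single_mul_apply_of_ne _ _ _ _ _ (Ne.symm h), mul_zero]
  have hE' : ∀ a b (N : Matrix (Fin r) (Fin r) K) i j, (N * E a b) i j =
      N i j + Polynomial.X * if b = j then N i a else 0 := by
    intro a b N i j
    simp only [E, mul_add, mul_one, Matrix.add_apply]
    congr 1
    split_ifs with h
    · subst h
      rw [Matrix.mul_single_apply_same, mul_comm]
    · rw [Matrix.mul_single_apply_of_ne _ _ _ _ _ (Ne.symm h), mul_zero]
  have hdiag : ∀ a b c, E a b c c = 1 + if a = c ∧ b = c then Polynomial.X else 0 := by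
    intro a b c
    simp only [E, Matrix.add_apply, Matrix.one_apply_eq, Matrix.single_apply]
  have hoff : ∀ a b c d, c ≠ d → E a b c d = if a = c ∧ b = d then Polynomial.X else 0 := by
    intro a b c d hcd
    simp only [E, Matrix.add_apply, Matrix.one_apply_ne hcd, Matrix.single_apply, zero_add]
  have hprod : ∀ a b (lm : Fin r → ℕ), ∏ c, E a b c c ^ lm c =
      (1 + Polynomial.X) ^ (if a = b then lm a else 0) := by
    intro a b lm
    rw [Finset.prod_eq_single a]
    · rw [hdiag]
      by_cases h : a = b
      · subst h; simp
      · simp [h, Ne.symm h]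
    · intro c _ hc
      rw [hdiag, if_neg (fun h => hc h.1.symm), add_zero, one_pow]
    · simp
  have hrow : ∀ a b, a ≤ b →
      (rowRep ι r).e a b f = ((if b = a then e else 0 : ℕ) : ℚ) • f := by
    intro a b hab
    refine polD_eq_of_aeval rowT a b f _ (fun s => (E b a * h0 s.1) s.2.1 s.2.2) ?_ ?_
    · rintro ⟨j, i, c⟩
      have h4 := polD_X rowT rowT_injective a b i (j, c)
      simp only [rowT] at h4
      rw [h4, hE]
      by_cases hi : b = i
      · rw [if_pos hi, if_pos hi]; rfl
      · rw [if_neg hi, if_neg hi, map_zero]; rfl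
    · have h4 := h1 K (E b a) h0
      rw [hh0] at h4
      refine Eq.trans h4 ?_
      congr 1
      rw [Matrix.det_of_isLowerTriangular, ← Finset.prod_pow]
      · exact hprod b a fun _ => e
      · intro c d hcd
        have hcd' : c < d := hcd
        rw [hoff _ _ _ _ hcd'.ne, if_neg]
        rintro ⟨rfl, rfl⟩
        exact absurd hab (not_le.2 hcd')
  have hcol : ∀ j c d, c ≤ d →
      (colRep r j).e c d f = ((if c = d then lam j c else 0 : ℕ) : ℚ) • f := by
    intro j c d hcd
    refine polD_eq_of_aeval (colT j) c d f _
      (fun s => (h0 s.1 * (if s.1 = j then E c d else 1)) s.2.1 s.2.2) ?_ ?_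
    · rintro ⟨j', i, b⟩
      dsimp only
      by_cases hj : j' = j
      · subst hj
        have h4 := polD_X (colT j') (colT_injective j') c d b i
        simp only [colT] at h4
        rw [if_pos rfl, h4, hE']
        by_cases hi : d = b
        · rw [if_pos hi, if_pos hi]; rfl
        · rw [if_neg hi, if_neg hi, map_zero]; rfl
      · rw [if_neg hj, mul_one, polD_X_of_notMem, map_zero, mul_zero, add_zero]
        · rfl
        · rintro ⟨x, hx⟩
          exact hj (congrArg Prod.fst hx).symm
    · have h4 := h2 K h0 (fun j' => if j' = j then E c d else 1) ?_
      · rw [hh0] at h4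
        refine Eq.trans h4 ?_
        congr 1
        rw [Finset.prod_eq_single j]
        · simp only [if_pos]
          exact hprod c d (lam j)
        · intro j' _ hj
          simp [hj]
        · simp
      · intro j' x y hxy
        by_cases hj : j' = j
        · rw [if_pos hj, hoff _ _ _ _ hxy.ne', if_neg]
          rintro ⟨rfl, rfl⟩
          exact absurd hcd (not_le.2 hxy)
        · rw [if_neg hj, Matrix.one_apply_ne hxy.ne']
  refine ⟨(rowRep ι r).mem_hw.2 ⟨fun a => ?_, fun a b hab => ?_⟩, ?_⟩
  · rw [hrow a a le_rfl, if_pos rfl]; rfl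
  · rw [hrow a b hab.le, if_neg hab.ne', Nat.cast_zero, zero_smul]
  · refine (Submodule.mem_iInf _).2 fun j =>
      (colRep r j).mem_hw.2 ⟨fun a => ?_, fun a b hab => ?_⟩
    · rw [hcol j a a le_rfl, if_pos rfl]; rfl
    · rw [hcol j a b hab.le, if_neg hab.ne, Nat.cast_zero, zero_smul]

end EvalMatrix

/-! ### Flags, adapted bases and codimensions -/

section Adapted

set_option linter.unusedSectionVars false

variable {κ : Type} [Fintype κ] {L V : Type*} [Field L] [AddCommGroup V] [Module L V]

/-- The coordinate subspace spanned by part of a basis. -/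
def coordSub (f : Basis κ L V) (A : Set κ) : Submodule L V where
  carrier := {v | ∀ b, b ∉ A → f.repr v b = 0}
  add_mem' hv hw b hb := by simp [hv b hb, hw b hb]
  zero_mem' b _ := by simp
  smul_mem' c v hv b hb := by simp [hv b hb]

theorem mem_coordSub {f : Basis κ L V} {A : Set κ} {v : V} :
    v ∈ coordSub f A ↔ ∀ b, b ∉ A → f.repr v b = 0 := Iff.rfl

theorem basis_mem_coordSub (f : Basis κ L V) {A : Set κ} {b : κ} (hb : b ∈ A) :
    f b ∈ coordSub f A := by
  classical
  intro c hc
  rw [Basis.repr_self, Finsupp.single_apply, if_neg]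
  rintro rfl
  exact hc hb

theorem coordSub_inf (f : Basis κ L V) (A A' : Set κ) :
    coordSub f A ⊓ coordSub f A' = coordSub f (A ∩ A') := by
  ext v
  simp only [Submodule.mem_inf, mem_coordSub, Set.mem_inter_iff]
  constructor
  · rintro ⟨h1, h2⟩ b hb
    by_cases h : b ∈ A
    · exact h2 b fun h' => hb ⟨h, h'⟩
    · exact h1 b h
  · exact fun h => ⟨fun b hb => h b fun h' => hb h'.1, fun b hb => h b fun h' => hb h'.2⟩

theorem coordSub_eq_span (f : Basis κ L V) (A : Set κ) : coordSub f A = span L (f '' A) := by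
  ext v
  rw [Basis.mem_span_image, mem_coordSub]
  constructor
  · intro h b hb
    by_contra h'
    exact (Finsupp.mem_support_iff.1 hb) (h b h')
  · intro h b hb
    by_contra h'
    exact hb (h (Finsupp.mem_support_iff.2 h'))

theorem finrank_coordSub [DecidableEq κ] (f : Basis κ L V) (A : Finset κ) :
    finrank L ↥(coordSub f (A : Set κ)) = A.card := by
  classical
  rw [coordSub_eq_span, ← Finset.coe_image, finrank_span_finset_eq_card,
    Finset.card_image_of_injective _ f.injective]
  have := f.linearIndependent.linearIndepOn_id
  rw [Finset.coe_image]
  exact this.mono (Set.image_subset_range _ _)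

theorem sum_mem_of_coordSub {f : Basis κ L V} {A : Set κ} {v : V} (hv : v ∈ coordSub f A)
    {M : Type*} [AddCommGroup M] [Module L M] (φ : V →ₗ[L] M) (W : Submodule L M)
    (h : ∀ b ∈ A, φ (f b) ∈ W) : φ v ∈ W := by
  rw [← f.sum_repr v, map_sum]
  refine W.sum_mem fun b _ => ?_
  rw [map_smul]
  by_cases hb : b ∈ A
  · exact W.smul_mem _ (h b hb)
  · rw [hv b hb, zero_smul]
    exact W.zero_mem

variable [LinearOrder κ]

/-- `f` is a basis obtained from `G` by a unitriangular change of basis such that `T` is spanned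
by a part of `f`. -/
structure IsAdapted (G f : Basis κ L V) (T : Submodule L V) (K : Finset κ) : Prop where
  tri : ∀ b b', b < b' → G.repr (f b) b' = 0
  diag : ∀ b, G.repr (f b) b = 1
  inv : ∀ b b', b < b' → f.repr (G b) b' = 0
  eq : T = coordSub f K

theorem exists_isAdapted (G : Basis κ L V) (T : Submodule L V) :
    ∃ f K, IsAdapted G f T K := by
  classical
  let K : Finset κ := Finset.univ.filter fun b =>
    ∃ v ∈ T, G.repr v b = 1 ∧ ∀ b', b < b' → G.repr v b' = 0
  have hK : ∀ b ∈ K, ∃ v ∈ T, G.repr v b = 1 ∧ ∀ b', b < b' → G.repr v b' = 0 :=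
    fun b hb => (Finset.mem_filter.1 hb).2
  choose! v hvT hv1 hv0 using hK
  let f0 : κ → V := fun b => if b ∈ K then v b else G b
  have hdiag : ∀ b, G.repr (f0 b) b = 1 := by
    intro b
    by_cases hb : b ∈ K
    · simp only [f0, if_pos hb, hv1 b hb]
    · simp [f0, if_neg hb]
  have htri : ∀ b b', b < b' → G.repr (f0 b) b' = 0 := by
    intro b b' hbb
    by_cases hb : b ∈ K
    · simp only [f0, if_pos hb, hv0 b hb b' hbb]
    · simp [f0, if_neg hb, hbb.ne]
  have hA : (G.toMatrix f0).IsUpperTriangular := fun b' b h => htri b b' h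
  have hdet : IsUnit (G.det f0) := by
    rw [Basis.det_apply, Matrix.det_of_isUpperTriangular hA]
    simp [Basis.toMatrix_apply, hdiag]
  have hb := (Basis.is_basis_iff_det G).2 hdet
  let f : Basis κ L V := Basis.mk hb.1 hb.2.ge
  have hf : ∀ b, f b = f0 b := fun b => Basis.mk_apply _ _ b
  have hff : ⇑f = f0 := funext hf
  refine ⟨f, K, ⟨?_, ?_, ?_, ?_⟩⟩
  · intro b b' h
    rw [hf, htri b b' h]
  · intro b
    rw [hf, hdiag]
  · intro b b' h
    have h1 : f.toMatrix G = (G.toMatrix f)⁻¹ :=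
      (Matrix.inv_eq_left_inv (f.toMatrix_mul_toMatrix_flip G)).symm
    have : Invertible (G.toMatrix f) := G.invertibleToMatrix f
    have hA' : (G.toMatrix f).IsUpperTriangular := by rw [hff]; exact hA
    have h2 : (G.toMatrix f)⁻¹.IsUpperTriangular :=
      Matrix.blockTriangular_inv_of_blockTriangular hA'
    rw [← h1] at h2
    exact h2 h
  · have hle : coordSub f (K : Set κ) ≤ T := by
      rw [coordSub_eq_span, span_le]
      rintro _ ⟨b, hb, rfl⟩
      have hb' : b ∈ K := hb
      rw [hf]
      simp only [f0, if_pos hb']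
      exact hvT b hb'
    refine le_antisymm ?_ hle
    intro w hw
    by_contra hcon
    set u : V := ∑ b ∈ K, f.repr w b • f b with hu
    have huK : u ∈ coordSub f (K : Set κ) :=
      Submodule.sum_mem _ fun b hb => Submodule.smul_mem _ _ (basis_mem_coordSub f hb)
    have hru : ∀ b ∈ K, f.repr u b = f.repr w b := by
      intro b hb
      rw [hu, map_sum, Finsupp.finsetSum_apply, Finset.sum_eq_single b]
      · simp
      · intro c _ hc
        simp [hc]
      · exact fun h => absurd hb h
    have hx : w - u ∈ T := T.sub_mem hw (hle huK)
    have hxK : ∀ b ∈ K, f.repr (w - u) b = 0 := by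
      intro b hb
      rw [map_sub, Finsupp.sub_apply, hru b hb, sub_self]
    have hne : (Finset.univ.filter fun b => f.repr (w - u) b ≠ 0).Nonempty := by
      by_contra h
      rw [Finset.not_nonempty_iff_eq_empty, Finset.filter_eq_empty_iff] at h
      apply hcon
      have : w = u := by
        rw [← sub_eq_zero]
        refine f.repr.map_eq_zero_iff.1 (Finsupp.ext fun b => ?_)
        simpa using h (Finset.mem_univ b)
      rw [this]
      exact huK
    set a := Finset.max' _ hne with ha
    have ha1 : f.repr (w - u) a ≠ 0 := (Finset.mem_filter.1 (Finset.max'_mem _ hne)).2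
    have ha2 : ∀ b, a < b → f.repr (w - u) b = 0 := by
      intro b hb
      by_contra h
      exact absurd (Finset.le_max' _ b (Finset.mem_filter.2 ⟨Finset.mem_univ _, h⟩)) (not_le.2 hb)
    have hG : ∀ b', G.repr (w - u) b' = ∑ b, f.repr (w - u) b * G.repr (f b) b' := by
      intro b'
      conv_lhs => rw [← f.sum_repr (w - u)]
      simp [map_sum, Finsupp.finsetSum_apply]
    have haK : a ∈ K := by
      refine Finset.mem_filter.2 ⟨Finset.mem_univ _, (f.repr (w - u) a)⁻¹ • (w - u),
        T.smul_mem _ hx, ?_, ?_⟩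
      · rw [map_smul, Finsupp.smul_apply, hG, Finset.sum_eq_single a, hf, hdiag, mul_one,
          smul_eq_mul, inv_mul_cancel₀ ha1]
        · intro b _ hb
          rcases lt_or_gt_of_ne hb with h | h
          · rw [hf, htri b a h, mul_zero]
          · rw [ha2 b h, zero_mul]
        · simp
      · intro b' hb'
        rw [map_smul, Finsupp.smul_apply, hG, Finset.sum_eq_zero, smul_zero]
        intro b _
        rcases le_or_gt b a with h | h
        · rw [hf, htri b b' (h.trans_lt hb'), mul_zero]
        · rw [ha2 b h, zero_mul]
    exact ha1 (hxK a haK)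

variable {G f : Basis κ L V} {T : Submodule L V} {K : Finset κ}

theorem IsAdapted.card (h : IsAdapted G f T K) : K.card = finrank L ↥T := by
  rw [h.eq, finrank_coordSub]

theorem IsAdapted.mem (h : IsAdapted G f T K) {b : κ} (hb : b ∈ K) : f b ∈ T := by
  rw [h.eq]
  exact basis_mem_coordSub f hb

/-- The steps of the flag attached to a basis and a weight. -/
def flagV (G : Basis κ L V) (lam : κ → ℕ) (u : ℕ) : Submodule L V :=
  coordSub G {b | u < lam b}

theorem IsAdapted.flag (h : IsAdapted G f T K) {lam : κ → ℕ} (hl : Antitone lam) (u : ℕ) :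
    flagV G lam u = flagV f lam u := by
  have key : ∀ (G f : Basis κ L V), (∀ b b', b < b' → f.repr (G b) b' = 0) →
      flagV G lam u ≤ flagV f lam u := by
    intro G f hinv
    rw [flagV, coordSub_eq_span, span_le]
    rintro _ ⟨b, hb, rfl⟩ b' hb'
    refine hinv b b' ?_
    by_contra hlt
    exact hb' (lt_of_lt_of_le hb (hl (not_lt.1 hlt)))
  exact le_antisymm (key G f h.inv) (key f G h.tri)

theorem IsAdapted.inf_flag (h : IsAdapted G f T K) {lam : κ → ℕ} (hl : Antitone lam) (u : ℕ) :
    T ⊓ flagV G lam u = coordSub f ((K.filter fun b => u < lam b : Finset κ) : Set κ) := by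
  rw [h.flag hl, flagV]
  conv_lhs => rw [h.eq]
  rw [coordSub_inf, Finset.coe_filter]
  rfl

/-- The expected codimension attached to the position of a subspace with respect to a flag. -/
def codF (G : Basis κ L V) (lam : κ → ℕ) (m : ℕ) (T : Submodule L V) : ℕ :=
  ∑ u ∈ Finset.range m, finrank L ↥(T ⊓ flagV G lam u)

theorem IsAdapted.codF_eq (h : IsAdapted G f T K) {lam : κ → ℕ} (hl : Antitone lam) {m : ℕ}
    (hm : ∀ b, lam b ≤ m) : codF G lam m T = ∑ b ∈ K, lam b := by
  have h1 : ∀ u, finrank L ↥(T ⊓ flagV G lam u) = ∑ b ∈ K, if u < lam b then 1 else 0 := by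
    intro u
    rw [h.inf_flag hl, finrank_coordSub, Finset.card_filter]
  rw [codF, Finset.sum_congr rfl fun u _ => h1 u, Finset.sum_comm]
  refine Finset.sum_congr rfl fun b _ => ?_
  rw [← Finset.card_filter]
  have : (Finset.range m).filter (fun u => u < lam b) = Finset.range (lam b) := by
    ext u
    have := hm b
    simp only [Finset.mem_filter, Finset.mem_range]
    omega
  rw [this, Finset.card_range]

end Adapted

/-! ### Semistability of generic flags -/

section Semistable

open MvPolynomial

variable {ι : Type} [Fintype ι] [DecidableEq ι] {r : ℕ} {L : Type} [Field L] [CharZero L]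
  [Algebra ℚ L]

/-- The matrix with prescribed columns. -/
def matB {κ κ' : Type} {L : Type} (v : κ → κ' → L) : Matrix κ' κ L := Matrix.of fun a c => v c a

/-- The numerical criterion: an invariant which does not vanish bounds the codimensions. -/
theorem sum_le_of_evM_ne_zero {nu : Fin r → ℕ} {lam : ι → Fin r → ℕ} {f : MPoly ι r}
    (hf : f ∈ hwSpace nu lam) {m : ℕ} (hm : ∀ a, nu a ≤ m)
    (g : ι → Matrix (Fin r) (Fin r) L) (hg : evM g f ≠ 0) (T : Submodule L (Fin r → L))
    (K : ι → Finset (Fin r)) (hK : ∀ j, ∀ k ∈ K j, (fun a => g j a k) ∈ T) :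
    ∑ j, ∑ k ∈ K j, lam j k ≤ m * finrank L ↥T := by
  have hrow : f ∈ (rowRep ι r).hw fun a => (nu a : ℤ) := hf.1
  have hcol : ∀ j, f ∈ (colRep r j).hw fun a => (lam j a : ℤ) := (Submodule.mem_iInf _).1 hf.2
  obtain ⟨e, J, hJ⟩ := exists_isAdapted
    ((Pi.basisFun L (Fin r)).reindex OrderDual.toDual) T
  let b : Matrix (Fin r) (Fin r) L := Matrix.of fun a c => e (OrderDual.toDual c) a
  let y : ι → Matrix (Fin r) (Fin r) L := fun j =>
    Matrix.of fun a k => e.repr (fun i => g j i k) (OrderDual.toDual a)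
  have hby : ∀ j, b * y j = g j := by
    intro j
    ext a k
    have h1 := congrFun (e.sum_repr (fun i => g j i k)) a
    rw [Finset.sum_apply] at h1
    rw [← h1, Matrix.mul_apply]
    exact Finset.sum_congr rfl fun c _ => mul_comm _ _
  have hcoord : ∀ a c : Fin r, b a c = ((Pi.basisFun L (Fin r)).reindex OrderDual.toDual).repr
      (e (OrderDual.toDual c)) (OrderDual.toDual a) := by
    intro a c
    simp [b]
  have hb : evM g f = evM y f := by
    have h1 := evM_mul_left hrow y b fun c d hcd => by
      rw [hcoord]
      exact hJ.tri _ _ (OrderDual.toDual_lt_toDual.2 hcd)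
    simp only [hby] at h1
    rw [h1]
    have h2 : ∀ c, b c c = 1 := fun c => by rw [hcoord]; exact hJ.diag _
    simp [h2]
  have hy0 : ∀ j, ∀ k ∈ K j, ∀ a, OrderDual.toDual a ∉ J → y j a k = 0 := by
    intro j k hk a ha
    have h1 := hK j k hk
    rw [hJ.eq] at h1
    exact h1 _ ha
  let D : Matrix (Fin r) (Fin r) (Polynomial L) :=
    Matrix.diagonal fun a => if OrderDual.toDual a ∈ J then Polynomial.X else 1
  let y' : ι → Matrix (Fin r) (Fin r) (Polynomial L) := fun j => Matrix.of fun a k =>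
    if k ∈ K j then Polynomial.C (y j a k) else
      (if OrderDual.toDual a ∈ J then Polynomial.X else 1) * Polynomial.C (y j a k)
  let E : ι → Matrix (Fin r) (Fin r) (Polynomial L) := fun j =>
    Matrix.diagonal fun k => if k ∈ K j then Polynomial.X else 1
  have hDy : ∀ j, D * (y j).map Polynomial.C = y' j * E j := by
    intro j
    ext1 a k
    simp only [D, E, y', Matrix.diagonal_mul, Matrix.mul_diagonal, Matrix.map_apply,
      Matrix.of_apply]
    by_cases hk : k ∈ K j
    · rw [if_pos hk, if_pos hk]
      by_cases ha : OrderDual.toDual a ∈ J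
      · rw [if_pos ha, mul_comm]
      · rw [hy0 j k hk a ha]
        simp
    · rw [if_neg hk, if_neg hk, mul_one]
  have h1 := evM_mul_left hrow (fun j => (y j).map Polynomial.C) D
    fun c d hcd => Matrix.diagonal_apply_ne _ hcd.ne
  have h2 := evM_mul_right hcol y' E fun j c d hcd => Matrix.diagonal_apply_ne _ hcd.ne'
  simp only [hDy] at h1
  rw [h1] at h2
  have h3 : evM (fun j => (y j).map Polynomial.C) f = Polynomial.C (evM y f) :=
    (map_evM (IsScalarTower.toAlgHom ℚ L (Polynomial L)) y f).symm
  have h4 : ∏ c, D c c ^ nu c =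
      Polynomial.X ^ ∑ a ∈ J, nu (OrderDual.ofDual a) := by
    simp only [D, Matrix.diagonal_apply_eq, ite_pow, one_pow]
    rw [← Finset.prod_pow_eq_pow_sum, Finset.prod_ite, Finset.prod_const_one, mul_one]
    refine Finset.prod_bij (fun a _ => OrderDual.toDual a) ?_ ?_ ?_ ?_
    · exact fun a ha => (Finset.mem_filter.1 ha).2
    · exact fun a _ b _ h => h
    · exact fun a ha => ⟨OrderDual.ofDual a, Finset.mem_filter.2 ⟨Finset.mem_univ _, ha⟩, rfl⟩
    · exact fun _ _ => rfl
  have h5 : ∏ j, ∏ c, E j c c ^ lam j c = Polynomial.X ^ ∑ j, ∑ k ∈ K j, lam j k := by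
    rw [← Finset.prod_pow_eq_pow_sum]
    refine Finset.prod_congr rfl fun j _ => ?_
    rw [← Finset.prod_pow_eq_pow_sum]
    simp only [E, Matrix.diagonal_apply_eq, ite_pow, one_pow]
    rw [Finset.prod_ite_mem, Finset.univ_inter]
  rw [h3, h4, h5] at h2
  have h6 : ∑ j, ∑ k ∈ K j, lam j k ≤ ∑ a ∈ J, nu (OrderDual.ofDual a) := by
    by_contra hlt
    have h7 := Polynomial.X_pow_dvd_iff.1 (Dvd.intro _ h2.symm) _ (not_le.1 hlt)
    rw [Polynomial.coeff_X_pow_mul', if_pos le_rfl, Nat.sub_self, Polynomial.coeff_C_zero] at h7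
    exact hg (hb.trans h7)
  refine h6.trans ?_
  rw [← hJ.card, mul_comm, ← smul_eq_mul]
  exact Finset.sum_le_card_nsmul _ _ _ fun a _ => hm _

theorem sum_codF_le {nu : Fin r → ℕ} {lam : ι → Fin r → ℕ} {f : MPoly ι r}
    (hf : f ∈ hwSpace nu lam) {m : ℕ} (hm : ∀ a, nu a ≤ m) (hl : ∀ j, Antitone (lam j))
    (hlm : ∀ j a, lam j a ≤ m) (G : ι → Basis (Fin r) L (Fin r → L))
    (hg : evM (fun j => matB (G j)) f ≠ 0) (T : Submodule L (Fin r → L)) :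
    ∑ j, codF (G j) (lam j) m T ≤ m * finrank L ↥T := by
  choose e K hK using fun j => exists_isAdapted (G j) T
  rw [Finset.sum_congr rfl fun j _ => (hK j).codF_eq (hl j) (hlm j)]
  refine sum_le_of_evM_ne_zero hf hm (fun j => matB (e j)) ?_ T K fun j k hk => (hK j).mem hk
  have h1 := evM_mul_right ((Submodule.mem_iInf _).1 hf.2) (fun j => matB (G j))
    (fun j => (G j).toMatrix (e j)) fun j c d hcd => (hK j).tri d c hcd
  have h2 : ∀ j, matB (G j) * (G j).toMatrix (e j) = matB (e j) := by
    intro j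
    ext a k
    have h3 := congrFun ((G j).sum_repr (e j k)) a
    rw [Finset.sum_apply] at h3
    refine Eq.trans ?_ h3
    rw [Matrix.mul_apply]
    exact Finset.sum_congr rfl fun c _ => mul_comm _ _
  simp only [h2, Basis.toMatrix_apply, (hK _).diag, one_pow, Finset.prod_const_one, one_mul] at h1
  rw [h1]
  exact hg

end Semistable

/-! ### Homomorphisms compatible with generic flags -/

section Connections

variable {κ : Type} [Fintype κ] {L : Type} [Field L] [Algebra ℚ L] {V : Type} [AddCommGroup V]
  [Module L V]

/-- A connection over a derivation. -/
def IsConn (D : Derivation ℚ L L) (N : V →+ V) : Prop :=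
  ∀ (a : L) (v : V), N (a • v) = D a • v + a • N v

/-- The connection for which a given basis is horizontal. -/
def connB (f : Basis κ L V) (D : Derivation ℚ L L) : V →+ V where
  toFun v := ∑ b, D (f.repr v b) • f b
  map_zero' := by simp
  map_add' v w := by simp [add_smul, Finset.sum_add_distrib]

theorem isConn_connB (f : Basis κ L V) (D : Derivation ℚ L L) : IsConn D (connB f D) := by
  intro a v
  change ∑ b, D (f.repr (a • v) b) • f b = D a • v + a • ∑ b, D (f.repr v b) • f b
  conv_rhs => rw [← f.sum_repr v]
  rw [Finset.smul_sum, Finset.smul_sum, ← Finset.sum_add_distrib]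
  refine Finset.sum_congr rfl fun b _ => ?_
  rw [map_smul, Finsupp.smul_apply, smul_eq_mul, Derivation.leibniz, f.sum_repr, smul_smul,
    smul_smul, ← add_smul, smul_eq_mul, smul_eq_mul]
  congr 1
  ring

theorem connB_mem (f : Basis κ L V) (D : Derivation ℚ L L) {A : Set κ} {v : V}
    (hv : v ∈ coordSub f A) : connB f D v ∈ coordSub f A := by
  refine Submodule.sum_mem _ fun b _ => ?_
  by_cases hb : b ∈ A
  · exact Submodule.smul_mem _ _ (basis_mem_coordSub f hb)
  · rw [hv b hb, map_zero, zero_smul]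
    exact Submodule.zero_mem _

theorem IsConn.add {D D' : Derivation ℚ L L} {N N' : V →+ V} (h : IsConn D N)
    (h' : IsConn D' N') : IsConn (D + D') (N + N') := by
  intro a v
  simp only [AddMonoidHom.add_apply, h a v, h' a v, Derivation.add_apply, add_smul, smul_add]
  abel

/-- The difference of two connections over the same derivation is linear. -/
def IsConn.diff {D : Derivation ℚ L L} {N N' : V →+ V} (h : IsConn D N) (h' : IsConn D N') :
    V →ₗ[L] V where
  toFun v := N v - N' v
  map_add' v w := by rw [map_add, map_add]; abel
  map_smul' a v := by rw [h, h', RingHom.id_apply, smul_sub]; abel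

/-- The covariant derivative of a linear map. -/
def IsConn.hom {Q : Type} [AddCommGroup Q] [Module L Q] {D : Derivation ℚ L L} {N : V →+ V}
    {P : Q →+ Q} (h : IsConn D N) (h' : IsConn D P) (φ : V →ₗ[L] Q) : V →ₗ[L] Q where
  toFun v := P (φ v) - φ (N v)
  map_add' v w := by simp only [map_add]; abel
  map_smul' a v := by
    rw [h, map_smul, h', RingHom.id_apply, map_add, map_smul, map_smul, smul_sub]; abel

end Connections

section ExtZero

set_option linter.unusedSectionVars false

variable {ι : Type} [Fintype ι] {r m : ℕ} {L : Type} [Field L] [Algebra ℚ L]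
  {V Q : Type} [AddCommGroup V] [Module L V] [AddCommGroup Q] [Module L Q]

/-- The flag on the target associated with a basis. -/
def flagQ (B : Basis (Fin m) L Q) (u : ℕ) : Submodule L Q :=
  coordSub B {c | (c : ℕ) + u + 1 < m}

variable (G : ι → Basis (Fin r) L V) (B : ι → Basis (Fin m) L Q) (lam : ι → Fin r → ℕ)

/-- Linear maps compatible with the `j`-th flags on the subspace `S`. -/
def homRes (S : Submodule L V) (j : ι) : Submodule L (V →ₗ[L] Q) where
  carrier := {φ | ∀ u, ∀ v ∈ S, v ∈ flagV (G j) (lam j) u → φ v ∈ flagQ (B j) u}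
  add_mem' h h' u v hv hu := Submodule.add_mem _ (h u v hv hu) (h' u v hv hu)
  zero_mem' _ _ _ _ := Submodule.zero_mem _
  smul_mem' a _ h u v hv hu := Submodule.smul_mem _ a (h u v hv hu)

/-- Surjectivity of the map from homomorphisms to local obstructions. -/
def ExtZero (S : Submodule L V) : Prop :=
  ∀ y : ι → V →ₗ[L] Q, ∃ φ : V →ₗ[L] Q, ∀ j, y j - φ ∈ homRes G B lam S j

/-- Genericity of the flags relative to the subspace `S`. -/
def GenericAt (S : Submodule L V) : Prop :=
  ∀ (X : ι → V →ₗ[L] V) (Y : ι → Q →ₗ[L] Q), (∀ j, ∀ v ∈ S, X j v ∈ S) →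
    ∃ (D : Derivation ℚ L L) (N : V →+ V) (P : Q →+ Q), IsConn D N ∧ IsConn D P ∧
      (∀ v ∈ S, N v ∈ S) ∧
      (∀ j u, ∀ v ∈ S, v ∈ flagV (G j) (lam j) u → N v - X j v ∈ flagV (G j) (lam j) u) ∧
      (∀ j u, ∀ q ∈ flagQ (B j) u, P q - Y j q ∈ flagQ (B j) u)

variable {G B lam}

theorem mem_homRes_iff (hl : ∀ j, Antitone (lam j)) {S : Submodule L V} {j : ι}
    {e : Basis (Fin r) L V} {K : Finset (Fin r)} (h : IsAdapted (G j) e S K) {φ : V →ₗ[L] Q} :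
    φ ∈ homRes G B lam S j ↔
      ∀ k ∈ K, ∀ c : Fin m, m ≤ c + lam j k → (B j).repr (φ (e k)) c = 0 := by
  constructor
  · intro hφ k hk c hc
    have h1 : e k ∈ flagV (G j) (lam j) (lam j k - 1) := by
      rw [h.flag (hl j)]
      exact basis_mem_coordSub e (by have := c.2; simp only [Set.mem_ofPred_eq]; omega)
    have h2 := hφ _ _ (h.mem hk) h1
    exact h2 c (by simp only [Set.mem_ofPred_eq]; omega)
  · intro hφ u v hv hu
    have h1 : v ∈ S ⊓ flagV (G j) (lam j) u := ⟨hv, hu⟩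
    rw [h.inf_flag (hl j)] at h1
    refine sum_mem_of_coordSub h1 φ _ fun k hk c hc => ?_
    have hk' := Finset.mem_filter.1 (Finset.mem_coe.1 hk)
    refine hφ k hk'.1 c ?_
    simp only [Set.mem_ofPred_eq] at hc
    omega

theorem exists_homRes_top (hl : ∀ j, Antitone (lam j)) {S : Submodule L V} {j : ι}
    {φ : V →ₗ[L] Q} (hφ : φ ∈ homRes G B lam S j) :
    ∃ φ' ∈ homRes G B lam ⊤ j, ∀ v ∈ S, φ' v = φ v := by
  classical
  obtain ⟨e, K, h⟩ := exists_isAdapted (G j) S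
  rw [mem_homRes_iff hl h] at hφ
  have htop : IsAdapted (G j) e ⊤ Finset.univ := by
    refine ⟨h.tri, h.diag, h.inv, ?_⟩
    ext v
    simp [mem_coordSub]
  have he : ∀ k, e.constr L (fun k => if k ∈ K then φ (e k) else 0) (e k) =
      if k ∈ K then φ (e k) else 0 := fun k => Basis.constr_basis _ _ _ _
  refine ⟨e.constr L fun k => if k ∈ K then φ (e k) else 0, ?_, ?_⟩
  · rw [mem_homRes_iff hl htop]
    intro k _ c hc
    rw [he]
    split_ifs with hk
    · exact hφ k hk c hc
    · simp
  · intro v hv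
    rw [h.eq] at hv
    rw [← sub_eq_zero, ← LinearMap.sub_apply]
    have := sum_mem_of_coordSub hv
      ((e.constr L fun k => if k ∈ K then φ (e k) else 0) - φ) ⊥ ?_
    · simpa using this
    · intro k hk
      rw [LinearMap.sub_apply, he, if_pos (Finset.mem_coe.1 hk), sub_self]
      exact Submodule.zero_mem _

theorem card_fin_filter_le {l m : ℕ} (h : l ≤ m) :
    (∑ c : Fin m, if m ≤ (c : ℕ) + l then 1 else 0) = l := by
  rw [Fin.sum_univ_eq_sum_range (fun c => if m ≤ c + l then 1 else 0), ← Finset.card_filter]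
  have : (Finset.range m).filter (fun c => m ≤ c + l) = Finset.Ico (m - l) m := by
    ext c
    simp only [Finset.mem_filter, Finset.mem_range, Finset.mem_Ico]
    omega
  rw [this, Nat.card_Ico]
  omega

theorem extZero_of_hom_eq_zero (hl : ∀ j, Antitone (lam j)) (hlm : ∀ j a, lam j a ≤ m)
    {S : Submodule L V}
    (h0 : ∀ φ : V →ₗ[L] Q, (∀ j, φ ∈ homRes G B lam S j) → ∀ v ∈ S, φ v = 0)
    (hdeg : ∑ j, codF (G j) (lam j) m S ≤ m * finrank L ↥S) [Nonempty ι] :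
    ExtZero G B lam S := by
  classical
  choose e K hK using fun j => exists_isAdapted (G j) S
  have hfV : FiniteDimensional L V := (G (Classical.arbitrary ι)).finiteDimensional_of_finite
  have hfQ : FiniteDimensional L Q := (B (Classical.arbitrary ι)).finiteDimensional_of_finite
  let Ω := {x : ι × Fin r × Fin m // x.2.1 ∈ K x.1 ∧ m ≤ (x.2.2 : ℕ) + lam x.1 x.2.1}
  have hΩ : Fintype.card Ω = ∑ j, codF (G j) (lam j) m S := by
    rw [Fintype.card_subtype, Finset.card_filter, Fintype.sum_prod_type]
    refine Finset.sum_congr rfl fun j _ => ?_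
    rw [(hK j).codF_eq (hl j) (hlm j), Fintype.sum_prod_type,
      ← Finset.sum_subset (Finset.subset_univ (K j))]
    · refine Finset.sum_congr rfl fun k hk => ?_
      simp only [hk, true_and]
      exact card_fin_filter_le (hlm j k)
    · intro k _ hk
      simp [hk]
  let Ψ : (↥S →ₗ[L] Q) →ₗ[L] (Ω → L) :=
    { toFun := fun φ x => (B x.1.1).repr (φ ⟨e x.1.1 x.1.2.1, (hK x.1.1).mem x.2.1⟩) x.1.2.2
      map_add' := fun φ ψ => by ext x; simp
      map_smul' := fun a φ => by ext x; simp }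
  have hinj : Function.Injective Ψ := by
    rw [injective_iff_map_eq_zero]
    intro φ hφ
    obtain ⟨φ', rfl⟩ := LinearMap.exists_extend φ
    ext ⟨v, hv⟩
    refine h0 φ' (fun j => ?_) v hv
    rw [mem_homRes_iff hl (hK j)]
    intro k hk c hc
    exact congrFun hφ ⟨(j, k, c), hk, hc⟩
  have hQ : finrank L Q = m := by
    rw [finrank_eq_card_basis (B (Classical.arbitrary ι)), Fintype.card_fin]
  have hdim : finrank L (↥S →ₗ[L] Q) = finrank L (Ω → L) := by
    refine le_antisymm (LinearMap.finrank_le_finrank_of_injective hinj) ?_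
    rw [finrank_fintype_fun_eq_card, hΩ, finrank_linearMap, hQ, mul_comm]
    exact hdeg
  have hsurj := (LinearMap.injective_iff_surjective_of_finrank_eq_finrank hdim).1 hinj
  intro y
  obtain ⟨φ, hφ⟩ := hsurj fun x => (B x.1.1).repr (y x.1.1 (e x.1.1 x.1.2.1)) x.1.2.2
  obtain ⟨φ', rfl⟩ := LinearMap.exists_extend φ
  refine ⟨φ', fun j => ?_⟩
  rw [mem_homRes_iff hl (hK j)]
  intro k hk c hc
  have h1 := congrFun hφ ⟨(j, k, c), hk, hc⟩
  rw [LinearMap.sub_apply, map_sub, Finsupp.sub_apply, sub_eq_zero]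
  exact h1.symm

/-- The common kernel on `S` of all compatible homomorphisms. -/
def commonKer (G : ι → Basis (Fin r) L V) (B : ι → Basis (Fin m) L Q) (lam : ι → Fin r → ℕ)
    (S : Submodule L V) : Submodule L V where
  carrier := {v | v ∈ S ∧ ∀ φ : V →ₗ[L] Q, (∀ j, φ ∈ homRes G B lam S j) → φ v = 0}
  add_mem' h h' := ⟨S.add_mem h.1 h'.1, fun φ hφ => by rw [map_add, h.2 φ hφ, h'.2 φ hφ, add_zero]⟩
  zero_mem' := ⟨S.zero_mem, fun φ _ => map_zero φ⟩
  smul_mem' a _ h := ⟨S.smul_mem a h.1, fun φ hφ => by rw [map_smul, h.2 φ hφ, smul_zero]⟩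

theorem GenericAt.commonKer [Nonempty ι] (hl : ∀ j, Antitone (lam j)) {S : Submodule L V}
    (h : GenericAt G B lam S) : GenericAt G B lam (commonKer G B lam S) := by
  classical
  intro X Y hX
  set S' := _root_.commonKer G B lam S with hS'
  have hle : S' ≤ S := fun v hv => hv.1
  obtain ⟨D1, N1, P1, hN1, hP1, hS1, hF1, hQ1⟩ := h 0 Y (fun j v _ => S.zero_mem)
  choose e K hK using fun j => exists_isAdapted (G j) S'
  have hcS : ∀ j, ∀ v ∈ S', connB (e j) D1 v ∈ S' := by
    intro j v hv
    rw [(hK j).eq] at hv ⊢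
    exact connB_mem _ _ hv
  have hcF : ∀ j u, ∀ v ∈ flagV (G j) (lam j) u,
      connB (e j) D1 v ∈ flagV (G j) (lam j) u := by
    intro j u v hv
    rw [(hK j).flag (hl j)] at hv ⊢
    exact connB_mem _ _ hv
  let j0 := Classical.arbitrary ι
  let n : ι → V →ₗ[L] V := fun j =>
    (isConn_connB (e j0) D1).diff (isConn_connB (e j) D1)
  have hn : ∀ j v, n j v = connB (e j0) D1 v - connB (e j) D1 v := fun j v => rfl
  obtain ⟨π, hπ⟩ := S'.subtype.exists_leftInverse_of_injective S'.ker_subtype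
  have hπ' : ∀ v (hv : v ∈ S'), ((π v : S') : V) = v := fun v hv =>
    congrArg Subtype.val (LinearMap.congr_fun hπ ⟨v, hv⟩)
  let X' : ι → V →ₗ[L] V := fun j => (X j - n j) ∘ₗ S'.subtype ∘ₗ π
  have hX' : ∀ j v, X' j v = X j (π v : S') - n j (π v : S') := fun j v => rfl
  have hXS : ∀ j v, X' j v ∈ S' := by
    intro j v
    rw [hX', hn]
    exact S'.sub_mem (hX j _ (π v).2) (S'.sub_mem (hcS _ _ (π v).2) (hcS _ _ (π v).2))
  obtain ⟨D2, N2, P2, hN2, hP2, hS2, hF2, hQ2⟩ := h X' 0 (fun j v _ => hle (hXS j v))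
  have hN2S : ∀ v ∈ S', N2 v ∈ S' := by
    intro v hv
    refine ⟨hS2 v (hle hv), fun φ hφ => ?_⟩
    have h1 := hv.2 (hN2.hom hP2 φ) (fun j u w hw hu => ?_)
    · change P2 (φ v) - φ (N2 v) = 0 at h1
      rw [hv.2 φ hφ, map_zero, zero_sub, neg_eq_zero] at h1
      exact h1
    · change P2 (φ w) - φ (N2 w) ∈ _
      have h2 : φ (N2 w) = φ (N2 w - X' j w) := by
        rw [map_sub, (hXS j w).2 φ hφ, sub_zero]
      rw [h2]
      refine Submodule.sub_mem _ ?_ ?_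
      · simpa using hQ2 j u _ (hφ j u w hw hu)
      · exact hφ j u _ (S.sub_mem (hS2 w hw) (hle (hXS j w))) (hF2 j u w hw hu)
  refine ⟨D1 + D2, connB (e j0) D1 + N2, P1 + P2, (isConn_connB _ _).add hN2, hP1.add hP2,
    fun v hv => S'.add_mem (hcS _ v hv) (hN2S v hv), fun j u v hv hu => ?_, fun j u q hq => ?_⟩
  · have h1 := hF2 j u v (hle hv) hu
    rw [hX', hπ' v hv, hn] at h1
    have h2 := Submodule.add_mem _ (hcF j u v hu) h1
    rw [AddMonoidHom.add_apply]
    convert h2 using 1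
    abel
  · have h1 := Submodule.add_mem _ (hQ1 j u q hq) (hQ2 j u q hq)
    rw [AddMonoidHom.add_apply]
    simp only [Pi.zero_apply, LinearMap.zero_apply, sub_zero] at h1
    convert h1 using 1
    abel

theorem extZero_of_commonKer [Nonempty ι] (hl : ∀ j, Antitone (lam j)) {S : Submodule L V}
    (h : GenericAt G B lam S) (h' : ExtZero G B lam (commonKer G B lam S)) :
    ExtZero G B lam S := by
  classical
  have hfV : FiniteDimensional L V := (G (Classical.arbitrary ι)).finiteDimensional_of_finite
  have hfQ : FiniteDimensional L Q := (B (Classical.arbitrary ι)).finiteDimensional_of_finite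
  intro y
  obtain ⟨φ0, h0⟩ := h' y
  choose η hη hηS using fun j => exists_homRes_top hl (h0 j)
  let H : Submodule L (V →ₗ[L] Q) := ⨅ j, homRes G B lam S j
  have hH : ∀ φ, φ ∈ H ↔ ∀ j, φ ∈ homRes G B lam S j := fun φ => Submodule.mem_iInf _
  let b := Module.finBasis L ↥H
  let Φ : ↥S →ₗ[L] (Fin (finrank L ↥H) → Q) := LinearMap.pi fun i => (b i : V →ₗ[L] Q) ∘ₗ S.subtype
  have hker : ∀ v : ↥S, Φ v = 0 → (v : V) ∈ commonKer G B lam S := by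
    intro v hv
    refine ⟨v.2, fun φ hφ => ?_⟩
    have h1 := b.sum_repr ⟨φ, (hH φ).2 hφ⟩
    have h2 := congrArg (fun x : ↥H => (x : V →ₗ[L] Q) v) h1
    simp only [AddSubmonoidClass.coe_finsetSum, Submodule.coe_smul, LinearMap.sum_apply,
      LinearMap.smul_apply] at h2
    rw [← h2]
    refine Finset.sum_eq_zero fun i _ => ?_
    have h3 : (b i : V →ₗ[L] Q) v = 0 := congrFun hv i
    rw [h3, smul_zero]
  let z : ι → V →ₗ[L] Q := fun j => y j - φ0 - η j
  have hz : ∀ j, ∀ v ∈ commonKer G B lam S, z j v = 0 := by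
    intro j v hv
    change (y j - φ0) v - η j v = 0
    rw [hηS j v hv, sub_self]
  have hfac : ∀ j, ∃ W : (Fin (finrank L ↥H) → Q) →ₗ[L] Q, W ∘ₗ Φ = z j ∘ₗ S.subtype := by
    intro j
    have hk : LinearMap.ker Φ ≤ LinearMap.ker (z j ∘ₗ S.subtype) := fun v hv =>
      hz j v (hker v hv)
    obtain ⟨W, hW⟩ := LinearMap.exists_extend
      (((LinearMap.ker Φ).liftQ _ hk) ∘ₗ Φ.quotKerEquivRange.symm.toLinearMap)
    refine ⟨W, ?_⟩
    ext v
    have h1 := LinearMap.congr_fun hW ⟨Φ v, LinearMap.mem_range_self Φ v⟩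
    simp only [LinearMap.comp_apply, Submodule.subtype_apply, LinearEquiv.coe_coe] at h1 ⊢
    rw [h1]
    have h2 : Φ.quotKerEquivRange.symm ⟨Φ v, LinearMap.mem_range_self Φ v⟩ =
        Submodule.Quotient.mk v := by
      rw [LinearEquiv.symm_apply_eq]
      rfl
    rw [h2]
    rfl
  choose W hW using hfac
  have hgen := fun i => h 0 (fun j => W j ∘ₗ LinearMap.single L (fun _ => Q) i)
    (fun j v _ => S.zero_mem)
  choose D N P hN hP hNS hF hQ using hgen
  refine ⟨φ0 + ∑ i, (hN i).hom (hP i) (b i), fun j => ?_⟩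
  intro u v hv hu
  have hbj : ∀ i, (b i : V →ₗ[L] Q) ∈ homRes G B lam S j := fun i => (hH _).1 (b i).2 j
  have h1 : z j v = ∑ i, (W j) (Pi.single i ((b i : V →ₗ[L] Q) v)) := by
    have h2 := LinearMap.congr_fun (hW j) ⟨v, hv⟩
    simp only [LinearMap.comp_apply, Submodule.subtype_apply] at h2
    rw [← h2, ← map_sum, Finset.univ_sum_single]
    rfl
  have h3 : (y j - (φ0 + ∑ i, (hN i).hom (hP i) (b i))) v =
      η j v + ∑ i, ((W j) (Pi.single i ((b i : V →ₗ[L] Q) v)) - P i ((b i : V →ₗ[L] Q) v) +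
        (b i : V →ₗ[L] Q) (N i v)) := by
    have h4 : ∑ i, ((W j) (Pi.single i ((b i : V →ₗ[L] Q) v)) - P i ((b i : V →ₗ[L] Q) v) +
        (b i : V →ₗ[L] Q) (N i v)) = z j v - ∑ i, (hN i).hom (hP i) (b i) v := by
      rw [h1, ← Finset.sum_sub_distrib]
      refine Finset.sum_congr rfl fun i _ => ?_
      change _ = _ - (P i ((b i : V →ₗ[L] Q) v) - (b i : V →ₗ[L] Q) (N i v))
      abel
    rw [h4]
    simp only [z, LinearMap.sub_apply, LinearMap.add_apply, LinearMap.sum_apply]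
    abel
  rw [h3]
  refine Submodule.add_mem _ (hη j u v trivial hu) (Submodule.sum_mem _ fun i _ => ?_)
  refine Submodule.add_mem _ ?_ ?_
  · have h5 := hQ i j u _ (hbj i u v hv hu)
    rw [← neg_sub]
    exact Submodule.neg_mem _ h5
  · have h5 := hF i j u v hv hu
    simp only [Pi.zero_apply, LinearMap.zero_apply, sub_zero] at h5
    exact hbj i u _ (hNS i v hv) h5

/-- Generic semistable flags have no higher obstruction. -/
theorem GenericAt.extZero [Nonempty ι] (hl : ∀ j, Antitone (lam j)) (hlm : ∀ j a, lam j a ≤ m)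
    (S : Submodule L V) (h : GenericAt G B lam S)
    (hss : ∀ T ≤ S, ∑ j, codF (G j) (lam j) m T ≤ m * finrank L ↥T) : ExtZero G B lam S := by
  have hfV : FiniteDimensional L V := (G (Classical.arbitrary ι)).finiteDimensional_of_finite
  induction hd : finrank L ↥S using Nat.strong_induction_on generalizing S with
  | _ d ih =>
    have hle : _root_.commonKer G B lam S ≤ S := fun v hv => hv.1
    by_cases hS : _root_.commonKer G B lam S = S
    · refine extZero_of_hom_eq_zero hl hlm (fun φ hφ v hv => ?_) (hss S le_rfl)
      rw [← hS] at hv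
      exact hv.2 φ hφ
    · refine extZero_of_commonKer hl h (ih _ ?_ _ (h.commonKer hl)
        (fun T hT => hss T (hT.trans hle)) rfl)
      rw [← hd]
      exact Submodule.finrank_lt_finrank_of_lt (lt_of_le_of_ne hle hS)

end ExtZero

/-! ### Restriction of covariants to generic points -/

section Dominance

set_option linter.unusedSectionVars false

open MvPolynomial

variable {ι : Type} [Fintype ι] [DecidableEq ι] {r : ℕ}

/-- Indexing of the entries of the matrix with index `j`. -/
def facT (j : ι) (x : Fin r × Fin r) : ι × Fin r × Fin r := (j, x.1, x.2)

theorem facT_injective (j : ι) : Function.Injective (facT j : Fin r × Fin r → _) := by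
  rintro ⟨a, c⟩ ⟨a', c'⟩ h
  simp only [facT, Prod.mk.injEq] at h
  obtain ⟨_, rfl, rfl⟩ := h
  rfl

theorem polD_facT_X (j : ι) (a b : Fin r) (s : ι × Fin r × Fin r) :
    polD (facT j) a b (X s) = if j = s.1 ∧ b = s.2.1 then X (s.1, a, s.2.2) else 0 := by
  by_cases h : j = s.1
  · subst h
    have := polD_X (facT s.1) (facT_injective s.1) a b s.2.1 s.2.2
    simp only [true_and]
    exact this
  · rw [if_neg (fun h1 => h h1.1)]
    apply polD_X_of_notMem
    rintro ⟨x, rfl⟩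
    exact h rfl

theorem col_fac_comm (j j' : ι) (a b c d : Fin r) (p : MPoly ι r) :
    (colRep r j').e a b (polD (facT j) c d p) = polD (facT j) c d ((colRep r j').e a b p) := by
  refine polD_comm_of (colT j') (facT j) a b c d (fun s => ?_) p
  have h1 := fun s => colRep_X (r := r) j' a b s
  have h2 := fun s => polD_facT_X (r := r) j c d s
  simp only [colRep, polRep_e] at h1
  rw [h1, h2, apply_ite (polD (facT j) c d), apply_ite (polD (colT j') a b), h1, h2, map_zero,
    map_zero]
  dsimp only
  grind

theorem row_fac_comm (j : ι) (a b c d : Fin r) (p : MPoly ι r) :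
    (rowRep ι r).e a b (polD (facT j) c d p) = polD (facT j) c d ((rowRep ι r).e a b p) +
      ((if b = c then polD (facT j) a d p else 0) -
        (if d = a then polD (facT j) c b p else 0)) := by
  have h : ⁅polD (rowT (ι := ι)) a b, polD (facT j) c d⁆ =
      (if b = c then polD (facT j) a d else 0) - (if d = a then polD (facT j) c b else 0) := by
    refine derivation_ext fun s => ?_
    have h1 := fun s => rowRep_X (ι := ι) a b s
    have h2 := fun c d s => polD_facT_X (r := r) j c d s
    simp only [rowRep, polRep_e] at h1
    rw [Derivation.commutator_apply, h1, h2, apply_ite (polD rowT a b),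
      apply_ite (polD (facT j) c d), h1, h2, map_zero, map_zero, Derivation.sub_apply,
      apply_ite (fun D : Derivation ℚ (MPoly ι r) (MPoly ι r) => D (X s)),
      apply_ite (fun D : Derivation ℚ (MPoly ι r) (MPoly ι r) => D (X s)), h2, h2]
    simp only [Derivation.zero_apply]
    grind
  have h2 := DFunLike.congr_fun h p
  rw [Derivation.commutator_apply, sub_eq_iff_eq_add', Derivation.sub_apply] at h2
  refine h2.trans ?_
  congr 2 <;> split_ifs <;> simp

variable {L : Type} [Field L] [CharZero L] [Algebra ℚ L]

/-- A polynomial function vanishing on all translates of a tuple. -/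
def vanishTrans (g : ι → Matrix (Fin r) (Fin r) L) (lam : ι → Fin r → ℕ) :
    Submodule ℚ (MPoly ι r) where
  carrier := {f | (∀ j, f ∈ (colRep r j).hw fun a => (lam j a : ℤ)) ∧
    ∀ M : Matrix (Fin r) (Fin r) L, evM (fun j => M * g j) f = 0}
  add_mem' h h' := ⟨fun j => Submodule.add_mem _ (h.1 j) (h'.1 j), fun M => by
    rw [evM, map_add]
    exact (congrArg₂ (· + ·) (h.2 M) (h'.2 M)).trans (add_zero 0)⟩
  zero_mem' := ⟨fun j => Submodule.zero_mem _, fun M => map_zero _⟩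
  smul_mem' c f h := ⟨fun j => Submodule.smul_mem _ c (h.1 j), fun M => by
    rw [evM, map_smul, Algebra.smul_def]
    exact (congrArg (_ * ·) (h.2 M)).trans (mul_zero _)⟩

theorem row_mem_vanishTrans (g : ι → Matrix (Fin r) (Fin r) L) (lam : ι → Fin r → ℕ)
    {f : MPoly ι r} (hf : f ∈ vanishTrans g lam) (a b : Fin r) :
    (rowRep ι r).e a b f ∈ vanishTrans g lam := by
  refine ⟨fun j => ?_, fun M => ?_⟩
  · have h1 := (GLRep.mem_hw _).1 (hf.1 j)
    rw [GLRep.mem_hw]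
    refine ⟨fun c => ?_, fun c d hcd => ?_⟩
    · rw [← row_col_comm, h1.1, map_smul]
    · rw [← row_col_comm, h1.2 c d hcd, map_zero]
  · let x : ι × Fin r × Fin r → L := fun s => (M * g s.1) s.2.1 s.2.2
    obtain ⟨δ, hδ⟩ : ∃ δ : ι × Fin r × Fin r → L, ∀ s, δ s = if b = s.2.1 then
      x (s.1, a, s.2.2) else 0 := ⟨_, fun _ => rfl⟩
    let y : ι × Fin r × Fin r → Polynomial L :=
      fun s => Polynomial.C (x s) + Polynomial.X * Polynomial.C (δ s)
    have hev : ∀ (t : L) (p : MPoly ι r),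
        Polynomial.eval t (aeval y p) = aeval (fun s => x s + t * δ s) p := by
      intro t p
      have h2 := MvPolynomial.map_aeval y (Polynomial.evalRingHom t) p
      rw [Polynomial.coe_evalRingHom] at h2
      rw [h2, coe_eval₂Hom, aeval_def]
      have h3 : (fun i => Polynomial.eval t (y i)) = fun s => x s + t * δ s := by
        funext s
        simp only [y, Polynomial.eval_add, Polynomial.eval_mul, Polynomial.eval_C,
          Polynomial.eval_X]
      rw [h3]
      congr 1
      exact Subsingleton.elim _ _
    have hy0 : aeval y f = 0 := by
      refine Polynomial.funext fun t => ?_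
      rw [hev, Polynomial.eval_zero]
      have h3 := hf.2 ((1 + Matrix.single b a t) * M)
      rw [evM] at h3
      refine Eq.trans ?_ h3
      congr 2
      funext s
      rw [hδ, Matrix.mul_assoc, Matrix.add_mul, Matrix.one_mul, Matrix.add_apply]
      congr 1
      by_cases hs : b = s.2.1
      · rw [if_pos hs, ← hs, Matrix.single_mul_apply_same]
      · rw [if_neg hs, Matrix.single_mul_apply_of_ne _ _ _ _ _ (Ne.symm hs), mul_zero]
    let D : Derivation ℚ (Polynomial L) (Polynomial L) :=
      (Polynomial.derivative' (R := L)).restrictScalars ℚ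
    have hD : ∀ p, D p = Polynomial.derivative p := fun _ => rfl
    have h1 := derivation_aeval (fun s : ι × Fin r × Fin r => pderiv s)
      (fun s => Polynomial.C (δ s)) D y (fun s => by
        rw [hD]
        simp [y, pderiv_X, Pi.single_apply]) f
    rw [hy0, map_zero] at h1
    have h2 := congrArg (Polynomial.eval 0) h1
    rw [Polynomial.eval_finsetSum] at h2
    simp only [Polynomial.eval_mul, hev, Polynomial.eval_C, Polynomial.eval_zero, zero_mul,
      add_zero] at h2
    rw [evM, rowRep, polRep_e, polD_apply, map_sum]
    rw [h2, Fintype.sum_prod_type, Fintype.sum_prod_type]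
    simp only [map_mul, aeval_X, rowT]
    refine Finset.sum_congr rfl fun j _ => ?_
    symm
    rw [Fintype.sum_prod_type, Finset.sum_eq_single b]
    · refine Finset.sum_congr rfl fun c _ => ?_
      rw [hδ, if_pos rfl]
    · intro i _ hi
      refine Finset.sum_eq_zero fun c _ => ?_
      rw [hδ, if_neg (Ne.symm hi), zero_mul]
    · exact fun h => absurd (Finset.mem_univ _) h

/-- The filtration generated by the infinitesimal left translations in each factor. -/
def transFilt (N : Submodule ℚ (MPoly ι r)) : ℕ → Submodule ℚ (MPoly ι r)
  | 0 => N
  | n + 1 => transFilt N n ⊔ ⨆ x : ι × Fin r × Fin r,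
      (transFilt N n).map (polD (facT x.1) x.2.1 x.2.2 : MPoly ι r →ₗ[ℚ] MPoly ι r)

theorem transFilt_le (N : Submodule ℚ (MPoly ι r)) (n : ℕ) : transFilt N n ≤ transFilt N (n + 1) :=
  le_sup_left

theorem polD_mem_transFilt (N : Submodule ℚ (MPoly ι r)) (n : ℕ) {p : MPoly ι r}
    (hp : p ∈ transFilt N n) (j : ι) (a b : Fin r) :
    polD (facT j) a b p ∈ transFilt N (n + 1) := by
  refine Submodule.mem_sup_right (Submodule.mem_iSup_of_mem (j, a, b) ?_)
  exact Submodule.mem_map_of_mem (f := (polD (facT j) a b : MPoly ι r →ₗ[ℚ] MPoly ι r)) hp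

theorem transFilt_succ_le {N W : Submodule ℚ (MPoly ι r)} {n : ℕ} (h : transFilt N n ≤ W)
    (h' : ∀ p ∈ transFilt N n, ∀ j a b, polD (facT j) a b p ∈ W) : transFilt N (n + 1) ≤ W := by
  refine sup_le h (iSup_le fun x => ?_)
  rintro _ ⟨p, hp, rfl⟩
  exact h' p hp _ _ _

theorem row_mem_transFilt {N : Submodule ℚ (MPoly ι r)}
    (hN : ∀ p ∈ N, ∀ a b, (rowRep ι r).e a b p ∈ N) (n : ℕ) :
    ∀ p ∈ transFilt N n, ∀ a b, (rowRep ι r).e a b p ∈ transFilt N n := by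
  induction n with
  | zero => exact hN
  | succ n ih =>
    intro p hp a b
    have key : transFilt N (n + 1) ≤ (transFilt N (n + 1)).comap ((rowRep ι r).e a b) := by
      refine transFilt_succ_le (fun p hp => transFilt_le N n (ih p hp a b)) ?_
      intro p hp j c d
      rw [Submodule.mem_comap, row_fac_comm]
      refine Submodule.add_mem _ (polD_mem_transFilt N n (ih p hp a b) _ _ _)
        (Submodule.sub_mem _ ?_ ?_)
      · split_ifs
        · exact polD_mem_transFilt N n hp _ _ _
        · exact Submodule.zero_mem _
      · split_ifs
        · exact polD_mem_transFilt N n hp _ _ _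
        · exact Submodule.zero_mem _
    exact key hp

theorem transFilt_le_hw {N : Submodule ℚ (MPoly ι r)} {lam : ι → Fin r → ℕ}
    (hN : ∀ p ∈ N, ∀ j, p ∈ (colRep r j).hw fun a => (lam j a : ℤ)) (n : ℕ) :
    ∀ p ∈ transFilt N n, ∀ j, p ∈ (colRep r j).hw fun a => (lam j a : ℤ) := by
  induction n with
  | zero => exact hN
  | succ n ih =>
    intro p hp j
    refine transFilt_succ_le (fun p hp => ih p hp j) (fun p hp j' c d => ?_) hp
    have h1 := (GLRep.mem_hw _).1 (ih p hp j)
    rw [GLRep.mem_hw]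
    refine ⟨fun a => ?_, fun a b hab => ?_⟩
    · rw [col_fac_comm, h1.1, Derivation.map_smul]
    · rw [col_fac_comm, h1.2 a b hab, map_zero]

/-- Flags that move in all directions modulo simultaneous motions detect highest weight vectors. -/
theorem eq_zero_of_dominant (g : ι → Matrix (Fin r) (Fin r) L) (hg : ∀ j, IsUnit (g j).det)
    (hD : ∀ X : ι → Matrix (Fin r) (Fin r) L, ∃ D : Derivation ℚ L L,
      ∃ y : Matrix (Fin r) (Fin r) L, ∃ β : ι → Matrix (Fin r) (Fin r) L,
      (∀ j c d, d < c → β j c d = 0) ∧ ∀ j, (g j).map D = (X j - y) * g j + g j * β j)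
    {lam : ι → Fin r → ℕ} {f : MPoly ι r} (hf : ∀ j, f ∈ (colRep r j).hw fun a => (lam j a : ℤ))
    (h0 : ∀ M : Matrix (Fin r) (Fin r) L, evM (fun j => M * g j) f = 0) : f = 0 := by
  let N := vanishTrans g lam
  let x : ι × Fin r × Fin r → L := fun s => g s.1 s.2.1 s.2.2
  have hrow := row_mem_transFilt (N := N) (fun p hp => row_mem_vanishTrans g lam hp)
  have hcol := transFilt_le_hw (N := N) (lam := lam) (fun p hp => hp.1)
  have hvan : ∀ n, ∀ p ∈ transFilt N n, aeval x p = 0 := by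
    intro n
    induction n with
    | zero =>
      intro p hp
      have h1 := hp.2 1
      simp only [Matrix.one_mul] at h1
      exact h1
    | succ n ih =>
      have key : transFilt N (n + 1) ≤ LinearMap.ker (aeval x : MPoly ι r →ₐ[ℚ] L).toLinearMap := by
        refine transFilt_succ_le (fun p hp => ih p hp) (fun p hp j a b => ?_)
        obtain ⟨D, y, β, hβ, hDg⟩ := hD fun j' => if j' = j then Matrix.single b a 1 else 0
        have h1 := derivation_aeval (κ := Unit ⊕ (Fin r × Fin r) ⊕ (ι × Fin r × Fin r))
          (Sum.elim (fun _ => polD (facT j) a b) (Sum.elim (fun s => polD rowT s.2 s.1)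
            (fun s => polD (colT s.1) s.2.1 s.2.2)))
          (Sum.elim (fun _ => 1) (Sum.elim (fun s => - y s.1 s.2) (fun s => β s.1 s.2.1 s.2.2)))
          D x (fun s => ?_) p
        · rw [ih p hp, map_zero, Fintype.sum_sum_type, Fintype.sum_sum_type] at h1
          simp only [Sum.elim_inl, Sum.elim_inr] at h1
          rw [Fintype.sum_eq_zero (fun s : Fin r × Fin r => _) (fun s => ?_),
            Fintype.sum_eq_zero (fun s : ι × Fin r × Fin r => _) (fun s => ?_)] at h1
          · simpa using h1.symm
          · rcases lt_trichotomy s.2.1 s.2.2 with h | h | h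
            · have h2 := ((GLRep.mem_hw _).1 (hcol n p hp s.1)).2 _ _ h
              rw [colRep, polRep_e] at h2
              rw [h2, map_zero, mul_zero]
            · have h2 := ((GLRep.mem_hw _).1 (hcol n p hp s.1)).1 s.2.1
              rw [colRep, polRep_e] at h2
              rw [← h, h2, map_smul, ih p hp, Algebra.smul_def, mul_zero, mul_zero]
            · rw [hβ _ _ _ h, zero_mul]
          · have h2 := ih _ (hrow n p hp s.2 s.1)
            rw [rowRep, polRep_e] at h2
            rw [h2, mul_zero]
        · have h3 : D (x s) = ((g s.1).map D) s.2.1 s.2.2 := rfl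
          rw [h3, hDg, Fintype.sum_sum_type, Fintype.sum_sum_type]
          have e1 := fun a b => rowRep_X (ι := ι) (r := r) a b s
          have e2 := fun j a b => colRep_X (r := r) j a b s
          simp only [rowRep, colRep, polRep_e] at e1 e2
          simp only [Sum.elim_inl, Sum.elim_inr, polD_facT_X, e1, e2, apply_ite (aeval x), aeval_X,
            map_zero, one_mul, mul_ite, mul_zero, Finset.univ_unique, Finset.sum_singleton]
          rw [Matrix.add_apply, Matrix.sub_mul, Matrix.sub_apply, sub_eq_add_neg, add_assoc]
          congr 1
          · by_cases hj : s.1 = j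
            · rw [if_pos hj]
              by_cases hb : b = s.2.1
              · rw [if_pos ⟨hj.symm, hb⟩, ← hb, Matrix.single_mul_apply_same, one_mul]
              · rw [if_neg (fun h => hb h.2), Matrix.single_mul_apply_of_ne _ _ _ _ _ (Ne.symm hb)]
            · rw [if_neg hj, if_neg (fun h => hj h.1.symm), Matrix.zero_mul, Matrix.zero_apply]
          · congr 1
            · rw [Fintype.sum_prod_type, Finset.sum_eq_single s.2.1, Matrix.mul_apply,
                ← Finset.sum_neg_distrib]
              · refine Finset.sum_congr rfl fun c _ => ?_
                rw [if_pos rfl, neg_mul]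
              · intro c _ hc
                refine Finset.sum_eq_zero fun d _ => ?_
                rw [if_neg hc]
              · exact fun h => absurd (Finset.mem_univ _) h
            · rw [Fintype.sum_prod_type, Finset.sum_eq_single s.1, Fintype.sum_prod_type,
                Matrix.mul_apply]
              · refine Finset.sum_congr rfl fun c _ => ?_
                rw [Finset.sum_eq_single s.2.2]
                · rw [if_pos ⟨rfl, rfl⟩, mul_comm]
                · intro d _ hd
                  rw [if_neg (fun h => hd h.2)]
                · exact fun h => absurd (Finset.mem_univ _) h
              · intro c _ hc
                refine Finset.sum_eq_zero fun d _ => ?_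
                rw [if_neg (fun h => hc h.1)]
              · exact fun h => absurd (Finset.mem_univ _) h
      intro p hp
      exact key hp
  have hmap : map (algebraMap ℚ L) f = 0 := by
    refine eq_zero_of_stable x (fun j => hg j)
      (fun F => ∃ n, ∃ p ∈ transFilt N n, map (algebraMap ℚ L) p = F) ?_ ?_ ⟨0, f, ⟨hf, h0⟩, rfl⟩
    · rintro _ ⟨n, p, hp, rfl⟩ j a b
      refine ⟨n + 1, _, polD_mem_transFilt N n hp j a b, ?_⟩
      rw [polD_apply, map_sum]
      refine Finset.sum_congr rfl fun c _ => ?_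
      rw [map_mul, map_X, pderiv_map]
      rfl
    · rintro _ ⟨n, p, hp, rfl⟩
      rw [eval_map]
      exact hvan n p hp
  exact map_injective _ (algebraMap ℚ L).injective (hmap.trans (map_zero _).symm)

end Dominance

/-! ### Derivations of fields of rational functions -/

section RationalFunctions

open MvPolynomial

variable {σ : Type} {L : Type} [Field L] [Algebra ℚ L] [Algebra (MvPolynomial σ ℚ) L]
  [IsScalarTower ℚ (MvPolynomial σ ℚ) L] [IsFractionRing (MvPolynomial σ ℚ) L]

theorem exists_derivation (a : σ → L) :
    ∃ D : Derivation ℚ L L, ∀ s, D (algebraMap (MvPolynomial σ ℚ) L (X s)) = a s := by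
  let φ0 : MvPolynomial σ ℚ →ₐ[ℚ] TrivSqZeroExt L L :=
    aeval fun s => TrivSqZeroExt.inl (algebraMap (MvPolynomial σ ℚ) L (X s)) +
      TrivSqZeroExt.inr (a s)
  have hfst0 : (TrivSqZeroExt.fstHom ℚ L L).comp φ0 =
      IsScalarTower.toAlgHom ℚ (MvPolynomial σ ℚ) L := by
    refine MvPolynomial.algHom_ext fun s => ?_
    simp [φ0]
  have hunit : ∀ y : nonZeroDivisors (MvPolynomial σ ℚ), IsUnit (φ0 y) := by
    intro y
    rw [TrivSqZeroExt.isUnit_iff_isUnit_fst]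
    have h1 := DFunLike.congr_fun hfst0 (y : MvPolynomial σ ℚ)
    have h2 : (φ0 y).fst = algebraMap (MvPolynomial σ ℚ) L y := h1
    rw [h2]
    exact IsLocalization.map_units L y
  let φ : L →ₐ[ℚ] TrivSqZeroExt L L :=
    IsLocalization.liftAlgHom (M := nonZeroDivisors (MvPolynomial σ ℚ)) (S := L) (f := φ0) hunit
  have hφ : ∀ p, φ (algebraMap (MvPolynomial σ ℚ) L p) = φ0 p := fun p =>
    IsLocalization.lift_eq hunit p
  have hfst : ∀ z, (φ z).fst = z := by
    intro z
    have h1 : ((TrivSqZeroExt.fstHom ℚ L L).comp φ : L →ₐ[ℚ] L).toRingHom = RingHom.id L := by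
      refine IsLocalization.ringHom_ext (nonZeroDivisors (MvPolynomial σ ℚ)) ?_
      ext p
      · simp
      · change (φ _).fst = _
        rw [hφ]
        simp [φ0]
    exact DFunLike.congr_fun h1 z
  refine ⟨Derivation.mk' ((TrivSqZeroExt.sndHom L L).restrictScalars ℚ ∘ₗ φ.toLinearMap) ?_, ?_⟩
  · intro z w
    change (φ (z * w)).snd = z • (φ w).snd + w • (φ z).snd
    rw [map_mul, TrivSqZeroExt.snd_mul, hfst, hfst]
    simp [mul_comm w]
  · intro s
    change (φ _).snd = _
    rw [hφ]
    simp [φ0]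

end RationalFunctions

section FreeFlags

set_option linter.unusedSectionVars false

variable {κ : Type} [Fintype κ] [DecidableEq κ] {L : Type} [Field L]

/-- The basis given by the columns of an invertible matrix. -/
def colBasis (g : Matrix κ κ L) (hg : IsUnit g.det) : Basis κ L (κ → L) :=
  Basis.ofEquivFun (LinearEquiv.ofLinearMap g⁻¹.mulVecLin g.mulVecLin
    (by rw [← Matrix.mulVecLin_mul, Matrix.nonsing_inv_mul _ hg, Matrix.mulVecLin_one])
    (by rw [← Matrix.mulVecLin_mul, Matrix.mul_nonsing_inv _ hg, Matrix.mulVecLin_one]))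

theorem colBasis_repr (g : Matrix κ κ L) (hg : IsUnit g.det) (v : κ → L) (b : κ) :
    (colBasis g hg).repr v b = (g⁻¹.mulVec v) b := rfl

theorem colBasis_apply (g : Matrix κ κ L) (hg : IsUnit g.det) (b : κ) :
    colBasis g hg b = fun a => g a b := by
  rw [colBasis, Basis.coe_ofEquivFun]
  change g.mulVec (Pi.single b 1) = _
  ext a
  simp

theorem matB_colBasis (g : Matrix κ κ L) (hg : IsUnit g.det) :
    matB (fun b => colBasis g hg b) = g := by
  ext a b
  rw [matB, Matrix.of_apply, colBasis_apply]

theorem map_derivation_mul [Algebra ℚ L] (D : Derivation ℚ L L) {κ₁ κ₂ κ₃ : Type*} [Fintype κ₂]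
    (A : Matrix κ₁ κ₂ L) (B : Matrix κ₂ κ₃ L) :
    (A * B).map D = A.map D * B + A * B.map D := by
  ext a b
  simp only [Matrix.map_apply, Matrix.mul_apply, Matrix.add_apply, map_sum, Derivation.leibniz,
    smul_eq_mul, ← Finset.sum_add_distrib]
  exact Finset.sum_congr rfl fun c _ => by ring

theorem map_derivation_mulVec [Algebra ℚ L] (D : Derivation ℚ L L) {κ₁ κ₂ : Type*} [Fintype κ₂]
    (A : Matrix κ₁ κ₂ L) (v : κ₂ → L) :
    (fun a => D (A.mulVec v a)) = (A.map D).mulVec v + A.mulVec fun b => D (v b) := by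
  ext a
  simp only [Matrix.map_apply, Matrix.mulVec, dotProduct, Pi.add_apply, map_sum,
    Derivation.leibniz, smul_eq_mul, ← Finset.sum_add_distrib]
  exact Finset.sum_congr rfl fun c _ => by ring

/-- The coordinatewise connection. -/
def connStd [Algebra ℚ L] (κ : Type) (D : Derivation ℚ L L) : (κ → L) →+ (κ → L) where
  toFun v a := D (v a)
  map_zero' := by ext; simp
  map_add' v w := by ext; simp

theorem isConn_connStd [Algebra ℚ L] (κ : Type) (D : Derivation ℚ L L) :
    IsConn D (connStd κ D) := by
  intro a v
  ext b
  change D (a * v b) = D a * v b + a * D (v b)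
  rw [Derivation.leibniz, smul_eq_mul, smul_eq_mul]
  ring

theorem connStd_sub_mem [Algebra ℚ L] (D : Derivation ℚ L L) {g : Matrix κ κ L}
    (hg : IsUnit g.det) {X : Matrix κ κ L} (hD : g.map D = X * g) {A : Set κ} {v : κ → L}
    (hv : v ∈ coordSub (colBasis g hg) A) :
    connStd κ D v - X.mulVec v ∈ coordSub (colBasis g hg) A := by
  intro b hb
  have h1 : v = g.mulVec (g⁻¹.mulVec v) := by
    rw [Matrix.mulVec_mulVec, Matrix.mul_nonsing_inv _ hg, Matrix.one_mulVec]
  have h2 : connStd κ D v - X.mulVec v = g.mulVec fun b => D (g⁻¹.mulVec v b) := by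
    have h3 := map_derivation_mulVec D g (g⁻¹.mulVec v)
    rw [← h1, hD, ← Matrix.mulVec_mulVec, ← h1] at h3
    change (fun a => D (v a)) - _ = _
    rw [h3, add_sub_cancel_left]
  rw [h2, colBasis_repr, Matrix.mulVec_mulVec, Matrix.nonsing_inv_mul _ hg, Matrix.one_mulVec]
  have h4 : g⁻¹.mulVec v b = 0 := hv b hb
  rw [h4, map_zero]

variable {ι : Type} [Fintype ι] [Nonempty ι] {r m : ℕ} [Algebra ℚ L]

theorem map_derivation_inv (D : Derivation ℚ L L) {l : Matrix κ κ L} (hl : IsUnit l.det) :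
    l⁻¹.map D = -(l⁻¹ * l.map D) * l⁻¹ := by
  have h1 := map_derivation_mul D l⁻¹ l
  rw [Matrix.nonsing_inv_mul _ hl] at h1
  have h2 : (1 : Matrix κ κ L).map D = 0 := by
    ext a b
    by_cases h : a = b
    · simp [h]
    · simp [h]
  rw [h2] at h1
  have h3 := congrArg (· * l⁻¹) (eq_neg_of_add_eq_zero_left h1.symm)
  simp only [Matrix.mul_assoc] at h3
  rw [Matrix.mul_nonsing_inv _ hl, Matrix.mul_one] at h3
  rw [h3]

/-- For freely moving semistable flags the linear incidence equations are solvable. -/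
theorem exists_solution_of_semistable (h : ι → Matrix (Fin r) (Fin r) L)
    (l : ι → Matrix (Fin m) (Fin m) L) (hh : ∀ j, IsUnit (h j).det) (hl : ∀ j, IsUnit (l j).det)
    (hfree : ∀ (X : ι → Matrix (Fin r) (Fin r) L) (Y : ι → Matrix (Fin m) (Fin m) L),
      ∃ D : Derivation ℚ L L, ∀ j, (h j).map D = X j ∧ (l j).map D = Y j)
    {lam : ι → Fin r → ℕ} (hlam : ∀ j, Antitone (lam j)) (hlm : ∀ j a, lam j a ≤ m)
    (hss : ∀ T : Submodule L (Fin r → L),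
      ∑ j, codF (colBasis (h j) (hh j)) (lam j) m T ≤ m * finrank L ↥T)
    (z : ι → Matrix (Fin m) (Fin r) L) :
    ∃ σ : Matrix (Fin m) (Fin r) L, ∀ j (c : Fin m) t, m ≤ c + lam j t →
      (l j * σ * h j) c t = z j c t := by
  have hl' : ∀ j, IsUnit (l j)⁻¹.det := fun j => Matrix.isUnit_nonsing_inv_det _ (hl j)
  have hgen : GenericAt (fun j => colBasis (h j) (hh j)) (fun j => colBasis (l j)⁻¹ (hl' j)) lam
      ⊤ := by
    intro X Y _
    obtain ⟨D, hD⟩ := hfree (fun j => LinearMap.toMatrix' (X j) * h j)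
      (fun j => -(l j * LinearMap.toMatrix' (Y j)))
    refine ⟨D, connStd _ D, connStd _ D, isConn_connStd _ D, isConn_connStd _ D,
      fun _ _ => trivial, fun j u v _ hv => ?_, fun j u q hq => ?_⟩
    · have h1 := connStd_sub_mem D (hh j) (hD j).1 hv
      rwa [LinearMap.toMatrix'_mulVec] at h1
    · have h2 : (l j)⁻¹.map D = LinearMap.toMatrix' (Y j) * (l j)⁻¹ := by
        rw [map_derivation_inv D (hl j), (hD j).2, Matrix.mul_neg, neg_neg, ← Matrix.mul_assoc,
          Matrix.nonsing_inv_mul _ (hl j), Matrix.one_mul]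
      have h1 := connStd_sub_mem D (hl' j) h2 hq
      rwa [LinearMap.toMatrix'_mulVec] at h1
  obtain ⟨φ, hφ⟩ := hgen.extZero hlam hlm ⊤ (fun T _ => hss T)
    (fun j => ((l j)⁻¹ * z j * (h j)⁻¹).mulVecLin)
  refine ⟨LinearMap.toMatrix' φ, fun j c t hct => ?_⟩
  have hA : IsAdapted (colBasis (h j) (hh j)) (colBasis (h j) (hh j)) ⊤ Finset.univ := by
    refine ⟨fun b b' hb => ?_, fun b => ?_, fun b b' hb => ?_, ?_⟩
    · simp [hb.ne]
    · simp
    · simp [hb.ne]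
    · ext v
      simp [mem_coordSub]
  have h1 := (mem_homRes_iff hlam hA).1 (hφ j) t (Finset.mem_univ _) c hct
  rw [colBasis_repr, Matrix.nonsing_inv_nonsing_inv _ (hl j), LinearMap.sub_apply,
    Matrix.mulVecLin_apply, ← LinearMap.toMatrix'_mulVec φ, Matrix.mulVec_sub, Pi.sub_apply,
    sub_eq_zero, colBasis_apply, Matrix.mulVec_mulVec, Matrix.mulVec_mulVec] at h1
  have h2 : ∀ A : Matrix (Fin m) (Fin r) L, A.mulVec (fun a => h j a t) c = (A * h j) c t :=
    fun A => rfl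
  rw [h2, h2] at h1
  rw [← h1, Matrix.mul_assoc, Matrix.mul_assoc, Matrix.nonsing_inv_mul _ (hh j), Matrix.mul_one,
    ← Matrix.mul_assoc, Matrix.mul_nonsing_inv _ (hl j), Matrix.one_mul]

end FreeFlags

/-! ### The determinantal invariant -/

theorem det_eq_prod_of_rank {α β K : Type*} [Fintype α] [DecidableEq α] [LinearOrder β]
    [CommRing K] (U : Matrix α α K) (b : α → β) (hb : Function.Injective b)
    (h : ∀ x x', b x' < b x → U x x' = 0) : U.det = ∏ x, U x x := by
  let _ : LinearOrder α := LinearOrder.lift' b hb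
  convert Matrix.det_of_isUpperTriangular (M := U) (fun x x' hx => h x x' hx)

section Theta

set_option linter.unusedSectionVars false

variable {ι : Type} [Fintype ι] [DecidableEq ι] {e d : ℕ}

/-- The index set of the linear incidence conditions. -/
abbrev Cells (e : ℕ) {d : ℕ} (lam : ι → Fin d → ℕ) : Type :=
  {x : ι × Fin e × Fin d // e ≤ (x.2.1 : ℕ) + lam x.1 x.2.2}

variable (lam : ι → Fin d → ℕ)

theorem sum_cells {N : Type*} [AddCommMonoid N] (F : ι × Fin e × Fin d → N) :
    ∑ x : Cells e lam, F x.1 =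
      ∑ j, ∑ t, ∑ c : Fin e, if e ≤ (c : ℕ) + lam j t then F (j, c, t) else 0 := by
  have h1 : ∑ x : Cells e lam, F x.1 =
      ∑ x : ι × Fin e × Fin d, if e ≤ (x.2.1 : ℕ) + lam x.1 x.2.2 then F x else 0 := by
    rw [← Finset.sum_filter]
    exact (Finset.sum_subtype _ (by simp) F).symm
  rw [h1, Fintype.sum_prod_type]
  refine Finset.sum_congr rfl fun j _ => ?_
  rw [Fintype.sum_prod_type, Finset.sum_comm]

theorem prod_cells {N : Type*} [CommMonoid N] (F : ι × Fin e × Fin d → N) :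
    ∏ x : Cells e lam, F x.1 =
      ∏ j, ∏ t, ∏ c : Fin e, if e ≤ (c : ℕ) + lam j t then F (j, c, t) else 1 := by
  have h1 : ∏ x : Cells e lam, F x.1 =
      ∏ x : ι × Fin e × Fin d, if e ≤ (x.2.1 : ℕ) + lam x.1 x.2.2 then F x else 1 := by
    rw [← Finset.prod_filter]
    exact (Finset.prod_subtype _ (by simp) F).symm
  rw [h1, Fintype.prod_prod_type]
  refine Finset.prod_congr rfl fun j _ => ?_
  rw [Fintype.prod_prod_type, Finset.prod_comm]

theorem card_cells (hle : ∀ j t, lam j t ≤ e) :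
    Fintype.card (Cells e lam) = ∑ j, ∑ t, lam j t := by
  rw [← Finset.card_univ, Finset.card_eq_sum_ones, sum_cells lam fun _ => 1]
  exact Finset.sum_congr rfl fun j _ => Finset.sum_congr rfl fun t _ =>
    card_fin_filter_le (hle j t)

variable {K : Type*} [CommRing K]

/-- The matrix of the linear incidence conditions. -/
def incMat (h : ι → Matrix (Fin d) (Fin d) K) (l : ι → Matrix (Fin e) (Fin e) K) :
    Matrix (Cells e lam) (Fin e × Fin d) K :=
  Matrix.of fun x y => l x.1.1 x.1.2.1 y.1 * h x.1.1 y.2 x.1.2.2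

theorem incMat_mulVec (h : ι → Matrix (Fin d) (Fin d) K) (l : ι → Matrix (Fin e) (Fin e) K)
    (σ : Matrix (Fin e) (Fin d) K) (x : Cells e lam) :
    (incMat lam h l).mulVec (fun y => σ y.1 y.2) x =
      (l x.1.1 * σ * h x.1.1) x.1.2.1 x.1.2.2 := by
  simp only [Matrix.mulVec, dotProduct, incMat, Matrix.of_apply, Matrix.mul_apply,
    Fintype.sum_prod_type, Finset.sum_mul]
  rw [Finset.sum_comm]
  exact Finset.sum_congr rfl fun t _ => Finset.sum_congr rfl fun c _ => by ring

theorem incMat_mul (h : ι → Matrix (Fin d) (Fin d) K) (l : ι → Matrix (Fin e) (Fin e) K)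
    (M : Matrix (Fin d) (Fin d) K) (N : Matrix (Fin e) (Fin e) K) :
    incMat lam (fun j => M * h j) (fun j => l j * N) =
      incMat lam h l * Matrix.kroneckerMap (· * ·) N M.transpose := by
  ext x y
  simp only [incMat, Matrix.of_apply, Matrix.mul_apply, Matrix.kroneckerMap_apply,
    Matrix.transpose_apply, Fintype.sum_prod_type, Finset.sum_mul_sum]
  exact Finset.sum_congr rfl fun c _ => Finset.sum_congr rfl fun t _ => by ring

/-- The triangular matrix by which triangular matrices act on the incidence conditions. -/
def cellMat (β : ι → Matrix (Fin d) (Fin d) K) (γ : ι → Matrix (Fin e) (Fin e) K) :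
    Matrix (Cells e lam) (Cells e lam) K :=
  Matrix.of fun x x' => if x.1.1 = x'.1.1 then
    γ x.1.1 x.1.2.1 x'.1.2.1 * β x.1.1 x'.1.2.2 x.1.2.2 else 0

theorem incMat_triangular {lam : ι → Fin d → ℕ} (hlam : ∀ j, Antitone (lam j))
    (h β : ι → Matrix (Fin d) (Fin d) K) (l γ : ι → Matrix (Fin e) (Fin e) K)
    (hβ : ∀ j a b, b < a → β j a b = 0) (hγ : ∀ j a b, b < a → γ j a b = 0) :
    incMat lam (fun j => h j * β j) (fun j => γ j * l j) =
      cellMat lam β γ * incMat lam h l := by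
  ext ⟨⟨j, c, t⟩, hx⟩ y
  rw [Matrix.mul_apply]
  have h1 := sum_cells lam (fun x' : ι × Fin e × Fin d => (if j = x'.1 then
    γ j c x'.2.1 * β j x'.2.2 t else 0) * (l x'.1 x'.2.1 y.1 * h x'.1 y.2 x'.2.2))
  refine Eq.trans ?_ h1.symm
  rw [Finset.sum_eq_single j]
  · simp only [incMat, Matrix.of_apply, Matrix.mul_apply, Finset.sum_mul_sum, if_true]
    rw [Finset.sum_comm]
    refine Finset.sum_congr rfl fun t' _ => Finset.sum_congr rfl fun c' _ => ?_
    split_ifs with hc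
    · ring
    · by_cases h2 : c' < c
      · rw [hγ j c c' h2]; ring
      · by_cases h3 : t < t'
        · rw [hβ j t' t h3]; ring
        · exfalso
          have h4 : lam j t ≤ lam j t' := hlam j (not_lt.1 h3)
          have h5 : (c : ℕ) ≤ c' := not_lt.1 h2
          have h6 : e ≤ (c : ℕ) + lam j t := hx
          omega
  · intro j' _ hj'
    refine Finset.sum_eq_zero fun t' _ => Finset.sum_eq_zero fun c' _ => ?_
    simp [hj'.symm]
  · simp

theorem det_cellMat (β : ι → Matrix (Fin d) (Fin d) K) (γ : ι → Matrix (Fin e) (Fin e) K)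
    (hβ : ∀ j a b, b < a → β j a b = 0) (hγ : ∀ j a b, b < a → γ j a b = 0) :
    (cellMat lam β γ).det =
      ∏ x : Cells e lam, γ x.1.1 x.1.2.1 x.1.2.1 * β x.1.1 x.1.2.2 x.1.2.2 := by
  rw [det_eq_prod_of_rank (cellMat lam β γ) (fun x : Cells e lam =>
    toLex (Fintype.equivFin ι x.1.1, toLex (x.1.2.1, OrderDual.toDual x.1.2.2)))]
  · simp [cellMat]
  · rintro ⟨⟨j, c, t⟩, hx⟩ ⟨⟨j', c', t'⟩, hx'⟩ h
    simpa using h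
  · rintro ⟨⟨j, c, t⟩, hx⟩ ⟨⟨j', c', t'⟩, hx'⟩ h
    simp only [Prod.Lex.toLex_lt_toLex, OrderDual.toDual_lt_toDual, EmbeddingLike.apply_eq_iff_eq]
      at h
    simp only [cellMat, Matrix.of_apply]
    split_ifs with hj
    · subst hj
      rcases h with h | ⟨_, h | ⟨_, h⟩⟩
      · exact absurd h (lt_irrefl _)
      · rw [hγ _ _ _ h, zero_mul]
      · rw [hβ _ _ _ h, mul_zero]
    · rfl

/-- The determinant of the incidence conditions. -/
def theta (E : Cells e lam ≃ Fin e × Fin d) (h : ι → Matrix (Fin d) (Fin d) K)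
    (l : ι → Matrix (Fin e) (Fin e) K) : K :=
  ((incMat lam h l).submatrix E.symm id).det

variable {lam} (E : Cells e lam ≃ Fin e × Fin d)

theorem theta_mul (h : ι → Matrix (Fin d) (Fin d) K) (l : ι → Matrix (Fin e) (Fin e) K)
    (M : Matrix (Fin d) (Fin d) K) (N : Matrix (Fin e) (Fin e) K) :
    theta lam E (fun j => M * h j) (fun j => l j * N) =
      M.det ^ e * N.det ^ d * theta lam E h l := by
  rw [theta, incMat_mul, ← Matrix.submatrix_mul_equiv _ _ _ (Equiv.refl _) _, Matrix.det_mul]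
  have h1 : (Matrix.kroneckerMap (· * ·) N M.transpose).submatrix (Equiv.refl _) id =
      Matrix.kroneckerMap (· * ·) N M.transpose := rfl
  rw [h1, Matrix.det_kronecker, Matrix.det_transpose, Fintype.card_fin, Fintype.card_fin, theta]
  change Matrix.det ((incMat lam h l).submatrix E.symm id) * _ = _
  ring

theorem theta_triangular (hlam : ∀ j, Antitone (lam j))
    (h β : ι → Matrix (Fin d) (Fin d) K) (l γ : ι → Matrix (Fin e) (Fin e) K)
    (hβ : ∀ j a b, b < a → β j a b = 0) (hγ : ∀ j a b, b < a → γ j a b = 0) :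
    theta lam E (fun j => h j * β j) (fun j => γ j * l j) =
      (∏ x : Cells e lam, γ x.1.1 x.1.2.1 x.1.2.1 * β x.1.1 x.1.2.2 x.1.2.2) *
        theta lam E h l := by
  rw [theta, incMat_triangular hlam h β l γ hβ hγ, ← Matrix.submatrix_mul_equiv _ _ _ E.symm _,
    Matrix.det_mul, Matrix.det_submatrix_equiv_self, det_cellMat lam β γ hβ hγ, theta]

theorem map_theta {K' : Type*} [CommRing K'] (φ : K →+* K')
    (h : ι → Matrix (Fin d) (Fin d) K) (l : ι → Matrix (Fin e) (Fin e) K) :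
    φ (theta lam E h l) = theta lam E (fun j => (h j).map φ) (fun j => (l j).map φ) := by
  rw [theta, RingHom.map_det]
  congr 1
  ext x y
  simp [incMat]

open MvPolynomial

/-- The determinant of the incidence conditions as a polynomial in the first tuple. -/
def thetaPoly (l : ι → Matrix (Fin e) (Fin e) ℚ) : MPoly ι d :=
  theta lam E (fun j => Matrix.of fun a b => X (j, a, b)) (fun j => (l j).map C)

theorem evM_thetaPoly [Algebra ℚ K] (l : ι → Matrix (Fin e) (Fin e) ℚ)
    (h : ι → Matrix (Fin d) (Fin d) K) :
    evM h (thetaPoly E l) = theta lam E h (fun j => (l j).map (algebraMap ℚ K)) := by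
  rw [evM, thetaPoly]
  refine (map_theta E (aeval (R := ℚ)
    fun s : ι × Fin d × Fin d => h s.1 s.2.1 s.2.2).toRingHom _ _).trans ?_
  congr 1
  · ext j a b
    simp
  · ext j a b
    simp

theorem prod_cells_diag (hle : ∀ j t, lam j t ≤ e) (β : ι → Fin d → K) :
    ∏ x : Cells e lam, β x.1.1 x.1.2.2 = ∏ j, ∏ t, β j t ^ lam j t := by
  rw [prod_cells lam fun x => β x.1 x.2.2]
  refine Finset.prod_congr rfl fun j _ => Finset.prod_congr rfl fun t _ => ?_
  dsimp only
  rw [Finset.prod_ite, Finset.prod_const_one, mul_one, Finset.prod_const, Finset.card_filter,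
    card_fin_filter_le (hle j t)]

theorem thetaPoly_mem (hlam : ∀ j, Antitone (lam j)) (hle : ∀ j t, lam j t ≤ e)
    (l : ι → Matrix (Fin e) (Fin e) ℚ) : thetaPoly E l ∈ hwSpace (fun _ => e) lam := by
  refine mem_hwSpace_of_evM (fun K _ _ _ M h => ?_) (fun K _ _ _ h β hβ => ?_)
  · have h1 := theta_mul E h (fun j => (l j).map (algebraMap ℚ K)) M 1
    simp only [Matrix.det_one, one_pow, mul_one] at h1
    rw [evM_thetaPoly, evM_thetaPoly, h1]
  · have h1 := theta_triangular E hlam h β (fun j => (l j).map (algebraMap ℚ K)) (fun _ => 1) hβ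
      (fun j a b hab => Matrix.one_apply_ne hab.ne')
    simp only [Matrix.one_apply_eq, one_mul] at h1
    rw [evM_thetaPoly, evM_thetaPoly, h1, prod_cells_diag hle fun j t => β j t t]

/-- A nonzero value of the determinant forces a nonzero highest weight vector. -/
theorem schurCoeff_ne_zero_of_theta (hlam : ∀ j, Antitone (lam j)) (hle : ∀ j t, lam j t ≤ e)
    {L : Type*} [Field L] [Algebra ℚ L] (h : ι → Matrix (Fin d) (Fin d) L)
    (l : ι → Matrix (Fin e) (Fin e) L) (hne : theta lam E h l ≠ 0) :
    (∃ l0 : ι → Matrix (Fin e) (Fin e) ℚ, thetaPoly E l0 ≠ 0) ∧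
    schurCoeff d (∏ j, schurP (lam j)) (fun _ => e) ≠ 0 := by
  have key : ∃ l0 : ι → Matrix (Fin e) (Fin e) ℚ, thetaPoly E l0 ≠ 0 := by
    let R := MvPolynomial ((ι × Fin d × Fin d) ⊕ (ι × Fin e × Fin e)) ℚ
    let P : R := theta lam E (fun j => Matrix.of fun a b => X (Sum.inl (j, a, b)))
      (fun j => Matrix.of fun a b => X (Sum.inr (j, a, b)))
    have hP : P ≠ 0 := by
      intro h0
      apply hne
      have h1 := map_theta E (aeval (R := ℚ) (Sum.elim (fun s : ι × Fin d × Fin d => h s.1 s.2.1 s.2.2)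
        (fun s : ι × Fin e × Fin e => l s.1 s.2.1 s.2.2))).toRingHom
        (fun j => Matrix.of fun a b => (X (Sum.inl (j, a, b)) : R))
        (fun j => Matrix.of fun a b => (X (Sum.inr (j, a, b)) : R))
      change (aeval (R := ℚ) _) P = _ at h1
      rw [h0, map_zero] at h1
      rw [h1]
      congr 1
      · ext j a b
        simp
      · ext j a b
        simp
    obtain ⟨x, hx⟩ : ∃ x, eval x P ≠ 0 := by
      by_contra hcon
      push Not at hcon
      exact hP (MvPolynomial.funext fun x => by rw [hcon, map_zero])
    refine ⟨fun j => Matrix.of fun a b => x (Sum.inr (j, a, b)), fun h0 => hx ?_⟩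
    have h1 := evM_thetaPoly (K := ℚ) E (fun j => Matrix.of fun a b => x (Sum.inr (j, a, b)))
      (fun j => Matrix.of fun a b => x (Sum.inl (j, a, b)))
    rw [h0, evM, map_zero] at h1
    have h2 := map_theta E (eval x : R →+* ℚ)
        (fun j => Matrix.of fun a b => (X (Sum.inl (j, a, b)) : R))
        (fun j => Matrix.of fun a b => (X (Sum.inr (j, a, b)) : R))
    change eval x P = _ at h2
    rw [h2, h1]
    congr 1
    · ext j a b
      simp
    · ext j a b
      simp
  refine ⟨key, fun h0 => ?_⟩
  obtain ⟨l0, hl0⟩ := key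
  have h1 := finrank_hwSpace (nu := fun _ : Fin d => e) (fun _ _ _ => le_rfl) hlam
  rw [h0] at h1
  have hfin : FiniteDimensional ℚ ↥(hwSpace (ι := ι) (fun _ : Fin d => e) lam) :=
    finiteDimensional_of_sum _ (∑ j, ∑ a, (lam j a : ℤ)) fun p hp α hα =>
      exponent_sum_of_col_wt
        (fun j => (colRep d j).hw_le_wt _ (mem_iInf _ |>.1 hp.2 j)) hα
  have h2 : finrank ℚ ↥(hwSpace (ι := ι) (fun _ : Fin d => e) lam) = 0 := by exact_mod_cast h1
  rw [Submodule.finrank_eq_zero] at h2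
  have h3 := thetaPoly_mem E hlam hle l0
  rw [h2] at h3
  exact hl0 ((Submodule.mem_bot ℚ).1 h3)

end Theta

section Completion

/-- A linearly independent family can be completed by standard basis vectors. -/
theorem exists_completion {L : Type*} [Field L] {α ρ : Type} [Finite α] [Fintype ρ] [DecidableEq ρ]
    (v : α → ρ → L) (hv : LinearIndependent L v) :
    ∃ (κ : Type) (_ : Fintype κ) (a : κ → ρ),
      LinearIndependent L (Sum.elim v fun q => Pi.single (a q) (1 : L)) ∧
      Nat.card α + Fintype.card κ = Fintype.card ρ := by
  have := Fintype.ofFinite α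
  set W := span L (Set.range v) with hW
  let w : ρ → (ρ → L) ⧸ W := fun b => Submodule.Quotient.mk (Pi.single b (1 : L))
  obtain ⟨κ, a, ha, hspan, hli⟩ := exists_linearIndependent' L w
  have hfin : Fintype κ := Fintype.ofInjective a ha
  have hw : span L (Set.range w) = ⊤ := by
    have h1 : Set.range w = W.mkQ '' Set.range (fun b : ρ => Pi.single b (1 : L)) := by
      rw [← Set.range_comp]; rfl
    have h2 : span L (Set.range (fun b : ρ => Pi.single b (1 : L))) = ⊤ := by
      have := (Pi.basisFun L ρ).span_eq
      convert this using 3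
      ext b
      simp
    rw [h1, span_image, h2, Submodule.map_top, Submodule.range_mkQ]
  refine ⟨κ, hfin, a, ?_, ?_⟩
  · exact LinearIndependent.sumElim_of_quotient (M' := W)
      (f := fun x => ⟨v x, subset_span ⟨x, rfl⟩⟩) (linearIndependent_span hv) _ hli
  · have h1 : finrank L W = Fintype.card α := finrank_span_eq_card hv
    have h2 : finrank L ((ρ → L) ⧸ W) = Fintype.card κ := by
      rw [← finrank_top, ← hw, ← hspan]
      exact finrank_span_eq_card hli
    have h3 := Submodule.finrank_quotient_add_finrank W
    rw [Module.finrank_fintype_fun_eq_card] at h3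
    rw [Nat.card_eq_fintype_card]
    omega

end Completion

/-! ### Nonvanishing from solvability of the incidence conditions -/

section Solvable

variable {ι : Type} [Fintype ι] [DecidableEq ι]

omit [Fintype ι] [DecidableEq ι] in
theorem theta_ne_zero {d e : ℕ} {lam : ι → Fin d → ℕ} (E : Cells e lam ≃ Fin e × Fin d)
    {L : Type*} [Field L] (h : ι → Matrix (Fin d) (Fin d) L) (l : ι → Matrix (Fin e) (Fin e) L)
    (hli : LinearIndependent L (fun x => incMat lam h l x)) : theta lam E h l ≠ 0 := by
  have h1 : LinearIndependent L ((incMat lam h l).submatrix E.symm id).row :=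
    hli.comp E.symm E.symm.injective
  rw [Matrix.linearIndependent_rows_iff_isUnit, Matrix.isUnit_iff_isUnit_det] at h1
  exact h1.ne_zero

theorem linearIndependent_incMat {d e : ℕ} {lam : ι → Fin d → ℕ} {L : Type*} [Field L]
    (h : ι → Matrix (Fin d) (Fin d) L) (l : ι → Matrix (Fin e) (Fin e) L)
    (hsol : ∀ z : ι → Matrix (Fin e) (Fin d) L, ∃ σ : Matrix (Fin e) (Fin d) L,
      ∀ j (c : Fin e) t, e ≤ c + lam j t → (l j * σ * h j) c t = z j c t) :
    LinearIndependent L (fun x => incMat lam h l x) := by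
  rw [Fintype.linearIndependent_iff]
  intro w hw x0
  obtain ⟨σ, hσ⟩ := hsol fun j => Matrix.of fun c t => if (j, c, t) = x0.1 then 1 else 0
  have h1 : ∀ x : Cells e lam, (incMat lam h l).mulVec (fun y => σ y.1 y.2) x =
      if x = x0 then 1 else 0 := by
    rintro ⟨⟨j, c, t⟩, hx⟩
    rw [incMat_mulVec, hσ j c t hx, Matrix.of_apply]
    simp [Subtype.ext_iff]
  have h2 : ∑ x, w x * (incMat lam h l).mulVec (fun y => σ y.1 y.2) x = 0 := by
    have h3 : (Matrix.vecMul w (incMat lam h l)) = 0 := by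
      rw [← hw]
      ext y
      simp [Matrix.vecMul, dotProduct]
    have h4 := Matrix.dotProduct_mulVec w (incMat lam h l) (fun y => σ y.1 y.2)
    rw [h3, zero_dotProduct] at h4
    exact h4
  simpa [h1] using h2

theorem prod_omegaCls_ne_zero_of_solvable {n r m : ℕ} (hrn : r ≤ n) (hm : n - r = m)
    {I : ι → Fin r → Fin n} (hI : ∀ j, StrictMono (I j)) {L : Type*} [Field L] [Algebra ℚ L]
    (h : ι → Matrix (Fin r) (Fin r) L) (l : ι → Matrix (Fin m) (Fin m) L)
    (hsol : ∀ z : ι → Matrix (Fin m) (Fin r) L, ∃ σ : Matrix (Fin m) (Fin r) L,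
      ∀ j (c : Fin m) t, m ≤ c + lamOf (I j) t → (l j * σ * h j) c t = z j c t) :
    ∏ j, omegaCls (I j) ≠ 0 := by
  classical
  obtain ⟨κ, _, a, hli, hcard⟩ := exists_completion _ (linearIndependent_incMat h l hsol)
  have hbd : ∀ j t, lamOf (I j) t ≤ m := fun j t => hm ▸ lamOf_le (hI j) t
  let lam : ι ⊕ κ → Fin r → ℕ :=
    Sum.elim (fun j => lamOf (I j)) fun _ t => if (t : ℕ) = 0 then 1 else 0
  let h' : ι ⊕ κ → Matrix (Fin r) (Fin r) L :=
    Sum.elim h fun q => Matrix.of fun b _ => if b = (a q).2 then 1 else 0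
  let l' : ι ⊕ κ → Matrix (Fin m) (Fin m) L :=
    Sum.elim l fun q => Matrix.of fun _ c => if c = (a q).1 then 1 else 0
  have hanti : ∀ j, Antitone (lam j) := by
    rintro (j | q)
    · exact lamOf_antitone (hI j)
    · intro s t hst
      change (if (t : ℕ) = 0 then 1 else 0) ≤ if (s : ℕ) = 0 then 1 else 0
      have : (s : ℕ) ≤ t := hst
      split_ifs <;> omega
  have hle : ∀ j t, lam j t ≤ m := by
    rintro (j | q) t
    · exact hbd j t
    · change (if (t : ℕ) = 0 then 1 else 0) ≤ m
      have := (a q).1.2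
      split_ifs <;> omega
  have hcard' : Fintype.card (Cells m lam) = Fintype.card (Fin m × Fin r) := by
    rw [card_cells lam hle, ← hcard, Nat.card_eq_fintype_card,
      card_cells (fun j => lamOf (I j)) hbd, Fintype.sum_sum_type]
    congr 1
    rw [Fintype.card_eq_sum_ones]
    refine Finset.sum_congr rfl fun q _ => ?_
    have hr : 0 < r := (a q).2.pos
    rw [Finset.sum_eq_single (⟨0, hr⟩ : Fin r)]
    · simp [lam]
    · intro t _ ht
      have : (t : ℕ) ≠ 0 := fun h0 => ht (Fin.ext h0)
      simp [lam, this]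
    · simp
  obtain ⟨E⟩ := Fintype.card_eq.1 hcard'
  let ψ : Cells m lam → Cells m (fun j => lamOf (I j)) ⊕ κ := fun x => match x with
    | ⟨(Sum.inl j, c, t), hx⟩ => Sum.inl ⟨(j, c, t), hx⟩
    | ⟨(Sum.inr q, _, _), _⟩ => Sum.inr q
  have hzero : ∀ (q : κ) (c : Fin m) (t : Fin r), m ≤ (c : ℕ) + lam (Sum.inr q) t →
      (t : ℕ) = 0 ∧ (c : ℕ) = m - 1 := by
    intro q c t hx
    have h1 : m ≤ (c : ℕ) + if (t : ℕ) = 0 then 1 else 0 := hx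
    have := c.2
    split_ifs at h1 <;> omega
  have hψ : Function.Injective ψ := by
    rintro ⟨⟨j | q, c, t⟩, hx⟩ ⟨⟨j' | q', c', t'⟩, hx'⟩ hxx
    · have h1 := congrArg Subtype.val (Sum.inl_injective hxx)
      simpa using h1
    · simp [ψ] at hxx
    · simp [ψ] at hxx
    · have h1 : q = q' := by simpa [ψ] using hxx
      have h2 := hzero q c t hx
      have h3 := hzero q' c' t' hx'
      have h4 : t = t' := Fin.ext (by omega)
      have h5 : c = c' := Fin.ext (by omega)
      subst h1 h4 h5
      rfl
  have hrow : LinearIndependent L (fun x => incMat lam h' l' x) := by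
    have h1 := hli.comp ψ hψ
    convert h1 using 1
    ext ⟨⟨j | q, c, t⟩, hx⟩ y
    · rfl
    · simp [incMat, ψ, h', l', Pi.single_apply, Prod.ext_iff, ite_and]
      split_ifs <;> rfl
  have h0 := (schurCoeff_ne_zero_of_theta E hanti hle h' l' (theta_ne_zero E h' l' hrow)).2
  rw [Fintype.prod_sum_type] at h0
  exact prod_omegaCls_ne_zero hrn hI _ (by rw [hm]; exact h0)

end Solvable

/-! ### The destabilizing subspace -/

theorem finrank_eq_finrank_inf_ker_add {L V W : Type*} [Field L] [AddCommGroup V] [Module L V]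
    [FiniteDimensional L V] [AddCommGroup W] [Module L W] (f : V →ₗ[L] W) (P : Submodule L V) :
    finrank L P = finrank L ↥(P ⊓ LinearMap.ker f) + finrank L ↥(P.map f) := by
  have h1 := LinearMap.finrank_range_add_finrank_ker (f.domRestrict P)
  have h2 : LinearMap.range (f.domRestrict P) = P.map f := by
    rw [LinearMap.range_domRestrict]
  have h3 : (LinearMap.ker (f.domRestrict P)).map P.subtype = P ⊓ LinearMap.ker f := by
    ext v
    simp only [Submodule.mem_map, LinearMap.mem_ker, LinearMap.domRestrict_apply, Submodule.mem_inf]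
    constructor
    · rintro ⟨x, hx, rfl⟩
      exact ⟨x.2, hx⟩
    · rintro ⟨h4, h5⟩
      exact ⟨⟨v, h4⟩, h5, rfl⟩
  rw [h2] at h1
  rw [← h3, Submodule.finrank_map_subtype_eq]
  omega

section Destabilizing

variable {ι : Type} [Fintype ι] {r : ℕ} {L : Type} [Field L]

theorem exists_destabilizing (G : ι → Basis (Fin r) L (Fin r → L)) (lam : ι → Fin r → ℕ) (m : ℕ)
    (h : ∃ T : Submodule L (Fin r → L), m * finrank L T < ∑ j, codF (G j) (lam j) m T) :
    ∃ S : Submodule L (Fin r → L), m * finrank L S < ∑ j, codF (G j) (lam j) m S ∧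
      ∀ σ : (Fin r → L) →ₗ[L] (Fin r → L),
        (∀ j u, ∀ v ∈ S ⊓ flagV (G j) (lam j) u, σ v ∈ flagV (G j) (lam j) u ⊔ S) →
        ∀ v ∈ S, σ v ∈ S := by
  have hdim : ∀ T : Submodule L (Fin r → L), finrank L T ≤ r := fun T => by
    have := Submodule.finrank_le T
    rwa [Module.finrank_fintype_fun_eq_card, Fintype.card_fin] at this
  let a : Submodule L (Fin r → L) → ℕ := fun T => ∑ j, codF (G j) (lam j) m T + m * (r - finrank L T)
  let b : Submodule L (Fin r → L) → ℕ := fun T => r - finrank L T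
  let Ψ : Submodule L (Fin r → L) → ℕ := fun T => (r + 1) * a T + b T
  have hbdd : BddAbove (Set.range Ψ) := by
    refine ⟨(r + 1) * (∑ _j : ι, ∑ _u ∈ Finset.range m, r + m * r) + r, ?_⟩
    rintro _ ⟨T, rfl⟩
    refine Nat.add_le_add (Nat.mul_le_mul le_rfl (Nat.add_le_add ?_
      (Nat.mul_le_mul le_rfl (Nat.sub_le _ _)))) (Nat.sub_le _ _)
    exact Finset.sum_le_sum fun j _ => Finset.sum_le_sum fun u _ => hdim _
  obtain ⟨S, hS⟩ := Nat.sSup_mem (Set.range_nonempty Ψ) hbdd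
  have hmax : ∀ T, Ψ T ≤ Ψ S := fun T => by
    rw [hS]
    exact le_csSup hbdd ⟨T, rfl⟩
  have hb : ∀ T, b T ≤ r := fun T => Nat.sub_le _ _
  have haS : ∀ T, a T ≤ a S := by
    intro T
    by_contra hcon
    have h1 : (r + 1) * (a S + 1) ≤ (r + 1) * a T := Nat.mul_le_mul le_rfl (by omega)
    have h2 : (r + 1) * a T + b T ≤ (r + 1) * a S + b S := hmax T
    have h3 := hb S
    rw [Nat.mul_add] at h1
    omega
  refine ⟨S, ?_, fun σ hσ => ?_⟩
  · obtain ⟨T, hT⟩ := h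
    have h1 : ∑ j, codF (G j) (lam j) m T + m * (r - finrank L T) ≤
      ∑ j, codF (G j) (lam j) m S + m * (r - finrank L S) := haS T
    have h2 : m * (r - finrank L T) + m * finrank L T = m * r := by
      rw [← Nat.mul_add, Nat.sub_add_cancel (hdim T)]
    have h3 : m * (r - finrank L S) + m * finrank L S = m * r := by
      rw [← Nat.mul_add, Nat.sub_add_cancel (hdim S)]
    omega
  · let f : (Fin r → L) →ₗ[L] (Fin r → L) ⧸ S := S.mkQ.comp σ
    have hker : LinearMap.ker f = S.comap σ := by
      rw [LinearMap.ker_comp, Submodule.ker_mkQ]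
    set N := S ⊓ S.comap σ with hN
    set T := S ⊔ S.map σ with hT
    have hTS : T ⊓ S = S := inf_eq_right.2 le_sup_left
    have hTN : finrank L T + finrank L N = finrank L S + finrank L S := by
      have h1 := finrank_eq_finrank_inf_ker_add f S
      have h2 := finrank_eq_finrank_inf_ker_add S.mkQ T
      rw [hker, ← hN] at h1
      rw [Submodule.ker_mkQ, hTS] at h2
      have h3 : T.map S.mkQ = S.map f := by
        rw [hT, Submodule.map_sup, Submodule.mkQ_map_self, bot_sup_eq, Submodule.map_comp]
      rw [h3] at h2
      omega
    have hF : ∀ j u, finrank L ↥(S ⊓ flagV (G j) (lam j) u) +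
        finrank L ↥(S ⊓ flagV (G j) (lam j) u) ≤
        finrank L ↥(T ⊓ flagV (G j) (lam j) u) + finrank L ↥(N ⊓ flagV (G j) (lam j) u) := by
      intro j u
      set F := flagV (G j) (lam j) u
      have h1 := finrank_eq_finrank_inf_ker_add f (S ⊓ F)
      have h2 := finrank_eq_finrank_inf_ker_add S.mkQ (T ⊓ F)
      have e1 : S ⊓ F ⊓ S.comap σ = N ⊓ F := by rw [hN, inf_right_comm]
      have e2 : T ⊓ F ⊓ S = S ⊓ F := by rw [inf_right_comm, hTS]
      rw [hker, e1] at h1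
      rw [Submodule.ker_mkQ, e2] at h2
      have h3 : (S ⊓ F).map f ≤ (T ⊓ F).map S.mkQ := by
        rintro _ ⟨v, hv, rfl⟩
        obtain ⟨x, hx, s, hs, hxs⟩ := Submodule.mem_sup.1 (hσ j u v hv)
        refine ⟨x, ⟨?_, hx⟩, ?_⟩
        · have : x = σ v - s := eq_sub_of_add_eq hxs
          rw [this]
          exact Submodule.sub_mem _ (le_sup_right (a := S) ⟨v, hv.1, rfl⟩)
            (le_sup_left (a := S) hs)
        · change S.mkQ x = S.mkQ (σ v)
          rw [← hxs, map_add, (Submodule.Quotient.mk_eq_zero S).2 hs |> fun h => (h :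
            S.mkQ s = 0), add_zero]
      have h4 := Submodule.finrank_mono h3
      omega
    have hcod : ∑ j, codF (G j) (lam j) m S + ∑ j, codF (G j) (lam j) m S ≤
        ∑ j, codF (G j) (lam j) m T + ∑ j, codF (G j) (lam j) m N := by
      rw [← Finset.sum_add_distrib, ← Finset.sum_add_distrib]
      refine Finset.sum_le_sum fun j _ => ?_
      simp only [codF]
      rw [← Finset.sum_add_distrib, ← Finset.sum_add_distrib]
      exact Finset.sum_le_sum fun u _ => hF j u
    have hdS := hdim S
    have hdT := hdim T
    have hdN := hdim N
    have h5 : m * (r - finrank L T) + m * (r - finrank L N) =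
        m * (r - finrank L S) + m * (r - finrank L S) := by
      rw [← Nat.mul_add, ← Nat.mul_add]
      congr 1
      omega
    have h6 : a S + a S ≤ a T + a N := by
      simp only [a]
      omega
    have h7 : a N = a S := by
      have := haS T
      have := haS N
      omega
    have h8 : a T = a S := by
      have := haS T
      have := haS N
      omega
    have h9 : b N ≤ b S := by
      have h10 : (r + 1) * a N + b N ≤ (r + 1) * a S + b S := hmax N
      rw [h7] at h10
      omega
    have h10 : finrank L S ≤ finrank L N := by
      simp only [b] at h9
      omega
    have h11 : N = S := Submodule.eq_of_le_of_finrank_le inf_le_left h10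
    intro v hv
    rw [← h11] at hv
    exact hv.2

end Destabilizing

/-! ### Block frames adapted to a subspace -/

/-- The shuffle of `Fin r` determined by a strictly increasing tuple and its complement. -/
theorem exists_shuffle {d e r : ℕ} (hde : r - d = e) {k : Fin d → Fin r} (hk : StrictMono k) :
    ∃ κ : Fin d ⊕ Fin e ≃ Fin r, (∀ t, κ (Sum.inl t) = k t) ∧
      StrictMono (fun c => κ (Sum.inr c)) ∧
      ∀ t c, κ (Sum.inl t) < κ (Sum.inr c) ↔ e ≤ (c : ℕ) + lamOf k t := by
  classical
  have hdr := le_of_strictMono hk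
  set s : Finset (Fin r) := Finset.univ.image k with hs
  have hcs : s.card = d := by
    rw [hs, Finset.card_image_of_injective _ hk.injective, Finset.card_univ, Fintype.card_fin]
  have hcs' : sᶜ.card = e := by
    rw [Finset.card_compl, hcs, Fintype.card_fin]
    omega
  set κ := finSumEquivOfFinset hcs hcs' with hκ
  have h1 : ∀ t, κ (Sum.inl t) = k t := by
    intro t
    rw [hκ, finSumEquivOfFinset_inl]
    exact (congrFun (Finset.orderEmbOfFin_unique hcs (fun x => Finset.mem_image_of_mem _
      (Finset.mem_univ x)) hk) t).symm
  have h2 : StrictMono (fun c => κ (Sum.inr c)) := by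
    intro c c' hc
    simp only [hκ, finSumEquivOfFinset_inr]
    exact (sᶜ.orderEmbOfFin hcs').strictMono hc
  refine ⟨κ, h1, h2, fun t c => ?_⟩
  have h3 : (k t : ℕ) = t + ((Finset.univ : Finset (Fin e)).filter
      fun c' => κ (Sum.inr c') < k t).card := by
    have h4 : ((Finset.univ : Finset (Fin r)).filter fun b => b < k t).card = k t := by
      rw [Finset.filter_gt_eq_Iio, Fin.card_Iio]
    have h5 : ((Finset.univ : Finset (Fin d)).filter fun t' => k t' < k t).card = t := by
      have : ((Finset.univ : Finset (Fin d)).filter fun t' => k t' < k t) = Finset.Iio t := by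
        ext t'
        simp [hk.lt_iff_lt]
      rw [this, Fin.card_Iio]
    rw [← h4, Finset.card_filter, ← Equiv.sum_comp κ, Fintype.sum_sum_type, ← Finset.card_filter,
      ← Finset.card_filter]
    simp only [h1]
    rw [h5]
  have h6 := lamOf_cast hk t
  have h7 : (k t : ℕ) ≤ e + t := by
    have := Finset.card_le_univ ((Finset.univ : Finset (Fin e)).filter
      fun c' => κ (Sum.inr c') < k t)
    rw [Fintype.card_fin] at this
    omega
  have h8 : lamOf k t = e + t - k t := by rw [lamOf, hde]
  rw [h1, h8]
  constructor
  · intro hlt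
    have h9 : ((Finset.univ : Finset (Fin e)).filter fun c' => κ (Sum.inr c') < k t) ⊆
        Finset.Iio c := by
      intro c' hc'
      rw [Finset.mem_filter] at hc'
      exact Finset.mem_Iio.2 (h2.lt_iff_lt.1 (hc'.2.trans hlt))
    have h10 := Finset.card_le_card h9
    rw [Fin.card_Iio] at h10
    omega
  · intro hle
    by_contra hcon
    have h11 : κ (Sum.inr c) < k t := by
      refine lt_of_le_of_ne (not_lt.1 hcon) fun h0 => ?_
      rw [← h1, EmbeddingLike.apply_eq_iff_eq] at h0
      exact Sum.inr_ne_inl h0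
    have h9 : Finset.Iic c ⊆
        ((Finset.univ : Finset (Fin e)).filter fun c' => κ (Sum.inr c') < k t) := by
      intro c' hc'
      rw [Finset.mem_filter]
      exact ⟨Finset.mem_univ _, (h2.monotone (Finset.mem_Iic.1 hc')).trans_lt h11⟩
    have h10 := Finset.card_le_card h9
    rw [Fin.card_Iic] at h10
    omega

section Frames

variable {ι : Type} {r d e : ℕ} {L : Type} [Field L]

/-- Matrices expressing a tuple of flags (the columns of `g`) in block triangular form with
respect to a fixed basis (the columns of `M`). -/
structure IsFrame (κ : ι → Fin d ⊕ Fin e ≃ Fin r) (g : ι → Matrix (Fin r) (Fin r) L)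
    (M : Matrix (Fin r) (Fin d ⊕ Fin e) L) (N : Matrix (Fin d ⊕ Fin e) (Fin r) L)
    (C : ι → Matrix (Fin r) (Fin d ⊕ Fin e) L) (C' : ι → Matrix (Fin d ⊕ Fin e) (Fin r) L)
    (h : ι → Matrix (Fin d) (Fin d) L) (n : ι → Matrix (Fin d) (Fin e) L)
    (l : ι → Matrix (Fin e) (Fin e) L) : Prop where
  mul_inv : M * N = 1
  inv_mul : N * M = 1
  mul_inv' : ∀ j, C j * C' j = 1
  inv_mul' : ∀ j, C' j * C j = 1
  upper : ∀ j a b, κ j b < a → C j a b = 0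
  upper' : ∀ j a b, a < κ j b → C' j b a = 0
  eq : ∀ j, g j * C j = M * Matrix.fromBlocks (h j) (n j) 0 (l j)

variable {κ : ι → Fin d ⊕ Fin e ≃ Fin r} {g : ι → Matrix (Fin r) (Fin r) L}
  {M : Matrix (Fin r) (Fin d ⊕ Fin e) L} {N : Matrix (Fin d ⊕ Fin e) (Fin r) L}
  {C : ι → Matrix (Fin r) (Fin d ⊕ Fin e) L} {C' : ι → Matrix (Fin d ⊕ Fin e) (Fin r) L}
  {h : ι → Matrix (Fin d) (Fin d) L} {n : ι → Matrix (Fin d) (Fin e) L}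
  {l : ι → Matrix (Fin e) (Fin e) L}

theorem IsFrame.isUnit_det (F : IsFrame κ g M N C C' h n l) (hg : ∀ j, IsUnit (g j).det) (j : ι) :
    IsUnit (h j).det ∧ IsUnit (l j).det := by
  have h1 : Matrix.fromBlocks (h j) (n j) 0 (l j) * (C' j * (g j)⁻¹ * M) = 1 := by
    have h2 : Matrix.fromBlocks (h j) (n j) 0 (l j) = N * (g j * C j) := by
      rw [F.eq, ← Matrix.mul_assoc, F.inv_mul, Matrix.one_mul]
    rw [h2]
    calc N * (g j * C j) * (C' j * (g j)⁻¹ * M)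
        = N * (g j * (C j * C' j) * (g j)⁻¹) * M := by simp only [Matrix.mul_assoc]
      _ = 1 := by
          rw [F.mul_inv', Matrix.mul_one, Matrix.mul_nonsing_inv _ (hg j), Matrix.mul_one,
            F.inv_mul]
  have h3 := Matrix.isUnit_det_of_right_inverse h1
  rw [Matrix.det_fromBlocks_zero₂₁] at h3
  exact IsUnit.mul_iff.1 h3

theorem IsFrame.derivation [Algebra ℚ L] (F : IsFrame κ g M N C C' h n l) (D : Derivation ℚ L L)
    {X : ι → Matrix (Fin r) (Fin r) L} (hD : ∀ j, (g j).map D = X j * g j) :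
    ∃ τ : ι → Matrix (Fin d ⊕ Fin e) (Fin d ⊕ Fin e) L,
      (∀ j b b', κ j b' < κ j b → τ j b b' = 0) ∧
      ∀ j, (N * M.map D).toBlocks₂₁ * h j =
          (N * X j * M).toBlocks₂₁ * h j + l j * (τ j).toBlocks₂₁ ∧
        (N * M.map D).toBlocks₁₁ * h j + (h j).map D =
          (N * X j * M).toBlocks₁₁ * h j + h j * (τ j).toBlocks₁₁ + n j * (τ j).toBlocks₂₁ := by
  refine ⟨fun j => C' j * (C j).map D, fun j b b' hbb => ?_, fun j => ?_⟩
  · change (C' j * (C j).map D) b b' = 0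
    rw [Matrix.mul_apply]
    refine Finset.sum_eq_zero fun a _ => ?_
    by_cases h1 : a < κ j b
    · rw [F.upper' j a b h1, zero_mul]
    · rw [Matrix.map_apply, F.upper j a b' (hbb.trans_le (not_lt.1 h1)), map_zero, mul_zero]
  · set u := Matrix.fromBlocks (h j) (n j) 0 (l j) with hu
    set τ := C' j * (C j).map D with hτ
    have h1 : N * M.map D * u + u.map D = N * X j * M * u + u * τ := by
      have h2 := map_derivation_mul D (g j) (C j)
      rw [F.eq, map_derivation_mul, hD] at h2
      have h3 : u = N * (g j * C j) := by
        rw [F.eq, ← Matrix.mul_assoc, F.inv_mul, Matrix.one_mul]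
      have h4 := congrArg (N * ·) h2
      simp only [Matrix.mul_add] at h4
      have h5 : N * (M * u.map D) = u.map D := by
        rw [← Matrix.mul_assoc, F.inv_mul, Matrix.one_mul]
      have h6 : N * (g j * (C j).map D) = u * τ := by
        have h8 : (C j).map D = C j * (C' j * (C j).map D) := by
          rw [← Matrix.mul_assoc, F.mul_inv', Matrix.one_mul]
        rw [h3, hτ, Matrix.mul_assoc N, Matrix.mul_assoc (g j), ← h8]
      have h7 : N * (X j * g j * C j) = N * X j * M * u := by
        rw [Matrix.mul_assoc (X j), F.eq]
        simp only [Matrix.mul_assoc]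
        rfl
      rw [h5, h6, h7, ← Matrix.mul_assoc] at h4
      exact h4
    have hmap : u.map D = Matrix.fromBlocks ((h j).map D) ((n j).map D) 0 ((l j).map D) := by
      rw [hu, Matrix.fromBlocks_map]
      congr 1
      ext a b
      simp
    rw [← Matrix.fromBlocks_toBlocks (N * M.map D), ← Matrix.fromBlocks_toBlocks (N * X j * M),
      ← Matrix.fromBlocks_toBlocks τ, hmap, hu, Matrix.fromBlocks_multiply,
      Matrix.fromBlocks_multiply, Matrix.fromBlocks_multiply, Matrix.fromBlocks_add,
      Matrix.fromBlocks_add, Matrix.fromBlocks_inj] at h1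
    obtain ⟨e11, -, e21, -⟩ := h1
    simp only [Matrix.mul_zero, Matrix.zero_mul, add_zero, zero_add] at e11 e21
    refine ⟨e21, ?_⟩
    rw [e11, add_assoc]

end Frames

/-! ### Row reduction over a valuation ring -/

section ValuationRing

variable {L : Type} [Field L]

theorem Matrix.mul_entry_mem (O : Subring L) {α β γ : Type} [Fintype β] {A : Matrix α β L}
    {B : Matrix β γ L} (hA : ∀ a b, A a b ∈ O) (hB : ∀ a b, B a b ∈ O) (a : α) (c : γ) :
    (A * B) a c ∈ O := by
  rw [Matrix.mul_apply]
  exact O.sum_mem fun b _ => O.mul_mem (hA a b) (hB b c)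

theorem Matrix.det_mem (O : Subring L) {α : Type} [Fintype α] [DecidableEq α] {A : Matrix α α L}
    (hA : ∀ a b, A a b ∈ O) : A.det ∈ O := by
  rw [Matrix.det_apply]
  exact O.sum_mem fun s _ => by
    rw [Units.smul_def]
    exact O.zsmul_mem (O.prod_mem fun i _ => hA _ _) _

theorem exists_pivot {O : Subring L} (hO : ∀ x : L, x ∈ O ∨ x⁻¹ ∈ O) {α : Type} [Fintype α]
    [Nonempty α] (v : α → L) : ∃ i, ∀ a, ∃ c ∈ O, v a = c * v i := by
  classical
  suffices h : ∀ s : Finset α, s.Nonempty → ∃ i, ∀ a ∈ s, ∃ c ∈ O, v a = c * v i by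
    obtain ⟨i, hi⟩ := h Finset.univ Finset.univ_nonempty
    exact ⟨i, fun a => hi a (Finset.mem_univ a)⟩
  intro s hs
  induction hs using Finset.Nonempty.cons_induction with
  | singleton a => exact ⟨a, fun b hb => ⟨1, O.one_mem, by
      rw [Finset.mem_singleton.1 hb, one_mul]⟩⟩
  | cons a s ha hs ih =>
    obtain ⟨i, hi⟩ := ih
    by_cases h0 : v i = 0
    · refine ⟨a, fun b hb => ?_⟩
      rcases Finset.mem_cons.1 hb with rfl | hb
      · exact ⟨1, O.one_mem, (one_mul _).symm⟩
      · obtain ⟨c, -, h2⟩ := hi b hb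
        exact ⟨0, O.zero_mem, by rw [h2, h0, mul_zero, zero_mul]⟩
    · rcases hO (v a / v i) with h1 | h1
      · refine ⟨i, fun b hb => ?_⟩
        rcases Finset.mem_cons.1 hb with rfl | hb
        · exact ⟨_, h1, (div_mul_cancel₀ _ h0).symm⟩
        · exact hi b hb
      · rw [inv_div] at h1
        by_cases h2 : v a = 0
        · refine ⟨i, fun b hb => ?_⟩
          rcases Finset.mem_cons.1 hb with rfl | hb
          · exact ⟨0, O.zero_mem, by rw [h2, zero_mul]⟩
          · exact hi b hb
        · refine ⟨a, fun b hb => ?_⟩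
          rcases Finset.mem_cons.1 hb with rfl | hb
          · exact ⟨1, O.one_mem, (one_mul _).symm⟩
          · obtain ⟨c, hc, h3⟩ := hi b hb
            exact ⟨c * (v i / v a), O.mul_mem hc h1, by
              rw [h3, mul_assoc, div_mul_cancel₀ _ h2]⟩

/-- Extend a square matrix by a leading `1`. -/
def Matrix.bordered {n : ℕ} (k : Matrix (Fin n) (Fin n) L) :
    Matrix (Fin (n + 1)) (Fin (n + 1)) L :=
  fun a b => Fin.cases (Fin.cases 1 (fun _ => 0) b) (fun a' => Fin.cases 0 (fun b' => k a' b') b) a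

theorem Matrix.bordered_mul {n : ℕ} (k k' : Matrix (Fin n) (Fin n) L) :
    k.bordered * k'.bordered = (k * k').bordered := by
  ext a b
  rw [Matrix.mul_apply, Fin.sum_univ_succ]
  refine Fin.cases ?_ (fun a' => ?_) a <;> refine Fin.cases ?_ (fun b' => ?_) b <;>
    simp [Matrix.bordered, Matrix.mul_apply]

theorem Matrix.bordered_one {n : ℕ} : (1 : Matrix (Fin n) (Fin n) L).bordered = 1 := by
  ext a b
  refine Fin.cases ?_ (fun a' => ?_) a <;> refine Fin.cases ?_ (fun b' => ?_) b <;>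
    simp [Matrix.bordered, Matrix.one_apply, Fin.succ_ne_zero, (Fin.succ_ne_zero _).symm]

/-- The elementary matrix subtracting multiples of row `0` from the others. -/
def Matrix.firstColumn {n : ℕ} (c : Fin (n + 1) → L) : Matrix (Fin (n + 1)) (Fin (n + 1)) L :=
  fun a b => (1 : Matrix (Fin (n + 1)) (Fin (n + 1)) L) a b +
    Fin.cases 0 (fun a' => Fin.cases (c a'.succ) (fun _ => 0) b) a

theorem Matrix.firstColumn_mul_apply {n : ℕ} (c : Fin (n + 1) → L) {β : Type}
    (A : Matrix (Fin (n + 1)) β L) (a : Fin n) (b : β) :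
    (Matrix.firstColumn c * A) a.succ b = A a.succ b + c a.succ * A 0 b := by
  rw [Matrix.mul_apply]
  simp only [Matrix.firstColumn, Fin.cases_succ, add_mul, Finset.sum_add_distrib,
    Matrix.one_apply, ite_mul, one_mul, zero_mul]
  rw [Finset.sum_ite_eq]
  simp [Fin.sum_univ_succ]

theorem Matrix.firstColumn_mul_zero {n : ℕ} (c : Fin (n + 1) → L) {β : Type}
    (A : Matrix (Fin (n + 1)) β L) (b : β) :
    (Matrix.firstColumn c * A) 0 b = A 0 b := by
  rw [Matrix.mul_apply]
  simp [Matrix.firstColumn, Matrix.one_apply]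

theorem Matrix.firstColumn_mul_neg {n : ℕ} (c : Fin (n + 1) → L) :
    Matrix.firstColumn c * Matrix.firstColumn (-c) = 1 := by
  ext a b
  refine Fin.cases ?_ (fun a' => ?_) a
  · rw [Matrix.firstColumn_mul_zero]
    simp [Matrix.firstColumn]
  · rw [Matrix.firstColumn_mul_apply]
    refine Fin.cases ?_ (fun b' => ?_) b <;>
      simp [Matrix.firstColumn, Matrix.one_apply, Fin.succ_ne_zero, (Fin.succ_ne_zero _).symm]

theorem exists_row_reduction {O : Subring L} (hO : ∀ x : L, x ∈ O ∨ x⁻¹ ∈ O) {n : ℕ}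
    (g : Matrix (Fin n) (Fin n) L) : ∃ k k' : Matrix (Fin n) (Fin n) L,
      k * k' = 1 ∧ (∀ a b, k a b ∈ O) ∧ (∀ a b, k' a b ∈ O) ∧
      ∀ a b, b < a → (k' * g) a b = 0 := by
  induction n with
  | zero => exact ⟨1, 1, Matrix.mul_one _, fun a => a.elim0, fun a => a.elim0, fun a => a.elim0⟩
  | succ n ih =>
    obtain ⟨i, hi⟩ := exists_pivot hO fun a => g a 0
    set s := Equiv.swap 0 i with hs
    choose c hc hgc using hi
    set G := Matrix.firstColumn (fun a => -c (s a)) * g.submatrix s id with hG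
    obtain ⟨k, k', h1, h2, h3, h4⟩ := ih (G.submatrix Fin.succ Fin.succ)
    have hG0 : ∀ a : Fin n, G a.succ 0 = 0 := by
      intro a
      rw [hG, Matrix.firstColumn_mul_apply, Matrix.submatrix_apply, Matrix.submatrix_apply, hs,
        Equiv.swap_apply_left, id, ← hs, hgc (s a.succ)]
      ring
    refine ⟨(Matrix.firstColumn (fun a => c (s a)) * k.bordered).submatrix s id,
      (k'.bordered * Matrix.firstColumn (fun a => -c (s a))).submatrix id s, ?_, ?_, ?_, ?_⟩
    · have h5 : k.bordered * (k'.bordered * Matrix.firstColumn fun a => -c (s a)) =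
          Matrix.firstColumn fun a => -c (s a) := by
        rw [← Matrix.mul_assoc, Matrix.bordered_mul, h1, Matrix.bordered_one, Matrix.one_mul]
      have h6 := Matrix.firstColumn_mul_neg (fun a => c (s a))
      have h7 : (-fun a => c (s a)) = fun a => -c (s a) := rfl
      rw [h7] at h6
      rw [← Matrix.submatrix_mul _ _ s id s Function.bijective_id, Matrix.mul_assoc, h5, h6]
      exact Matrix.submatrix_one_equiv s
    · intro a b
      rw [Matrix.submatrix_apply]
      refine Matrix.mul_entry_mem O (fun a b => ?_) (fun a b => ?_) _ _
      · refine O.add_mem ?_ ?_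
        · rw [Matrix.one_apply]
          split_ifs
          exacts [O.one_mem, O.zero_mem]
        · refine Fin.cases O.zero_mem (fun a' => ?_) a
          exact Fin.cases (hc _) (fun _ => O.zero_mem) b
      · exact Fin.cases (Fin.cases O.one_mem (fun _ => O.zero_mem) b)
          (fun a' => Fin.cases O.zero_mem (fun b' => h2 a' b') b) a
    · intro a b
      rw [Matrix.submatrix_apply]
      refine Matrix.mul_entry_mem O (fun a b => ?_) (fun a b => ?_) _ _
      · exact Fin.cases (Fin.cases O.one_mem (fun _ => O.zero_mem) b)
          (fun a' => Fin.cases O.zero_mem (fun b' => h3 a' b') b) a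
      · refine O.add_mem ?_ ?_
        · rw [Matrix.one_apply]
          split_ifs
          exacts [O.one_mem, O.zero_mem]
        · refine Fin.cases O.zero_mem (fun a' => ?_) a
          exact Fin.cases (O.neg_mem (hc _)) (fun _ => O.zero_mem) b
    · have h5 : (k'.bordered * Matrix.firstColumn (fun a => -c (s a))).submatrix id s * g =
          k'.bordered * G := by
        have h6 : g = (g.submatrix s id).submatrix s id := by
          ext a b
          simp [hs]
        conv_lhs => rw [h6]
        rw [Matrix.submatrix_mul_equiv, hG, Matrix.mul_assoc, Matrix.submatrix_id_id]
      intro a b hab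
      rw [h5, Matrix.mul_apply, Fin.sum_univ_succ]
      revert hab
      refine Fin.cases (fun h => absurd h (Fin.not_lt_zero _)) (fun a' => ?_) a
      refine Fin.cases (fun _ => ?_) (fun b' hab => ?_) b
      · simp [Matrix.bordered, hG0]
      · have := h4 a' b' (Fin.succ_lt_succ_iff.1 hab)
        rw [Matrix.mul_apply] at this
        simpa [Matrix.bordered] using this

theorem exists_iwasawa {O : Subring L} (hO : ∀ x : L, x ∈ O ∨ x⁻¹ ∈ O) {n : ℕ}
    {g : Matrix (Fin n) (Fin n) L} (hg : IsUnit g.det) : ∃ β β' k' : Matrix (Fin n) (Fin n) L,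
      β * β' = 1 ∧ (∀ a b, b < a → β a b = 0) ∧ (∀ a b, b < a → β' a b = 0) ∧
      g * β * k' = 1 ∧ (∀ a b, (g * β) a b ∈ O) ∧ (∀ a b, k' a b ∈ O) := by
  obtain ⟨k, k', h1, h2, h3, h4⟩ := exists_row_reduction hO g
  have h5 : k' * k = 1 := mul_eq_one_comm.1 h1
  have h6 : IsUnit (k' * g).det := by
    rw [Matrix.det_mul]
    exact (Matrix.isUnit_det_of_right_inverse h5).mul hg
  have h7 : g * (k' * g)⁻¹ = k := by
    calc g * (k' * g)⁻¹ = k * k' * g * (k' * g)⁻¹ := by rw [h1, Matrix.one_mul]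
      _ = k * (k' * g * (k' * g)⁻¹) := by simp only [Matrix.mul_assoc]
      _ = k := by rw [Matrix.mul_nonsing_inv _ h6, Matrix.mul_one]
  refine ⟨(k' * g)⁻¹, k' * g, k', Matrix.nonsing_inv_mul _ h6, ?_, h4, ?_, ?_, h3⟩
  · let _ : Invertible (k' * g) := Matrix.invertibleOfIsUnitDet _ h6
    have : Matrix.BlockTriangular (k' * g) id := fun a b hab => h4 a b hab
    exact fun a b hab => Matrix.blockTriangular_inv_of_blockTriangular this hab
  · rw [h7, h1]
  · rw [h7]
    exact h2

end ValuationRing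

/-! ### Moving frames -/

section MovingFrames

variable {ι : Type} {r d e : ℕ} {L : Type} [Field L] [Algebra ℚ L]

/-- Over the subring `O`, the flags given by `g` can be moved independently. -/
def HasFlow (g : ι → Matrix (Fin r) (Fin r) L) (O : Subring L) : Prop :=
  ∀ X : ι → Matrix (Fin r) (Fin r) L, (∀ j a b, X j a b ∈ O) →
    ∃ D : Derivation ℚ L L, (∀ j, (g j).map D = X j * g j) ∧ ∀ x ∈ O, D x ∈ O

variable {κ : ι → Fin d ⊕ Fin e ≃ Fin r} {g : ι → Matrix (Fin r) (Fin r) L}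
  {M : Matrix (Fin r) (Fin d ⊕ Fin e) L} {N : Matrix (Fin d ⊕ Fin e) (Fin r) L}
  {C : ι → Matrix (Fin r) (Fin d ⊕ Fin e) L} {C' : ι → Matrix (Fin d ⊕ Fin e) (Fin r) L}
  {h : ι → Matrix (Fin d) (Fin d) L} {n : ι → Matrix (Fin d) (Fin e) L}
  {l : ι → Matrix (Fin e) (Fin e) L} {lam : ι → Fin d → ℕ}

theorem IsFrame.apply_cell (F : IsFrame κ g M N C C' h n l) (hg : ∀ j, IsUnit (g j).det)
    (hcell : ∀ j t c, κ j (Sum.inl t) < κ j (Sum.inr c) ↔ e ≤ (c : ℕ) + lam j t)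
    (D : Derivation ℚ L L) {X : ι → Matrix (Fin r) (Fin r) L}
    (hD : ∀ j, (g j).map D = X j * g j) (j : ι) (c : Fin e) (t : Fin d)
    (hct : e ≤ (c : ℕ) + lam j t) :
    ((l j)⁻¹ * (N * M.map D).toBlocks₂₁ * h j) c t =
      ((l j)⁻¹ * (N * X j * M).toBlocks₂₁ * h j) c t := by
  obtain ⟨τ, h1, h2⟩ := F.derivation D hD
  rw [Matrix.mul_assoc, Matrix.mul_assoc, (h2 j).1, Matrix.mul_add, ← Matrix.mul_assoc _ (l j),
    Matrix.nonsing_inv_mul _ (F.isUnit_det hg j).2, Matrix.one_mul, Matrix.add_apply]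
  have h3 : (τ j).toBlocks₂₁ c t = 0 := h1 j _ _ ((hcell j t c).2 hct)
  rw [h3, add_zero]

omit [Algebra ℚ L] in
theorem IsFrame.conj (F : IsFrame κ g M N C C' h n l)
    (Z : Matrix (Fin d ⊕ Fin e) (Fin d ⊕ Fin e) L) : N * (M * Z * N) * M = Z := by
  rw [Matrix.mul_assoc M, ← Matrix.mul_assoc N, F.inv_mul, Matrix.one_mul, Matrix.mul_assoc,
    F.inv_mul, Matrix.mul_one]

theorem IsFrame.exists_solution (F : IsFrame κ g M N C C' h n l) (hg : ∀ j, IsUnit (g j).det)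
    (hcell : ∀ j t c, κ j (Sum.inl t) < κ j (Sum.inr c) ↔ e ≤ (c : ℕ) + lam j t)
    {O : Subring L} (hO : HasFlow g O) (hM : ∀ a b, M a b ∈ O) (hN : ∀ a b, N a b ∈ O)
    (hh : ∀ j a b, (h j)⁻¹ a b ∈ O) (hl : ∀ j a b, l j a b ∈ O)
    {z : ι → Matrix (Fin e) (Fin d) L} (hz : ∀ j a b, z j a b ∈ O) :
    ∃ σ : Matrix (Fin e) (Fin d) L, (∀ a b, σ a b ∈ O) ∧
      ∀ j (c : Fin e) t, e ≤ (c : ℕ) + lam j t → ((l j)⁻¹ * σ * h j) c t = z j c t := by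
  have h0 : ∀ j a b, (l j * z j * (h j)⁻¹) a b ∈ O := fun j =>
    Matrix.mul_entry_mem O (Matrix.mul_entry_mem O (hl j) (hz j)) (hh j)
  obtain ⟨D, hD, hDO⟩ := hO
    (fun j => M * (Matrix.fromBlocks 0 0 (l j * z j * (h j)⁻¹) 0 :
      Matrix (Fin d ⊕ Fin e) (Fin d ⊕ Fin e) L) * N) (fun j => by
      refine Matrix.mul_entry_mem O (Matrix.mul_entry_mem O hM ?_) hN
      rintro (a | a) (b | b)
      exacts [O.zero_mem, O.zero_mem, h0 j a b, O.zero_mem])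
  refine ⟨(N * M.map D).toBlocks₂₁, fun a b => Matrix.mul_entry_mem O hN
    (fun a b => hDO _ (hM a b)) _ _, fun j c t hct => ?_⟩
  rw [F.apply_cell hg hcell D hD j c t hct]
  obtain ⟨u1, u2⟩ := F.isUnit_det hg j
  have h2 : (l j)⁻¹ * (l j * z j * (h j)⁻¹) * h j = z j := by
    rw [Matrix.mul_assoc, Matrix.mul_assoc (l j * z j), Matrix.nonsing_inv_mul _ u1,
      Matrix.mul_one, ← Matrix.mul_assoc, Matrix.nonsing_inv_mul _ u2, Matrix.one_mul]
  rw [F.conj, Matrix.toBlocks_fromBlocks₂₁, h2]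

theorem IsFrame.exists_dominant (F : IsFrame κ g M N C C' h n l) (hg : ∀ j, IsUnit (g j).det)
    (hcell : ∀ j t c, κ j (Sum.inl t) < κ j (Sum.inr c) ↔ e ≤ (c : ℕ) + lam j t)
    (hinl : ∀ j, StrictMono fun t => κ j (Sum.inl t)) (hO : HasFlow g ⊤)
    (hinj : ∀ σ : Matrix (Fin e) (Fin d) L,
      (∀ j (c : Fin e) t, e ≤ (c : ℕ) + lam j t → ((l j)⁻¹ * σ * h j) c t = 0) → σ = 0)
    (X : ι → Matrix (Fin d) (Fin d) L) : ∃ D : Derivation ℚ L L,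
      ∃ y : Matrix (Fin d) (Fin d) L, ∃ β : ι → Matrix (Fin d) (Fin d) L,
      (∀ j c d, d < c → β j c d = 0) ∧ ∀ j, (h j).map D = (X j - y) * h j + h j * β j := by
  obtain ⟨D, hD, -⟩ := hO (fun j => M * (Matrix.fromBlocks (X j) 0 0 0 :
    Matrix (Fin d ⊕ Fin e) (Fin d ⊕ Fin e) L) * N)
    fun _ _ _ => Subring.mem_top _
  have h0 : (N * M.map D).toBlocks₂₁ = 0 := by
    refine hinj _ fun j c t hct => ?_
    rw [F.apply_cell hg hcell D hD j c t hct, F.conj, Matrix.toBlocks_fromBlocks₂₁, Matrix.mul_zero,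
      Matrix.zero_mul, Matrix.zero_apply]
  obtain ⟨τ, h2, h3⟩ := F.derivation D hD
  refine ⟨D, (N * M.map D).toBlocks₁₁, fun j => (τ j).toBlocks₁₁, fun j a b hab =>
    h2 j _ _ (hinl j hab), fun j => ?_⟩
  obtain ⟨h4, h5⟩ := h3 j
  rw [F.conj, Matrix.toBlocks_fromBlocks₂₁, h0, Matrix.zero_mul, zero_add] at h4
  have h6 : (τ j).toBlocks₂₁ = 0 := by
    rw [← Matrix.one_mul (τ j).toBlocks₂₁, ← Matrix.nonsing_inv_mul _ (F.isUnit_det hg j).2,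
      Matrix.mul_assoc, ← h4, Matrix.mul_zero]
  rw [F.conj, Matrix.toBlocks_fromBlocks₁₁, h6, Matrix.mul_zero, add_zero] at h5
  rw [Matrix.sub_mul, ← sub_eq_zero, ← sub_eq_zero.2 h5]
  abel

omit [Algebra ℚ L] in
/-- Change of frame. -/
theorem IsFrame.change (F : IsFrame κ g M N C C' h n l)
    (hinl : ∀ j, StrictMono fun t => κ j (Sum.inl t))
    (hinr : ∀ j, StrictMono fun c => κ j (Sum.inr c))
    {M₁ : Matrix (Fin r) (Fin d ⊕ Fin e) L} {N₁ : Matrix (Fin d ⊕ Fin e) (Fin r) L}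
    (hMN : M₁ * N₁ = 1) (hNM : N₁ * M₁ = 1) (h21 : (N₁ * M).toBlocks₂₁ = 0)
    {β β' : ι → Matrix (Fin d) (Fin d) L} {γ γ' : ι → Matrix (Fin e) (Fin e) L}
    (hβ : ∀ j, β j * β' j = 1) (hγ : ∀ j, γ j * γ' j = 1)
    (uβ : ∀ j a b, b < a → β j a b = 0) (uβ' : ∀ j a b, b < a → β' j a b = 0)
    (uγ : ∀ j a b, b < a → γ j a b = 0) (uγ' : ∀ j a b, b < a → γ' j a b = 0) :
    IsFrame κ g M₁ N₁ (fun j => C j * Matrix.fromBlocks (β j) 0 0 (γ j))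
      (fun j => Matrix.fromBlocks (β' j) 0 0 (γ' j) * C' j)
      (fun j => (N₁ * M).toBlocks₁₁ * h j * β j)
      (fun j => ((N₁ * M).toBlocks₁₁ * n j + (N₁ * M).toBlocks₁₂ * l j) * γ j)
      (fun j => (N₁ * M).toBlocks₂₂ * l j * γ j) := by
  have h1 : ∀ j, Matrix.fromBlocks (β j) 0 0 (γ j) * Matrix.fromBlocks (β' j) 0 0 (γ' j) = 1 := by
    intro j
    rw [Matrix.fromBlocks_multiply, hβ, hγ]
    simp
  have h2 : ∀ j, Matrix.fromBlocks (β' j) 0 0 (γ' j) * Matrix.fromBlocks (β j) 0 0 (γ j) = 1 :=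
    fun j => mul_eq_one_comm.1 (h1 j)
  have up : ∀ (j : ι) (b : Matrix (Fin d) (Fin d) L) (c : Matrix (Fin e) (Fin e) L),
      (∀ x y, y < x → b x y = 0) → (∀ x y, y < x → c x y = 0) →
      ∀ x y, κ j y < κ j x → Matrix.fromBlocks b 0 0 c x y = 0 := by
    rintro j b c hb hc (x | x) (y | y) hxy
    · exact hb x y ((hinl j).lt_iff_lt.1 hxy)
    · rfl
    · rfl
    · exact hc x y ((hinr j).lt_iff_lt.1 hxy)
  refine ⟨hMN, hNM, fun j => ?_, fun j => ?_, fun j a b hab => ?_, fun j a b hab => ?_, fun j => ?_⟩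
  · rw [Matrix.mul_assoc, ← Matrix.mul_assoc _ _ (C' j), h1, Matrix.one_mul, F.mul_inv']
  · rw [Matrix.mul_assoc, ← Matrix.mul_assoc (C' j), F.inv_mul', Matrix.one_mul, h2]
  · rw [Matrix.mul_apply]
    refine Finset.sum_eq_zero fun x _ => ?_
    by_cases hx : κ j b < κ j x
    · rw [up j _ _ (uβ j) (uγ j) x b hx, mul_zero]
    · rw [F.upper j a x ((not_lt.1 hx).trans_lt hab), zero_mul]
  · rw [Matrix.mul_apply]
    refine Finset.sum_eq_zero fun x _ => ?_
    by_cases hx : κ j x < κ j b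
    · rw [up j _ _ (uβ' j) (uγ' j) b x hx, zero_mul]
    · rw [F.upper' j a x (hab.trans_le (not_lt.1 hx)), mul_zero]
  · have h3 : M = M₁ * (N₁ * M) := by rw [← Matrix.mul_assoc, hMN, Matrix.one_mul]
    have h4 : N₁ * M = Matrix.fromBlocks (N₁ * M).toBlocks₁₁ (N₁ * M).toBlocks₁₂ 0
        (N₁ * M).toBlocks₂₂ := by
      rw [← h21, Matrix.fromBlocks_toBlocks]
    rw [← Matrix.mul_assoc, F.eq]
    conv_lhs => rw [h3, h4]
    rw [Matrix.mul_assoc, Matrix.mul_assoc, Matrix.fromBlocks_multiply,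
      Matrix.fromBlocks_multiply]
    congr 2 <;> simp [Matrix.mul_assoc, Matrix.add_mul]

omit [Algebra ℚ L] in
/-- Over a valuation ring every frame can be made integral. -/
theorem IsFrame.exists_integral (F : IsFrame κ g M N C C' h n l) (hg : ∀ j, IsUnit (g j).det)
    (hinl : ∀ j, StrictMono fun t => κ j (Sum.inl t))
    (hinr : ∀ j, StrictMono fun c => κ j (Sum.inr c)) (hr : d + e = r)
    {O : Subring L} (hO : ∀ x : L, x ∈ O ∨ x⁻¹ ∈ O) :
    ∃ (M₁ : Matrix (Fin r) (Fin d ⊕ Fin e) L) (N₁ : Matrix (Fin d ⊕ Fin e) (Fin r) L)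
      (C₁ : ι → Matrix (Fin r) (Fin d ⊕ Fin e) L) (C₁' : ι → Matrix (Fin d ⊕ Fin e) (Fin r) L)
      (n₁ : ι → Matrix (Fin d) (Fin e) L)
      (P : Matrix (Fin d) (Fin d) L) (Q : Matrix (Fin e) (Fin e) L)
      (β : ι → Matrix (Fin d) (Fin d) L) (γ γ' : ι → Matrix (Fin e) (Fin e) L),
      IsFrame κ g M₁ N₁ C₁ C₁' (fun j => P * h j * β j) n₁ (fun j => Q * l j * γ j) ∧
      (∀ a b, M₁ a b ∈ O) ∧ (∀ a b, N₁ a b ∈ O) ∧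
      (∀ j a b, (P * h j * β j) a b ∈ O) ∧ (∀ j a b, (P * h j * β j)⁻¹ a b ∈ O) ∧
      (∀ j a b, (Q * l j * γ j) a b ∈ O) ∧ (∀ j a b, (Q * l j * γ j)⁻¹ a b ∈ O) ∧
      (∀ j a b, b < a → β j a b = 0) ∧ (∀ j a b, b < a → γ' j a b = 0) ∧
      IsUnit P.det ∧ IsUnit Q.det ∧ (∀ j, γ j * γ' j = 1) := by
  have hM : IsUnit (M.submatrix id (finSumFinEquiv.trans (finCongr hr)).symm).det := by
    refine Matrix.isUnit_det_of_right_inverse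
      (B := N.submatrix (finSumFinEquiv.trans (finCongr hr)).symm id) ?_
    rw [Matrix.submatrix_mul_equiv, F.mul_inv]
    exact Matrix.submatrix_id_id _
  obtain ⟨β₀, β₀', N₀, h1, -, h2, h3, h4, h5⟩ := exists_iwasawa hO hM
  set e₀ : Fin d ⊕ Fin e ≃ Fin r := finSumFinEquiv.trans (finCongr hr) with he₀
  have hlt : ∀ t c, e₀ (Sum.inl t) < e₀ (Sum.inr c) := by
    intro t c
    simp only [he₀, Fin.lt_def, Equiv.trans_apply, finSumFinEquiv_apply_left,
      finSumFinEquiv_apply_right, finCongr_apply, Fin.val_cast, Fin.val_castAdd, Fin.val_natAdd]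
    omega
  set M₁ := (M.submatrix id e₀.symm * β₀).submatrix id e₀ with hM₁
  set N₁ := N₀.submatrix e₀ id with hN₁
  have hMN : M₁ * N₁ = 1 := by
    rw [hM₁, hN₁, Matrix.submatrix_mul_equiv, h3]
    exact Matrix.submatrix_id_id _
  have hNM : N₁ * M₁ = 1 := by
    rw [hM₁, hN₁, ← Matrix.submatrix_mul _ _ e₀ id e₀ Function.bijective_id,
      mul_eq_one_comm.1 h3]
    exact Matrix.submatrix_one_equiv e₀
  have hNM' : N₁ * M = β₀'.submatrix e₀ e₀ := by
    have h6 : M = (M.submatrix id e₀.symm * β₀ * β₀').submatrix id e₀ := by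
      rw [Matrix.mul_assoc, h1, Matrix.mul_one]
      ext a b
      simp
    conv_lhs => rw [h6]
    rw [hN₁, ← Matrix.submatrix_mul _ _ e₀ id e₀ Function.bijective_id, ← Matrix.mul_assoc,
      mul_eq_one_comm.1 h3, Matrix.one_mul]
  have h21 : (N₁ * M).toBlocks₂₁ = 0 := by
    ext c t
    rw [hNM']
    exact h2 _ _ (hlt t c)
  have hdet : IsUnit ((N₁ * M).toBlocks₁₁.det) ∧ IsUnit ((N₁ * M).toBlocks₂₂.det) := by
    have h6 : (N₁ * M) * (N * M₁) = 1 := by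
      rw [Matrix.mul_assoc, ← Matrix.mul_assoc M, F.mul_inv, Matrix.one_mul, hNM]
    have h7 := Matrix.isUnit_det_of_right_inverse h6
    rw [← Matrix.fromBlocks_toBlocks (N₁ * M), h21, Matrix.det_fromBlocks_zero₂₁] at h7
    exact IsUnit.mul_iff.1 h7
  have h8 := fun j => exists_iwasawa hO (g := (N₁ * M).toBlocks₁₁ * h j)
    (by rw [Matrix.det_mul]; exact hdet.1.mul (F.isUnit_det hg j).1)
  have h9 := fun j => exists_iwasawa hO (g := (N₁ * M).toBlocks₂₂ * l j)
    (by rw [Matrix.det_mul]; exact hdet.2.mul (F.isUnit_det hg j).2)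
  choose β β' kh b1 b2 b3 b4 b5 b6 using h8
  choose γ γ' kl c1 c2 c3 c4 c5 c6 using h9
  refine ⟨M₁, N₁, _, _, _, (N₁ * M).toBlocks₁₁, (N₁ * M).toBlocks₂₂, β, γ, γ',
    F.change hinl hinr hMN hNM h21 b1 c1 b2 b3 c2 c3, fun a b => h4 _ _, fun a b => h5 _ _, b5,
    fun j => ?_, c5, fun j => ?_, b2, c3, hdet.1, hdet.2, c1⟩
  · rw [Matrix.inv_eq_right_inv (b4 j)]
    exact b6 j
  · rw [Matrix.inv_eq_right_inv (c4 j)]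
    exact c6 j

end MovingFrames

/-! ### Integrality of the ratio of a highest weight vector to the incidence determinant -/

section Integrality

variable {ι : Type} [Fintype ι] [DecidableEq ι] {r d e : ℕ} {L : Type} [Field L] [Algebra ℚ L]

omit [Fintype ι] [DecidableEq ι] in
theorem evM_mem {O : Subring L} (hQ : ∀ q : ℚ, algebraMap ℚ L q ∈ O)
    {h : ι → Matrix (Fin d) (Fin d) L} (hh : ∀ j a b, h j a b ∈ O) (f : MPoly ι d) :
    evM h f ∈ O := by
  rw [evM]
  induction f using MvPolynomial.induction_on with
  | C q => rw [MvPolynomial.aeval_C]; exact hQ q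
  | add p q hp hq => rw [map_add]; exact O.add_mem hp hq
  | mul_X p s hp => rw [map_mul, MvPolynomial.aeval_X]; exact O.mul_mem hp (hh _ _ _)

omit [Fintype ι] [DecidableEq ι] [Algebra ℚ L] in
theorem theta_mem {O : Subring L} {lam : ι → Fin d → ℕ} (E : Cells e lam ≃ Fin e × Fin d)
    {h : ι → Matrix (Fin d) (Fin d) L} {l : ι → Matrix (Fin e) (Fin e) L}
    (hh : ∀ j a b, h j a b ∈ O) (hl : ∀ j a b, l j a b ∈ O) : theta lam E h l ∈ O :=
  Matrix.det_mem O fun _ _ => O.mul_mem (hl _ _ _) (hh _ _ _)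

omit [Algebra ℚ L] in
theorem theta_inv_mem {O : Subring L} {lam : ι → Fin d → ℕ} (E : Cells e lam ≃ Fin e × Fin d)
    {h : ι → Matrix (Fin d) (Fin d) L} {l : ι → Matrix (Fin e) (Fin e) L}
    (hsol : ∀ z : ι → Matrix (Fin e) (Fin d) L, (∀ j a b, z j a b ∈ O) →
      ∃ σ : Matrix (Fin e) (Fin d) L, (∀ a b, σ a b ∈ O) ∧
      ∀ j (c : Fin e) t, e ≤ (c : ℕ) + lam j t → (l j * σ * h j) c t = z j c t) :
    (theta lam E h l)⁻¹ ∈ O := by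
  have h1 : ∀ y : Fin e × Fin d, ∃ σ : Matrix (Fin e) (Fin d) L, (∀ a b, σ a b ∈ O) ∧
      ∀ x, (incMat lam h l).mulVec (fun p => σ p.1 p.2) (E.symm x) = if x = y then 1 else 0 := by
    intro y
    obtain ⟨σ, hσ, hσ'⟩ := hsol (fun j => Matrix.of fun c t =>
      if (j, c, t) = (E.symm y).1 then 1 else 0) (fun j a b => by
        rw [Matrix.of_apply]
        split_ifs
        exacts [O.one_mem, O.zero_mem])
    refine ⟨σ, hσ, fun x => ?_⟩
    obtain ⟨⟨⟨j, c, t⟩, hx⟩, rfl⟩ := E.surjective x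
    rw [Equiv.symm_apply_apply, incMat_mulVec, hσ' j c t hx, Matrix.of_apply]
    refine if_congr ?_ rfl rfl
    rw [← Equiv.eq_symm_apply, Subtype.ext_iff]
  choose σ hσ hσ' using h1
  have h2 : (incMat lam h l).submatrix E.symm id *
      (Matrix.of fun p y => σ y p.1 p.2 : Matrix (Fin e × Fin d) (Fin e × Fin d) L) = 1 := by
    ext x y
    rw [Matrix.one_apply, ← hσ' y x]
    rfl
  have h3 := congrArg Matrix.det h2
  rw [Matrix.det_mul, Matrix.det_one] at h3
  rw [theta, inv_eq_of_mul_eq_one_right h3]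
  exact Matrix.det_mem O fun p y => hσ y _ _

variable {κ : ι → Fin d ⊕ Fin e ≃ Fin r} {g : ι → Matrix (Fin r) (Fin r) L}
  {M : Matrix (Fin r) (Fin d ⊕ Fin e) L} {N : Matrix (Fin d ⊕ Fin e) (Fin r) L}
  {C : ι → Matrix (Fin r) (Fin d ⊕ Fin e) L} {C' : ι → Matrix (Fin d ⊕ Fin e) (Fin r) L}
  {h : ι → Matrix (Fin d) (Fin d) L} {n : ι → Matrix (Fin d) (Fin e) L}
  {l : ι → Matrix (Fin e) (Fin e) L} {lam : ι → Fin d → ℕ}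

theorem IsFrame.ratio_mem [CharZero L] (F : IsFrame κ g M N C C' h n l)
    (hg : ∀ j, IsUnit (g j).det)
    (hcell : ∀ j t c, κ j (Sum.inl t) < κ j (Sum.inr c) ↔ e ≤ (c : ℕ) + lam j t)
    (hinl : ∀ j, StrictMono fun t => κ j (Sum.inl t))
    (hinr : ∀ j, StrictMono fun c => κ j (Sum.inr c)) (hr : d + e = r)
    (hlam : ∀ j, Antitone (lam j)) (hle : ∀ j t, lam j t ≤ e) {O : Subring L}
    (hO : ∀ x : L, x ∈ O ∨ x⁻¹ ∈ O) (hQ : ∀ q : ℚ, algebraMap ℚ L q ∈ O) (hflow : HasFlow g O)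
    (E : Cells e lam ≃ Fin e × Fin d) (h0 : ι → Matrix (Fin d) (Fin d) ℚ) {f : MPoly ι d}
    (hf : f ∈ hwSpace (fun _ => e) lam) :
    evM h f * theta lam E (fun j => (h0 j).map (algebraMap ℚ L)) (fun j => (l j)⁻¹) /
      theta lam E h (fun j => (l j)⁻¹) ∈ O := by
  obtain ⟨M₁, N₁, C₁, C₁', n₁, P, Q, β, γ, γ', F₁, hM, hN, hh, hh', hl, hl', uβ, uγ', hPd, hQd, hγ⟩ :=
    F.exists_integral hg hinl hinr hr hO
  have hinv : ∀ j, (Q * l j * γ j)⁻¹ = γ' j * ((l j)⁻¹ * Q⁻¹) := by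
    intro j
    rw [Matrix.mul_inv_rev, Matrix.mul_inv_rev, Matrix.inv_eq_right_inv (hγ j)]
  set w : ι → Matrix (Fin e) (Fin e) L := fun j => (l j)⁻¹ with hw
  set hq : ι → Matrix (Fin d) (Fin d) L := fun j => (h0 j).map (algebraMap ℚ L) with hhq
  have hf1 : f ∈ (rowRep ι d).hw fun _ => (e : ℤ) := hf.1
  have hf2 : ∀ j, f ∈ (colRep d j).hw fun a => (lam j a : ℤ) := (mem_iInf _).1 hf.2
  have t1 : (theta lam E (fun j => P * h j * β j) fun j => (Q * l j * γ j)⁻¹)⁻¹ ∈ O :=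
    theta_inv_mem E fun z hz => F₁.exists_solution hg hcell hflow hM hN hh' hl hz
  have t2 : evM (fun j => P * h j * β j) f ∈ O := evM_mem hQ hh f
  have t3 : (theta lam E hq fun j => (Q * l j * γ j)⁻¹) ∈ O :=
    theta_mem E (fun j a b => hQ _) hl'
  have e1 : (theta lam E (fun j => P * h j * β j) fun j => (Q * l j * γ j)⁻¹) =
      (∏ x : Cells e lam, γ' x.1.1 x.1.2.1 x.1.2.1) * (∏ j, ∏ c, β j c c ^ lam j c) *
        (P.det ^ e * Q⁻¹.det ^ d * theta lam E h w) := by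
    simp only [hinv]
    rw [theta_triangular E hlam (fun j => P * h j) β (fun j => w j * Q⁻¹) γ' uβ uγ',
      theta_mul E h w P Q⁻¹, Finset.prod_mul_distrib,
      prod_cells_diag hle fun j t => β j t t]
  have e2 : evM (fun j => P * h j * β j) f =
      (∏ j, ∏ c, β j c c ^ lam j c) * (P.det ^ e * evM h f) := by
    rw [evM_mul_right hf2 (fun j => P * h j) β uβ, evM_mul_left_rect hf1]
  have e3 : (theta lam E hq fun j => (Q * l j * γ j)⁻¹) =
      (∏ x : Cells e lam, γ' x.1.1 x.1.2.1 x.1.2.1) * (Q⁻¹.det ^ d * theta lam E hq w) := by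
    have h1 := theta_triangular E hlam (fun j => hq j) (fun _ => 1) (fun j => w j * Q⁻¹) γ'
      (fun j a b hab => Matrix.one_apply_ne hab.ne') uγ'
    have h2 := theta_mul E hq w 1 Q⁻¹
    simp only [Matrix.det_one, one_pow, one_mul] at h2
    simp only [Matrix.one_apply_eq, mul_one] at h1
    simp only [hinv]
    rw [h1, h2]
  have hΓ : (∏ x : Cells e lam, γ' x.1.1 x.1.2.1 x.1.2.1) ≠ 0 := by
    refine Finset.prod_ne_zero_iff.2 fun x _ => ?_
    have h1 := Matrix.isUnit_det_of_left_inverse (hγ x.1.1)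
    have h2 : (γ' x.1.1).det = ∏ c, γ' x.1.1 c c :=
      Matrix.det_of_isUpperTriangular fun a b hab => uγ' _ a b hab
    rw [h2] at h1
    exact Finset.prod_ne_zero_iff.1 h1.ne_zero _ (Finset.mem_univ _)
  have hB : (∏ j, ∏ c, β j c c ^ lam j c) * P.det ^ e ≠ 0 := by
    refine mul_ne_zero (Finset.prod_ne_zero_iff.2 fun j _ => Finset.prod_ne_zero_iff.2 fun c _ =>
      pow_ne_zero _ ?_) (pow_ne_zero _ hPd.ne_zero)
    have h1 := (F₁.isUnit_det hg j).1
    have h2 : (β j).det = ∏ c, β j c c :=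
      Matrix.det_of_isUpperTriangular fun a b hab => uβ _ a b hab
    rw [Matrix.det_mul, h2] at h1
    exact Finset.prod_ne_zero_iff.1 (IsUnit.mul_iff.1 h1).2.ne_zero _ (Finset.mem_univ _)
  have hQ' : Q⁻¹.det ^ d ≠ 0 := by
    refine pow_ne_zero _ ?_
    rw [Matrix.det_nonsing_inv, Ring.inverse_eq_inv']
    exact inv_ne_zero hQd.ne_zero
  have := O.mul_mem (O.mul_mem t2 t3) t1
  rw [e1, e2, e3] at this
  convert this using 1
  by_cases hθ : theta lam E h w = 0
  · rw [hθ]; simp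
  · generalize evM h f = x at *
    generalize theta lam E h w = y at *
    generalize theta lam E hq w = z at *
    have a1 := left_ne_zero_of_mul hB
    have a2 := right_ne_zero_of_mul hB
    field_simp

end Integrality

/-! ### Valuation rings of a field of rational functions -/

section FunctionField

open MvPolynomial

variable {σ : Type} {L : Type} [Field L] [Algebra ℚ L] [Algebra (MvPolynomial σ ℚ) L]
  [IsScalarTower ℚ (MvPolynomial σ ℚ) L] [IsFractionRing (MvPolynomial σ ℚ) L]

omit [Algebra ℚ L] [IsScalarTower ℚ (MvPolynomial σ ℚ) L] in
theorem algebraMap_ne_zero_of_ne_zero {b : MvPolynomial σ ℚ} (hb : b ≠ 0) : algebraMap (MvPolynomial σ ℚ) L b ≠ 0 := fun h =>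
  hb (IsFractionRing.injective (MvPolynomial σ ℚ) L (h.trans (map_zero _).symm))

variable (L) in
/-- Fractions whose denominator is not divisible by the prime `p`. -/
def primeSubring (p : MvPolynomial σ ℚ) (hp : Prime p) : Subring L where
  carrier := {x | ∃ a b, ¬ p ∣ b ∧ x * algebraMap (MvPolynomial σ ℚ) L b = algebraMap (MvPolynomial σ ℚ) L a}
  mul_mem' := by
    rintro x y ⟨a, b, hb, h1⟩ ⟨a', b', hb', h2⟩
    refine ⟨a * a', b * b', fun h => (hp.dvd_or_dvd h).elim hb hb', ?_⟩
    rw [map_mul, map_mul, ← h1, ← h2]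
    ring
  one_mem' := ⟨1, 1, hp.not_dvd_one, by rw [one_mul]⟩
  add_mem' := by
    rintro x y ⟨a, b, hb, h1⟩ ⟨a', b', hb', h2⟩
    refine ⟨a * b' + b * a', b * b', fun h => (hp.dvd_or_dvd h).elim hb hb', ?_⟩
    rw [map_add, map_mul, map_mul, map_mul, ← h1, ← h2]
    ring
  zero_mem' := ⟨0, 1, hp.not_dvd_one, by rw [zero_mul, map_zero]⟩
  neg_mem' := by
    rintro x ⟨a, b, hb, h1⟩
    exact ⟨-a, b, hb, by rw [map_neg, ← h1, neg_mul]⟩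

omit [Algebra ℚ L] [IsScalarTower ℚ (MvPolynomial σ ℚ) L] [IsFractionRing (MvPolynomial σ ℚ) L] in
theorem algebraMap_mem_primeSubring {p : MvPolynomial σ ℚ} (hp : Prime p) (a : MvPolynomial σ ℚ) :
    algebraMap (MvPolynomial σ ℚ) L a ∈ primeSubring L p hp :=
  ⟨a, 1, hp.not_dvd_one, by rw [map_one, mul_one]⟩

omit [Algebra ℚ L] [IsScalarTower ℚ (MvPolynomial σ ℚ) L] in
theorem primeSubring_valuation {p : MvPolynomial σ ℚ} (hp : Prime p) (x : L) :
    x ∈ primeSubring L p hp ∨ x⁻¹ ∈ primeSubring L p hp := by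
  obtain ⟨a, b, hab, h1⟩ := IsFractionRing.exists_reduced_fraction (A := MvPolynomial σ ℚ) x
  have hb : algebraMap (MvPolynomial σ ℚ) L b ≠ 0 := algebraMap_ne_zero_of_ne_zero (nonZeroDivisors.ne_zero b.2)
  have h2 : x * algebraMap (MvPolynomial σ ℚ) L b = algebraMap (MvPolynomial σ ℚ) L a := by
    rw [← h1, mul_comm, IsLocalization.mk'_spec']
  by_cases h3 : p ∣ (b : MvPolynomial σ ℚ)
  · right
    have h4 : ¬ p ∣ a := fun h => hp.not_isUnit (hab h h3)
    refine ⟨b, a, h4, ?_⟩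
    by_cases hx : x = 0
    · rw [hx, zero_mul] at h2
      have : a = 0 := IsFractionRing.injective (MvPolynomial σ ℚ) L (h2.symm.trans (map_zero _).symm)
      exact absurd (this ▸ dvd_zero p) h4
    · rw [← h2, inv_mul_cancel_left₀ hx]
  · exact Or.inl ⟨a, b, h3, h2⟩

theorem derivation_mem_primeSubring {p : MvPolynomial σ ℚ} (hp : Prime p) (D : Derivation ℚ L L)
    (hD : ∀ s, D (algebraMap (MvPolynomial σ ℚ) L (X s)) ∈ primeSubring L p hp) {x : L} (hx : x ∈ primeSubring L p hp) :
    D x ∈ primeSubring L p hp := by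
  set O := primeSubring L p hp with hO
  have h1 : ∀ a, D (algebraMap (MvPolynomial σ ℚ) L a) ∈ O := by
    intro a
    induction a using MvPolynomial.induction_on with
    | C q =>
      have : algebraMap (MvPolynomial σ ℚ) L (C q) = algebraMap ℚ L q := (IsScalarTower.algebraMap_apply _ _ _ _).symm
      rw [this, Derivation.map_algebraMap]
      exact O.zero_mem
    | add a b ha hb => rw [map_add, map_add]; exact O.add_mem ha hb
    | mul_X a s ha =>
      rw [map_mul, Derivation.leibniz, smul_eq_mul, smul_eq_mul]
      exact O.add_mem (O.mul_mem (algebraMap_mem_primeSubring hp _) (hD s))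
        (O.mul_mem (algebraMap_mem_primeSubring hp _) ha)
  obtain ⟨a, b, hb, h2⟩ := hx
  have hb0 : algebraMap (MvPolynomial σ ℚ) L b ≠ 0 := algebraMap_ne_zero_of_ne_zero fun h => hb (h ▸ dvd_zero p)
  have h3 : (algebraMap (MvPolynomial σ ℚ) L b)⁻¹ ∈ O := ⟨1, b, hb, by rw [inv_mul_cancel₀ hb0, map_one]⟩
  have h4 := congrArg D h2
  rw [Derivation.leibniz, smul_eq_mul, smul_eq_mul] at h4
  have h5 : D x = (algebraMap (MvPolynomial σ ℚ) L b)⁻¹ * (D (algebraMap (MvPolynomial σ ℚ) L a) - x * D (algebraMap (MvPolynomial σ ℚ) L b)) := by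
    rw [← h4]
    field_simp
    ring
  rw [h5]
  exact O.mul_mem h3 (O.sub_mem (h1 a) (O.mul_mem ⟨a, b, hb, h2⟩ (h1 b)))

variable (σ L) in
/-- Fractions of degree at most `k`. -/
def degLE (k : ℕ) : Set L :=
  {x | ∃ a b : MvPolynomial σ ℚ, b ≠ 0 ∧ x * algebraMap (MvPolynomial σ ℚ) L b = algebraMap (MvPolynomial σ ℚ) L a ∧ a.totalDegree ≤ b.totalDegree + k}

omit [Algebra ℚ L] [IsScalarTower ℚ (MvPolynomial σ ℚ) L] [IsFractionRing (MvPolynomial σ ℚ) L] in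
theorem degLE_mul {k k' : ℕ} {x y : L} (hx : x ∈ degLE σ L k) (hy : y ∈ degLE σ L k') :
    x * y ∈ degLE σ L (k + k') := by
  obtain ⟨a, b, hb, h1, h2⟩ := hx
  obtain ⟨a', b', hb', h1', h2'⟩ := hy
  refine ⟨a * a', b * b', mul_ne_zero hb hb', ?_, ?_⟩
  · rw [map_mul, map_mul, ← h1, ← h1']
    ring
  · rw [totalDegree_mul_of_isDomain hb hb']
    have := totalDegree_mul a a'
    omega

omit [Algebra ℚ L] [IsScalarTower ℚ (MvPolynomial σ ℚ) L] [IsFractionRing (MvPolynomial σ ℚ) L] in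
theorem degLE_add {k : ℕ} {x y : L} (hx : x ∈ degLE σ L k) (hy : y ∈ degLE σ L k) :
    x + y ∈ degLE σ L k := by
  obtain ⟨a, b, hb, h1, h2⟩ := hx
  obtain ⟨a', b', hb', h1', h2'⟩ := hy
  refine ⟨a * b' + b * a', b * b', mul_ne_zero hb hb', ?_, ?_⟩
  · rw [map_add, map_mul, map_mul, map_mul, ← h1, ← h1']
    ring
  · rw [totalDegree_mul_of_isDomain hb hb']
    have h3 := totalDegree_mul a b'
    have h4 := totalDegree_mul b a'
    refine (totalDegree_add _ _).trans (max_le ?_ ?_) <;> omega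

omit [Algebra ℚ L] [IsScalarTower ℚ (MvPolynomial σ ℚ) L] [IsFractionRing (MvPolynomial σ ℚ) L] in
theorem degLE_mono {k k' : ℕ} (h : k ≤ k') {x : L} (hx : x ∈ degLE σ L k) : x ∈ degLE σ L k' := by
  obtain ⟨a, b, hb, h1, h2⟩ := hx
  exact ⟨a, b, hb, h1, by omega⟩

omit [Algebra ℚ L] [IsScalarTower ℚ (MvPolynomial σ ℚ) L] [IsFractionRing (MvPolynomial σ ℚ) L] in
theorem algebraMap_mem_degLE (a : MvPolynomial σ ℚ) : algebraMap (MvPolynomial σ ℚ) L a ∈ degLE σ L a.totalDegree :=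
  ⟨a, 1, one_ne_zero, by rw [map_one, mul_one], by omega⟩

variable (σ L) in
/-- Fractions of degree at most `0`. -/
def degSubring : Subring L where
  carrier := degLE σ L 0
  mul_mem' := fun hx hy => degLE_mul hx hy
  one_mem' := ⟨1, 1, one_ne_zero, by rw [one_mul], le_rfl⟩
  add_mem' := fun hx hy => degLE_add hx hy
  zero_mem' := ⟨0, 1, one_ne_zero, by rw [zero_mul, map_zero], by simp⟩
  neg_mem' := by
    rintro x ⟨a, b, hb, h1, h2⟩
    exact ⟨-a, b, hb, by rw [map_neg, ← h1, neg_mul], by rwa [totalDegree_neg]⟩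

omit [Algebra ℚ L] [IsScalarTower ℚ (MvPolynomial σ ℚ) L] in
theorem degSubring_valuation (x : L) : x ∈ degSubring σ L ∨ x⁻¹ ∈ degSubring σ L := by
  by_cases hx : x = 0
  · rw [hx]
    exact Or.inl (degSubring σ L).zero_mem
  obtain ⟨a, b, hb, h1⟩ := IsFractionRing.div_surjective (MvPolynomial σ ℚ) x
  have hb1 : b ≠ 0 := nonZeroDivisors.ne_zero hb
  have hb0 : algebraMap (MvPolynomial σ ℚ) L b ≠ 0 := algebraMap_ne_zero_of_ne_zero hb1
  have h2 : x * algebraMap (MvPolynomial σ ℚ) L b = algebraMap (MvPolynomial σ ℚ) L a := by rw [← h1, div_mul_cancel₀ _ hb0]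
  rcases le_total a.totalDegree b.totalDegree with h3 | h3
  · exact Or.inl ⟨a, b, hb1, h2, h3⟩
  · refine Or.inr ⟨b, a, ?_, by rw [← h2, inv_mul_cancel_left₀ hx], h3⟩
    rintro rfl
    rw [map_zero] at h2
    exact (mul_ne_zero hx hb0) h2

omit [IsFractionRing (MvPolynomial σ ℚ) L] in
theorem algebraMap_rat_mem_degLE (q : ℚ) : algebraMap ℚ L q ∈ degLE σ L 0 := by
  have h := algebraMap_mem_degLE (L := L) (C q : MvPolynomial σ ℚ)
  rw [totalDegree_C] at h
  have h2 : algebraMap ℚ L q = algebraMap (MvPolynomial σ ℚ) L (C q) := IsScalarTower.algebraMap_apply ℚ (MvPolynomial σ ℚ) L q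
  rwa [h2]

omit [IsFractionRing (MvPolynomial σ ℚ) L] in
theorem derivation_mem_degSubring (D : Derivation ℚ L L)
    (hD : ∀ s, D (algebraMap (MvPolynomial σ ℚ) L (X s)) ∈ degLE σ L 1) {x : L} (hx : x ∈ degSubring σ L) :
    D x ∈ degSubring σ L := by
  classical
  have h1 : ∀ (k : ℕ) (m : σ →₀ ℕ) (q : ℚ), m.degree = k →
      D (algebraMap (MvPolynomial σ ℚ) L (monomial m q)) ∈ degLE σ L k := by
    intro k
    induction k with
    | zero =>
      intro m q hm
      rw [Finsupp.degree_eq_zero_iff] at hm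
      have : algebraMap (MvPolynomial σ ℚ) L (monomial m q) = algebraMap ℚ L q := by
        rw [hm]
        exact (IsScalarTower.algebraMap_apply ℚ (MvPolynomial σ ℚ) L q).symm
      rw [this, Derivation.map_algebraMap]
      exact (degSubring σ L).zero_mem
    | succ k ih =>
      intro m q hm
      obtain ⟨s, hs⟩ : ∃ s, m s ≠ 0 := by
        by_contra hcon
        push Not at hcon
        rw [(Finsupp.ext hcon : m = 0), map_zero] at hm
        omega
      have h2 : m = (m - Finsupp.single s 1) + Finsupp.single s 1 := by
        rw [tsub_add_cancel_of_le]
        exact Finsupp.single_le_iff.2 (Nat.one_le_iff_ne_zero.2 hs)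
      set m' := m - Finsupp.single s 1 with hm'
      have h3 : m'.degree = k := by
        rw [h2, map_add, Finsupp.degree_single] at hm
        omega
      have h4 : monomial m q = monomial m' q * X s := by
        rw [X, monomial_mul, ← h2, mul_one]
      rw [h4, map_mul, Derivation.leibniz, smul_eq_mul, smul_eq_mul]
      refine degLE_add (degLE_mul (degLE_mono ?_ (algebraMap_mem_degLE _)) (hD s)) ?_
      · by_cases hq : q = 0
        · rw [hq, map_zero, totalDegree_zero]; omega
        · rw [totalDegree_monomial _ hq, ← h3]
          rfl
      · rw [add_comm]
        refine degLE_mul (degLE_mono ?_ (algebraMap_mem_degLE _)) (ih m' q h3)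
        rw [totalDegree_X]
  have h2 : ∀ a, D (algebraMap (MvPolynomial σ ℚ) L a) ∈ degLE σ L a.totalDegree := by
    intro a
    have h3 : ∀ s : Finset (σ →₀ ℕ), s ⊆ a.support →
        D (algebraMap (MvPolynomial σ ℚ) L (∑ m ∈ s, monomial m (coeff m a))) ∈ degLE σ L a.totalDegree := by
      intro s
      induction s using Finset.induction_on with
      | empty =>
        intro _
        rw [Finset.sum_empty, map_zero, map_zero]
        exact degLE_mono (Nat.zero_le _) (degSubring σ L).zero_mem
      | insert m s hm ih =>
        intro hs
        rw [Finset.sum_insert hm, map_add, map_add]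
        refine degLE_add (degLE_mono ?_ (h1 _ m _ rfl)) (ih ((Finset.subset_insert _ _).trans hs))
        exact le_totalDegree (hs (Finset.mem_insert_self _ _))
    have h4 := h3 a.support subset_rfl
    rwa [← as_sum a] at h4
  obtain ⟨a, b, hb, h3, h4⟩ := hx
  have h5 := congrArg D h3
  rw [Derivation.leibniz, smul_eq_mul, smul_eq_mul] at h5
  have h6 : algebraMap (MvPolynomial σ ℚ) L b * D x ∈ degLE σ L b.totalDegree := by
    have h7 : algebraMap (MvPolynomial σ ℚ) L b * D x = D (algebraMap (MvPolynomial σ ℚ) L a) + (algebraMap ℚ L (-1) * x) * D (algebraMap (MvPolynomial σ ℚ) L b) := by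
      rw [← h5, map_neg, map_one]
      ring
    rw [h7]
    refine degLE_add (degLE_mono h4 (h2 a)) ?_
    have := degLE_mul (degLE_mul (algebraMap_rat_mem_degLE (σ := σ) (-1)) ⟨a, b, hb, h3, h4⟩) (h2 b)
    rwa [zero_add, zero_add] at this
  obtain ⟨p, q, hq, h7, h8⟩ := h6
  refine ⟨p, b * q, mul_ne_zero hb hq, ?_, ?_⟩
  · rw [← h7, map_mul]
    ring
  · rw [totalDegree_mul_of_isDomain hb hq]
    omega

/-- An element integral at all primes and at infinity is constant. -/
theorem exists_rat_of_mem {x : L} (h : ∀ p (hp : Prime p), x ∈ primeSubring (σ := σ) L p hp)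
    (h' : x ∈ degSubring σ L) : ∃ q : ℚ, x = algebraMap ℚ L q := by
  classical
  obtain ⟨a, b, hab, h1⟩ := IsFractionRing.exists_reduced_fraction (A := MvPolynomial σ ℚ) x
  have hb1 : (b : MvPolynomial σ ℚ) ≠ 0 := nonZeroDivisors.ne_zero b.2
  have hb : algebraMap (MvPolynomial σ ℚ) L b ≠ 0 := algebraMap_ne_zero_of_ne_zero hb1
  have h2 : x * algebraMap (MvPolynomial σ ℚ) L b = algebraMap (MvPolynomial σ ℚ) L a := by
    rw [← h1, mul_comm, IsLocalization.mk'_spec']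
  have inj := IsFractionRing.injective (MvPolynomial σ ℚ) L
  have hu : IsUnit (b : MvPolynomial σ ℚ) := by
    by_contra hu
    obtain ⟨p, hp, hpb⟩ := WfDvdMonoid.exists_irreducible_factor hu hb1
    have hp := hp.prime
    obtain ⟨a', b', hb', h3⟩ := h p hp
    have h4 : a * b' = a' * b := by
      apply inj
      rw [map_mul, map_mul, ← h2, ← h3]
      ring
    have h5 : p ∣ a * b' := h4 ▸ hpb.mul_left a'
    exact hp.not_isUnit (hab ((hp.dvd_or_dvd h5).resolve_right hb') hpb)
  obtain ⟨u, hu⟩ := hu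
  have h3 : x = algebraMap (MvPolynomial σ ℚ) L (a * ↑u⁻¹) := by
    rw [map_mul, ← h2, ← hu, mul_assoc, ← map_mul, Units.mul_inv, map_one, mul_one]
  set P := a * (↑u⁻¹ : MvPolynomial σ ℚ) with hP
  obtain ⟨a', b', hb', h4, h5⟩ := h'
  rw [h3, ← map_mul] at h4
  have h6 := inj h4
  have h7 : P.totalDegree = 0 := by
    by_cases hP0 : P = 0
    · rw [hP0, totalDegree_zero]
    · rw [← h6, totalDegree_mul_of_isDomain hP0 hb'] at h5
      omega
  rw [totalDegree_eq_zero_iff_eq_C] at h7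
  refine ⟨coeff 0 P, ?_⟩
  rw [h3, h7, IsScalarTower.algebraMap_apply ℚ (MvPolynomial σ ℚ) L, algebraMap_eq, coeff_C,
    if_pos rfl]

variable {ι : Type} {r : ℕ} {v : ι × Fin r × Fin r → σ}

theorem exists_flow (hv : Function.Injective v) (X' : ι → Matrix (Fin r) (Fin r) L) :
    ∃ D : Derivation ℚ L L,
      (∀ j, Matrix.map (Matrix.of fun a b => algebraMap (MvPolynomial σ ℚ) L (X (v (j, a, b)))) D =
        X' j * Matrix.of fun a b => algebraMap (MvPolynomial σ ℚ) L (X (v (j, a, b)))) ∧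
      ∀ s, D (algebraMap (MvPolynomial σ ℚ) L (X s)) = 0 ∨
        ∃ j a b, D (algebraMap (MvPolynomial σ ℚ) L (X s)) = ∑ c, X' j a c * algebraMap (MvPolynomial σ ℚ) L (X (v (j, c, b))) := by
  obtain ⟨D, hD⟩ := exists_derivation (σ := σ) (Function.extend v
    (fun q => ∑ c, X' q.1 q.2.1 c * algebraMap (MvPolynomial σ ℚ) L (X (v (q.1, c, q.2.2)))) 0)
  refine ⟨D, fun j => ?_, fun s => ?_⟩
  · ext a b
    rw [Matrix.map_apply, Matrix.of_apply, hD, hv.extend_apply, Matrix.mul_apply]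
    rfl
  · rw [hD]
    by_cases hs : ∃ q, v q = s
    · obtain ⟨⟨j, a, b⟩, rfl⟩ := hs
      exact Or.inr ⟨j, a, b, by rw [hv.extend_apply]⟩
    · exact Or.inl (Function.extend_apply' _ _ _ hs)

theorem hasFlow_top (hv : Function.Injective v) :
    HasFlow (fun j => Matrix.of fun a b => algebraMap (MvPolynomial σ ℚ) L (X (v (j, a, b)))) ⊤ := fun X' _ => by
  obtain ⟨D, h1, -⟩ := exists_flow hv X'
  exact ⟨D, h1, fun _ _ => Subring.mem_top _⟩

theorem hasFlow_primeSubring (hv : Function.Injective v) {p : MvPolynomial σ ℚ} (hp : Prime p) :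
    HasFlow (fun j => Matrix.of fun a b => algebraMap (MvPolynomial σ ℚ) L (X (v (j, a, b)))) (primeSubring L p hp) := by
  intro X' hX
  obtain ⟨D, h1, h2⟩ := exists_flow hv X'
  refine ⟨D, h1, fun x hx => derivation_mem_primeSubring hp D (fun s => ?_) hx⟩
  rcases h2 s with h3 | ⟨j, a, b, h3⟩ <;> rw [h3]
  · exact Subring.zero_mem _
  · exact Subring.sum_mem _ fun c _ =>
      Subring.mul_mem _ (hX j a c) (algebraMap_mem_primeSubring hp _)

theorem hasFlow_degSubring (hv : Function.Injective v) :
    HasFlow (fun j => Matrix.of fun a b => algebraMap (MvPolynomial σ ℚ) L (X (v (j, a, b)))) (degSubring σ L) := by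
  intro X' hX
  obtain ⟨D, h1, h2⟩ := exists_flow hv X'
  refine ⟨D, h1, fun x hx => derivation_mem_degSubring D (fun s => ?_) hx⟩
  rcases h2 s with h3 | ⟨j, a, b, h3⟩ <;> rw [h3]
  · exact degLE_mono (Nat.zero_le _) (degSubring σ L).zero_mem
  · have key : ∀ t : Finset (Fin r),
        ∑ c ∈ t, X' j a c * algebraMap (MvPolynomial σ ℚ) L (X (v (j, c, b))) ∈ degLE σ L 1 := by
      intro t
      induction t using Finset.induction_on with
      | empty => exact degLE_mono (Nat.zero_le _) (degSubring σ L).zero_mem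
      | insert c t hc ih =>
        rw [Finset.sum_insert hc]
        refine degLE_add ?_ ih
        have h4 := degLE_mul (hX j a c) (algebraMap_mem_degLE (L := L) (X (v (j, c, b))))
        rwa [totalDegree_X, zero_add] at h4
    exact key Finset.univ

end FunctionField

/-! ### Rigid frames and the class of a point -/

section Rigid

open MvPolynomial

variable {ι : Type} {r d e : ℕ}

theorem exists_rat_theta_ne_zero {L : Type} [Field L] [Algebra ℚ L] [CharZero L] [Fintype ι] [DecidableEq ι]
    {lam : ι → Fin d → ℕ}
    (E : Cells e lam ≃ Fin e × Fin d) (h : ι → Matrix (Fin d) (Fin d) L)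
    (l : ι → Matrix (Fin e) (Fin e) L) (hne : theta lam E h l ≠ 0) :
    ∃ h0 : ι → Matrix (Fin d) (Fin d) ℚ,
      theta lam E (fun j => (h0 j).map (algebraMap ℚ L)) l ≠ 0 := by
  let P : MvPolynomial (ι × Fin d × Fin d) L := theta lam E
    (fun j => Matrix.of fun a b => X (j, a, b)) (fun j => (l j).map C)
  have h1 : ∀ x : ι → Matrix (Fin d) (Fin d) L,
      eval (fun s => x s.1 s.2.1 s.2.2) P = theta lam E x l := by
    intro x
    refine (map_theta E (eval fun s : ι × Fin d × Fin d => x s.1 s.2.1 s.2.2) _ _).trans ?_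
    congr 1
    · ext j a b
      simp
    · ext j a b
      simp
  have hP : P ≠ 0 := by
    intro h0
    rw [← h1 h, h0, map_zero] at hne
    exact hne rfl
  by_contra! hcon
  refine hP (MvPolynomial.funext_set (fun _ => Set.range (algebraMap ℚ L))
    (fun _ => Set.infinite_range_of_injective (algebraMap ℚ L).injective) fun x hx => ?_)
  have h2 : ∀ s, ∃ q : ℚ, algebraMap ℚ L q = x s := fun s => hx s (Set.mem_univ s)
  choose q hq using h2
  have h3 := hcon fun j => Matrix.of fun a b => q (j, a, b)
  rw [map_zero, ← h3, ← h1]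
  congr 1
  congr 1
  ext s
  exact (hq s).symm

variable {σ : Type} {L : Type} [Field L] [Algebra ℚ L] [Algebra (MvPolynomial σ ℚ) L]
  [IsScalarTower ℚ (MvPolynomial σ ℚ) L] [IsFractionRing (MvPolynomial σ ℚ) L]

variable (L) in
/-- The tuple of square matrices of independent variables. -/
def genMat (v : ι × Fin r × Fin r → σ) (j : ι) : Matrix (Fin r) (Fin r) L :=
  Matrix.of fun a b => algebraMap (MvPolynomial σ ℚ) L (X (v (j, a, b)))

omit [Algebra ℚ L] [IsScalarTower ℚ (MvPolynomial σ ℚ) L] in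
theorem isUnit_det_genMat {v : ι × Fin r × Fin r → σ} (hv : Function.Injective v) (j : ι) :
    IsUnit (genMat L v j).det := by
  rw [isUnit_iff_ne_zero]
  let φ : MvPolynomial (Fin r × Fin r) ℚ →+* L :=
    (algebraMap (MvPolynomial σ ℚ) L).comp (rename fun p => v (j, p)).toRingHom
  have hφ : Function.Injective φ := (IsFractionRing.injective (MvPolynomial σ ℚ) L).comp
    (rename_injective _ fun p q hpq => (Prod.ext_iff.1 (hv hpq)).2)
  have h1 : genMat L v j = φ.mapMatrix (Matrix.mvPolynomialX (Fin r) (Fin r) ℚ) := by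
    ext a b
    simp [genMat, φ]
  rw [h1, ← RingHom.map_det]
  exact fun h0 => Matrix.det_mvPolynomialX_ne_zero (Fin r) ℚ (hφ (h0.trans (map_zero _).symm))

variable [Fintype ι] [DecidableEq ι] {κ : ι → Fin d ⊕ Fin e ≃ Fin r}
  {v : ι × Fin r × Fin r → σ}
  {M : Matrix (Fin r) (Fin d ⊕ Fin e) L} {N : Matrix (Fin d ⊕ Fin e) (Fin r) L}
  {C : ι → Matrix (Fin r) (Fin d ⊕ Fin e) L} {C' : ι → Matrix (Fin d ⊕ Fin e) (Fin r) L}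
  {h : ι → Matrix (Fin d) (Fin d) L} {n : ι → Matrix (Fin d) (Fin e) L}
  {l : ι → Matrix (Fin e) (Fin e) L} {lam : ι → Fin d → ℕ}

theorem IsFrame.rigid (F : IsFrame κ (genMat L v) M N C C' h n l) (hv : Function.Injective v)
    (hcell : ∀ j t c, κ j (Sum.inl t) < κ j (Sum.inr c) ↔ e ≤ (c : ℕ) + lam j t)
    (hinl : ∀ j, StrictMono fun t => κ j (Sum.inl t))
    (hinr : ∀ j, StrictMono fun c => κ j (Sum.inr c)) (hr : d + e = r)
    (hlam : ∀ j, Antitone (lam j)) (hle : ∀ j t, lam j t ≤ e)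
    (hinj : ∀ σ : Matrix (Fin e) (Fin d) L,
      (∀ j (c : Fin e) t, e ≤ (c : ℕ) + lam j t → ((l j)⁻¹ * σ * h j) c t = 0) → σ = 0) :
    ∑ j, ∑ t, lam j t = d * e ∧ schurCoeff d (∏ j, schurP (lam j)) (fun _ => e) = 1 := by
  have : CharZero L := algebraRat.charZero L
  have hg := isUnit_det_genMat (L := L) hv
  have hli : LinearIndependent L (fun x => incMat lam h (fun j => (l j)⁻¹) x) := by
    refine linearIndependent_incMat h _ fun z => ?_
    obtain ⟨τ, -, hτ⟩ := F.exists_solution hg hcell (O := ⊤) (hasFlow_top hv)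
      (fun _ _ => Subring.mem_top _) (fun _ _ => Subring.mem_top _)
      (fun _ _ _ => Subring.mem_top _) (fun _ _ _ => Subring.mem_top _) (z := z)
      (fun _ _ _ => Subring.mem_top _)
    exact ⟨τ, hτ⟩
  have hcard : Fintype.card (Cells e lam) = Fintype.card (Fin e × Fin d) := by
    refine le_antisymm ?_ ?_
    · have := hli.fintype_card_le_finrank
      rwa [Module.finrank_fintype_fun_eq_card] at this
    · have h1 : Function.Injective (incMat lam h fun j => (l j)⁻¹).mulVecLin := by
        rw [injective_iff_map_eq_zero]
        intro w hw
        have h2 := hinj (Matrix.of fun a b => w (a, b)) fun j c t hct => by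
          rw [← incMat_mulVec lam h (fun j => (l j)⁻¹) (Matrix.of fun a b => w (a, b))
            ⟨(j, c, t), hct⟩]
          exact congrFun hw _
        ext ⟨a, b⟩
        exact congrFun (congrFun h2 a) b
      have h3 := LinearMap.finrank_le_finrank_of_injective h1
      rwa [Module.finrank_fintype_fun_eq_card, Module.finrank_fintype_fun_eq_card] at h3
  have E : Cells e lam ≃ Fin e × Fin d := Fintype.equivOfCardEq hcard
  have hθ := theta_ne_zero E h (fun j => (l j)⁻¹) hli
  obtain ⟨h0, hh0⟩ := exists_rat_theta_ne_zero E h _ hθ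
  obtain ⟨⟨l0, hl0⟩, hne⟩ := schurCoeff_ne_zero_of_theta E hlam hle h _ hθ
  have hratio : ∀ f : MPoly ι d, f ∈ hwSpace (fun _ => e) lam → ∃ q : ℚ,
      evM h f * theta lam E (fun j => (h0 j).map (algebraMap ℚ L)) (fun j => (l j)⁻¹) /
        theta lam E h (fun j => (l j)⁻¹) = algebraMap ℚ L q := by
    intro f hf
    refine exists_rat_of_mem (σ := σ) (fun p hp => ?_) ?_
    · refine F.ratio_mem hg hcell hinl hinr hr hlam hle (primeSubring_valuation hp) (fun q => ?_)
        (hasFlow_primeSubring hv hp) E h0 hf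
      rw [IsScalarTower.algebraMap_apply ℚ (MvPolynomial σ ℚ) L]
      exact algebraMap_mem_primeSubring hp _
    · exact F.ratio_mem hg hcell hinl hinr hr hlam hle degSubring_valuation
        algebraMap_rat_mem_degLE (hasFlow_degSubring hv) E h0 hf
  have hzero : ∀ f : MPoly ι d, f ∈ hwSpace (fun _ => e) lam → evM h f = 0 → f = 0 := by
    intro f hf hf0
    refine eq_zero_of_dominant h (fun j => (F.isUnit_det hg j).1)
      (F.exists_dominant hg hcell hinl (hasFlow_top hv) hinj) (lam := lam)
      ((mem_iInf _).1 hf.2) fun A => ?_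
    rw [evM_mul_left_rect hf.1, hf0, mul_zero]
  have hev : ∀ (q : ℚ) (f : MPoly ι d), evM h (q • f) = algebraMap ℚ L q * evM h f := by
    intro q f
    rw [evM, map_smul, Algebra.smul_def]
    rfl
  have hmem := thetaPoly_mem E hlam hle l0
  have hone : finrank ℚ ↥(hwSpace (ι := ι) (fun _ : Fin d => e) lam) ≤ 1 := by
    obtain ⟨q0, hq0⟩ := hratio _ hmem
    have hq0' : q0 ≠ 0 := by
      rintro rfl
      rw [map_zero, div_eq_zero_iff, mul_eq_zero] at hq0
      rcases hq0 with (h1 | h1) | h1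
      exacts [hl0 (hzero _ hmem h1), hh0 h1, hθ h1]
    refine finrank_le_one (⟨thetaPoly E l0, hmem⟩ : ↥(hwSpace (fun _ : Fin d => e) lam))
      fun ⟨f, hf⟩ => ?_
    obtain ⟨q, hq⟩ := hratio f hf
    refine ⟨q / q0, Subtype.ext ?_⟩
    change (q / q0) • thetaPoly E l0 = f
    rw [← sub_eq_zero]
    refine hzero _ (Submodule.sub_mem _ (Submodule.smul_mem _ _ hmem) hf) ?_
    have h1 : evM h ((q / q0) • thetaPoly E l0 - f) =
        evM h ((q / q0) • thetaPoly E l0) - evM h f := map_sub _ _ _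
    have h2 : algebraMap ℚ L q0 ≠ 0 := by
      rwa [Ne, map_eq_zero]
    rw [h1, hev, map_div₀, sub_eq_zero]
    rw [div_eq_iff hθ] at hq hq0
    apply mul_right_cancel₀ hh0
    rw [hq, mul_assoc, hq0, ← mul_assoc, div_mul_cancel₀ _ h2]
  refine ⟨?_, ?_⟩
  · rw [← card_cells lam hle, hcard, Fintype.card_prod, Fintype.card_fin, Fintype.card_fin,
      mul_comm]
  · have h1 := finrank_hwSpace (nu := fun _ : Fin d => e) (fun _ _ _ => le_rfl) hlam
    rw [← h1] at hne ⊢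
    have : finrank ℚ ↥(hwSpace (ι := ι) (fun _ : Fin d => e) lam) ≠ 0 := by exact_mod_cast hne
    exact_mod_cast le_antisymm hone (Nat.one_le_iff_ne_zero.2 this)

end Rigid

/-! ### Unstable generic flags -/

section Unstable

variable {ι : Type} {r d e : ℕ} {L : Type} [Field L]

/-- The frame attached to a subspace and bases adapted to it. -/
theorem exists_isFrame (G : ι → Basis (Fin r) L (Fin r → L))
    (f : ι → Basis (Fin r) L (Fin r → L)) (S : Submodule L (Fin r → L)) (K : ι → Finset (Fin r))
    (hA : ∀ j, IsAdapted (G j) (f j) S (K j)) (hK : ∀ j, (K j).card = d) (j0 : ι)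
    (κ : ι → Fin d ⊕ Fin e ≃ Fin r)
    (hκ : ∀ j t, κ j (Sum.inl t) = (K j).orderEmbOfFin (hK j) t) :
    ∃ (M : _) (N : _) (C : _) (C' : _) (h : _) (n : _) (l : _),
      IsFrame κ (fun j => (Pi.basisFun L (Fin r)).toMatrix (G j)) M N C C' h n l ∧
      ((∀ j, IsUnit (l j).det) → ∀ lam : ι → Fin r → ℕ, (∀ j, Antitone (lam j)) →
      (∀ φ : (Fin r → L) →ₗ[L] (Fin r → L),
        (∀ j u, ∀ v ∈ S ⊓ flagV (G j) (lam j) u, φ v ∈ flagV (G j) (lam j) u ⊔ S) →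
        ∀ v ∈ S, φ v ∈ S) →
      ∀ σ : Matrix (Fin e) (Fin d) L,
        (∀ j (c : Fin e) t, κ j (Sum.inl t) < κ j (Sum.inr c) →
          ((l j)⁻¹ * σ * h j) c t = 0) → σ = 0) := by
  classical
  have hinl : ∀ j t, κ j (Sum.inl t) ∈ K j := fun j t => by
    rw [hκ]
    exact Finset.orderEmbOfFin_mem _ _ _
  have hinl' : ∀ j, ∀ b ∈ K j, ∃ t, b = κ j (Sum.inl t) := fun j b hb => by
    have h1 : b ∈ Set.range ((K j).orderEmbOfFin (hK j)) := by
      rwa [Finset.range_orderEmbOfFin]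
    obtain ⟨t, rfl⟩ := h1
    exact ⟨t, (hκ j t).symm⟩
  have hinr : ∀ j c, κ j (Sum.inr c) ∉ K j := fun j c hc => by
    obtain ⟨t, ht⟩ := hinl' j _ hc
    exact Sum.inr_ne_inl ((κ j).injective ht)
  let fb : ι → Basis (Fin d ⊕ Fin e) L (Fin r → L) := fun j => (f j).reindex (κ j).symm
  have hfb : ∀ j x, fb j x = f j (κ j x) := fun j x => by simp [fb]
  have hfbr : ∀ j v x, (fb j).repr v x = (f j).repr v (κ j x) := fun j v x => by simp [fb]
  obtain ⟨b, hb⟩ : ∃ b, b = fb j0 := ⟨_, rfl⟩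
  have hbS : ∀ v, v ∈ S ↔ ∀ c, b.repr v (Sum.inr c) = 0 := by
    intro v
    rw [(hA j0).eq, mem_coordSub]
    constructor
    · intro h c
      rw [hb, hfbr]
      exact h _ (hinr j0 c)
    · intro h x hx
      obtain ⟨y | y, rfl⟩ := (κ j0).surjective x
      · exact absurd (hinl j0 y) hx
      · rw [← hfbr, ← hb]
        exact h y
  have hfS : ∀ j t, fb j (Sum.inl t) ∈ S := fun j t => by
    rw [hfb]
    exact (hA j).mem (hinl j t)
  refine ⟨(Pi.basisFun L (Fin r)).toMatrix b, b.toMatrix (Pi.basisFun L (Fin r)),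
    fun j => (G j).toMatrix (fb j), fun j => (fb j).toMatrix (G j),
    fun j => (b.toMatrix (fb j)).toBlocks₁₁, fun j => (b.toMatrix (fb j)).toBlocks₁₂,
    fun j => (b.toMatrix (fb j)).toBlocks₂₂, ⟨?_, ?_, fun j => ?_, fun j => ?_, fun j a x hx => ?_,
      fun j a x hx => ?_, fun j => ?_⟩, fun hl lam hlam hend σ hσ => ?_⟩
  · exact Basis.toMatrix_mul_toMatrix_flip _ _
  · exact Basis.toMatrix_mul_toMatrix_flip _ _
  · exact Basis.toMatrix_mul_toMatrix_flip _ _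
  · exact Basis.toMatrix_mul_toMatrix_flip _ _
  · change (G j).repr (fb j x) a = 0
    rw [hfb]
    exact (hA j).tri _ _ hx
  · change (fb j).repr (G j a) x = 0
    rw [hfbr]
    exact (hA j).inv _ _ hx
  · have h1 : b.toMatrix (fb j) = Matrix.fromBlocks (b.toMatrix (fb j)).toBlocks₁₁
        (b.toMatrix (fb j)).toBlocks₁₂ 0 (b.toMatrix (fb j)).toBlocks₂₂ := by
      conv_lhs => rw [← Matrix.fromBlocks_toBlocks (b.toMatrix (fb j))]
      congr 1
      ext c t
      exact (hbS _).1 (hfS j t) c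
    rw [← h1, Basis.toMatrix_mul_toMatrix, Basis.toMatrix_mul_toMatrix]
  · let φ : (Fin r → L) →ₗ[L] (Fin r → L) := Matrix.toLin b b (Matrix.fromBlocks 0 0 σ 0)
    have hφ : ∀ v c, b.repr (φ v) (Sum.inr c) = ∑ t, σ c t * b.repr v (Sum.inl t) := by
      intro v c
      rw [Matrix.repr_toLin, Matrix.mulVec, dotProduct, Fintype.sum_sum_type]
      simp
    have key := hend φ fun j u v hv => ?_
    · ext c t
      have h1 := (hbS _).1 (key (b (Sum.inl t)) (hb ▸ hfS j0 t)) c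
      rw [hφ] at h1
      simpa [Finsupp.single_apply] using h1
    · rw [(hA j).inf_flag (hlam j)] at hv
      refine sum_mem_of_coordSub hv φ _ fun x hx => ?_
      obtain ⟨hxK, hxu⟩ := Finset.mem_filter.1 (Finset.mem_coe.1 hx)
      obtain ⟨t, rfl⟩ := hinl' j x hxK
      set τ := ((b.toMatrix (fb j)).toBlocks₂₂)⁻¹ * σ * (b.toMatrix (fb j)).toBlocks₁₁ with hτ
      have hlτ : (b.toMatrix (fb j)).toBlocks₂₂ * τ = σ * (b.toMatrix (fb j)).toBlocks₁₁ := by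
        rw [hτ, Matrix.mul_assoc, ← Matrix.mul_assoc, Matrix.mul_nonsing_inv _ (hl j),
          Matrix.one_mul]
      have h1 : φ (f j (κ j (Sum.inl t))) - ∑ c, τ c t • fb j (Sum.inr c) ∈ S := by
        rw [hbS]
        intro c
        have h2 := congrFun (congrFun hlτ c) t
        rw [Matrix.mul_apply, Matrix.mul_apply] at h2
        rw [map_sub, Finsupp.sub_apply, hφ, map_sum, Finsupp.finsetSum_apply, sub_eq_zero, ← hfb]
        refine h2.symm.trans (Finset.sum_congr rfl fun c' _ => ?_)
        rw [map_smul, Finsupp.smul_apply, smul_eq_mul, mul_comm]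
        rfl
      rw [← sub_add_cancel (φ (f j (κ j (Sum.inl t)))) (∑ c, τ c t • fb j (Sum.inr c)), add_comm]
      refine Submodule.add_mem_sup (Submodule.sum_mem _ fun c _ => ?_) h1
      by_cases hc : κ j (Sum.inl t) < κ j (Sum.inr c)
      · rw [show τ c t = 0 from hσ j c t hc, zero_smul]
        exact Submodule.zero_mem _
      · refine Submodule.smul_mem _ _ ?_
        rw [hfb, (hA j).flag (hlam j)]
        exact basis_mem_coordSub _ (lt_of_lt_of_le hxu (hlam j (not_lt.1 hc)))

variable {σ : Type} [Algebra ℚ L] [Algebra (MvPolynomial σ ℚ) L]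
  [IsScalarTower ℚ (MvPolynomial σ ℚ) L] [IsFractionRing (MvPolynomial σ ℚ) L]
  [Fintype ι] [DecidableEq ι]

theorem exists_pointCls_of_unstable {v : ι × Fin r × Fin r → σ} (hv : Function.Injective v)
    {lam : ι → Fin r → ℕ} (hlam : ∀ j, Antitone (lam j)) {m : ℕ} (hlm : ∀ j a, lam j a ≤ m)
    (hT : ∃ T : Submodule L (Fin r → L), m * finrank L T <
      ∑ j, codF (colBasis (genMat L v j) (isUnit_det_genMat hv j)) (lam j) m T) :
    ∃ (d : ℕ) (hdr : d ≤ r) (k : ι → Fin d → Fin r), 0 < d ∧ (∀ j, StrictMono (k j)) ∧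
      ∏ j, omegaCls (k j) = pointCls d r hdr ∧ m * d < ∑ j, ∑ t, lam j (k j t) := by
  obtain ⟨S, hS, hend⟩ := exists_destabilizing _ lam m hT
  obtain ⟨d, hd⟩ : ∃ d, finrank L S = d := ⟨_, rfl⟩
  have hdr : d ≤ r := by
    have := Submodule.finrank_le S
    rwa [Module.finrank_fintype_fun_eq_card, Fintype.card_fin, hd] at this
  choose f K hA using fun j => exists_isAdapted (colBasis (genMat L v j) (isUnit_det_genMat hv j)) S
  have hK : ∀ j, (K j).card = d := fun j => (hA j).card.trans hd
  have hmono : ∀ j, StrictMono ((K j).orderEmbOfFin (hK j)) := fun j => OrderEmbedding.strictMono _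
  have hlt : m * d < ∑ j, ∑ t, lam j ((K j).orderEmbOfFin (hK j) t) := by
    rw [hd] at hS
    refine hS.trans_eq (Finset.sum_congr rfl fun j _ => ?_)
    rw [(hA j).codF_eq (hlam j) (hlm j)]
    conv_lhs => rw [← Finset.map_orderEmbOfFin_univ (K j) (hK j)]
    rw [Finset.sum_map]
    rfl
  have hd0 : 0 < d := by
    rcases Nat.eq_zero_or_pos d with rfl | h
    · simp at hlt
    · exact h
  obtain ⟨j0⟩ : Nonempty ι := by
    by_contra hcon
    rw [not_nonempty_iff] at hcon
    simp at hlt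
  choose κ hκl hκr hcell using fun j => exists_shuffle (rfl : r - d = r - d) (hmono j)
  obtain ⟨M, N, C, C', h, n, l, F, hF⟩ := exists_isFrame _ f S K hA hK j0 κ hκl
  have hg : (fun j => (Pi.basisFun L (Fin r)).toMatrix
      (colBasis (genMat L v j) (isUnit_det_genMat hv j))) = genMat L v := by
    ext j a b
    rw [Basis.toMatrix_apply, Pi.basisFun_repr, colBasis_apply]
  rw [hg] at F
  have hinj := hF (fun j => (F.isUnit_det (isUnit_det_genMat hv) j).2) lam hlam hend
  obtain ⟨h1, h2⟩ := F.rigid hv (lam := fun j => lamOf ((K j).orderEmbOfFin (hK j))) hcell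
    (fun j => by simpa only [hκl] using hmono j) hκr (by omega)
    (fun j => lamOf_antitone (hmono j)) (fun j t => lamOf_le (hmono j) t)
    fun τ hτ => hinj τ fun j c t hct => hτ j c t ((hcell j t c).1 hct)
  exact ⟨d, hdr, fun j => (K j).orderEmbOfFin (hK j), hd0, hmono,
    prod_omegaCls_eq_pointCls hdr hmono h1 h2, hlt⟩

end Unstable

/-! ### The inequalities -/

section Extension

open MvPolynomial

variable {ι : Type} {r d e : ℕ} {L : Type} [Field L] [Algebra ℚ L]

/-- A generic extension of two frames with solvable incidence equations moves in a dominant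
family under left translations. -/
theorem exists_evM_ne_zero_of_extension [Fintype ι] [DecidableEq ι] (ρ : Fin d ⊕ Fin e ≃ Fin r)
    (κ : ι → Fin d ⊕ Fin e ≃ Fin r) (h : ι → Matrix (Fin d) (Fin d) L)
    (w : ι → Matrix (Fin e) (Fin e) L) (n : ι → Matrix (Fin d) (Fin e) L)
    (hh : ∀ j, IsUnit (h j).det) (hw : ∀ j, IsUnit (w j).det)
    (hfree : ∀ (X : ι → Matrix (Fin d) (Fin d) L) (Y : ι → Matrix (Fin e) (Fin e) L)
      (Z : ι → Matrix (Fin d) (Fin e) L), ∃ D : Derivation ℚ L L,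
        ∀ j, (h j).map D = X j ∧ (w j).map D = Y j ∧ (n j).map D = Z j)
    (hsol : ∀ z : ι → Matrix (Fin e) (Fin d) L, ∃ σ : Matrix (Fin e) (Fin d) L, ∀ j c t,
      κ j (Sum.inl t) < κ j (Sum.inr c) → (w j * σ * h j) c t = z j c t)
    {lam : ι → Fin r → ℕ} {f : MPoly ι r}
    (hf : ∀ j, f ∈ (colRep r j).hw fun a => (lam j a : ℤ)) (hf0 : f ≠ 0) :
    ∃ M : Matrix (Fin r) (Fin r) L, evM (fun j => M * (Matrix.fromBlocks (h j) (n j) 0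
      (w j)⁻¹).submatrix ρ.symm (κ j).symm) f ≠ 0 := by
  have := algebraRat.charZero L
  by_contra! hM
  refine hf0 (eq_zero_of_dominant _ (fun j => ?_) (fun X => ?_) hf hM)
  · have h1 : (Matrix.fromBlocks (h j) (n j) 0 (w j)⁻¹ : Matrix (Fin d ⊕ Fin e) (Fin d ⊕ Fin e) L) *
        Matrix.fromBlocks (h j)⁻¹ (-((h j)⁻¹ * n j * w j)) 0 (w j) = 1 := by
      rw [Matrix.fromBlocks_multiply, ← Matrix.fromBlocks_one]
      congr 1
      · rw [Matrix.mul_nonsing_inv _ (hh j), Matrix.mul_zero, add_zero]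
      · rw [Matrix.mul_neg, Matrix.mul_assoc, ← Matrix.mul_assoc (h j),
          Matrix.mul_nonsing_inv _ (hh j), Matrix.one_mul, neg_add_cancel]
      · simp
      · rw [Matrix.nonsing_inv_mul _ (hw j), Matrix.zero_mul, zero_add]
    refine Matrix.isUnit_det_of_right_inverse (B := (Matrix.fromBlocks (h j)⁻¹
      (-((h j)⁻¹ * n j * w j)) 0 (w j)).submatrix (κ j).symm ρ.symm) ?_
    rw [Matrix.submatrix_mul_equiv, h1, Matrix.submatrix_one_equiv]
  · let X' : ι → Matrix (Fin d ⊕ Fin e) (Fin d ⊕ Fin e) L := fun j => (X j).submatrix ρ ρ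
    obtain ⟨ψ, hψ⟩ := hsol fun j => w j * (X' j).toBlocks₂₁ * h j
    let Q : ι → Matrix (Fin e) (Fin d) L := fun j => (X' j).toBlocks₂₁ - ψ
    obtain ⟨D, hD⟩ := hfree (fun j => (X' j).toBlocks₁₁ * h j - n j * (w j * Q j * h j))
      (fun j => -(w j * (Q j * n j + (X' j).toBlocks₂₂ * (w j)⁻¹) * w j))
      (fun j => (X' j).toBlocks₁₁ * n j + (X' j).toBlocks₁₂ * (w j)⁻¹)
    let y : Matrix (Fin d ⊕ Fin e) (Fin d ⊕ Fin e) L := Matrix.fromBlocks 0 0 ψ 0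
    let τ : ι → Matrix (Fin d ⊕ Fin e) (Fin d ⊕ Fin e) L := fun j =>
      Matrix.fromBlocks 0 0 (-(w j * Q j * h j)) 0
    refine ⟨D, y.submatrix ρ.symm ρ.symm, fun j => (τ j).submatrix (κ j).symm (κ j).symm,
      fun j c b hbc => ?_, fun j => ?_⟩
    · obtain ⟨c, rfl⟩ := (κ j).surjective c
      obtain ⟨b, rfl⟩ := (κ j).surjective b
      change τ j ((κ j).symm (κ j c)) ((κ j).symm (κ j b)) = 0
      rw [Equiv.symm_apply_apply, Equiv.symm_apply_apply]
      rcases c with c | c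
      · rcases b with b | b <;> rfl
      · rcases b with b | b
        · have h1 := hψ j c b hbc
          change -(w j * Q j * h j) c b = 0
          rw [neg_eq_zero, Matrix.mul_sub, Matrix.sub_mul, Matrix.sub_apply, h1, sub_self]
        · rfl
    · have hX : X j - y.submatrix ρ.symm ρ.symm = (X' j - y).submatrix ρ.symm ρ.symm := by
        ext a b
        simp [X']
      have hA : X' j - y = Matrix.fromBlocks (X' j).toBlocks₁₁ (X' j).toBlocks₁₂ (Q j)
          (X' j).toBlocks₂₂ := by
        rw [← Matrix.fromBlocks_toBlocks (X' j)]
        ext (a | a) (b | b) <;> simp [y, Q]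
      have hwD : (w j)⁻¹.map D = Q j * n j + (X' j).toBlocks₂₂ * (w j)⁻¹ := by
        rw [map_derivation_inv D (hw j), (hD j).2.1, Matrix.mul_neg, neg_neg, Matrix.mul_assoc,
          Matrix.mul_assoc, Matrix.mul_assoc, Matrix.mul_nonsing_inv _ (hw j), Matrix.mul_one,
          ← Matrix.mul_assoc, Matrix.nonsing_inv_mul _ (hw j), Matrix.one_mul]
      have hmain : (Matrix.fromBlocks (h j) (n j) 0 (w j)⁻¹ :
          Matrix (Fin d ⊕ Fin e) (Fin d ⊕ Fin e) L).map D =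
          (X' j - y) * Matrix.fromBlocks (h j) (n j) 0 (w j)⁻¹ +
            Matrix.fromBlocks (h j) (n j) 0 (w j)⁻¹ * τ j := by
        rw [hA, Matrix.fromBlocks_map, Matrix.fromBlocks_multiply, Matrix.fromBlocks_multiply,
          Matrix.fromBlocks_add, (hD j).1, (hD j).2.2, hwD]
        have h0 : (w j)⁻¹ * (w j * Q j * h j) = Q j * h j := by
          rw [Matrix.mul_assoc, ← Matrix.mul_assoc, Matrix.nonsing_inv_mul _ (hw j),
            Matrix.one_mul]
        congr 1
        · simp [sub_eq_add_neg]
        · simp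
        · rw [Matrix.mul_neg, h0]
          ext a b
          simp
        · simp
      have h3 : ∀ A : Matrix (Fin d ⊕ Fin e) (Fin d ⊕ Fin e) L,
          (A.submatrix ρ.symm (κ j).symm).map D = (A.map D).submatrix ρ.symm (κ j).symm :=
        fun A => rfl
      rw [h3, hmain, hX, Matrix.submatrix_mul_equiv, Matrix.submatrix_mul_equiv]
      rfl

end Extension

section Inequality

open MvPolynomial

variable {ι : Type} {r : ℕ}

theorem evM_genMat_ne_zero {σ L : Type} [Field L] [Algebra ℚ L] [Algebra (MvPolynomial σ ℚ) L]
    [IsScalarTower ℚ (MvPolynomial σ ℚ) L] [IsFractionRing (MvPolynomial σ ℚ) L]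
    {v : ι × Fin r × Fin r → σ} (hv : Function.Injective v) {f : MPoly ι r} (hf : f ≠ 0) :
    evM (genMat L v) f ≠ 0 := by
  have h1 : evM (genMat L v) f = algebraMap (MvPolynomial σ ℚ) L (rename v f) := by
    have h2 : (aeval (R := ℚ) fun s : ι × Fin r × Fin r => genMat L v s.1 s.2.1 s.2.2) =
        (IsScalarTower.toAlgHom ℚ (MvPolynomial σ ℚ) L).comp (rename v) := by
      refine MvPolynomial.algHom_ext fun s => ?_
      simp [genMat]
    exact DFunLike.congr_fun h2 f
  rw [h1]
  intro h0
  exact hf (rename_injective v hv ((IsFractionRing.injective (MvPolynomial σ ℚ) L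
    (h0.trans (map_zero _).symm)).trans (map_zero _).symm))

theorem exists_hwSpace_ne_zero {n s : ℕ} {I : Fin s → Fin r → Fin n} (hrn : r ≤ n)
    (hI : ∀ j, StrictMono (I j)) (hA : ∏ j, omegaCls (I j) ≠ 0) :
    ∃ nu : Fin r → ℕ, (∀ a, nu a ≤ n - r) ∧
      ∃ f ∈ hwSpace nu fun j => lamOf (I j), f ≠ 0 := by
  obtain ⟨nu, hnu, hle, hc⟩ := exists_schurCoeff_ne_zero hrn hI hA
  refine ⟨nu, hle, ?_⟩
  rw [← finrank_hwSpace hnu fun j => lamOf_antitone (hI j)] at hc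
  by_contra! h0
  refine hc ?_
  have h1 : hwSpace nu (fun j => lamOf (I j)) = ⊥ := (Submodule.eq_bot_iff _).2 h0
  rw [h1, finrank_bot, Nat.cast_zero]

theorem sum_lamOf_le_of_genMat {n d e s : ℕ} (hs : 0 < s) (he : r - d = e) {L : Type} [Field L]
    [Algebra ℚ L] [Algebra (MvPolynomial ((Fin s × Fin d × Fin d) ⊕ (Fin s × Fin e × Fin e) ⊕
      (Fin s × Fin d × Fin e)) ℚ) L]
    [IsScalarTower ℚ (MvPolynomial ((Fin s × Fin d × Fin d) ⊕ (Fin s × Fin e × Fin e) ⊕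
      (Fin s × Fin d × Fin e)) ℚ) L]
    [IsFractionRing (MvPolynomial ((Fin s × Fin d × Fin d) ⊕ (Fin s × Fin e × Fin e) ⊕
      (Fin s × Fin d × Fin e)) ℚ) L] {I : Fin s → Fin r → Fin n}
    (hI : ∀ j, StrictMono (I j)) (hA : ∏ j, omegaCls (I j) ≠ 0) {K : Fin s → Fin d → Fin r}
    (hK : ∀ j, StrictMono (K j)) (hKA : ∏ j, omegaCls (K j) ≠ 0) :
    ∑ j, ∑ t, lamOf (I j) (K j t) ≤ (n - r) * d := by
  have : Nonempty (Fin s) := ⟨⟨0, hs⟩⟩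
  have hrn : r ≤ n := le_of_strictMono (hI ⟨0, hs⟩)
  have hdr : d ≤ r := le_of_strictMono (hK ⟨0, hs⟩)
  have := algebraRat.charZero L
  obtain ⟨nu, hnu, f, hf, hf0⟩ := exists_hwSpace_ne_zero hrn hI hA
  obtain ⟨nu', hnu', f', hf', hf0'⟩ := exists_hwSpace_ne_zero hdr hK hKA
  rw [he] at hnu'
  choose κ hκ _ hcell using fun j => exists_shuffle he (hK j)
  let ι := Fin s
  let σ := (ι × Fin d × Fin d) ⊕ (ι × Fin e × Fin e) ⊕ (ι × Fin d × Fin e)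
  let v : ι × Fin d × Fin d → σ := Sum.inl
  let v' : ι × Fin e × Fin e → σ := fun x => Sum.inr (Sum.inl x)
  have hv : Function.Injective v := Sum.inl_injective
  have hv' : Function.Injective v' := Sum.inr_injective.comp Sum.inl_injective
  let h : ι → Matrix (Fin d) (Fin d) L := genMat L v
  let w : ι → Matrix (Fin e) (Fin e) L := genMat L v'
  let q : ι → Matrix (Fin d) (Fin e) L := fun j => Matrix.of fun a b =>
    algebraMap (MvPolynomial σ ℚ) L (X (Sum.inr (Sum.inr (j, a, b))))
  have hh : ∀ j, IsUnit (h j).det := isUnit_det_genMat hv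
  have hw : ∀ j, IsUnit (w j).det := isUnit_det_genMat hv'
  have hfree : ∀ (X : ι → Matrix (Fin d) (Fin d) L) (Y : ι → Matrix (Fin e) (Fin e) L)
      (Z : ι → Matrix (Fin d) (Fin e) L), ∃ D : Derivation ℚ L L,
        ∀ j, (h j).map D = X j ∧ (w j).map D = Y j ∧ (q j).map D = Z j := by
    intro X Y Z
    obtain ⟨D, hD⟩ := exists_derivation (σ := σ) (L := L) (Sum.elim (fun x => X x.1 x.2.1 x.2.2)
      (Sum.elim (fun x => Y x.1 x.2.1 x.2.2) (fun x => Z x.1 x.2.1 x.2.2)))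
    refine ⟨D, fun j => ⟨?_, ?_, ?_⟩⟩
    · ext a b
      exact hD (Sum.inl (j, a, b))
    · ext a b
      exact hD (Sum.inr (Sum.inl (j, a, b)))
    · ext a b
      exact hD (Sum.inr (Sum.inr (j, a, b)))
  have hsol := exists_solution_of_semistable h w hh hw
    (fun X Y => (hfree X Y 0).imp fun D hD j => ⟨(hD j).1, (hD j).2.1⟩)
    (fun j => lamOf_antitone (hK j)) (fun j a => he ▸ lamOf_le (hK j) a)
    (sum_codF_le hf' hnu' (fun j => lamOf_antitone (hK j)) (fun j a => he ▸ lamOf_le (hK j) a) _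
      (by
        simp only [matB_colBasis]
        exact evM_genMat_ne_zero hv hf0'))
  have hcol : ∀ j, f ∈ (colRep r j).hw fun a => (lamOf (I j) a : ℤ) := fun j =>
    (Submodule.mem_iInf _).1 hf.2 j
  let ρ := κ ⟨0, hs⟩
  obtain ⟨M, hM⟩ := exists_evM_ne_zero_of_extension ρ κ h w q hh hw hfree
    (fun z => (hsol z).imp fun x hx j c t hct => hx j c t ((hcell j t c).1 hct)) hcol hf0
  let T : Submodule L (Fin r → L) := span L (Set.range fun t a => M a (ρ (Sum.inl t)))
  have hT : finrank L T ≤ d := by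
    have := finrank_range_le_card (R := L) fun (t : Fin d) (a : Fin r) => M a (ρ (Sum.inl t))
    rwa [Fintype.card_fin] at this
  have h1 := sum_le_of_evM_ne_zero hf hnu _ hM T (fun j => Finset.univ.image (K j))
    (by
      intro j k hk
      obtain ⟨t, _, rfl⟩ := Finset.mem_image.1 hk
      rw [← hκ j t]
      have h2 : (fun a => (M * (Matrix.fromBlocks (h j) (q j) 0 (w j)⁻¹).submatrix ρ.symm
          (κ j).symm) a (κ j (Sum.inl t))) =
          ∑ b, h j b t • fun a => M a (ρ (Sum.inl b)) := by
        ext a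
        rw [Matrix.mul_apply, ← Equiv.sum_comp ρ, Fintype.sum_sum_type, Finset.sum_apply]
        simp [mul_comm]
      rw [h2]
      exact sum_mem fun b _ => T.smul_mem _ (subset_span ⟨b, rfl⟩))
  refine le_trans (le_of_eq ?_) (h1.trans (Nat.mul_le_mul_left _ hT))
  exact Finset.sum_congr rfl fun j _ =>
    (Finset.sum_image fun x _ y _ hxy => (hK j).injective hxy).symm

theorem sum_lamOf_le_of_prod_ne_zero {n d s : ℕ} (hs : 0 < s) {I : Fin s → Fin r → Fin n}
    (hI : ∀ j, StrictMono (I j)) (hA : ∏ j, omegaCls (I j) ≠ 0) {K : Fin s → Fin d → Fin r}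
    (hK : ∀ j, StrictMono (K j)) (hKA : ∏ j, omegaCls (K j) ≠ 0) :
    ∑ j, ∑ t, lamOf (I j) (K j t) ≤ (n - r) * d :=
  sum_lamOf_le_of_genMat hs rfl (L := FractionRing (MvPolynomial ((Fin s × Fin d × Fin d) ⊕
    (Fin s × Fin (r - d) × Fin (r - d)) ⊕ (Fin s × Fin d × Fin (r - d))) ℚ)) hI hA hK hKA

theorem exists_pointCls_of_genMat {n m s : ℕ} (hs : 0 < s) (hrn : r ≤ n) (hm : n - r = m)
    {L : Type} [Field L] [Algebra ℚ L]
    [Algebra (MvPolynomial ((Fin s × Fin r × Fin r) ⊕ (Fin s × Fin m × Fin m)) ℚ) L]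
    [IsScalarTower ℚ (MvPolynomial ((Fin s × Fin r × Fin r) ⊕ (Fin s × Fin m × Fin m)) ℚ) L]
    [IsFractionRing (MvPolynomial ((Fin s × Fin r × Fin r) ⊕ (Fin s × Fin m × Fin m)) ℚ) L]
    {I : Fin s → Fin r → Fin n} (hI : ∀ j, StrictMono (I j)) (hA : ∏ j, omegaCls (I j) = 0) :
    ∃ d, ∃ hdr : d ≤ r, ∃ K : Fin s → Fin d → Fin r, 0 < d ∧ (∀ j, StrictMono (K j)) ∧
      ∏ j, omegaCls (K j) = pointCls d r hdr ∧ m * d < ∑ j, ∑ t, lamOf (I j) (K j t) := by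
  have : Nonempty (Fin s) := ⟨⟨0, hs⟩⟩
  let σ := (Fin s × Fin r × Fin r) ⊕ (Fin s × Fin m × Fin m)
  let v : Fin s × Fin r × Fin r → σ := Sum.inl
  let v' : Fin s × Fin m × Fin m → σ := Sum.inr
  have hv : Function.Injective v := Sum.inl_injective
  have hv' : Function.Injective v' := Sum.inr_injective
  have hlm : ∀ j a, lamOf (I j) a ≤ m := fun j a => hm ▸ lamOf_le (hI j) a
  refine exists_pointCls_of_unstable (L := L) hv (fun j => lamOf_antitone (hI j)) hlm ?_
  by_contra! hss
  refine prod_omegaCls_ne_zero_of_solvable hrn hm hI (genMat L v) (genMat L v')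
    (exists_solution_of_semistable _ _ (isUnit_det_genMat hv) (isUnit_det_genMat hv')
      (fun X Y => ?_) (fun j => lamOf_antitone (hI j)) hlm hss) hA
  obtain ⟨D, hD⟩ := exists_derivation (σ := σ) (L := L)
    (Sum.elim (fun x => X x.1 x.2.1 x.2.2) fun x => Y x.1 x.2.1 x.2.2)
  refine ⟨D, fun j => ⟨?_, ?_⟩⟩
  · ext a b
    exact hD (Sum.inl (j, a, b))
  · ext a b
    exact hD (Sum.inr (j, a, b))

theorem exists_pointCls_of_prod_eq_zero {n s : ℕ} (hs : 0 < s) {I : Fin s → Fin r → Fin n}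
    (hI : ∀ j, StrictMono (I j)) (hA : ∏ j, omegaCls (I j) = 0) :
    ∃ d, ∃ hdr : d ≤ r, ∃ K : Fin s → Fin d → Fin r, 0 < d ∧ (∀ j, StrictMono (K j)) ∧
      ∏ j, omegaCls (K j) = pointCls d r hdr ∧
      (n - r) * d < ∑ j, ∑ t, lamOf (I j) (K j t) :=
  exists_pointCls_of_genMat hs (le_of_strictMono (hI ⟨0, hs⟩)) rfl
    (L := FractionRing (MvPolynomial ((Fin s × Fin r × Fin r) ⊕
      (Fin s × Fin (n - r) × Fin (n - r))) ℚ)) hI hA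

theorem daggerZ_eq {n d s : ℕ} (hrn : r ≤ n) {I : Fin s → Fin r → Fin n}
    (hI : ∀ j, StrictMono (I j)) (K : Fin s → Fin d → Fin r) :
    daggerZ n r d I K = ((∑ j, ∑ t, lamOf (I j) (K j t) : ℕ) : ℤ) - ((n - r) * d : ℕ) := by
  rw [daggerZ]
  push_cast [Nat.cast_sub hrn]
  simp only [lamOf_cast (hI _)]
  ring

end Inequality

/-- Theorem `MainTe`.  For an `s`-tuple `𝓘 = (I^1, …, I^s)` of subsets
of `[n]` of cardinality `r`, the following are equivalent:
(A) `∏_j ω_{I^j} ≠ 0` in `H^*(Gr(r,n))`;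
(B) for every `0 < d ≤ r` and every `s`-tuple `𝓚` of subsets of `[r]` of cardinality `d`
with `∏_j ω_{K^j} ≠ 0` in `H^*(Gr(d,r))`, the inequality `(†^𝓘_𝓚) ≤ 0` holds;
(C) the same with `∏_j ω_{K^j}` equal to the class of a point in `H^*(Gr(d,r))`. -/
theorem stmt1 (n r s : ℕ) (hs : 0 < s)
    (I : Fin s → Fin r → Fin n) (hI : ∀ j, StrictMono (I j)) :
    ((∏ j : Fin s, omegaCls (I j)) ≠ 0 ↔
      (∀ d : ℕ, 0 < d → ∀ hdr : d ≤ r, ∀ K : Fin s → Fin d → Fin r,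
        (∀ j, StrictMono (K j)) → (∏ j : Fin s, omegaCls (K j)) ≠ 0 →
        daggerZ n r d I K ≤ 0)) ∧
    ((∏ j : Fin s, omegaCls (I j)) ≠ 0 ↔
      (∀ d : ℕ, 0 < d → ∀ hdr : d ≤ r, ∀ K : Fin s → Fin d → Fin r,
        (∀ j, StrictMono (K j)) →
        (∏ j : Fin s, omegaCls (K j)) = pointCls d r hdr →
        daggerZ n r d I K ≤ 0)) := by
  have hrn : r ≤ n := le_of_strictMono (hI ⟨0, hs⟩)
  have hAB : (∏ j : Fin s, omegaCls (I j)) ≠ 0 → ∀ d : ℕ, 0 < d → ∀ _ : d ≤ r,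
      ∀ K : Fin s → Fin d → Fin r, (∀ j, StrictMono (K j)) →
        (∏ j : Fin s, omegaCls (K j)) ≠ 0 → daggerZ n r d I K ≤ 0 := by
    intro hA d _ _ K hK hKA
    rw [daggerZ_eq hrn hI, sub_nonpos]
    exact_mod_cast sum_lamOf_le_of_prod_ne_zero hs hI hA hK hKA
  have hCA : (∀ d : ℕ, 0 < d → ∀ hdr : d ≤ r, ∀ K : Fin s → Fin d → Fin r,
      (∀ j, StrictMono (K j)) → (∏ j : Fin s, omegaCls (K j)) = pointCls d r hdr →
      daggerZ n r d I K ≤ 0) → (∏ j : Fin s, omegaCls (I j)) ≠ 0 := by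
    intro hC hA
    obtain ⟨d, hdr, K, hd, hK, hKp, hlt⟩ := exists_pointCls_of_prod_eq_zero hs hI hA
    have h1 := hC d hd hdr K hK hKp
    rw [daggerZ_eq hrn hI, sub_nonpos] at h1
    exact absurd hlt (not_lt.2 (by exact_mod_cast h1))
  exact ⟨⟨hAB, fun hB => hCA fun d hd hdr K hK hKp =>
      hB d hd hdr K hK (hKp ▸ pointCls_ne_zero hdr)⟩,
    ⟨fun hA d hd hdr K hK hKp => hAB hA d hd hdr K hK (hKp ▸ pointCls_ne_zero hdr), hCA⟩⟩

end
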